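/- Let M be a positive integer and let f be a transcendental meromorphic function in the plane with Schwarzian derivative S_f = 2A such that: (i) f has finitely many critical values and all multiple points of f have multiplicity at most M; (ii) the inverse function of f has finitely many transcendental singularities. If A is transcendental, then the inverse function of A does not have a direct transcendental singularity over ∞. -/

import Mathlib

open Filter Set Topology Bornology MeasureTheory

noncomputable section

def chordal : Option ℂ → Option ℂ → ℝ
  | Option.none, Option.none => 0
  | Option.none, Option.some w => 1 / Real.sqrt (1 + ‖w‖ ^ 2)
  | Option.some z, Option.none => 1 / Real.sqrt (1 + ‖z‖ ^ 2)
  | Option.some z, Option.some w =>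
      ‖z - w‖ / Real.sqrt ((1 + ‖z‖ ^ 2) * (1 + ‖w‖ ^ 2))

def MeroPlane (f : ℂ → ℂ) (P : Set ℂ) : Prop :=
  (∀ K : Set ℂ, IsCompact K → (P ∩ K).Finite) ∧
  (∀ z ∉ P, AnalyticAt ℂ f z) ∧
  ∀ p ∈ P, Tendsto (fun z => ‖f z‖) (nhdsWithin p Pᶜ) atTop

def RationalFn (f : ℂ → ℂ) (P : Set ℂ) : Prop :=
  ∃ p q : Polynomial ℂ, q ≠ 0 ∧ ∀ z ∉ P, q.eval z ≠ 0 → f z = p.eval z / q.eval z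

def TranscMeroPlane (f : ℂ → ℂ) (P : Set ℂ) : Prop :=
  MeroPlane f P ∧ ¬ RationalFn f P

def PoleOrder (f : ℂ → ℂ) (z₀ : ℂ) (m : ℕ) : Prop :=
  0 < m ∧ ∃ g : ℂ → ℂ, AnalyticAt ℂ g z₀ ∧ g z₀ ≠ 0 ∧
    ∀ᶠ z in nhdsWithin z₀ {z₀}ᶜ, f z = g z / (z - z₀) ^ m

def ZeroOrder (f : ℂ → ℂ) (z₀ : ℂ) (m : ℕ) : Prop :=
  0 < m ∧ ∃ g : ℂ → ℂ, AnalyticAt ℂ g z₀ ∧ g z₀ ≠ 0 ∧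
    ∀ᶠ z in nhds z₀, f z = (z - z₀) ^ m * g z

def MultiplePointWithMult (f : ℂ → ℂ) (z₀ : ℂ) (μ : ℕ) : Prop :=
  2 ≤ μ ∧ (PoleOrder f z₀ μ ∨ (AnalyticAt ℂ f z₀ ∧ ZeroOrder (deriv f) z₀ (μ - 1)))

def MultiplePoint (f : ℂ → ℂ) (z₀ : ℂ) : Prop :=
  ∃ μ, MultiplePointWithMult f z₀ μ

open scoped Classical in
def valueAt (f : ℂ → ℂ) (P : Set ℂ) (z : ℂ) : Option ℂ :=
  if z ∈ P then none else some (f z)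

def CriticalValues (f : ℂ → ℂ) (P : Set ℂ) : Set (Option ℂ) :=
  {w | ∃ z, MultiplePoint f z ∧ w = valueAt f P z}

def AsymptoticPath (f : ℂ → ℂ) (P : Set ℂ) (a : Option ℂ) (γ : ℝ → ℂ) : Prop :=
  ContinuousOn γ (Ici 0) ∧
  Tendsto (fun t => ‖γ t‖) atTop atTop ∧
  Tendsto (fun t => chordal (valueAt f P (γ t)) a) atTop (nhds 0)

def IsComponentOf (C S : Set ℂ) : Prop :=
  ∃ x ∈ S, C = connectedComponentIn S x

def DistinctSingularities (f : ℂ → ℂ) (P : Set ℂ) (a₁ a₂ : Option ℂ) (γ₁ γ₂ : ℝ → ℂ) : Prop :=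
  a₁ ≠ a₂ ∨ ∃ t : ℝ, 0 < t ∧ ∃ C₁ C₂ : Set ℂ,
    IsComponentOf C₁ {z | chordal (valueAt f P z) a₁ < t} ∧
    IsComponentOf C₂ {z | chordal (valueAt f P z) a₂ < t} ∧
    Disjoint C₁ C₂ ∧
    IsBounded (γ₁ '' Ici 0 \ C₁) ∧ IsBounded (γ₂ '' Ici 0 \ C₂)

def FinitelyManyTranscSing (f : ℂ → ℂ) (P : Set ℂ) : Prop :=
  ∃ n : ℕ, ∀ m : ℕ, ∀ a : Fin m → Option ℂ, ∀ γ : Fin m → ℝ → ℂ,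
    (∀ i, AsymptoticPath f P (a i) (γ i)) →
    (∀ i j, i ≠ j → DistinctSingularities f P (a i) (a j) (γ i) (γ j)) →
    m ≤ n

def schwarzian (f : ℂ → ℂ) (z : ℂ) : ℂ :=
  deriv (deriv (deriv f)) z / deriv f z - (3 / 2) * (deriv (deriv f) z / deriv f z) ^ 2

def SingularValue (f : ℂ → ℂ) (P : Set ℂ) (w : Option ℂ) : Prop :=
  w ∈ CriticalValues f P ∨ ∃ γ : ℝ → ℂ, AsymptoticPath f P w γ

open scoped Classical in
def poleOrderAt (f : ℂ → ℂ) (z : ℂ) : ℕ :=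
  if h : ∃ m, PoleOrder f z m then h.choose else 0

def nCount (f : ℂ → ℂ) (t : ℝ) : ℕ :=
  ∑ᶠ z ∈ {w : ℂ | ‖w‖ ≤ t}, poleOrderAt f z

def nevN (f : ℂ → ℂ) (r : ℝ) : ℝ :=
  (nCount f 0 : ℝ) * Real.log r + ∫ t in (0:ℝ)..r, ((nCount f t : ℝ) - (nCount f 0 : ℝ)) / t

def nevm (f : ℂ → ℂ) (r : ℝ) : ℝ :=
  (1 / (2 * Real.pi)) * ∫ θ in (0:ℝ)..(2 * Real.pi),
    Real.log (max 1 (‖f (r * Complex.exp (θ * Complex.I))‖))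

def nevT (f : ℂ → ℂ) (r : ℝ) : ℝ := nevm f r + nevN f r

def growthOrder (f : ℂ → ℂ) : EReal :=
  Filter.limsup (fun r : ℝ => ((Real.log (nevT f r) / Real.log r : ℝ) : EReal)) atTop

def BorelExceptionalInfty (f : ℂ → ℂ) : Prop :=
  Filter.limsup (fun r : ℝ => ((Real.log (nevN f r) / Real.log r : ℝ) : EReal)) atTop <
  Filter.limsup (fun r : ℝ => ((Real.log (nevT f r) / Real.log r : ℝ) : EReal)) atTop

def MeroAnnulus (A : ℂ → ℂ) (R : ℝ) (P : Set ℂ) : Prop :=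
  P ⊆ {z : ℂ | R ≤ ‖z‖} ∧
  (∀ K : Set ℂ, IsCompact K → (P ∩ K).Finite) ∧
  (∀ z : ℂ, R < ‖z‖ → z ∉ P → AnalyticAt ℂ A z) ∧
  ∀ p ∈ P, Tendsto (fun z => ‖A z‖) (nhdsWithin p Pᶜ) atTop

def EssSingAtInfty (A : ℂ → ℂ) (P : Set ℂ) : Prop :=
  ¬ (IsBounded P ∧ ∃ (n : ℤ) (c : ℂ), c ≠ 0 ∧
      Tendsto (fun z : ℂ => A z / z ^ n)
        (Filter.comap (fun z : ℂ => ‖z‖) atTop ⊓ Filter.principal Pᶜ) (nhds c))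

def WVDisk (z₀ : ℂ) (Nr phir L : ℝ) : Set ℂ :=
  {z : ℂ | ∃ τ : ℂ, z = z₀ * Complex.exp τ ∧
    |τ.re| ≤ L * phir / Nr ∧ |τ.im| ≤ L * phir / Nr}

structure WVData (A : ℂ → ℂ) (R : ℝ) where
  F1 : Set ℝ
  N : ℝ → ℝ
  phi : ℝ → ℝ
  zr : ℝ → ℂ
  F1_sub : F1 ⊆ Ici R
  F1_unbounded : ∀ c : ℝ, ∃ r ∈ F1, c < r
  N_ge : ∀ r ∈ F1, 2 ≤ N r
  phi_ge : ∀ r ∈ F1, 1 ≤ phi r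
  N_tendsto : Tendsto N (atTop ⊓ Filter.principal F1) atTop
  phi_over_N : Tendsto (fun r => phi r / N r) (atTop ⊓ Filter.principal F1) (nhds 0)
  phi_over_logN : Tendsto (fun r => phi r / Real.log (N r)) (atTop ⊓ Filter.principal F1) atTop
  zr_abs : ∀ r ∈ F1, ‖zr r‖ = r
  phi_small : Tendsto (fun r => phi r / Real.log (max 1 (‖A (zr r)‖)))
      (atTop ⊓ Filter.principal F1) (nhds 0)
  approx : ∀ ε : ℝ, 0 < ε → ∀ᶠ r in atTop ⊓ Filter.principal F1, ∀ τ : ℂ,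
      |τ.re| ≤ 8 * phi r / N r → |τ.im| ≤ 8 * phi r / N r →
      ‖A (zr r * Complex.exp τ) - Complex.exp ((N r : ℂ) * τ) * A (zr r)‖
        ≤ ε * ‖Complex.exp ((N r : ℂ) * τ) * A (zr r)‖

def HasWVProp (A : ℂ → ℂ) (R : ℝ) : Prop := Nonempty (WVData A R)

def WVwr {A : ℂ → ℂ} {R : ℝ} (W : WVData A R) (r : ℝ) : ℂ :=
  W.zr r * Complex.exp (((-(4 * W.phi r / W.N r) : ℝ) : ℂ))

def WVZr {A : ℂ → ℂ} {R : ℝ} (W : WVData A R) (r : ℝ) : ℝ :=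
  2 * r * Real.sqrt (‖A (W.zr r)‖) / (W.N r + 2)

def IsZData {A : ℂ → ℂ} {R : ℝ} (W : WVData A R) (sqA Z : ℝ → ℂ → ℂ) (r : ℝ) : Prop :=
  (∀ z ∈ WVDisk (W.zr r) (W.N r) (W.phi r) 4,
      (sqA r z) ^ 2 = A z ∧ AnalyticAt ℂ (sqA r) z ∧ HasDerivAt (Z r) (sqA r z) z) ∧
  Z r (WVwr W r) = 2 * WVwr W r * sqA r (WVwr W r) / ((W.N r : ℂ) + 2)

def J1 (Zr phir : ℝ) : Set ℂ :=
  {w : ℂ | w ≠ 0 ∧ |Real.log (‖w‖ / Zr)| ≤ phir ∧ |Complex.arg w| ≤ Real.pi / 4}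

def IsEpsilonSet (E : Set ℂ) : Prop :=
  ∃ (b : ℕ → ℂ) (ρ : ℕ → ℝ), (∀ j, 0 ≤ ρ j) ∧
    Tendsto (fun j => ‖b j‖) atTop atTop ∧
    Summable (fun j => ρ j / ‖b j‖) ∧
    E = ⋃ j, Metric.ball (b j) (ρ j)

def DirectSingularityOverInfty (A : ℂ → ℂ) (P : Set ℂ) : Prop :=
  ∃ γ : ℝ → ℂ, AsymptoticPath A P none γ ∧
    ∃ t : ℝ, 0 < t ∧ ∃ C : Set ℂ,
      IsComponentOf C {z | chordal (valueAt A P z) none < t} ∧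
      (∀ z ∈ C, z ∉ P) ∧
      IsBounded (γ '' Ici 0 \ C)

section
open Complex (I)
open Complex renaming exp → cexp
open Real renaming exp → rexp, log → rlog, pi → π
open Metric (ball closedBall sphere)

section

def SH (v : ℂ → ℝ) (Ω : Set ℂ) : Prop :=
  ContinuousOn v Ω ∧ ∀ z ∈ Ω, ∀ᶠ r in 𝓝[>] (0:ℝ), v z ≤ Real.circleAverage v z r

lemma circ_small {Ω : Set ℂ} (hΩ : IsOpen Ω) {z : ℂ} (hz : z ∈ Ω) :
    ∀ᶠ r in 𝓝[>] (0:ℝ), 0 < r ∧ closedBall z |r| ⊆ Ω := by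
  obtain ⟨ε, hε, h⟩ := Metric.isOpen_iff.1 hΩ z hz
  filter_upwards [Ioo_mem_nhdsGT hε] with r hr
  refine ⟨hr.1, fun w hw => h ?_⟩
  rw [abs_of_pos hr.1] at hw
  exact Metric.closedBall_subset_ball hr.2 hw

lemma ci_of_cont {v : ℂ → ℝ} {Ω : Set ℂ} (hv : ContinuousOn v Ω) {z : ℂ} {r : ℝ}
    (h : closedBall z |r| ⊆ Ω) : CircleIntegrable v z r :=
  (hv.mono (Metric.sphere_subset_closedBall.trans h)).circleIntegrable'

lemma SH.mono {v : ℂ → ℝ} {Ω Ω' : Set ℂ} (h : SH v Ω) (hs : Ω' ⊆ Ω) : SH v Ω' :=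
  ⟨h.1.mono hs, fun z hz => h.2 z (hs hz)⟩

lemma SH.congr {v w : ℂ → ℝ} {Ω : Set ℂ} (hΩ : IsOpen Ω) (h : SH v Ω) (hs : EqOn w v Ω) :
    SH w Ω := by
  refine ⟨h.1.congr hs, fun z hz => ?_⟩
  filter_upwards [h.2 z hz, circ_small hΩ hz] with r hr hr'
  rw [hs hz, Real.circleAverage_congr_sphere
    (hs.mono (Metric.sphere_subset_closedBall.trans hr'.2))]
  exact hr

lemma SH.add {v w : ℂ → ℝ} {Ω : Set ℂ} (hΩ : IsOpen Ω) (hv : SH v Ω) (hw : SH w Ω) :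
    SH (fun z => v z + w z) Ω := by
  refine ⟨hv.1.add hw.1, fun z hz => ?_⟩
  filter_upwards [hv.2 z hz, hw.2 z hz, circ_small hΩ hz] with r h1 h2 h3
  rw [Real.circleAverage_fun_add (ci_of_cont hv.1 h3.2) (ci_of_cont hw.1 h3.2)]
  linarith


lemma SH.smax {v w : ℂ → ℝ} {Ω : Set ℂ} (hΩ : IsOpen Ω) (hv : SH v Ω) (hw : SH w Ω) :
    SH (fun z => max (v z) (w z)) Ω := by
  have hc : ContinuousOn (fun z => max (v z) (w z)) Ω := ContinuousOn.sup hv.1 hw.1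
  refine ⟨hc, fun z hz => ?_⟩
  filter_upwards [hv.2 z hz, hw.2 z hz, circ_small hΩ hz] with r h1 h2 h3
  refine max_le (h1.trans ?_) (h2.trans ?_)
  · exact Real.circleAverage_mono (ci_of_cont hv.1 h3.2) (ci_of_cont hc h3.2)
      fun x _ => le_max_left _ _
  · exact Real.circleAverage_mono (ci_of_cont hw.1 h3.2) (ci_of_cont hc h3.2)
      fun x _ => le_max_right _ _

lemma harm_SH {v : ℂ → ℝ} {Ω : Set ℂ} (hΩ : IsOpen Ω)
    (hv : InnerProductSpace.HarmonicOnNhd v Ω) : SH v Ω := by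
  refine ⟨fun z hz => (hv z hz).1.continuousAt.continuousWithinAt, fun z hz => ?_⟩
  filter_upwards [circ_small hΩ hz] with r h
  rw [InnerProductSpace.HarmonicOnNhd.circleAverage_eq (hv.mono h.2)]

lemma SH_const (a : ℝ) (Ω : Set ℂ) : SH (fun _ => a) Ω :=
  ⟨continuousOn_const, fun z _ => by simp [Real.circleAverage_const]⟩

lemma harm_re {g : ℂ → ℂ} {Ω : Set ℂ} (hg : AnalyticOnNhd ℂ g Ω) :
    InnerProductSpace.HarmonicOnNhd (fun z => (g z).re) Ω := fun z hz => (hg z hz).harmonicAt_re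

lemma SH_re {g : ℂ → ℂ} {Ω : Set ℂ} (hΩ : IsOpen Ω) (hg : AnalyticOnNhd ℂ g Ω) :
    SH (fun z => (g z).re) Ω := harm_SH hΩ (harm_re hg)

lemma SH_log {g : ℂ → ℂ} {Ω : Set ℂ} (hΩ : IsOpen Ω) (hg : AnalyticOnNhd ℂ g Ω)
    (h0 : ∀ z ∈ Ω, g z ≠ 0) (a : ℝ) : SH (fun z => a * rlog ‖g z‖) Ω := by
  refine harm_SH hΩ fun z hz => ?_
  have := ((hg z hz).harmonicAt_log_norm (h0 z hz)).const_smul (c := a)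
  exact this

lemma SH.sum {ι : Type*} (s : Finset ι) {v : ι → ℂ → ℝ} {Ω : Set ℂ} (hΩ : IsOpen Ω)
    (hv : ∀ i ∈ s, SH (v i) Ω) : SH (fun z => ∑ i ∈ s, v i z) Ω := by
  classical
  induction s using Finset.induction_on with
  | empty => simpa using SH_const 0 Ω
  | insert a s ha ih =>
    simp only [Finset.sum_insert ha]
    exact (hv a (Finset.mem_insert_self _ _)).add hΩ
      (ih fun i hi => hv i (Finset.mem_insert_of_mem hi))

lemma avg_normSq (z : ℂ) (r : ℝ) :
    Real.circleAverage (fun w : ℂ => ‖w‖ ^ 2) z r = ‖z‖ ^ 2 + r ^ 2 := by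
  have h1 : Real.circleAverage (fun w : ℂ => ‖w‖ ^ 2) z r
      = Real.circleAverage (fun w : ℂ => (2 * (starRingEnd ℂ z) * w).re +
        (r ^ 2 - ‖z‖ ^ 2)) z r := by
    apply Real.circleAverage_congr_sphere
    intro w hw
    have : ‖w - z‖ ^ 2 = r ^ 2 := by
      rw [mem_sphere_iff_norm.1 hw, sq_abs]
    simp only [← Complex.normSq_eq_norm_sq, Complex.normSq_apply, Complex.sub_re,
      Complex.sub_im] at this ⊢
    simp
    nlinarith
  rw [h1]
  have hh : InnerProductSpace.HarmonicOnNhd (fun w : ℂ => (2 * (starRingEnd ℂ z) * w +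
      ((r ^ 2 - ‖z‖ ^ 2 : ℝ) : ℂ)).re) univ :=
    harm_re (fun w _ => by fun_prop)
  have := InnerProductSpace.HarmonicOnNhd.circleAverage_eq (c := z) (R := r)
    (hh.mono (subset_univ _))
  simp only [Complex.add_re, Complex.ofReal_re] at this
  rw [this]
  simp only [← Complex.normSq_eq_norm_sq, Complex.normSq_apply]
  simp
  ring

lemma max_prin {v : ℂ → ℝ} {Ω : Set ℂ} (hΩ : IsOpen Ω) (hb : IsBounded Ω) (hv : SH v Ω)
    (hc : ContinuousOn v (closure Ω)) {m : ℝ} (hm : ∀ z ∈ frontier Ω, v z ≤ m) :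
    ∀ z ∈ Ω, v z ≤ m := by
  intro z0 hz0
  by_contra! hlt
  have hK : IsCompact (closure Ω) := hb.isCompact_closure
  obtain ⟨R, hR⟩ := hK.isBounded.exists_norm_le
  have hR0 : 0 ≤ R := (norm_nonneg _).trans (hR z0 (subset_closure hz0))
  set ε : ℝ := (v z0 - m) / (2 * (R ^ 2 + 1)) with hε
  have hε0 : 0 < ε := by
    apply div_pos (by linarith); positivity
  have hεR : ε * R ^ 2 < v z0 - m := by
    have : ε * (2 * (R ^ 2 + 1)) = v z0 - m := by rw [hε]; field_simp
    nlinarith [sq_nonneg R]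
  have hcv : ContinuousOn (fun z => v z + ε * ‖z‖ ^ 2) (closure Ω) :=
    hc.add (by fun_prop)
  obtain ⟨z1, hz1, hmax⟩ := hK.exists_isMaxOn ⟨z0, subset_closure hz0⟩ hcv
  have h1 : v z0 ≤ v z1 + ε * ‖z1‖ ^ 2 := by
    have h := hmax (subset_closure hz0)
    simp only [mem_ofPred_eq] at h
    have := mul_nonneg hε0.le (sq_nonneg ‖z0‖)
    linarith
  have hz1Ω : z1 ∈ Ω := by
    by_contra hn
    have : z1 ∈ frontier Ω := by
      rw [frontier, hΩ.interior_eq]; exact ⟨hz1, hn⟩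
    have h2 := hm z1 this
    have h3 : ε * ‖z1‖ ^ 2 ≤ ε * R ^ 2 := by
      gcongr; exact hR z1 hz1
    linarith
  obtain ⟨r, hr, hr2⟩ := ((hv.2 z1 hz1Ω).and (circ_small hΩ hz1Ω)).exists
  have hi := ci_of_cont hv.1 hr2.2
  have hi2 : CircleIntegrable (fun z : ℂ => ε * ‖z‖ ^ 2) z1 r :=
    ci_of_cont (Ω := univ) (by fun_prop) (subset_univ _)
  have e1 := Real.circleAverage_fun_add hi hi2
  have e2 := Real.circleAverage_fun_smul (f := fun w : ℂ => ‖w‖ ^ 2) (c := z1) (R := r) (a := ε)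
  simp only [smul_eq_mul] at e2
  rw [e2, avg_normSq] at e1
  have h5 := Real.circleAverage_mono_on_of_le_circle (f := fun z => v z + ε * ‖z‖ ^ 2)
    (c := z1) (R := r) (a := v z1 + ε * ‖z1‖ ^ 2) (hi.add hi2) (fun x hx =>
      hmax (subset_closure (hr2.2 (Metric.sphere_subset_closedBall hx))))
  rw [e1] at h5
  nlinarith [hr2.1, mul_pos hε0 (pow_pos hr2.1 2)]
end

section

lemma trig_aux (g : C(AddCircle (2 * π), ℂ))
    (hg : g ∈ Submodule.span ℂ (Set.range (fourier (T := 2 * π)))) :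
    ∃ p q : Polynomial ℂ, ∀ θ : ℝ, g (θ : AddCircle (2 * π)) =
      p.eval (cexp (θ * I)) +
        starRingEnd ℂ (q.eval (cexp (θ * I))) := by
  induction hg using Submodule.span_induction with
  | mem x hx =>
    obtain ⟨n, rfl⟩ := hx
    obtain ⟨k, rfl | rfl⟩ := n.eq_nat_or_neg
    · refine ⟨Polynomial.X ^ k, 0, fun θ => ?_⟩
      rw [fourier_coe_apply]
      simp only [Polynomial.eval_pow, Polynomial.eval_X, Polynomial.eval_zero, map_zero, add_zero,
        ← Complex.exp_nat_mul]
      congr 1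
      have : (π : ℂ) ≠ 0 := by exact_mod_cast Real.pi_ne_zero
      push_cast; field_simp
    · refine ⟨0, Polynomial.X ^ k, fun θ => ?_⟩
      rw [fourier_coe_apply]
      simp only [Polynomial.eval_pow, Polynomial.eval_X, Polynomial.eval_zero, zero_add,
        ← Complex.exp_nat_mul, ← Complex.exp_conj]
      congr 1
      have : (π : ℂ) ≠ 0 := by exact_mod_cast Real.pi_ne_zero
      simp only [map_mul, map_natCast, Complex.conj_ofReal, Complex.conj_I]
      push_cast; field_simp
  | zero => exact ⟨0, 0, by simp⟩
  | add x y _ _ hx hy =>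
    obtain ⟨p, q, h⟩ := hx
    obtain ⟨p', q', h'⟩ := hy
    refine ⟨p + p', q + q', fun θ => ?_⟩
    simp only [ContinuousMap.add_apply, h, h', Polynomial.eval_add, map_add]; ring
  | smul a x _ hx =>
    obtain ⟨p, q, h⟩ := hx
    refine ⟨Polynomial.C a * p, Polynomial.C (starRingEnd ℂ a) * q, fun θ => ?_⟩
    simp [h]; ring

lemma trig_approx {v : ℂ → ℝ} {c : ℂ} {r : ℝ} (hr : 0 < r)
    (hv : ContinuousOn v (sphere c r)) {η : ℝ} (hη : 0 < η) :
    ∃ g : ℂ → ℂ, AnalyticOnNhd ℂ g univ ∧ ∀ z ∈ sphere c r, |v z - (g z).re| ≤ η := by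
  have : Fact (0 < 2 * π) := ⟨by positivity⟩
  have hcm : Continuous fun x : ℝ => v (circleMap c r x) := by
    refine hv.comp_continuous (continuous_circleMap c r) fun x => ?_
    exact circleMap_mem_sphere c hr.le x
  have hper : Function.Periodic (fun x : ℝ => (v (circleMap c r x) : ℂ)) (2 * π) := by
    intro x; simp only [periodic_circleMap c r x]
  let G : C(AddCircle (2 * π), ℂ) :=
    ⟨hper.lift, continuous_coinduced_dom.mpr (Complex.continuous_ofReal.comp hcm)⟩
  have hG : G ∈ closure ((Submodule.span ℂ (Set.range (fourier (T := 2 * π)))) :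
      Set C(AddCircle (2 * π), ℂ)) := by
    have h := span_fourier_closure_eq_top (T := 2 * π)
    have : G ∈ (Submodule.span ℂ (Set.range (fourier (T := 2 * π)))).topologicalClosure := by
      rw [h]; trivial
    exact this
  obtain ⟨b, hb, hd⟩ := Metric.mem_closure_iff.1 hG η hη
  obtain ⟨p, q, h⟩ := trig_aux b hb
  refine ⟨fun z => (p + q).eval ((z - c) / r), fun z _ => ?_, fun z hz => ?_⟩
  · have : Differentiable ℂ fun z : ℂ => (p + q).eval ((z - c) / r) :=
      (Polynomial.differentiable (p + q)).comp
        ((differentiable_id.sub_const c).div_const (r : ℂ))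
    exact this.analyticAt z
  · obtain ⟨θ, -, rfl⟩ : ∃ θ ∈ Ioc 0 (2 * π), circleMap c r θ = z := by
      have := image_circleMap_Ioc c r
      rw [abs_of_pos hr] at this
      rw [← this] at hz
      exact hz
    have h1 : dist (G (θ : AddCircle (2 * π))) (b θ) < η :=
      (ContinuousMap.dist_apply_le_dist _).trans_lt hd
    have h2 : G (θ : AddCircle (2 * π)) = (v (circleMap c r θ) : ℂ) := rfl
    have hr' : (r : ℂ) ≠ 0 := by exact_mod_cast hr.ne'
    have h3 : (circleMap c r θ - c) / r = cexp (θ * I) := by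
      simp [circleMap]; field_simp
    rw [h2, h, dist_eq_norm] at h1
    have h4 := (Complex.abs_re_le_norm _).trans h1.le
    simp only [Complex.sub_re, Complex.add_re, Complex.conj_re, Complex.ofReal_re] at h4
    simp only [h3, Polynomial.eval_add, Complex.add_re]
    exact h4

lemma submean {v : ℂ → ℝ} {c : ℂ} {r : ℝ} (hr : 0 < r) (hv : SH v (ball c r))
    (hc : ContinuousOn v (closedBall c r)) : v c ≤ Real.circleAverage v c r := by
  refine le_of_forall_pos_le_add fun η hη => ?_
  obtain ⟨g, hg, hgv⟩ := trig_approx hr (hc.mono Metric.sphere_subset_closedBall) (half_pos hη)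
  have hgc : Continuous fun z => (g z).re :=
    Complex.continuous_re.comp (continuous_iff_continuousAt.2 fun z => (hg z trivial).continuousAt)
  have hS : SH (fun z => v z + (- g z).re) (ball c r) :=
    hv.add Metric.isOpen_ball (SH_re Metric.isOpen_ball
      fun z _ => (hg z trivial).neg)
  have hcl : closure (ball c r) = closedBall c r := closure_ball c hr.ne'
  have h1 := max_prin Metric.isOpen_ball Metric.isBounded_ball hS
    (by rw [hcl]; exact hc.add ((hgc.neg.continuousOn).congr (fun z _ => Complex.neg_re _))) (m := η / 2) (by
      intro z hz
      rw [frontier_ball c hr.ne'] at hz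
      have := (abs_le.1 (hgv z hz)).2
      simp only [Complex.neg_re]; linarith) c (Metric.mem_ball_self hr)
  have h2 : Real.circleAverage (fun z => (g z).re) c r = (g c).re :=
    InnerProductSpace.HarmonicOnNhd.circleAverage_eq ((harm_re hg).mono (subset_univ _))
  have h3 : Real.circleAverage (fun z => (g z).re) c r ≤
      Real.circleAverage (fun z => v z + η / 2) c r := by
    have hvi : CircleIntegrable v c r :=
      ci_of_cont hc (by rw [abs_of_pos hr])
    apply Real.circleAverage_mono (ci_of_cont (Ω := univ) hgc.continuousOn (subset_univ _))
      (hvi.add (circleIntegrable_const _ _ _))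
    intro x hx
    rw [abs_of_pos hr] at hx
    have := (abs_le.1 (hgv x hx)).1
    show (g x).re ≤ v x + η / 2
    linarith
  rw [Real.circleAverage_fun_add (ci_of_cont hc (by rw [abs_of_pos hr]))
    (circleIntegrable_const _ _ _), Real.circleAverage_const, h2] at h3
  simp only [Complex.neg_re] at h1
  linarith
end

section

def ann (a b : ℝ) : Set ℂ := {z | a < ‖z‖ ∧ ‖z‖ < b}

lemma isOpen_ann (a b : ℝ) : IsOpen (ann a b) :=
  (isOpen_lt continuous_const continuous_norm).inter (isOpen_lt continuous_norm continuous_const)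

lemma avg_rot (v : ℂ → ℝ) (z : ℂ) : Real.circleAverage v 0 ‖z‖ =
    (2 * π)⁻¹ * ∫ θ in (0:ℝ)..2 * π, v (z * cexp (θ * I)) := by
  rw [Real.circleAverage_eq_integral_add (Complex.arg z), smul_eq_mul]
  congr 1
  apply intervalIntegral.integral_congr
  intro θ _
  simp only [circleMap, zero_add]
  congr 1
  conv_rhs => rw [← Complex.norm_mul_exp_arg_mul_I z]
  push_cast
  rw [add_mul, Complex.exp_add]; ring

lemma SH_avg {v : ℂ → ℝ} {a b : ℝ} (hv : SH v (ann a b)) :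
    SH (fun z => Real.circleAverage v 0 ‖z‖) (ann a b) := by
  constructor
  · have h : ContinuousOn (Real.circleAverage v 0) {t | 0 ≤ t ∧ a < t ∧ t < b} := by
      apply Real.ContinuousOn.circleAverage
      · apply hv.1.mono
        rintro z ⟨-, h1, h2⟩
        simp only [sub_zero] at h1 h2
        exact ⟨h1, h2⟩
      · exact fun r hr => hr.1
    exact h.comp continuous_norm.continuousOn fun z hz => ⟨norm_nonneg z, hz.1, hz.2⟩
  · intro z hz
    filter_upwards [circ_small (isOpen_ann a b) hz] with r hr
    obtain ⟨hr0, hr⟩ := hr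
    rw [abs_of_pos hr0] at hr
    have hsub : ∀ θ : ℝ, closedBall (z * cexp (θ * I)) r ⊆ ann a b := by
      intro θ w hw
      have hn : ‖cexp (-(θ * I))‖ = 1 := by
        have := Complex.norm_exp_ofReal_mul_I (-θ)
        push_cast at this; rwa [neg_mul] at this
      have : w * cexp (-(θ * I)) ∈ ann a b := by
        apply hr
        rw [mem_closedBall_iff_norm] at hw ⊢
        have e : w * cexp (-(θ * I)) - z
            = (w - z * cexp (θ * I)) * cexp (-(θ * I)) := by
          rw [sub_mul, mul_assoc, ← Complex.exp_add]; simp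
        rw [e, norm_mul, hn, mul_one]; exact hw
      simpa [ann, hn] using this
    have key : ∀ θ : ℝ, v (z * cexp (θ * I)) ≤
        Real.circleAverage v (z * cexp (θ * I)) r := fun θ =>
      submean hr0 (hv.mono (Metric.ball_subset_closedBall.trans (hsub θ))) (hv.1.mono (hsub θ))
    have hF : Continuous (fun p : ℝ × ℝ => v (circleMap z r p.1 * cexp (p.2 * I))) := by
      rw [← continuousOn_univ]
      apply hv.1.comp (by fun_prop)
      intro p _
      have := hr (circleMap_mem_closedBall z hr0.le p.1)
      simpa [ann] using this
    have e0 : Real.circleAverage (fun z => Real.circleAverage v 0 ‖z‖) z r =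
        (2 * π)⁻¹ * ∫ θ in (0:ℝ)..2 * π,
          Real.circleAverage v (z * cexp (θ * I)) r := by
      rw [Real.circleAverage_def, smul_eq_mul]
      congr 1
      simp only [avg_rot]
      rw [intervalIntegral.integral_const_mul]
      rw [intervalIntegral_intervalIntegral_swap
        (F := fun φ θ => v (circleMap z r φ * cexp (θ * I)))]
      · rw [← intervalIntegral.integral_const_mul]
        apply intervalIntegral.integral_congr
        intro θ _
        simp only
        rw [Real.circleAverage_eq_integral_add θ, smul_eq_mul]
        congr 1
        apply intervalIntegral.integral_congr
        intro φ _
        simp only [circleMap]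
        congr 1
        push_cast
        rw [add_mul (φ : ℂ), Complex.exp_add]; ring
      · exact (hF.continuousOn.integrableOn_compact (isCompact_uIcc.prod isCompact_uIcc)).mono_set
          (prod_mono uIoc_subset_uIcc uIoc_subset_uIcc)
    rw [e0]; simp only [avg_rot]
    apply mul_le_mul_of_nonneg_left _ (by positivity)
    have hc2 : Continuous fun θ : ℝ => Real.circleAverage v (z * cexp (θ * I)) r := by
      simp only [Real.circleAverage_def, smul_eq_mul]
      apply continuous_const.mul
      apply intervalIntegral.continuous_parametric_intervalIntegral_of_continuous'
      rw [← continuousOn_univ]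
      apply hv.1.comp (by unfold circleMap; fun_prop)
      rintro ⟨θ, φ⟩ _
      exact hsub θ (circleMap_mem_closedBall _ hr0.le φ)
    have hc1 : Continuous fun θ : ℝ => v (z * cexp (θ * I)) := by
      rw [← continuousOn_univ]
      apply hv.1.comp (by fun_prop)
      intro θ _
      exact hsub θ (Metric.mem_closedBall_self hr0.le)
    apply intervalIntegral.integral_mono_on (by positivity) (hc1.intervalIntegrable _ _)
      (hc2.intervalIntegrable _ _)
    intro θ _; exact key θ

lemma closure_ann_sub {a b s t : ℝ} (h1 : a < s) (h2 : t < b) : closure (ann s t) ⊆ ann a b := by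
  have : closure (ann s t) ⊆ {z | s ≤ ‖z‖ ∧ ‖z‖ ≤ t} :=
    closure_minimal (fun z hz => ⟨hz.1.le, hz.2.le⟩)
      ((isClosed_le continuous_const continuous_norm).inter
        (isClosed_le continuous_norm continuous_const))
  exact this.trans fun z hz => ⟨h1.trans_le hz.1, hz.2.trans_lt h2⟩

lemma frontier_ann_sub {s t : ℝ} {z : ℂ} (hz : z ∈ frontier (ann s t)) : ‖z‖ = s ∨ ‖z‖ = t := by
  rw [frontier, (isOpen_ann s t).interior_eq] at hz
  have : closure (ann s t) ⊆ {z | s ≤ ‖z‖ ∧ ‖z‖ ≤ t} :=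
    closure_minimal (fun z hz => ⟨hz.1.le, hz.2.le⟩)
      ((isClosed_le continuous_const continuous_norm).inter
        (isClosed_le continuous_norm continuous_const))
  have h := this hz.1
  by_contra! hc
  exact hz.2 ⟨lt_of_le_of_ne h.1 hc.1.symm, lt_of_le_of_ne h.2 hc.2⟩

lemma isBounded_ann (s t : ℝ) : IsBounded (ann s t) :=
  (Metric.isBounded_ball (x := (0:ℂ)) (r := t)).subset fun z hz => by
    simpa using hz.2

lemma avg_mono {v : ℂ → ℝ} {b s t : ℝ} (hv : SH v (ball 0 b)) (hs : 0 ≤ s) (hst : s ≤ t)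
    (ht : t < b) : Real.circleAverage v 0 s ≤ Real.circleAverage v 0 t := by
  rcases hst.eq_or_lt with rfl | hst
  · rfl
  have hv' : SH v (ann (-2) b) := hv.mono fun z hz => by simpa using hz.2
  have hJ := SH_avg hv'
  have := max_prin (isOpen_ann (-1) t) (isBounded_ann _ _)
    (hJ.mono fun z hz => ⟨by linarith [hz.1], hz.2.trans ht⟩)
    (hJ.1.mono (closure_ann_sub (by norm_num) ht)) (m := Real.circleAverage v 0 t)
    (by
      intro z hz
      rcases frontier_ann_sub hz with h | h
      · linarith [norm_nonneg z]
      · rw [h]) (s : ℂ) ⟨by simp [abs_of_nonneg hs]; linarith, by simp [abs_of_nonneg hs, hst]⟩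
  simpa [abs_of_nonneg hs] using this

lemma avg_convex {v : ℂ → ℝ} {a b r s t : ℝ} (hv : SH v (ann a b)) (har : a < r) (hr : 0 < r)
    (hrs : r ≤ s) (hst : s ≤ t) (ht : t < b) {α β : ℝ}
    (h1 : Real.circleAverage v 0 r ≤ α + β * rlog r)
    (h2 : Real.circleAverage v 0 t ≤ α + β * rlog t) :
    Real.circleAverage v 0 s ≤ α + β * rlog s := by
  rcases hrs.eq_or_lt with rfl | hrs
  · exact h1
  rcases hst.eq_or_lt with rfl | hst
  · exact h2
  have hs : 0 < s := hr.trans hrs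
  have hJ := SH_avg hv
  set a' := max a 0
  have ha' : a' < r := max_lt har hr
  have hsub : ann a' b ⊆ ann a b := fun z hz => ⟨(le_max_left _ _).trans_lt hz.1, hz.2⟩
  have hlog : SH (fun z => -β * rlog ‖id z‖) (ann a' b) := SH_log (isOpen_ann _ _)
    (fun z _ => analyticAt_id) (fun z hz => by
      have : 0 < ‖z‖ := (le_max_right _ _).trans_lt hz.1
      simpa using this) _
  have hS := (hJ.mono hsub).add (isOpen_ann _ _) hlog
  have := max_prin (isOpen_ann r t) (isBounded_ann _ _)
    (hS.mono (subset_closure.trans (closure_ann_sub ha' ht)))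
    (hS.1.mono (closure_ann_sub ha' ht)) (m := α)
    (by
      intro z hz
      simp only [id]
      rcases frontier_ann_sub hz with h | h
      · rw [h]; linarith
      · rw [h]; linarith) (s : ℂ) ⟨by simp [abs_of_pos hs, hrs], by simp [abs_of_pos hs, hst]⟩
  simp [abs_of_pos hs] at this
  linarith

lemma SH_lift {u : ℂ → ℝ} {Ω : Set ℂ} (hΩ : IsOpen Ω) (hu : SH u Ω) {e : ℂ} {δ : ℝ} (hδ : 0 < δ)
    (hsub : closedBall e δ ⊆ Ω) (hlt : u e < Real.circleAverage u e δ) :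
    ∃ w : ℂ → ℝ, SH w Ω ∧ (∀ z, u z ≤ w z) ∧ (∀ z, z ∉ ball e δ → w z = u z) ∧ u e < w e := by
  set η := (Real.circleAverage u e δ - u e) / 4 with hη
  have hη0 : 0 < η := by rw [hη]; linarith
  obtain ⟨g, hg, hgv⟩ := trig_approx hδ (hu.1.mono (Metric.sphere_subset_closedBall.trans hsub)) hη0
  have hgc : Continuous fun z => (g z).re :=
    Complex.continuous_re.comp (continuous_iff_continuousAt.2 fun z => (hg z trivial).continuousAt)
  classical
  set q : ℂ → ℝ := fun z => (g z).re - 2 * η with hq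
  have hqc : Continuous q := hgc.sub continuous_const
  have hqs : SH q univ := by
    have := (SH_re isOpen_univ hg).add isOpen_univ (SH_const (-2 * η) univ)
    exact this.congr isOpen_univ fun z _ => by simp [hq]; ring
  set w : ℂ → ℝ := fun z => if z ∈ ball e δ then max (u z) (q z) else u z with hw
  have hsph : ∀ z ∈ sphere e δ, q z < u z := by
    intro z hz
    have := (abs_le.1 (hgv z hz)).1
    simp only [hq]; linarith
  have huw : ∀ z, u z ≤ w z := by
    intro z; simp only [hw]; split_ifs
    · exact le_max_left _ _
    · exact le_rfl
  have hwm : SH (fun z => max (u z) (q z)) Ω := hu.smax hΩ (hqs.mono (subset_univ _))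
  have hloc : ∀ z ∈ Ω, z ∉ ball e δ → w =ᶠ[𝓝 z] u := by
    intro z hz hzb
    by_cases hs : z ∈ sphere e δ
    · have : ∀ᶠ y in 𝓝 z, q y < u y :=
        (hqc.continuousAt).eventually_lt (hu.1.continuousAt (hΩ.mem_nhds hz)) (hsph z hs)
      filter_upwards [this] with y hy
      simp only [hw]; split_ifs
      · exact max_eq_left hy.le
      · rfl
    · have : z ∈ (closedBall e δ)ᶜ := by
        simp only [mem_compl_iff, Metric.mem_closedBall, Metric.mem_ball, Metric.mem_sphere] at *
        intro h; exact hs (le_antisymm h (not_lt.1 hzb))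
      filter_upwards [Metric.isClosed_closedBall.isOpen_compl.mem_nhds this] with y hy
      have : y ∉ ball e δ := fun h => hy (Metric.ball_subset_closedBall h)
      simp only [hw, this, if_false]
  have hloc2 : ∀ z ∈ ball e δ, w =ᶠ[𝓝 z] fun z => max (u z) (q z) := by
    intro z hz
    filter_upwards [Metric.isOpen_ball.mem_nhds hz] with y hy
    simp only [hw, hy, if_true]
  have hci : ContinuousOn w Ω := by
    intro z hz
    apply ContinuousAt.continuousWithinAt
    by_cases hzb : z ∈ ball e δ
    · exact (hwm.1.continuousAt (hΩ.mem_nhds hz)).congr (hloc2 z hzb).symm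
    · exact (hu.1.continuousAt (hΩ.mem_nhds hz)).congr (hloc z hz hzb).symm
  refine ⟨w, ⟨hci, fun z hz => ?_⟩, huw, fun z hz => by simp only [hw, hz, if_false], ?_⟩
  · by_cases hzb : z ∈ ball e δ
    · filter_upwards [hwm.2 z hz, circ_small Metric.isOpen_ball hzb] with r h1 h2
      rw [Real.circleAverage_congr_sphere (f₂ := fun z => max (u z) (q z))]
      · simp only [hw, hzb, if_true]; exact h1
      · intro y hy
        have := h2.2 (Metric.sphere_subset_closedBall hy)
        simp only [hw, this, if_true]
    · filter_upwards [hu.2 z hz, circ_small hΩ hz] with r h1 h2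
      have : w z = u z := by simp only [hw, hzb, if_false]
      rw [this]
      refine h1.trans (Real.circleAverage_mono (ci_of_cont hu.1 h2.2) (ci_of_cont hci h2.2) ?_)
      exact fun x _ => huw x
  · have heb : e ∈ ball e δ := Metric.mem_ball_self hδ
    have h2 : Real.circleAverage (fun z => (g z).re) e δ = (g e).re :=
      InnerProductSpace.HarmonicOnNhd.circleAverage_eq ((harm_re hg).mono (subset_univ _))
    have hci : CircleIntegrable u e δ := ci_of_cont hu.1 (by rw [abs_of_pos hδ]; exact hsub)
    have h3 : Real.circleAverage u e δ ≤ (g e).re + η := by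
      rw [← h2]
      have hgi : CircleIntegrable (fun z => (g z).re) e δ :=
        ci_of_cont (Ω := univ) hgc.continuousOn (subset_univ _)
      rw [← Real.circleAverage_const η e δ, ← Real.circleAverage_fun_add hgi
        (circleIntegrable_const _ _ _)]
      apply Real.circleAverage_mono hci (hgi.add (circleIntegrable_const _ _ _))
      intro x hx
      rw [abs_of_pos hδ] at hx
      have := (abs_le.1 (hgv x hx)).2
      show u x ≤ (g x).re + η
      linarith
    have : q e > u e := by simp only [hq]; linarith
    have h4 : w e = max (u e) (q e) := by simp only [hw, heb, if_true]
    rw [h4]; exact lt_max_of_lt_right this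
end

section

lemma sum_log_aux (N m : ℕ) (hN : 1 ≤ N) (hm : m ≤ N) :
    ∑ k ∈ Finset.range m, rlog (64 * N / ((k : ℝ) + 1)) ≤ 64 * N := by
  have hN0 : (0:ℝ) < N := by exact_mod_cast hN
  have h1 : ∑ k ∈ Finset.range m, rlog (64 * N / ((k : ℝ) + 1)) ≤
      ∑ k ∈ Finset.range N, rlog (64 * N / ((k : ℝ) + 1)) := by
    apply Finset.sum_le_sum_of_subset_of_nonneg (Finset.range_mono hm)
    intro k hk _
    apply Real.log_nonneg
    have : (k : ℝ) + 1 ≤ N := by exact_mod_cast Finset.mem_range.1 hk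
    rw [le_div_iff₀ (by positivity)]; linarith
  refine h1.trans ?_
  have h2 : ∀ k ∈ Finset.range N, rlog (64 * N / ((k : ℝ) + 1)) =
      rlog (64 * N) - rlog (((k + 1 : ℕ) : ℝ)) := by
    intro k _
    rw [Real.log_div (by positivity) (by positivity)]; push_cast; rfl
  rw [Finset.sum_congr rfl h2, Finset.sum_sub_distrib, ← Real.log_prod (f := fun k : ℕ => ((k + 1 : ℕ) : ℝ)) (fun i _ => by positivity),
    ← Nat.cast_prod, Finset.prod_range_add_one_eq_factorial]
  simp only [Finset.sum_const, Finset.card_range, nsmul_eq_mul]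
  have h3 := Real.log_le_log (by positivity) (Real.pow_div_factorial_le_exp (N : ℝ) hN0.le N)
  rw [Real.log_exp, Real.log_div (by positivity) (by positivity), Real.log_pow] at h3
  have h4 : rlog (64 * N) = rlog 64 + rlog N := Real.log_mul (by norm_num) hN0.ne'
  have h5 : rlog 64 ≤ 64 - 1 := Real.log_le_sub_one_of_pos (by norm_num)
  rw [h4]
  nlinarith

lemma sum_log_aux2 (N j : ℕ) (hN : 1 ≤ N) (hj : j < N) (T : ℕ → ℝ)
    (h0 : T j ≤ rlog (64 * N))
    (h1 : ∀ i < N, i < j → T i ≤ rlog (64 * N / ((j - i : ℕ) : ℝ)))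
    (h2 : ∀ i < N, j < i → T i ≤ rlog (64 * N / ((i - j : ℕ) : ℝ))) :
    ∑ i ∈ Finset.range N, T i ≤ 192 * N := by
  have hN0 : (0:ℝ) < N := by exact_mod_cast hN
  obtain ⟨m, rfl⟩ : ∃ m, N = j + 1 + m := ⟨N - (j + 1), by omega⟩
  rw [Finset.sum_range_add, Finset.sum_range_succ, ← Finset.sum_range_reflect]
  have e1 : ∑ k ∈ Finset.range j, T (j - 1 - k) ≤ 64 * ((j + 1 + m : ℕ) : ℝ) := by
    refine le_trans (Finset.sum_le_sum ?_) (sum_log_aux (j + 1 + m) j hN (by omega))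
    intro k hk
    have hk := Finset.mem_range.1 hk
    have := h1 (j - 1 - k) (by omega) (by omega)
    have e : j - (j - 1 - k) = k + 1 := by omega
    rw [e] at this; exact_mod_cast this
  have e2 : ∑ k ∈ Finset.range m, T (j + 1 + k) ≤ 64 * ((j + 1 + m : ℕ) : ℝ) := by
    refine le_trans (Finset.sum_le_sum ?_) (sum_log_aux (j + 1 + m) m hN (by omega))
    intro k hk
    have hk := Finset.mem_range.1 hk
    have := h2 (j + 1 + k) (by omega) (by omega)
    have e : j + 1 + k - j = k + 1 := by omega
    rw [e] at this; exact_mod_cast this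
  have e3 : rlog (64 * ((j + 1 + m : ℕ) : ℝ)) ≤ 64 * ((j + 1 + m : ℕ) : ℝ) := by
    linarith [Real.log_le_sub_one_of_pos (x := 64 * ((j + 1 + m : ℕ) : ℝ)) (by positivity)]
  linarith

lemma capacity {w : ℂ → ℝ} {L H : ℝ} (hL : 0 < L) (hH : 0 < H)
    (hw : SH w (ball 0 L)) (hc : ContinuousOn w (closedBall 0 L))
    (hneg : ∀ z ∈ closedBall (0:ℂ) L, w z ≤ 0)
    (hE : ∀ s ∈ Icc (L / 16) (L / 8), ∃ e : ℂ, ‖e‖ = s ∧ w e ≤ -H) :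
    ∀ z : ℂ, ‖z‖ ≤ L / 32 → w z ≤ -(H / 400) := by
  have huc := (isCompact_closedBall (0:ℂ) L).uniformContinuousOn_of_continuous hc
  obtain ⟨η, hη, hη2⟩ := Metric.uniformContinuousOn_iff.1 huc (H / 2) (by positivity)
  obtain ⟨N0, hN0⟩ := exists_nat_gt (L / (32 * η))
  set N := N0 + 2 with hN
  have hNp : (0:ℝ) < N := by positivity
  have hN2 : (2:ℝ) ≤ N := by rw [hN]; push_cast; linarith [(Nat.cast_nonneg N0 : (0:ℝ) ≤ N0)]
  set η' := L / (32 * N) with hη'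
  have hη'0 : 0 < η' := by positivity
  have hη'η : η' < η := by
    rw [hη', div_lt_iff₀ (by positivity)]
    rw [div_lt_iff₀ (by positivity)] at hN0
    have : (N0:ℝ) ≤ N := by rw [hN]; push_cast; linarith
    nlinarith
  have hη'L : η' ≤ L / 64 := by
    rw [hη', div_le_div_iff₀ (by positivity) (by positivity)]; nlinarith
  have hE' : ∀ i : ℕ, ∃ e : ℂ, i < N → ‖e‖ = L / 16 + i * (2 * η') ∧ w e ≤ -H := by
    intro i
    by_cases hi : i < N
    · obtain ⟨e, he⟩ := hE (L / 16 + i * (2 * η')) ⟨by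
        have : 0 ≤ (i:ℝ) * (2 * η') := by positivity
        linarith, by
        have h1 : (i:ℝ) ≤ N := by exact_mod_cast hi.le
        have h2 : (N:ℝ) * (2 * η') = L / 16 := by rw [hη']; field_simp; norm_num
        have h3 : (i:ℝ) * (2 * η') ≤ (N:ℝ) * (2 * η') := by gcongr
        linarith⟩
      exact ⟨e, fun _ => he⟩
    · exact ⟨0, fun h => absurd h hi⟩
  choose e he using hE'
  have heL : ∀ i < N, ‖e i‖ ≤ L / 8 ∧ L / 16 ≤ ‖e i‖ := by
    intro i hi
    have h1 : (i:ℝ) ≤ N := by exact_mod_cast hi.le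
    have h2 : (N:ℝ) * (2 * η') = L / 16 := by rw [hη']; field_simp; norm_num
    have h3 : (i:ℝ) * (2 * η') ≤ (N:ℝ) * (2 * η') := by gcongr
    have : 0 ≤ (i:ℝ) * (2 * η') := by positivity
    rw [(he i hi).1]; constructor <;> linarith
  set Ω : Set ℂ := {z | ‖z‖ < L ∧ ∀ i ∈ Finset.range N, η' < ‖z - e i‖} with hΩ
  have hΩo : IsOpen Ω := by
    have : Ω = {z | ‖z‖ < L} ∩ ⋂ i ∈ Finset.range N, {z | η' < ‖z - e i‖} := by
      ext z; simp [hΩ]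
    rw [this]
    refine (isOpen_lt continuous_norm continuous_const).inter
      (isOpen_biInter_finset fun i _ => isOpen_lt continuous_const (by fun_prop))
  have hcl : closure Ω ⊆ {z | ‖z‖ ≤ L ∧ ∀ i ∈ Finset.range N, η' ≤ ‖z - e i‖} := by
    apply closure_minimal
    · exact fun z hz => ⟨hz.1.le, fun i hi => (hz.2 i hi).le⟩
    · have : {z | ‖z‖ ≤ L ∧ ∀ i ∈ Finset.range N, η' ≤ ‖z - e i‖} =
          {z | ‖z‖ ≤ L} ∩ ⋂ i ∈ Finset.range N, {z | η' ≤ ‖z - e i‖} := by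
        ext z; simp
      rw [this]
      exact (isClosed_le continuous_norm continuous_const).inter
        (isClosed_biInter fun i _ => isClosed_le continuous_const (by fun_prop))
  have hΩL : Ω ⊆ ball 0 L := fun z hz => by simpa using hz.1
  set a := H / (384 * N) with ha
  have ha0 : 0 < a := by positivity
  have hne : ∀ z ∈ closure Ω, ∀ i ∈ Finset.range N, 0 < ‖z - e i‖ :=
    fun z hz i hi => hη'0.trans_le ((hcl hz).2 i hi)
  have hp : SH (fun z => ∑ i ∈ Finset.range N, (-a) * rlog ‖z - e i‖) Ω := by
    apply SH.sum _ hΩo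
    intro i hi
    apply SH_log hΩo (g := fun z => z - e i)
    · intro z _; fun_prop
    · exact fun z hz => norm_pos_iff.1 (hne z (subset_closure hz) i hi)
  have hS := (hw.mono hΩL).add hΩo hp
  have hlog : ∀ i : ℕ, ∀ z : ℂ, 0 < ‖z - e i‖ →
      rlog (2 * L / ‖z - e i‖) = rlog (2 * L) - rlog ‖z - e i‖ := by
    intro i z h
    rw [Real.log_div (by positivity) h.ne']
  have main := max_prin hΩo (Metric.isBounded_ball.subset hΩL) hS (m := -(a * N) * rlog (7 / 8 * L))
    (by
      refine (hc.mono fun z hz => by simpa using (hcl hz).1).add ?_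
      apply continuousOn_finsetSum
      intro i hi
      apply continuousOn_const.mul
      apply ContinuousOn.log (by fun_prop)
      exact fun z hz => (hne z hz i hi).ne') (by
      intro z hz
      have hzc : z ∈ closure Ω := frontier_subset_closure hz
      rw [frontier, hΩo.interior_eq] at hz
      rw [← Finset.mul_sum]
      by_cases hzL : ‖z‖ = L
      · have h1 : w z ≤ 0 := hneg z (by simp [hzL])
        have h2 : ∑ i ∈ Finset.range N, rlog (7 / 8 * L) ≤
            ∑ i ∈ Finset.range N, rlog ‖z - e i‖ := by
          apply Finset.sum_le_sum
          intro i hi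
          apply Real.log_le_log (by positivity)
          have := norm_sub_norm_le z (e i)
          have := (heL i (Finset.mem_range.1 hi)).1
          linarith
        simp only [Finset.sum_const, Finset.card_range, nsmul_eq_mul] at h2
        nlinarith
      · have hzL' : ‖z‖ < L := lt_of_le_of_ne (hcl hzc).1 hzL
        obtain ⟨j, hj, hjη⟩ : ∃ j ∈ Finset.range N, ‖z - e j‖ = η' := by
          by_contra! hcon
          exact hz.2 ⟨hzL', fun i hi => lt_of_le_of_ne ((hcl hzc).2 i hi) (hcon i hi).symm⟩
        have hjN := Finset.mem_range.1 hj
        have h1 : w z ≤ -(H / 2) := by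
          have := hη2 z (by simpa using hzL'.le) (e j) (by simpa using (heL j hjN).1.trans (by linarith))
            (by rw [dist_eq_norm, hjη]; exact hη'η)
          rw [Real.dist_eq] at this
          have h3 := (abs_lt.1 this).2
          have := (he j hjN).2
          linarith
        have h2 := sum_log_aux2 N j (by omega) hjN (fun i => rlog (2 * L / ‖z - e i‖)) (by
          simp only [hjη, hη']
          apply le_of_eq; congr 1; field_simp; norm_num) (by
          intro i hi hij
          apply Real.log_le_log
          · have := hne z hzc i (Finset.mem_range.2 hi); positivity
          · have h5 : ((j - i : ℕ) : ℝ) = j - i := Nat.cast_sub hij.le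
            have h6 : (1:ℝ) ≤ ((j - i : ℕ) : ℝ) := by
              exact_mod_cast (by omega : 1 ≤ j - i)
            have h7 : ((j - i : ℕ) : ℝ) * η' ≤ ‖z - e i‖ := by
              have a1 := (he i hi).1
              have a2 := (he j hjN).1
              have a3 : ‖e j‖ - ‖e i‖ ≤ ‖z - e j‖ + ‖z - e i‖ := by
                have := norm_sub_norm_le (e j) (e i)
                have h8 : e j - e i = (z - e i) - (z - e j) := by ring
                rw [h8] at this
                linarith [norm_sub_le (z - e i) (z - e j)]
              rw [h5] at h6 ⊢
              nlinarith
            have h8 := hne z hzc i (Finset.mem_range.2 hi)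
            rw [div_le_div_iff₀ h8 (by linarith)]
            calc 2 * L * ((j - i : ℕ) : ℝ) = 64 * N * (((j - i : ℕ) : ℝ) * η') := by
                  rw [hη']; field_simp; norm_num
              _ ≤ 64 * N * ‖z - e i‖ := by gcongr) (by
          intro i hi hij
          apply Real.log_le_log
          · have := hne z hzc i (Finset.mem_range.2 hi); positivity
          · have h5 : ((i - j : ℕ) : ℝ) = i - j := Nat.cast_sub hij.le
            have h6 : (1:ℝ) ≤ ((i - j : ℕ) : ℝ) := by
              exact_mod_cast (by omega : 1 ≤ i - j)
            have h7 : ((i - j : ℕ) : ℝ) * η' ≤ ‖z - e i‖ := by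
              have a1 := (he i hi).1
              have a2 := (he j hjN).1
              have a3 : ‖e i‖ - ‖e j‖ ≤ ‖z - e j‖ + ‖z - e i‖ := by
                have := norm_sub_norm_le (e i) (e j)
                have h8 : e i - e j = (z - e j) - (z - e i) := by ring
                rw [h8] at this
                linarith [norm_sub_le (z - e j) (z - e i)]
              rw [h5] at h6 ⊢
              nlinarith
            have h8 := hne z hzc i (Finset.mem_range.2 hi)
            rw [div_le_div_iff₀ h8 (by linarith)]
            calc 2 * L * ((i - j : ℕ) : ℝ) = 64 * N * (((i - j : ℕ) : ℝ) * η') := by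
                  rw [hη']; field_simp; norm_num
              _ ≤ 64 * N * ‖z - e i‖ := by gcongr)
        rw [Finset.sum_congr rfl fun i hi => hlog i z (hne z hzc i hi), Finset.sum_sub_distrib] at h2
        simp only [Finset.sum_const, Finset.card_range, nsmul_eq_mul] at h2
        have h3 : rlog (7 / 8 * L) ≤ rlog (2 * L) :=
          Real.log_le_log (by positivity) (by linarith)
        have h4 : a * (192 * N) = H / 2 := by rw [ha]; field_simp; norm_num
        have h5 := mul_le_mul_of_nonneg_left h2 ha0.le
        have h6 : a * N * rlog (7 / 8 * L) ≤ a * N * rlog (2 * L) := by gcongr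
        nlinarith)
  intro z hz
  have hzΩ : z ∈ Ω := by
    refine ⟨by linarith, fun i hi => ?_⟩
    have := norm_sub_norm_le (e i) z
    rw [norm_sub_rev] at this
    have := (heL i (Finset.mem_range.1 hi)).2
    linarith
  have h1 := main z hzΩ
  rw [← Finset.mul_sum] at h1
  have h2 : ∑ i ∈ Finset.range N, rlog ‖z - e i‖ ≤ ∑ i ∈ Finset.range N, rlog (5 / 32 * L) := by
    apply Finset.sum_le_sum
    intro i hi
    apply Real.log_le_log (hne z (subset_closure hzΩ) i hi)
    have := norm_sub_le z (e i)
    have := (heL i (Finset.mem_range.1 hi)).1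
    linarith
  simp only [Finset.sum_const, Finset.card_range, nsmul_eq_mul] at h2
  have h3 : rlog (7 / 8 * L) = rlog (28 / 5) + rlog (5 / 32 * L) := by
    rw [← Real.log_mul (by norm_num) (by positivity)]; congr 1; ring
  have h4 : (1:ℝ) ≤ rlog (28 / 5) := by
    rw [Real.le_log_iff_exp_le (by norm_num)]
    linarith [Real.exp_one_lt_d9]
  have h5 : a * N = H / 384 := by rw [ha]; field_simp
  have h6 := mul_le_mul_of_nonneg_left h2 ha0.le
  have h7 : a * N ≤ a * N * rlog (28 / 5) := le_mul_of_one_le_right (by positivity) h4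
  rw [h3] at h1
  nlinarith
end

section

lemma isSimplyConnected_of_convex {Ω : Set ℂ} (hc : Convex ℝ Ω) (hne : Ω.Nonempty) :
    IsSimplyConnected Ω := by
  have := hc.contractibleSpace hne
  show SimplyConnectedSpace Ω
  infer_instance

lemma cont_log_differentiable {Ω : Set ℂ} (ho : IsOpen Ω) {g ℓ : ℂ → ℂ}
    (hg : DifferentiableOn ℂ g Ω) (hℓ : ContinuousOn ℓ Ω) (he : ∀ z ∈ Ω, cexp (ℓ z) = g z) :
    DifferentiableOn ℂ ℓ Ω := by
  intro z hz
  apply DifferentiableAt.differentiableWithinAt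
  have h0 : g z ≠ 0 := by rw [← he z hz]; exact Complex.exp_ne_zero _
  have hd : DifferentiableAt ℂ (fun w => ℓ z + Complex.log (g w / g z)) z := by
    apply DifferentiableAt.const_add
    apply DifferentiableAt.clog
    · exact (hg.differentiableAt (ho.mem_nhds hz)).div_const _
    · rw [div_self h0]; exact Complex.one_mem_slitPlane
  apply hd.congr_of_eventuallyEq
  have hcz := (hℓ.continuousAt (ho.mem_nhds hz))
  have : ∀ᶠ w in 𝓝 z, ‖ℓ w - ℓ z‖ < π := by
    have := hcz.tendsto.eventually (Metric.ball_mem_nhds (ℓ z) Real.pi_pos)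
    filter_upwards [this] with w hw
    rw [← dist_eq_norm]; exact hw
  filter_upwards [this, ho.mem_nhds hz] with w hw hwΩ
  rw [← he w hwΩ, ← he z hz, ← Complex.exp_sub, Complex.log_exp]
  · ring
  · have := (abs_lt.1 ((Complex.abs_im_le_norm _).trans_lt hw)).1
    linarith
  · have := (abs_lt.1 ((Complex.abs_im_le_norm _).trans_lt hw)).2
    exact this.le

lemma convex_log {Ω : Set ℂ} (ho : IsOpen Ω) (hc : Convex ℝ Ω) (hne : Ω.Nonempty) {g : ℂ → ℂ}
    (hg : DifferentiableOn ℂ g Ω) (h0 : ∀ z ∈ Ω, g z ≠ 0) :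
    ∃ ℓ : ℂ → ℂ, DifferentiableOn ℂ ℓ Ω ∧ ∀ z ∈ Ω, cexp (ℓ z) = g z := by
  obtain ⟨ℓ, h1, h2⟩ := Complex.exists_continuousOn_eqOn_exp_comp
    (isSimplyConnected_of_convex hc hne) ho hg.continuousOn (by rintro ⟨z, hz, h⟩; exact h0 z hz h)
  exact ⟨ℓ, cont_log_differentiable ho hg h1 h2, h2⟩

structure Tr (A : ℂ → ℂ) (U : Set ℂ) (u : ℂ → ℝ) (K : ℝ) : Prop where
  ho : IsOpen U
  an : ∀ z ∈ U, AnalyticAt ℂ A z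
  ne : ∀ z ∈ U, A z ≠ 0
  cont : Continuous u
  pos : ∀ z ∈ U, 0 < u z
  zero : ∀ z ∉ U, u z = 0
  eq : ∀ z ∈ U, u z = rlog ‖A z‖ - rlog K

lemma Tr.nonneg {A : ℂ → ℂ} {U : Set ℂ} {u : ℂ → ℝ} {K : ℝ} (T : Tr A U u K) (z : ℂ) : 0 ≤ u z := by
  by_cases h : z ∈ U
  · exact (T.pos z h).le
  · rw [T.zero z h]

lemma Tr.sh {A : ℂ → ℂ} {U : Set ℂ} {u : ℂ → ℝ} {K : ℝ} (T : Tr A U u K) : SH u univ := by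
  refine ⟨T.cont.continuousOn, fun z _ => ?_⟩
  by_cases hz : z ∈ U
  · have h1 : SH (fun z => 1 * rlog ‖A z‖ + -rlog K) U :=
      (SH_log T.ho (fun z hz => T.an z hz) T.ne 1).add T.ho (SH_const _ _)
    exact (h1.congr T.ho (fun z hz => by rw [T.eq z hz]; ring)).2 z hz
  · filter_upwards with r
    rw [T.zero z hz]
    exact Real.circleAverage_nonneg_of_nonneg fun x _ => T.nonneg x

lemma Tr.winding {A : ℂ → ℂ} {U : Set ℂ} {u : ℂ → ℝ} {K : ℝ} (T : Tr A U u K) {t : ℝ} (ht : 0 < t)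
    (hU : ∀ z : ℂ, ‖z‖ = t → z ∈ U) : ∃ n : ℤ, ∃ δ > 0, ∀ s, |s - t| < δ → 0 < s →
      Real.circleAverage u 0 s = Real.circleAverage u 0 t + n * (rlog s - rlog t) := by
  obtain ⟨δ, hδ, hth⟩ : ∃ δ > 0, Metric.thickening δ (sphere (0:ℂ) t) ⊆ U :=
    (isCompact_sphere (0:ℂ) t).exists_thickening_subset_open T.ho
      (fun z hz => hU z (by simpa using hz))
  have hth' : ∀ z : ℂ, 0 < ‖z‖ → |‖z‖ - t| < δ → z ∈ U := by
    intro z hz h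
    apply hth
    rw [Metric.mem_thickening_iff]
    have hz' : (‖z‖ : ℂ) ≠ 0 := by exact_mod_cast hz.ne'
    refine ⟨(t / ‖z‖ : ℝ) * z, ?_, ?_⟩
    · rw [mem_sphere_zero_iff_norm, norm_mul, Complex.norm_real, norm_div, norm_norm,
        Real.norm_of_nonneg ht.le, div_mul_cancel₀ _ hz.ne']
    · rw [dist_eq_norm]
      have : z - ((t / ‖z‖ : ℝ) : ℂ) * z = ((‖z‖ - t) / ‖z‖ : ℝ) * z := by
        push_cast; field_simp
      rw [this, norm_mul, Complex.norm_real, norm_div, norm_norm, div_mul_cancel₀ _ hz.ne',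
        Real.norm_eq_abs]
      exact h
  set Ω : Set ℂ := {ζ | |rexp ζ.re - t| < δ} with hΩ
  have hΩo : IsOpen Ω := isOpen_lt (by fun_prop) continuous_const
  have hΩc : Convex ℝ Ω := by
    have e : Ω = Complex.reLm ⁻¹' {x | t - δ < rexp x ∧ rexp x < t + δ} := by
      ext ζ; simp only [hΩ, mem_ofPred_eq, mem_preimage, Complex.reLm_coe, abs_lt]
      constructor
      · rintro ⟨h1, h2⟩; constructor <;> linarith
      · rintro ⟨h1, h2⟩; constructor <;> linarith
    rw [e]
    refine Convex.linear_preimage ?_ _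
    apply Set.OrdConnected.convex
    constructor
    rintro x ⟨hx1, hx2⟩ y ⟨hy1, hy2⟩ z ⟨hz1, hz2⟩
    exact ⟨hx1.trans_le (Real.exp_le_exp.2 hz1), (Real.exp_le_exp.2 hz2).trans_lt hy2⟩
  have hlogt : ∀ y : ℝ, (rlog t + y * I : ℂ) ∈ Ω := by
    intro y; simp [hΩ, Real.exp_log ht, hδ]
  have hmem : ∀ ζ ∈ Ω, cexp ζ ∈ U := by
    intro ζ hζ
    apply hth' _ (norm_pos_iff.2 (Complex.exp_ne_zero _))
    rw [Complex.norm_exp]; exact hζ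
  obtain ⟨ℓ, hℓd, hℓ⟩ := convex_log hΩo hΩc ⟨_, hlogt 0⟩ (g := fun ζ => A (cexp ζ))
    (fun ζ hζ => (((T.an _ (hmem ζ hζ)).differentiableAt).comp ζ
      Complex.differentiable_exp.differentiableAt).differentiableWithinAt)
    (fun ζ hζ => T.ne _ (hmem ζ hζ))
  have hshift : ∀ ζ ∈ Ω, ζ + 2 * π * I ∈ Ω := by
    intro ζ hζ; simpa [hΩ] using hζ
  have hint : ∀ ζ ∈ Ω, ∃ n : ℤ, ℓ (ζ + 2 * π * I) = ℓ ζ + n * (2 * π * I) := by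
    intro ζ hζ
    rw [← Complex.exp_eq_exp_iff_exists_int, hℓ _ hζ, hℓ _ (hshift ζ hζ), Complex.exp_periodic]
  have hcst : ∃ n : ℤ, ∀ ζ ∈ Ω, ℓ (ζ + 2 * π * I) = ℓ ζ + n * (2 * π * I) := by
    choose! n hn using hint
    have hpi : (2 * π * I : ℂ) ≠ 0 := Complex.two_pi_I_ne_zero
    have hcont : ContinuousOn (fun ζ => (n ζ : ℂ)) Ω := by
      have : ContinuousOn (fun ζ => (ℓ (ζ + 2 * π * I) - ℓ ζ) / (2 * π * I)) Ω :=
        ((hℓd.continuousOn.comp (by fun_prop) hshift).sub hℓd.continuousOn).div_const _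
      refine this.congr fun ζ hζ => ?_
      simp only; rw [hn ζ hζ]; field_simp; ring
    have hcz : ContinuousOn n Ω := by
      have : IsClosedEmbedding ((↑) : ℤ → ℂ) := Complex.isClosedEmbedding_intCast
      exact this.isInducing.continuousOn_iff.2 hcont
    refine ⟨n (rlog t + (0:ℝ) * I), fun ζ hζ => ?_⟩
    rw [hn ζ hζ, hΩc.isPreconnected.constant hcz hζ (hlogt 0)]
  obtain ⟨n, hn⟩ := hcst
  refine ⟨n, δ, hδ, fun s hs hs0 => ?_⟩
  have havg : ∀ s, |s - t| < δ → 0 < s → Real.circleAverage u 0 s - n * rlog s =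
      (2 * π)⁻¹ * (∫ y in (0:ℝ)..2 * π, ((fun ζ => ℓ ζ - n * ζ) (rlog s + y * I))).re
        - rlog K := by
    intro s hs hs0
    have hsΩ : ∀ y : ℝ, (rlog s + y * I : ℂ) ∈ Ω := by
      intro y; simpa [hΩ, Real.exp_log hs0] using hs
    have hci : Continuous fun y : ℝ => ℓ (rlog s + y * I) - n * (rlog s + y * I) := by
      apply Continuous.sub _ (by fun_prop)
      rw [← continuousOn_univ]
      exact hℓd.continuousOn.comp (by fun_prop) fun y _ => hsΩ y
    have hre := (Complex.reCLM.intervalIntegral_comp_comm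
      (hci.intervalIntegrable (μ := volume) 0 (2 * π)))
    simp only [Complex.reCLM_apply] at hre
    rw [← hre]
    have e1 : ∀ y : ℝ, (ℓ (rlog s + y * I) - n * (rlog s + y * I)).re
        = u (circleMap 0 s y) - n * rlog s + rlog K := by
      intro y
      have a1 : cexp (rlog s + y * I) = circleMap 0 s y := by
        rw [Complex.exp_add, ← Complex.ofReal_exp, Real.exp_log hs0]; simp [circleMap]
      have a2 := hℓ _ (hsΩ y)
      have a3 := hmem _ (hsΩ y)
      rw [a1] at a2 a3
      have a4 := T.eq _ a3
      rw [← a2, Complex.norm_exp, Real.log_exp] at a4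
      rw [a4]
      simp
      ring
    simp only [e1]
    have hcu : Continuous fun y : ℝ => u (circleMap 0 s y) := T.cont.comp (by fun_prop)
    have e2 : ∀ y : ℝ, u (circleMap 0 s y) - n * rlog s + rlog K
        = u (circleMap 0 s y) + (rlog K - n * rlog s) := fun y => by ring
    simp only [e2]
    rw [intervalIntegral.integral_add (hcu.intervalIntegrable _ _) (by simp), Real.circleAverage_def]
    simp only [intervalIntegral.integral_const, smul_eq_mul, sub_zero]
    have := Real.pi_pos
    field_simp
    ring
  have hrect := Complex.integral_boundary_rect_eq_zero_of_differentiableOn (fun ζ => ℓ ζ - n * ζ)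
    (rlog t) (rlog s + 2 * π * I) (by
      have : DifferentiableOn ℂ (fun ζ => ℓ ζ - n * ζ) Ω := hℓd.sub (by fun_prop)
      apply this.mono
      rintro ζ ⟨hζ, -⟩
      have hoc : OrdConnected {x : ℝ | |rexp x - t| < δ} := by
        constructor
        rintro x hx y hy z ⟨hz1, hz2⟩
        have := Real.exp_le_exp.2 hz1
        have := Real.exp_le_exp.2 hz2
        simp only [mem_ofPred_eq, abs_lt] at *
        constructor <;> linarith
      have := hoc.uIcc_subset (x := rlog t) (y := rlog s) (by simpa [Real.exp_log ht] using hδ)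
        (by simpa [Real.exp_log hs0] using hs)
      apply this
      simpa using hζ)
  simp only [Complex.ofReal_re, Complex.ofReal_im, Complex.add_re, Complex.mul_re,
    Complex.I_re, Complex.I_im, Complex.add_im, Complex.mul_im, Complex.re_ofNat, Complex.im_ofNat,
    mul_zero, mul_one, sub_zero, zero_mul, add_zero, zero_add, Complex.ofReal_zero,
    smul_eq_mul] at hrect
  have hhor : (∫ x in (rlog t)..(rlog s), (ℓ x - n * (x:ℂ))) =
      ∫ x in (rlog t)..(rlog s), (ℓ (x + ((2 * π : ℝ) : ℂ) * I) -
        n * ((x:ℂ) + ((2 * π : ℝ) : ℂ) * I)) := by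
    apply intervalIntegral.integral_congr
    intro x hx
    have hoc : OrdConnected {x : ℝ | |rexp x - t| < δ} := by
      constructor
      rintro x hx y hy z ⟨hz1, hz2⟩
      have := Real.exp_le_exp.2 hz1
      have := Real.exp_le_exp.2 hz2
      simp only [mem_ofPred_eq, abs_lt] at *
      constructor <;> linarith
    have hx' := hoc.uIcc_subset (x := rlog t) (y := rlog s) (by simpa [Real.exp_log ht] using hδ)
        (by simpa [Real.exp_log hs0] using hs) hx
    have := hn (x : ℂ) (by simpa [hΩ] using hx')
    simp only
    push_cast
    rw [this]; ring
  rw [hhor, sub_self, zero_add, ← mul_sub, mul_eq_zero] at hrect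
  have hrect' := hrect.resolve_left Complex.I_ne_zero
  have h1 := havg s hs hs0
  have h2 := havg t (by simpa using hδ) ht
  rw [sub_eq_zero] at hrect'
  simp only [hrect'] at h1
  simp only at h2
  linarith
end

section

lemma avg_lt {f g : ℂ → ℝ} {c : ℂ} {r : ℝ} (hf : ContinuousOn f (sphere c |r|))
    (hg : ContinuousOn g (sphere c |r|)) (hle : ∀ z ∈ sphere c |r|, f z ≤ g z)
    {p : ℂ} (hp : p ∈ sphere c |r|) (hlt : f p < g p) :
    Real.circleAverage f c r < Real.circleAverage g c r := by
  rw [Real.circleAverage_def, Real.circleAverage_def, smul_eq_mul, smul_eq_mul]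
  apply mul_lt_mul_of_pos_left _ (by positivity)
  have hm : ∀ θ, circleMap c r θ ∈ sphere c |r| := fun θ => circleMap_mem_sphere' c r θ
  apply intervalIntegral.integral_lt_integral_of_continuousOn_of_le_of_exists_lt (by positivity)
  · exact hf.comp (by fun_prop) fun θ _ => hm θ
  · exact hg.comp (by fun_prop) fun θ _ => hm θ
  · exact fun θ _ => hle _ (hm θ)
  · have := image_circleMap_Ioc c r
    rw [← this] at hp
    obtain ⟨θ, hθ, rfl⟩ := hp
    exact ⟨θ, ⟨hθ.1.le, hθ.2⟩, hlt⟩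

lemma exists_frontier {U : Set ℂ} {p e : ℂ} (hU : IsOpen U) (hp : p ∈ U) (he : e ∉ U) :
    ∃ e' ∈ segment ℝ p e, e' ∈ frontier U := by
  by_contra! hcon
  have hpre : IsPreconnected (segment ℝ p e) := (convex_segment p e).isPreconnected
  have := hpre.subset_left_of_subset_union hU (isClosed_closure (s := U)).isOpen_compl
    (disjoint_compl_right.mono_right (compl_subset_compl.2 subset_closure)) (by
      intro x hx
      by_cases h : x ∈ closure U
      · left
        by_contra hxU
        exact hcon x hx (by rw [frontier, hU.interior_eq]; exact ⟨h, hxU⟩)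
      · right; exact h) ⟨p, left_mem_segment ℝ p e, hp⟩
  exact he (this (right_mem_segment ℝ p e))

variable {A : ℂ → ℂ} {U : Set ℂ} {u : ℂ → ℝ} {K : ℝ}

lemma Tr.lift (T : Tr A U u K) {e : ℂ} (he : e ∈ frontier U) {δ0 : ℝ} (hδ0 : 0 < δ0) :
    ∃ w : ℂ → ℝ, SH w univ ∧ (∀ z, u z ≤ w z) ∧ (∀ z, z ∉ ball e δ0 → w z = u z) ∧ u e < w e := by
  have heU : e ∉ U := by rw [frontier, T.ho.interior_eq] at he; exact he.2
  obtain ⟨p, hpU, hpe⟩ := Metric.mem_closure_iff.1 (frontier_subset_closure he) δ0 hδ0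
  have hne : p ≠ e := fun h => heU (h ▸ hpU)
  have hd : 0 < dist e p := dist_pos.2 hne.symm
  have hlt : u e < Real.circleAverage u e (dist e p) := by
    rw [T.zero e heU]
    have := avg_lt (f := fun _ => 0) (g := u) (c := e) (r := dist e p) (p := p)
      continuousOn_const T.cont.continuousOn (fun z _ => T.nonneg z)
      (by rw [abs_of_pos hd, Metric.mem_sphere, dist_comm]) (T.pos p hpU)
    rwa [Real.circleAverage_const] at this
  obtain ⟨w, h1, h2, h3, h4⟩ := SH_lift isOpen_univ T.sh hd (subset_univ _) hlt
  exact ⟨w, h1, h2, fun z hz => h3 z fun h => hz (Metric.ball_subset_ball hpe.le h), h4⟩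

lemma avg_chord {v : ℂ → ℝ} (hv : SH v univ) {r s t : ℝ} (hr : 0 < r) (hrs : r < s) (hst : s < t) :
    Real.circleAverage v 0 s * (rlog t - rlog r) ≤
      Real.circleAverage v 0 r * (rlog t - rlog s) +
      Real.circleAverage v 0 t * (rlog s - rlog r) := by
  have hs := hr.trans hrs
  have l1 := Real.log_lt_log hr hrs
  have l2 := Real.log_lt_log hs hst
  set I := Real.circleAverage v 0
  set β := (I t - I r) / (rlog t - rlog r)
  have hβ : β * (rlog t - rlog r) = I t - I r := div_mul_cancel₀ _ (by linarith)
  have := avg_convex (a := -1) (b := t + 1) (hv.mono (subset_univ _)) (by linarith) hr hrs.le hst.le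
    (by linarith) (α := I r - β * rlog r) (β := β) (by simp [I]) (by
      show I t ≤ _
      linarith)
  change I s ≤ _ at this
  have h2 := mul_le_mul_of_nonneg_right this (by linarith : 0 ≤ rlog t - rlog r)
  nlinarith

def Slope (u : ℂ → ℝ) (t : ℝ) (n : ℤ) : Prop := ∃ δ > 0, ∀ s, |s - t| < δ → 0 < s →
      Real.circleAverage u 0 s = Real.circleAverage u 0 t + n * (rlog s - rlog t)

lemma Slope.fwd {v : ℂ → ℝ} (hv : SH v univ) {t s : ℝ} {n : ℤ} (ht : 0 < t) (h : Slope v t n)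
    (hts : t < s) : Real.circleAverage v 0 t + n * (rlog s - rlog t) ≤
      Real.circleAverage v 0 s := by
  obtain ⟨δ, hδ, h⟩ := h
  set r := max (t / 2) (t - δ / 2)
  have hr0 : 0 < r := lt_max_of_lt_left (by linarith)
  have hrt : r < t := max_lt (by linarith) (by linarith)
  have h1 := h r (by
    rw [abs_lt]; constructor
    · linarith [le_max_right (t/2) (t - δ/2)]
    · linarith) hr0
  have h2 := avg_chord hv hr0 hrt hts
  rw [h1] at h2
  have l1 := Real.log_lt_log hr0 hrt
  have l2 := Real.log_lt_log ht hts
  by_contra! hc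
  nlinarith

lemma Slope.bwd {v : ℂ → ℝ} (hv : SH v univ) {t s : ℝ} {n : ℤ} (hs : 0 < s) (h : Slope v t n)
    (hts : s < t) : Real.circleAverage v 0 t + n * (rlog s - rlog t) ≤
      Real.circleAverage v 0 s := by
  obtain ⟨δ, hδ, h⟩ := h
  have ht := hs.trans hts
  have h1 := h (t + δ / 2) (by rw [abs_lt]; constructor <;> linarith) (by linarith)
  have h2 := avg_chord hv hs hts (by linarith : t < t + δ / 2)
  rw [h1] at h2
  have l1 := Real.log_lt_log hs hts
  have l2 := Real.log_lt_log ht (by linarith : t < t + δ / 2)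
  by_contra! hc
  nlinarith

lemma noholes (T : Tr A U u K) {H ε L : ℝ} (hL : 0 < L) (h0 : u 0 = H) (hε1 : ε < 1)
    (hH : 400 * ε + L < H) (hHp : L < H)
    (hle : ∀ τ : ℂ, ‖τ‖ ≤ L → u τ ≤ H + τ.re + ε) : ball 0 (L / 16) ⊆ U := by
  have hε0 : 0 ≤ ε := by have := hle 0 (by simpa using hL.le); rw [h0] at this; simp at this; linarith
  have h0U : (0:ℂ) ∈ U := by by_contra h; have := T.zero 0 h; linarith
  have hex : ∃ t ∈ Icc (L / 16) (L / 8), ∀ z : ℂ, ‖z‖ = t → z ∈ U := by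
    by_contra! hcon
    have hS : SH (fun z => u z + ((-z).re + -(H + ε))) univ :=
      T.sh.add isOpen_univ ((SH_re isOpen_univ (g := fun z => -z) (fun z _ => by fun_prop)).add
        isOpen_univ (SH_const _ _))
    have := capacity hL (H := H - L) (by linarith) (hS.mono (subset_univ _))
      (hS.1.mono (subset_univ _)) (by
        intro z hz
        have := hle z (by simpa using hz)
        simp only [Complex.neg_re]; linarith) (by
        intro s hs
        obtain ⟨e, he, heU⟩ := hcon s hs
        refine ⟨e, he, ?_⟩
        rw [T.zero e heU]
        have := (abs_le.1 (Complex.abs_re_le_norm e)).1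
        have := hs.2
        simp only [Complex.neg_re]; linarith) 0 (by simp; linarith)
    simp [h0] at this
    linarith
  obtain ⟨t, ⟨ht1, ht2⟩, htU⟩ := hex
  have ht : 0 < t := by linarith
  obtain ⟨n, hn⟩ := T.winding ht htU
  have hn : Slope u t n := hn
  have hI0 : Real.circleAverage u 0 0 = H := by rw [Real.circleAverage_zero, h0]
  have hIt : H ≤ Real.circleAverage u 0 t := by
    rw [← hI0]; exact avg_mono (b := t + 1) (T.sh.mono (subset_univ _)) le_rfl ht.le (by linarith)
  have hIL : Real.circleAverage u 0 L ≤ H + ε := by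
    have hre : Real.circleAverage (fun z : ℂ => z.re) 0 L = 0 := by
      have := InnerProductSpace.HarmonicOnNhd.circleAverage_eq (c := (0:ℂ)) (R := L)
        (harm_re (g := id) (Ω := closedBall 0 |L|) fun z _ => analyticAt_id)
      simpa using this
    have e : Real.circleAverage (fun z : ℂ => z.re + (H + ε)) 0 L = H + ε := by
      rw [Real.circleAverage_fun_add (ci_of_cont (Ω := univ) (by fun_prop) (subset_univ _))
        (circleIntegrable_const _ _ _), Real.circleAverage_const, hre, zero_add]
    rw [← e]
    apply Real.circleAverage_mono (ci_of_cont T.cont.continuousOn (subset_univ _))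
      (ci_of_cont (Ω := univ) (by fun_prop) (subset_univ _))
    intro x hx
    have := hle x (by rw [abs_of_pos hL] at hx; simpa using le_of_eq (by simpa using hx))
    linarith
  have hn0 : n = 0 := by
    have h1 := hn.fwd T.sh ht (by linarith : t < L)
    have hlog : 1 < rlog L - rlog t := by
      rw [← Real.log_div hL.ne' ht.ne', Real.lt_log_iff_exp_lt (by positivity), lt_div_iff₀ ht]
      have := Real.exp_one_lt_d9
      nlinarith
    have h2 := avg_mono (v := u) (b := L + 1) (T.sh.mono (subset_univ _)) ht.le (by linarith : t ≤ L) (by linarith)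
    have h3 : n < 1 := by
      by_contra! hc
      have : (1:ℝ) ≤ n := by exact_mod_cast hc
      nlinarith
    have h4 : 0 ≤ n := by
      by_contra! hc
      have : (n:ℝ) < 0 := by exact_mod_cast hc
      obtain ⟨δ, hδ, h⟩ := hn
      have h5 := h (t + δ / 2) (by rw [abs_lt]; constructor <;> linarith) (by linarith)
      have h6 := avg_mono (v := u) (b := t + δ + 1) (T.sh.mono (subset_univ _)) ht.le
        (by linarith : t ≤ t + δ / 2) (by linarith)
      have l2 := Real.log_lt_log ht (by linarith : t < t + δ / 2)
      nlinarith
    omega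
  subst hn0
  intro e he
  by_contra heU
  obtain ⟨e', hes, hef⟩ := exists_frontier T.ho h0U heU
  have het : ‖e'‖ < t := by
    have : e' ∈ ball (0:ℂ) (L / 16) :=
      (convex_ball (0:ℂ) (L / 16)).segment_subset (Metric.mem_ball_self (by linarith)) he hes
    have : ‖e'‖ < L / 16 := by simpa using this
    linarith
  have he'U : e' ∉ U := by rw [frontier, T.ho.interior_eq] at hef; exact hef.2
  have he0 : 0 < ‖e'‖ := norm_pos_iff.2 fun h => he'U (h ▸ h0U)
  obtain ⟨w, w1, w2, w3, w4⟩ := T.lift hef (δ0 := t - ‖e'‖) (by linarith)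
  have h1 := hn.bwd T.sh he0 het
  simp only [Int.cast_zero, zero_mul, add_zero] at h1
  have h2 : Real.circleAverage u 0 ‖e'‖ < Real.circleAverage w 0 ‖e'‖ :=
    avg_lt T.cont.continuousOn (w1.1.mono (subset_univ _)) (fun z _ => w2 z) (p := e') (by simp) w4
  have h3 : Real.circleAverage w 0 t = Real.circleAverage u 0 t := by
    apply Real.circleAverage_congr_sphere
    intro z hz
    apply w3
    rw [abs_of_pos ht] at hz
    have : ‖z‖ = t := by simpa using hz
    simp only [mem_ball_iff_norm, not_lt]
    have := norm_sub_norm_le z e'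
    linarith
  have h4 := avg_mono (v := w) (b := t + 1) (w1.mono (subset_univ _)) he0.le het.le (by linarith)
  linarith

lemma log_growth (T : Tr A U u K) (hne : U.Nonempty) {C : ℝ} 
    (hC : ∀ z : ℂ, 1 ≤ ‖z‖ → u z ≤ C * (1 + rlog ‖z‖)) :
    ∃ R, ∀ z : ℂ, R < ‖z‖ → z ∈ U := by
  have hIC : ∀ s, 1 ≤ s → Real.circleAverage u 0 s ≤ C * (1 + rlog s) := by
    intro s hs
    apply Real.circleAverage_mono_on_of_le_circle (ci_of_cont T.cont.continuousOn (subset_univ _))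
    intro x hx
    have : ‖x‖ = s := by rw [abs_of_pos (by linarith)] at hx; simpa using hx
    rw [← this]; exact hC x (by rw [this]; exact hs)
  have good : ∀ R1 : ℝ, ∃ t, R1 < t ∧ ∀ z : ℂ, ‖z‖ = t → z ∈ U := by
    by_contra! hcon
    obtain ⟨R1, hR1⟩ := hcon
    obtain ⟨p, hp⟩ := hne
    set R2 := max (max 1 (R1 + 1)) ‖p‖ with hR2
    have hR2' : 1 ≤ R2 := (le_max_left _ _).trans (le_max_left _ _)
    have hR21 : R1 < R2 := by
      have : R1 + 1 ≤ R2 := (le_max_right _ _).trans (le_max_left _ _)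
      linarith
    have hmax : ∀ R : ℝ, 0 ≤ R → ∃ m ∈ closedBall (0:ℂ) R, ∀ z ∈ closedBall (0:ℂ) R, u z ≤ u m := by
      intro R hR
      obtain ⟨m, hm, hm2⟩ := (isCompact_closedBall (0:ℂ) R).exists_isMaxOn ⟨0, by simpa using hR⟩
        T.cont.continuousOn
      exact ⟨m, hm, fun z hz => hm2 hz⟩
    have step : ∀ k : ℕ, ∃ m ∈ closedBall (0:ℂ) (32 ^ k * R2), u p * (400 / 399) ^ k ≤ u m := by
      intro k
      induction k with
      | zero => exact ⟨p, by simp [hR2], by simp⟩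
      | succ k ih =>
        obtain ⟨m, hm, hum⟩ := ih
        have h32 : (1:ℝ) ≤ 32 ^ k := one_le_pow₀ (by norm_num)
        have hRk : (32 ^ k : ℝ) * R2 ≥ R2 := by nlinarith
        obtain ⟨m', hm', hmm⟩ := hmax (32 ^ (k + 1) * R2) (by positivity)
        refine ⟨m', hm', ?_⟩
        have hup := T.pos p hp
        have hum0 : 0 < u m := lt_of_lt_of_le (by positivity) hum
        have hmle : m ∈ closedBall (0:ℂ) (32 ^ (k + 1) * R2) := by
          apply Metric.closedBall_subset_closedBall _ hm
          rw [pow_succ]; nlinarith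
        have hum' : 0 < u m' := hum0.trans_le (hmm m hmle)
        have hS : SH (fun z => u z + -(u m')) univ := T.sh.add isOpen_univ (SH_const _ _)
        have := capacity (L := 32 ^ (k + 1) * R2) (by positivity) (H := u m') hum'
          (hS.mono (subset_univ _)) (hS.1.mono (subset_univ _)) (by
            intro z hz; have := hmm z hz; linarith) (by
            intro s hs
            obtain ⟨e, he, heU⟩ := hR1 s (by
              have := hs.1; rw [pow_succ] at this; nlinarith)
            exact ⟨e, he, by rw [T.zero e heU]; linarith⟩) m (by
              rw [pow_succ]; simp only [mem_closedBall_zero_iff] at hm; linarith)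
        rw [pow_succ]
        nlinarith
    have hub : ∀ k : ℕ, u p * (400 / 399) ^ k ≤ |C| * (1 + rlog R2) + k * (|C| * rlog 32) := by
      intro k
      obtain ⟨m, hm, hum⟩ := step k
      have hm' : ‖m‖ ≤ 32 ^ k * R2 := by simpa using hm
      have h32 : (1:ℝ) ≤ 32 ^ k := one_le_pow₀ (by norm_num)
      have hRk : (32 ^ k : ℝ) * R2 ≥ R2 := by nlinarith
      have hlogR : rlog (32 ^ k * R2) = k * rlog 32 + rlog R2 := by
        rw [Real.log_mul (by positivity) (by positivity), Real.log_pow]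
      have := max_prin (Ω := ball (0:ℂ) (32 ^ k * R2)) Metric.isOpen_ball Metric.isBounded_ball
        (T.sh.mono (subset_univ _)) T.cont.continuousOn
        (m := |C| * (1 + rlog R2) + k * (|C| * rlog 32)) (by
          intro z hz
          rw [frontier_ball _ (by positivity)] at hz
          have hz' : ‖z‖ = 32 ^ k * R2 := by simpa using hz
          have h1 := hC z (by rw [hz']; linarith)
          rw [hz', hlogR] at h1
          have h2 : 0 ≤ 1 + (k * rlog 32 + rlog R2) := by
            have := Real.log_nonneg hR2'
            have : 0 ≤ rlog 32 := Real.log_nonneg (by norm_num)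
            positivity
          have := mul_le_mul_of_nonneg_right (le_abs_self C) h2
          linarith)
      rcases hm'.eq_or_lt with h | h
      · have h1 := hC m (by rw [h]; linarith)
        rw [h, hlogR] at h1
        have h2 : 0 ≤ 1 + (k * rlog 32 + rlog R2) := by
          have := Real.log_nonneg hR2'
          have : 0 ≤ rlog 32 := Real.log_nonneg (by norm_num)
          positivity
        have := mul_le_mul_of_nonneg_right (le_abs_self C) h2
        linarith
      · exact hum.trans (this m (by simpa using h))
    have t1 := tendsto_pow_const_div_const_pow_of_one_lt 1 (by norm_num : (1:ℝ) < 400 / 399)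
    have t0 := tendsto_pow_const_div_const_pow_of_one_lt 0 (by norm_num : (1:ℝ) < 400 / 399)
    have t2 := (t0.const_mul (|C| * (1 + rlog R2))).add (t1.const_mul (|C| * rlog 32))
    simp only [mul_zero, add_zero] at t2
    have := ge_of_tendsto' t2 (b := u p) (fun k => by
      have := hub k
      have hpk : (0:ℝ) < (400 / 399) ^ k := by positivity
      have e : |C| * (1 + rlog R2) * ((k:ℝ) ^ 0 / (400 / 399) ^ k) + |C| * rlog 32 * ((k:ℝ) ^ 1 / (400 / 399) ^ k)
        = (|C| * (1 + rlog R2) + k * (|C| * rlog 32)) / (400 / 399) ^ k := by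
          field_simp
      rw [e, le_div_iff₀ hpk]; exact this)
    linarith [T.pos p hp]
  have hbd : ∀ t n, 0 < t → Slope u t n → (n:ℝ) ≤ C := by
    intro t n ht hs
    by_contra! hc
    have h1 : ∀ s, max 1 t < s → (n - C) * rlog s ≤ C + n * rlog t - Real.circleAverage u 0 t := by
      intro s hs'
      have a1 := hs.fwd T.sh ht ((le_max_right _ _).trans_lt hs')
      have a2 := hIC s ((le_max_left _ _).trans hs'.le)
      linarith
    have h2 : Tendsto (fun s => (n - C) * rlog s) atTop atTop :=
      Real.tendsto_log_atTop.const_mul_atTop (by linarith)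
    obtain ⟨s, hs1, hs2⟩ := ((h2.eventually_gt_atTop (C + n * rlog t - Real.circleAverage u 0 t)).and
      (eventually_gt_atTop (max 1 t))).exists
    linarith [h1 s hs2]
  obtain ⟨N, ⟨t1, ht1, hU1, hs1⟩, hNmax⟩ := Int.exists_greatest_of_bdd
    (P := fun n => ∃ t, 0 < t ∧ (∀ z : ℂ, ‖z‖ = t → z ∈ U) ∧ Slope u t n)
    ⟨⌈C⌉, fun z ⟨t, ht, _, hs⟩ => by
      have := hbd t z ht hs
      exact_mod_cast this.trans (Int.le_ceil C)⟩ (by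
      obtain ⟨t, ht, hU⟩ := good 0
      obtain ⟨n, hn⟩ := T.winding ht hU
      exact ⟨n, t, ht, hU, hn⟩)
  refine ⟨t1, fun e he => ?_⟩
  by_contra heU
  obtain ⟨t2, ht2, hU2⟩ := good ‖e‖
  have ht20 : 0 < t2 := by linarith
  have h12 : t1 < t2 := by linarith
  obtain ⟨n2, hs2⟩ := T.winding ht20 hU2
  have hs2 : Slope u t2 n2 := hs2
  have hn2N : n2 ≤ N := hNmax n2 ⟨t2, ht20, hU2, hs2⟩
  have l12 := Real.log_lt_log ht1 h12
  have a1 := hs1.fwd T.sh ht1 h12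
  have a2 := hs2.bwd T.sh ht1 h12
  have hNn2 : N = n2 := by
    have : (N:ℝ) ≤ n2 := by
      by_contra! hc
      nlinarith
    exact le_antisymm (by exact_mod_cast this) hn2N
  subst hNn2
  have hx0 : 0 < ‖e‖ := ht1.trans he
  have hpU : ((t1 / ‖e‖ : ℝ) : ℂ) * e ∈ U := by
    apply hU1
    rw [norm_mul, Complex.norm_real, norm_div, norm_norm, Real.norm_of_nonneg ht1.le,
      div_mul_cancel₀ _ hx0.ne']
  obtain ⟨e', hes, hef⟩ := exists_frontier T.ho hpU heU
  have he'U : e' ∉ U := by rw [frontier, T.ho.interior_eq] at hef; exact hef.2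
  have hnorm : t1 ≤ ‖e'‖ ∧ ‖e'‖ ≤ ‖e‖ := by
    obtain ⟨a, b, ha, hb, hab, rfl⟩ := hes
    have e1 : a • (((t1 / ‖e‖ : ℝ) : ℂ) * e) + b • e = ((a * (t1 / ‖e‖) + b : ℝ) : ℂ) * e := by
      simp only [Complex.real_smul]; push_cast; ring
    have e2 : (a * (t1 / ‖e‖) + b) * ‖e‖ = a * t1 + b * ‖e‖ := by field_simp
    rw [e1, norm_mul, Complex.norm_real, Real.norm_of_nonneg (by positivity), e2]
    constructor <;> nlinarith
  have hgt : t1 < ‖e'‖ := lt_of_le_of_ne hnorm.1 fun h => he'U (hU1 e' h.symm)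
  have hlt : ‖e'‖ < t2 := hnorm.2.trans_lt ht2
  obtain ⟨w, w1, w2, w3, w4⟩ := T.lift hef (δ0 := min (‖e'‖ - t1) (t2 - ‖e'‖))
    (lt_min (by linarith) (by linarith))
  have he0 : 0 < ‖e'‖ := ht1.trans hgt
  have h2 : Real.circleAverage u 0 ‖e'‖ < Real.circleAverage w 0 ‖e'‖ :=
    avg_lt T.cont.continuousOn (w1.1.mono (subset_univ _)) (fun z _ => w2 z) (p := e') (by simp) w4
  have h3 : ∀ t, 0 < t → (t = t1 ∨ t = t2) → Real.circleAverage w 0 t = Real.circleAverage u 0 t := by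
    intro t ht hh
    apply Real.circleAverage_congr_sphere
    intro z hz
    apply w3
    rw [abs_of_pos ht] at hz
    have hz' : ‖z‖ = t := by simpa using hz
    simp only [mem_ball_iff_norm, not_lt]
    have b1 := norm_sub_norm_le z e'
    have b2 := norm_sub_norm_le e' z
    rw [norm_sub_rev] at b2
    rcases hh with rfl | rfl
    · exact (min_le_left _ _).trans (by linarith)
    · exact (min_le_right _ _).trans (by linarith)
  have h4 := avg_chord w1 ht1 hgt hlt
  rw [h3 t1 ht1 (Or.inl rfl), h3 t2 ht20 (Or.inr rfl)] at h4
  have l1 := Real.log_lt_log ht1 hgt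
  have l2 := Real.log_lt_log he0 hlt
  have a3 := hs1.fwd T.sh ht1 hgt
  have heq : Real.circleAverage u 0 t2 = Real.circleAverage u 0 t1 + N * (rlog t2 - rlog t1) := by
    linarith
  rw [heq] at h4
  nlinarith
end

section

lemma poly_growth (N : ℕ) : ∀ {h : ℂ → ℂ} {C : ℝ}, Differentiable ℂ h →
    (∀ z, ‖h z‖ ≤ C * (1 + ‖z‖) ^ N) → ∃ p : Polynomial ℂ, ∀ z, h z = p.eval z := by
  induction N with
  | zero =>
    intro h C hd hb
    obtain ⟨c, hc⟩ := hd.exists_const_forall_eq_of_bounded (by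
      rw [isBounded_iff_forall_norm_le]
      exact ⟨C, by rintro _ ⟨z, rfl⟩; simpa using hb z⟩)
    exact ⟨Polynomial.C c, fun z => by simp [hc]⟩
  | succ N ih =>
    intro h C hd hb
    have hd' : Differentiable ℂ (dslope h 0) := by
      rw [← differentiableOn_univ, Complex.differentiableOn_dslope univ_mem, differentiableOn_univ]
      exact hd
    obtain ⟨D, hD⟩ := (isCompact_closedBall (0:ℂ) 1).exists_bound_of_continuousOn
      hd'.continuous.continuousOn
    have hC0 : 0 ≤ C := by have := (norm_nonneg _).trans (hb 0); simpa using this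
    have hh0 : ‖h 0‖ ≤ C := by simpa using hb 0
    have hD0 : 0 ≤ D := (norm_nonneg _).trans (hD 0 (by simp))
    obtain ⟨p, hp⟩ := ih (C := D + 4 * C) hd' (fun z => by
      have hpow : 1 ≤ (1 + ‖z‖) ^ N := one_le_pow₀ (by linarith [norm_nonneg z])
      by_cases hz : ‖z‖ ≤ 1
      · have := hD z (by simpa using hz)
        nlinarith
      · push Not at hz
        have hz0 : z ≠ 0 := by rintro rfl; simp at hz; linarith
        rw [dslope_of_ne _ hz0, slope_def_field, norm_div, sub_zero, div_le_iff₀ (by linarith)]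
        have h1 := norm_sub_le (h z) (h 0)
        have h2 := hb z
        rw [pow_succ] at h2
        have h3 : C * ((1 + ‖z‖) ^ N * (1 + ‖z‖)) ≤ C * ((1 + ‖z‖) ^ N * (2 * ‖z‖)) := by
          gcongr; linarith
        have h4 : C ≤ C * ((1 + ‖z‖) ^ N * (2 * ‖z‖)) := by
          have : 1 ≤ (1 + ‖z‖) ^ N * (2 * ‖z‖) := by nlinarith
          nlinarith
        have h5 : 0 ≤ D * (1 + ‖z‖) ^ N * ‖z‖ := by positivity
        nlinarith)
    refine ⟨Polynomial.C (h 0) + Polynomial.X * p, fun z => ?_⟩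
    have := sub_smul_dslope h 0 z
    simp only [sub_zero, smul_eq_mul, hp] at this
    simp [this]

lemma mero_punct {f : ℂ → ℂ} {P : Set ℂ} (hf : MeroPlane f P) (p : ℂ) : ∀ᶠ z in 𝓝[≠] p, z ∉ P := by
  have h1 : (P ∩ closedBall p 1).Finite := hf.1 _ (isCompact_closedBall p 1)
  have h2 : ((P ∩ closedBall p 1) \ {p}).Finite := h1.subset sdiff_subset
  have h3 : ((P ∩ closedBall p 1) \ {p})ᶜ ∈ 𝓝 p := h2.isClosed.isOpen_compl.mem_nhds (by simp)
  filter_upwards [nhdsWithin_le_nhds h3, nhdsWithin_le_nhds (Metric.closedBall_mem_nhds p one_pos),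
    self_mem_nhdsWithin] with z h1 h2 h3 h4
  exact h1 ⟨⟨h4, h2⟩, h3⟩

lemma mero_closed {f : ℂ → ℂ} {P : Set ℂ} (hf : MeroPlane f P) : IsClosed P := by
  rw [← isOpen_compl_iff, isOpen_iff_mem_nhds]
  intro z hz
  have := mero_punct hf z
  rw [eventually_nhdsWithin_iff] at this
  filter_upwards [this] with w hw hwP
  by_cases h : w = z
  · exact hz (h ▸ hwP)
  · exact hw h hwP

lemma mero_tendsto {f : ℂ → ℂ} {P : Set ℂ} (hf : MeroPlane f P) {p : ℂ} (hp : p ∈ P) :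
    Tendsto (fun z => ‖f z‖) (𝓝[≠] p) atTop := by
  refine (hf.2.2 p hp).mono_left ?_
  exact le_inf nhdsWithin_le_nhds (le_principal_iff.2 (mero_punct hf p))

lemma pole_order {f : ℂ → ℂ} {p : ℂ} (han : ∀ᶠ z in 𝓝[≠] p, AnalyticAt ℂ f z)
    (ht : Tendsto (fun z => ‖f z‖) (𝓝[≠] p) atTop) : ∃ m, PoleOrder f p m := by
  set h : ℂ → ℂ := Function.update (fun z => (f z)⁻¹) p 0 with hh
  have hne : ∀ᶠ z in 𝓝[≠] p, f z ≠ 0 := by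
    filter_upwards [ht.eventually_gt_atTop 0] with z hz
    exact norm_pos_iff.1 hz
  have hev : ∀ᶠ z in 𝓝[≠] p, h z = (f z)⁻¹ := by
    filter_upwards [self_mem_nhdsWithin] with z hz
    rw [hh, Function.update_of_ne hz]
  have hc : ContinuousAt h p := by
    rw [hh, continuousAt_update_same]
    rw [tendsto_zero_iff_norm_tendsto_zero]
    simp only [norm_inv]
    exact ht.inv_tendsto_atTop
  have hd : ∀ᶠ z in 𝓝[≠] p, DifferentiableAt ℂ h z := by
    filter_upwards [han, hne, self_mem_nhdsWithin] with z h1 h2 h3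
    have : h =ᶠ[𝓝 z] fun z => (f z)⁻¹ := by
      filter_upwards [isOpen_ne.mem_nhds h3] with w hw
      rw [hh, Function.update_of_ne hw]
    exact (h1.differentiableAt.inv h2).congr_of_eventuallyEq this
  have ha := Complex.analyticAt_of_differentiable_on_punctured_nhds_of_continuousAt hd hc
  have h0 : h p = 0 := by simp [hh]
  have hnz : ¬ ∀ᶠ z in 𝓝 p, h z = 0 := by
    intro hz
    have := (hev.and (hne.and (nhdsWithin_le_nhds hz))).exists
    obtain ⟨z, h1, h2, h3⟩ := this
    exact inv_ne_zero h2 (h1 ▸ h3)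
  obtain ⟨m, k, hk, hk0, hm⟩ := ha.exists_eventuallyEq_pow_smul_nonzero_iff.2 hnz
  refine ⟨m, ?_, fun z => (k z)⁻¹, hk.inv hk0, inv_ne_zero hk0, ?_⟩
  · rcases Nat.eq_zero_or_pos m with rfl | h
    · have := hm.self_of_nhds
      simp [h0] at this
      exact absurd this.symm hk0
    · exact h
  · filter_upwards [hev, hne, nhdsWithin_le_nhds hm] with z h1 h2 h3
    rw [h1, smul_eq_mul] at h3
    rw [← inv_inv (f z), h3, mul_inv, inv_eq_one_div ((z-p)^m)]; ring

lemma mero_pole {f : ℂ → ℂ} {P : Set ℂ} (hf : MeroPlane f P) {p : ℂ} (hp : p ∈ P) :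
    ∃ m, PoleOrder f p m :=
  pole_order ((mero_punct hf p).mono fun z hz => hf.2.1 z hz) (mero_tendsto hf hp)

lemma rational_of_growth {f : ℂ → ℂ} {P : Set ℂ} (hf : MeroPlane f P) {R C : ℝ} {N : ℕ}
    (hR : ∀ z : ℂ, R < ‖z‖ → z ∉ P ∧ ‖f z‖ ≤ C * (1 + ‖z‖) ^ N) : RationalFn f P := by
  have hPs : P ⊆ closedBall 0 R := fun z hz => by
    by_contra h
    exact (hR z (by simpa using h)).1 hz
  have hfin : P.Finite := by
    have := hf.1 _ (isCompact_closedBall (0:ℂ) R)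
    rwa [inter_eq_left.2 hPs] at this
  choose! m hm using fun p (hp : p ∈ P) => mero_pole hf hp
  set q : Polynomial ℂ := ∏ p ∈ hfin.toFinset, (Polynomial.X - Polynomial.C p) ^ (m p + 1) with hq
  have hqe : ∀ z, q.eval z = ∏ p ∈ hfin.toFinset, (z - p) ^ (m p + 1) := by
    intro z; simp [hq, Polynomial.eval_prod]
  have hq0 : ∀ z, q.eval z = 0 ↔ z ∈ P := by
    intro z
    rw [hqe, Finset.prod_eq_zero_iff]
    constructor
    · rintro ⟨p, hp, h⟩
      have := pow_eq_zero_iff (by omega) |>.1 h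
      rw [sub_eq_zero] at this; rw [this]; simpa using hp
    · intro h; exact ⟨z, by simpa using h, by simp⟩
  classical
  set h : ℂ → ℂ := fun z => if z ∈ P then 0 else q.eval z * f z with hh
  have hd1 : ∀ z ∉ P, DifferentiableAt ℂ h z := by
    intro z hz
    have : h =ᶠ[𝓝 z] fun z => q.eval z * f z := by
      filter_upwards [(mero_closed hf).isOpen_compl.mem_nhds hz] with w hw
      simp only [hh]; rw [if_neg hw]
    exact (q.differentiable.differentiableAt.mul (hf.2.1 z hz).differentiableAt).congr_of_eventuallyEq this
  have hd : Differentiable ℂ h := by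
    intro z
    by_cases hz : z ∈ P
    · apply AnalyticAt.differentiableAt
      apply Complex.analyticAt_of_differentiable_on_punctured_nhds_of_continuousAt
      · filter_upwards [mero_punct hf z] with w hw using hd1 w hw
      · have h0 : h z = 0 := by simp [hh, hz]
        rw [continuousAt_iff_punctured_nhds, h0]
        obtain ⟨_, g, hg, hg0, hgf⟩ := hm z hz
        set q' : ℂ → ℂ := fun w => ∏ p ∈ hfin.toFinset.erase z, (w - p) ^ (m p + 1) with hq'
        have ht : Tendsto (fun w => q' w * g w * (w - z)) (𝓝[≠] z) (𝓝 (q' z * g z * (z - z))) := by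
          apply Tendsto.mono_left _ nhdsWithin_le_nhds
          have : ContinuousAt q' z := by
            apply Continuous.continuousAt
            exact continuous_finsetProd _ fun p _ => by fun_prop
          exact (this.mul hg.continuousAt).mul (by fun_prop)
        rw [sub_self, mul_zero] at ht
        apply ht.congr'
        filter_upwards [mero_punct hf z, hgf, self_mem_nhdsWithin] with w h1 h2 h3
        have h3' : w - z ≠ 0 := sub_ne_zero.2 h3
        simp only [hh]; rw [if_neg h1, h2, hqe, ← Finset.mul_prod_erase _ _ (hfin.mem_toFinset.2 hz), hq']
        field_simp
        ring
    · exact hd1 z hz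
  obtain ⟨D, hD⟩ := (isCompact_closedBall (0:ℂ) R).exists_bound_of_continuousOn hd.continuous.continuousOn
  obtain ⟨D', N', hD'⟩ : ∃ D' : ℝ, ∃ N' : ℕ, ∀ z, ‖q.eval z‖ ≤ D' * (1 + ‖z‖) ^ N' := by
    refine ⟨∑ i ∈ q.support, ‖q.coeff i‖, q.natDegree, fun z => ?_⟩
    rw [Polynomial.eval_eq_sum, Polynomial.sum, Finset.sum_mul]
    refine (norm_sum_le _ _).trans (Finset.sum_le_sum fun i hi => ?_)
    rw [norm_mul, norm_pow]
    gcongr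
    calc ‖z‖ ^ i ≤ (1 + ‖z‖) ^ i := by gcongr; linarith
      _ ≤ _ := pow_le_pow_right₀ (by linarith [norm_nonneg z]) (Polynomial.le_natDegree_of_mem_supp _ hi)
  have hD'0 : 0 ≤ D' := by have := (norm_nonneg _).trans (hD' 0); simpa using this
  obtain ⟨p, hp⟩ := poly_growth (N' + N) (C := |D| + D' * |C|) hd (fun z => by
    have hpow : 1 ≤ (1 + ‖z‖) ^ (N' + N) := one_le_pow₀ (by linarith [norm_nonneg z])
    have hp2 : 0 ≤ D' * |C| * (1 + ‖z‖) ^ (N' + N) := by positivity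
    by_cases hz : ‖z‖ ≤ R
    · have := hD z (by simpa using hz)
      have := le_abs_self D
      nlinarith [abs_nonneg D]
    · push Not at hz
      have h1 := hR z hz
      have h2 : h z = q.eval z * f z := by simp only [hh]; rw [if_neg h1.1]
      rw [h2, norm_mul]
      have h3 : ‖f z‖ ≤ |C| * (1 + ‖z‖) ^ N := h1.2.trans (by gcongr; exact le_abs_self C)
      calc _ ≤ (D' * (1 + ‖z‖) ^ N') * (|C| * (1 + ‖z‖) ^ N) := by
            gcongr; exact hD' z
        _ = D' * |C| * (1 + ‖z‖) ^ (N' + N) := by ring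
        _ ≤ _ := by
          have : 0 ≤ |D| * (1 + ‖z‖) ^ (N' + N) := by positivity
          linarith)
  refine ⟨p, q, ?_, fun z hz hqz => ?_⟩
  · rw [hq, Finset.prod_ne_zero_iff]
    intro a _
    exact pow_ne_zero _ (Polynomial.X_sub_C_ne_zero a)
  · rw [← hp z, eq_div_iff hqz]
    simp only [hh]; rw [if_neg hz]; ring
end

section

set_option maxHeartbeats 2000000 in
lemma select {u : ℂ → ℝ} (hc : Continuous u) (h0 : ∀ z, 0 ≤ u z)
    (hn : ¬ ∃ C : ℝ, ∀ z : ℂ, 1 ≤ ‖z‖ → u z ≤ C * (1 + rlog ‖z‖))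
    {L ε : ℝ} (hL : 1 ≤ L) (hε : 0 < ε) (X : ℝ) :
    ∃ z0 ρ : ℂ, ρ ≠ 0 ∧ X ≤ u z0 ∧ X ≤ u z0 + 2 * rlog ‖ρ‖ ∧
      ∀ τ : ℂ, ‖τ‖ ≤ L → u (z0 + ρ * τ) ≤ u z0 + τ.re + ε := by
  set m : ℝ → ℝ := fun r => sSup (u '' closedBall 0 r) with hm
  have hbd : ∀ r, BddAbove (u '' closedBall (0:ℂ) r) := fun r =>
    ((isCompact_closedBall (0:ℂ) r).image hc).bddAbove
  have hle : ∀ r (z : ℂ), ‖z‖ ≤ r → u z ≤ m r := fun r z hz =>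
    le_csSup (hbd r) ⟨z, by simpa using hz, rfl⟩
  have hatt : ∀ r, 0 ≤ r → ∃ z : ℂ, ‖z‖ ≤ r ∧ u z = m r := by
    intro r hr
    have := ((isCompact_closedBall (0:ℂ) r).image hc).sSup_mem (by simpa using hr)
    obtain ⟨z, hz, h⟩ := this
    exact ⟨z, by simpa using hz, h⟩
  have hmono : ∀ r s, 0 ≤ r → r ≤ s → m r ≤ m s := by
    intro r s hr hrs
    obtain ⟨z, hz, h⟩ := hatt r hr
    rw [← h]; exact hle s z (hz.trans hrs)
  set l := max 2 (max (4 * L + 1) (12 * L ^ 2 / ε)) with hl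
  have hl2 : 2 ≤ l := le_max_left _ _
  have hl4 : 4 * L + 1 ≤ l := (le_max_left _ _).trans (le_max_right _ _)
  have hle' : 12 * L ^ 2 / ε ≤ l := (le_max_right _ _).trans (le_max_right _ _)
  set Y := X + l + rlog (4 * l ^ 2) + 1 + |X| + |rlog (4 * l ^ 2)| with hY
  obtain ⟨N, hN1, hN⟩ : ∃ N : ℝ, 4 ≤ N ∧ Y ≤ m (N / 4) := by
    by_contra! hcon
    apply hn
    refine ⟨|Y|, fun z hz => ?_⟩
    have h1 := hcon (4 * max 1 ‖z‖) (by have := le_max_left 1 ‖z‖; linarith)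
    have h2 := hle (4 * max 1 ‖z‖ / 4) z (by have := le_max_right 1 ‖z‖; linarith)
    have h3 := Real.log_nonneg hz
    have h4 := le_abs_self Y
    nlinarith [abs_nonneg Y]
  obtain ⟨R, hRN, hR⟩ : ∃ R : ℝ, N ≤ R ∧ l * rlog (4 / 3) < m (R / 2) - m (R / 4) := by
    by_contra! hcon
    apply hn
    set q := l * rlog (4 / 3) with hq
    have hq0 : 0 ≤ q := mul_nonneg (by linarith) (Real.log_nonneg (by norm_num))
    have hk : ∀ k : ℕ, m (2 ^ k * (N / 4)) ≤ m (N / 4) + k * q := by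
      intro k
      induction k with
      | zero => simp
      | succ k ih =>
        have h1 := hcon (2 ^ (k + 2) * (N / 4)) (by
          have : (1:ℝ) ≤ 2 ^ k := one_le_pow₀ (by norm_num)
          rw [pow_add]; nlinarith)
        rw [show (2:ℝ) ^ (k + 2) * (N / 4) / 2 = 2 ^ (k + 1) * (N / 4) by ring,
          show (2:ℝ) ^ (k + 2) * (N / 4) / 4 = 2 ^ k * (N / 4) by ring] at h1
        push_cast
        linarith
    have hm0 : 0 ≤ m (N / 4) := (h0 0).trans (hle _ 0 (by simp; linarith))
    refine ⟨m (N / 4) + 2 * q + 2 * q, fun z hz => ?_⟩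
    have hlog := Real.log_nonneg hz
    set k := ⌈rlog ‖z‖ / rlog 2⌉₊
    have h2 : rlog ‖z‖ / rlog 2 ≤ k := Nat.le_ceil _
    have hl0 : 0 < rlog 2 := Real.log_pos (by norm_num)
    have hl1 : 1 / 2 < rlog 2 := by have := Real.log_two_gt_d9; linarith
    have h3 : (k:ℝ) < rlog ‖z‖ / rlog 2 + 1 := Nat.ceil_lt_add_one (by positivity)
    have h4 : ‖z‖ ≤ 2 ^ k := by
      rw [← Real.log_le_log_iff (by linarith) (by positivity), Real.log_pow]
      rwa [div_le_iff₀ hl0] at h2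
    have h5 := hle (2 ^ k * (N / 4)) z (h4.trans (by
      have : (0:ℝ) < 2 ^ k := by positivity
      nlinarith))
    have h6 := hk k
    have h7 : rlog ‖z‖ / rlog 2 ≤ 2 * rlog ‖z‖ := by
      rw [div_le_iff₀ hl0]; nlinarith
    have h8 : (k:ℝ) * q ≤ (2 * rlog ‖z‖ + 1) * q := by gcongr; linarith
    nlinarith [mul_nonneg hm0 hlog, mul_nonneg hq0 hlog]
  have hR4 : 4 ≤ R := hN1.trans hRN
  have hR0 : 0 < R := by linarith
  have hl0 : 0 < l := by linarith
  obtain ⟨z0, hz0, hmax⟩ := (isCompact_closedBall (0:ℂ) R).exists_isMaxOn ⟨0, by simpa using hR0.le⟩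
    (f := fun z => rexp (u z / l) * (R ^ 2 - ‖z‖ ^ 2)) (by fun_prop)
  have hz0R : ‖z0‖ ≤ R := by simpa using hz0
  obtain ⟨z1, hz1, hz1m⟩ := hatt (R / 2) (by linarith)
  have hbig : rexp (m (R / 2) / l) * (3 / 4 * R ^ 2) ≤
      rexp (u z0 / l) * (R ^ 2 - ‖z0‖ ^ 2) := by
    have h1 := isMaxOn_iff.1 hmax z1 (by simp; linarith)
    rw [hz1m] at h1
    refine le_trans ?_ h1
    gcongr
    nlinarith [norm_nonneg z1]
  have hd0 : 0 < R ^ 2 - ‖z0‖ ^ 2 := by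
    by_contra h
    push Not at h
    have : 0 < rexp (m (R / 2) / l) * (3 / 4 * R ^ 2) := by positivity
    have : rexp (u z0 / l) * (R ^ 2 - ‖z0‖ ^ 2) ≤ 0 := mul_nonpos_of_nonneg_of_nonpos (Real.exp_pos _).le h
    linarith
  set d := R ^ 2 - ‖z0‖ ^ 2 with hd
  have hdR : d ≤ R ^ 2 := by nlinarith [sq_nonneg ‖z0‖]
  have hlogb : m (R / 2) / l + rlog (3 / 4) + 2 * rlog R ≤ u z0 / l + rlog d := by
    have := Real.log_le_log (by positivity) hbig
    rw [Real.log_mul (by positivity) (by positivity), Real.log_mul (by positivity) (by positivity),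
      Real.log_mul (by positivity) (by positivity), Real.log_exp, Real.log_exp, Real.log_pow] at this
    push_cast at this
    linarith
  have hlogd : rlog d ≤ 2 * rlog R := by
    have := Real.log_le_log hd0 hdR
    rwa [Real.log_pow] at this
  have h34 : rlog (4 / 3) = - rlog (3 / 4) := by
    rw [← Real.log_inv]; norm_num
  have h34' : -1 ≤ rlog (3 / 4) := by
    have := Real.log_le_sub_one_of_pos (show (0:ℝ) < 4 / 3 by norm_num)
    linarith
  have hlogb' : m (R / 2) + l * rlog (3 / 4) + l * (2 * rlog R) ≤ u z0 + l * rlog d := by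
    have := mul_le_mul_of_nonneg_left hlogb hl0.le
    rw [mul_add, mul_add, mul_add, mul_div_cancel₀ _ hl0.ne', mul_div_cancel₀ _ hl0.ne'] at this
    exact this
  have hz4 : R / 4 < ‖z0‖ := by
    by_contra h
    push Not at h
    have h1 := hle (R / 4) z0 h
    rw [h34] at hR
    nlinarith [mul_le_mul_of_nonneg_left hlogd hl0.le]
  have hmR : Y ≤ m (R / 2) := hN.trans (hmono _ _ (by linarith) (by linarith))
  have hz0pos : 0 < ‖z0‖ := by linarith
  have hz0ne : z0 ≠ 0 := norm_pos_iff.1 hz0pos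
  set ρ : ℂ := ((d / (2 * l * ‖z0‖ ^ 2) : ℝ) : ℂ) * z0 with hρ
  have hρn : ‖ρ‖ = d / (2 * l * ‖z0‖) := by
    rw [hρ, norm_mul, Complex.norm_real, Real.norm_eq_abs, abs_of_pos (by positivity)]
    field_simp
  have hρ0 : 0 < ‖ρ‖ := by rw [hρn]; positivity
  have hzlt : ‖z0‖ < R := by nlinarith
  refine ⟨z0, ρ, norm_pos_iff.1 hρ0, ?_, ?_, ?_⟩
  · have : 0 ≤ |rlog (4 * l ^ 2)| + rlog (4 * l ^ 2) := by linarith [neg_abs_le (rlog (4 * l ^ 2))]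
    nlinarith [mul_le_mul_of_nonneg_left hlogd hl0.le, abs_nonneg X]
  · have h1 : rlog ‖ρ‖ = rlog d - rlog (2 * l) - rlog ‖z0‖ := by
      rw [hρn, Real.log_div (by positivity) (by positivity), Real.log_mul (by positivity) (by positivity)]
      ring
    have h2 : rlog (4 * l ^ 2) = 2 * rlog (2 * l) := by
      rw [show 4 * l ^ 2 = (2 * l) ^ 2 by ring, Real.log_pow]; norm_num
    have h3 : rlog ‖z0‖ ≤ rlog R := Real.log_le_log hz0pos hzlt.le
    have h4 : 0 ≤ rlog R := Real.log_nonneg (by linarith)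
    have h5 : (l - 2) * rlog d ≤ (l - 2) * (2 * rlog R) := by
      apply mul_le_mul_of_nonneg_left hlogd; linarith
    rw [h1]
    have h6 : -l ≤ l * rlog (3 / 4) := by nlinarith
    nlinarith [abs_nonneg X, abs_nonneg (rlog (4 * l ^ 2))]
  · intro τ hτ
    have hL2 : ‖τ‖ ^ 2 ≤ L ^ 2 := by gcongr
    have hre : |τ.re| ≤ L := (Complex.abs_re_le_norm τ).trans hτ
    have hns : ‖z0 + ρ * τ‖ ^ 2 = ‖z0‖ ^ 2 + d / l * τ.re + ‖ρ‖ ^ 2 * ‖τ‖ ^ 2 := by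
      have h1 : ρ * τ = ((d / (2 * l * ‖z0‖ ^ 2) : ℝ) : ℂ) * (z0 * τ) := by rw [hρ]; ring
      rw [← mul_pow, ← norm_mul, ← Complex.normSq_eq_norm_sq, Complex.normSq_add,
        Complex.normSq_eq_norm_sq, Complex.normSq_eq_norm_sq]
      have h2 : (z0 * (starRingEnd ℂ) (ρ * τ)).re = d / (2 * l) * τ.re := by
        have h3 : (z0 * (starRingEnd ℂ) (ρ * τ)) = ((d / (2 * l * ‖z0‖ ^ 2) : ℝ) : ℂ) *
          ((z0 * starRingEnd ℂ z0) * starRingEnd ℂ τ) := by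
          rw [h1]; simp only [map_mul, Complex.conj_ofReal]; ring
        rw [h3, Complex.mul_conj, Complex.normSq_eq_norm_sq, Complex.re_ofReal_mul, Complex.re_ofReal_mul,
          Complex.conj_re]
        field_simp
      rw [h2]
      field_simp
      ring
    set δ := ‖ρ‖ ^ 2 * ‖τ‖ ^ 2 / d with hδ
    have hδ0 : 0 ≤ δ := by positivity
    have hρ2 : ‖ρ‖ ^ 2 ≤ d * (4 / l ^ 2) := by
      rw [hρn, div_pow, div_le_iff₀ (by positivity)]
      have : d * (4 / l ^ 2) * (2 * l * ‖z0‖) ^ 2 = d * (16 * ‖z0‖ ^ 2) := by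
        field_simp; ring
      rw [this, sq d]
      apply mul_le_mul_of_nonneg_left _ hd0.le
      nlinarith
    have hδ1 : δ ≤ 4 * L ^ 2 / l ^ 2 := by
      rw [hδ, div_le_iff₀ hd0]
      calc ‖ρ‖ ^ 2 * ‖τ‖ ^ 2 ≤ (d * (4 / l ^ 2)) * L ^ 2 := by gcongr
        _ = _ := by ring
    set x := τ.re / l + δ with hx
    have hRz : R ^ 2 - ‖z0 + ρ * τ‖ ^ 2 = d * (1 - x) := by
      rw [hns, hx, hδ]; field_simp; rw [hd]; ring
    have hLl : L / l ≤ 1 / 4 := by rw [div_le_iff₀ hl0]; linarith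
    have hLl0 : 0 ≤ L / l := by positivity
    have hδ2 : δ ≤ L / l := by
      have : 4 * L ^ 2 / l ^ 2 = 4 * (L / l) * (L / l) := by ring
      nlinarith
    have hxa : |x| ≤ 2 * (L / l) := by
      have : |τ.re / l| ≤ L / l := by rw [abs_div, abs_of_pos hl0]; gcongr
      rw [hx]
      calc _ ≤ |τ.re / l| + |δ| := abs_add_le _ _
        _ ≤ _ := by rw [abs_of_nonneg hδ0]; linarith
    have hx1 : x ≤ 1 / 2 := (le_abs_self x).trans (by linarith)
    have hin : ‖z0 + ρ * τ‖ ≤ R := by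
      have : 0 ≤ R ^ 2 - ‖z0 + ρ * τ‖ ^ 2 := by rw [hRz]; apply mul_nonneg hd0.le; linarith
      exact abs_le_of_sq_le_sq' (by linarith) hR0.le |>.2
    have hmx := isMaxOn_iff.1 hmax (z0 + ρ * τ) (by simpa using hin)
    rw [hRz, ← hd] at hmx
    have h1x : 0 < 1 - x := by linarith
    have hle2 : u (z0 + ρ * τ) / l + rlog (1 - x) ≤ u z0 / l := by
      have h := Real.log_le_log (by positivity) hmx
      rw [Real.log_mul (by positivity) (by positivity), Real.log_mul (by positivity) (by positivity),
        Real.log_mul (by positivity) (by positivity), Real.log_exp, Real.log_exp] at h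
      linarith
    have hlogx : -(x + 2 * x ^ 2) ≤ rlog (1 - x) := by
      have h := Real.one_sub_inv_le_log_of_pos h1x
      refine le_trans ?_ h
      rw [← sub_nonneg]
      have : 1 - (1 - x)⁻¹ - -(x + 2 * x ^ 2) = x ^ 2 * (1 - 2 * x) / (1 - x) := by
        field_simp; ring
      rw [this]
      apply div_nonneg _ h1x.le
      apply mul_nonneg (sq_nonneg _); linarith
    have hfin : u (z0 + ρ * τ) / l ≤ u z0 / l + (x + 2 * x ^ 2) := by linarith
    have hx2 : x ^ 2 ≤ (2 * (L / l)) ^ 2 := by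
      rw [← sq_abs x]; gcongr
    have hfin2 : u (z0 + ρ * τ) ≤ u z0 + l * (x + 2 * x ^ 2) := by
      have := mul_le_mul_of_nonneg_left hfin hl0.le
      rwa [mul_div_cancel₀ _ hl0.ne', mul_add, mul_div_cancel₀ _ hl0.ne'] at this
    have e1 : l * (x + 2 * x ^ 2) ≤ τ.re + 12 * L ^ 2 / l := by
      calc l * (x + 2 * x ^ 2) ≤ l * ((τ.re / l + 4 * L ^ 2 / l ^ 2) + 2 * (2 * (L / l)) ^ 2) := by
            rw [hx] at *; gcongr
        _ = _ := by field_simp; ring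
    have e2 : 12 * L ^ 2 / l ≤ ε := by
      rw [div_le_iff₀ hl0]; rw [div_le_iff₀ hε] at hle'; linarith
    linarith
end

section

lemma Tr.rescale {A : ℂ → ℂ} {U : Set ℂ} {u : ℂ → ℝ} {K : ℝ} (T : Tr A U u K) (z0 ρ : ℂ) :
    Tr (fun τ => A (z0 + ρ * τ)) {τ | z0 + ρ * τ ∈ U} (fun τ => u (z0 + ρ * τ)) K where
  ho := T.ho.preimage (by fun_prop)
  an := fun z hz => AnalyticAt.comp' (T.an _ hz) (by fun_prop)
  ne := fun z hz => T.ne _ hz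
  cont := T.cont.comp (by fun_prop)
  pos := fun z hz => T.pos _ hz
  zero := fun z hz => T.zero _ hz
  eq := fun z hz => T.eq _ hz

lemma blowup_aux {A : ℂ → ℂ} {U : Set ℂ} {u : ℂ → ℝ} {K : ℝ} (hK : 0 < K) (T : Tr A U u K)
    (hn : ¬ ∃ C : ℝ, ∀ z : ℂ, 1 ≤ ‖z‖ → u z ≤ C * (1 + rlog ‖z‖))
    {k ε : ℝ} (hk : 1 ≤ k) (hε : 0 < ε) (X : ℝ) :
    ∃ z0 ρ : ℂ, ∃ g : ℂ → ℂ, ρ ≠ 0 ∧ X ≤ ‖ρ ^ 2 * A z0‖ ∧ (∀ τ, ‖τ‖ < k → z0 + ρ * τ ∈ U) ∧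
      DifferentiableOn ℂ g (ball 0 k) ∧ g 0 = 0 ∧
      (∀ τ, ‖τ‖ < k → A (z0 + ρ * τ) = A z0 * cexp (τ + g τ)) ∧
      (∀ τ, ‖τ‖ < k → ‖g τ‖ ≤ ε) ∧ (∀ τ, ‖τ‖ < k → ‖deriv g τ‖ ≤ ε) := by
  set L := 32 * (k + 1) with hL
  set ε' := min (1 / 2) (ε / 2) with hε'
  have hε'0 : 0 < ε' := lt_min (by norm_num) (by linarith)
  have hε'1 : ε' ≤ 1 / 2 := min_le_left _ _
  have hε'2 : ε' ≤ ε / 2 := min_le_right _ _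
  obtain ⟨z0, ρ, hρ, h1, h2, h3⟩ := select T.cont T.nonneg hn (L := L) (by linarith) hε'0
    (max (401 + L) (rlog (max X 1) - rlog K))
  have T' := T.rescale z0 ρ
  have hX1 := (le_max_left _ _).trans h1
  have hX2 := (le_max_right _ _).trans h2
  have hsub := noholes T' (H := u z0) (ε := ε') (L := L) (by linarith) (by simp) (by linarith) (by linarith)
    (by linarith) h3
  have hU : ∀ τ : ℂ, ‖τ‖ < 2 * (k + 1) → z0 + ρ * τ ∈ U := fun τ hτ =>
    hsub (show τ ∈ ball 0 (L / 16) by simp; linarith)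
  have hU' : ∀ τ ∈ ball (0:ℂ) (2 * (k + 1)), z0 + ρ * τ ∈ U := fun τ hτ => hU τ (by simpa using hτ)
  have hz0U : z0 ∈ U := by simpa using hU 0 (by simp; linarith)
  have hA0 := T.ne z0 hz0U
  obtain ⟨ℓ, hℓd, hℓ⟩ := convex_log Metric.isOpen_ball (convex_ball (0:ℂ) (2 * (k + 1)))
    ⟨0, by simp; linarith⟩ (g := fun τ => A (z0 + ρ * τ) / A z0)
    (fun τ hτ => ((T'.an τ (hU' τ hτ)).differentiableAt.div_const _).differentiableWithinAt)
    (fun τ hτ => div_ne_zero (T.ne _ (hU' τ hτ)) hA0)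
  set g : ℂ → ℂ := fun τ => ℓ τ - ℓ 0 - τ with hg
  have h0b : (0:ℂ) ∈ ball (0:ℂ) (2 * (k + 1)) := by simp; linarith
  have hℓ0 : cexp (ℓ 0) = 1 := by rw [hℓ 0 h0b]; simp [hA0]
  have hgd : DifferentiableOn ℂ g (ball 0 (2 * (k + 1))) := by
    exact (hℓd.sub_const _).sub differentiableOn_id
  have hexp : ∀ τ ∈ ball (0:ℂ) (2 * (k + 1)), A (z0 + ρ * τ) = A z0 * cexp (τ + g τ) := by
    intro τ hτ
    rw [hg, show τ + (ℓ τ - ℓ 0 - τ) = ℓ τ - ℓ 0 by ring, Complex.exp_sub, hℓ0, hℓ τ hτ]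
    field_simp
  have hre : ∀ τ ∈ ball (0:ℂ) (2 * (k + 1)), (g τ).re ≤ ε' := by
    intro τ hτ
    have e1 := h3 τ (by simp at hτ; linarith)
    have e2 := T.eq _ (hU' τ hτ)
    have e3 := T.eq _ hz0U
    rw [hexp τ hτ, norm_mul, Complex.norm_exp, Real.log_mul (norm_ne_zero_iff.2 hA0) (Real.exp_pos _).ne',
      Real.log_exp, Complex.add_re] at e2
    linarith
  have hg0 : g 0 = 0 := by simp [hg]
  have hgb : ∀ τ : ℂ, ‖τ‖ ≤ k + 1 → ‖g τ‖ ≤ ε := by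
    intro τ hτ
    have := Complex.borelCaratheodory_zero hε'0 hgd hre (by linarith) (z := τ) (by simp; linarith) hg0
    refine this.trans ?_
    rw [div_le_iff₀ (by linarith)]
    nlinarith [norm_nonneg τ]
  refine ⟨z0, ρ, g, hρ, ?_, fun τ hτ => hU τ (by linarith), hgd.mono (Metric.ball_subset_ball (by linarith)),
    hg0, fun τ hτ => hexp τ (by simp; linarith), fun τ hτ => hgb τ (by linarith), ?_⟩
  · rw [T.eq _ hz0U] at hX2
    have hp : 0 < ‖ρ ^ 2 * A z0‖ := by
      rw [norm_pos_iff]; exact mul_ne_zero (pow_ne_zero 2 hρ) hA0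
    refine (le_max_left X 1).trans ((Real.log_le_log_iff (by positivity) hp).1 ?_)
    rw [norm_mul, norm_pow, Real.log_mul (by positivity) (norm_ne_zero_iff.2 hA0), Real.log_pow]
    push_cast
    linarith
  · intro τ hτ
    have := Complex.norm_deriv_le_of_forall_mem_sphere_norm_le (c := τ) (R := 1) (C := ε) (f := g) one_pos (by
      apply DifferentiableOn.diffContOnCl
      apply hgd.mono
      rw [closure_ball _ one_ne_zero]
      intro z hz
      have h1 := norm_sub_norm_le z τ
      rw [mem_closedBall_iff_norm] at hz
      simp; linarith) (fun z hz => hgb z (by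
        have h1 := norm_sub_norm_le z τ
        rw [mem_sphere_iff_norm] at hz
        linarith))
    simpa using this

lemma sing_tr {A : ℂ → ℂ} {P : Set ℂ} (hA : TranscMeroPlane A P) (hd : DirectSingularityOverInfty A P) :
    ∃ (U : Set ℂ) (u : ℂ → ℝ) (K : ℝ), 0 < K ∧ Tr A U u K ∧ (∀ z ∈ U, z ∉ P) ∧
      ¬ ∃ C : ℝ, ∀ z : ℂ, 1 ≤ ‖z‖ → u z ≤ C * (1 + rlog ‖z‖) := by
  obtain ⟨γ, ⟨hγ1, hγ2, hγ3⟩, t, ht, C, ⟨x, hx, hC⟩, hCP, hCb⟩ := hd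
  have hM := hA.1
  set S : Set ℂ := {z | chordal (valueAt A P z) none < t} with hS
  set K : ℝ := 1 / t with hK
  have hK0 : 0 < K := by positivity
  have hval : ∀ z, z ∉ P → chordal (valueAt A P z) none = 1 / Real.sqrt (1 + ‖A z‖ ^ 2) := by
    intro z hz
    simp [valueAt, hz, chordal]
  have hbig : ∀ z, z ∉ P → K ≤ ‖A z‖ → z ∈ S := by
    intro z hz h
    rw [hS, mem_ofPred_eq, hval z hz, div_lt_iff₀ (by positivity)]
    have : K < Real.sqrt (1 + ‖A z‖ ^ 2) := by
      apply Real.lt_sqrt_of_sq_lt; nlinarith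
    rw [hK, div_lt_iff₀ ht] at this
    linarith
  have hPS : P ⊆ S := by
    intro z hz
    simp [hS, valueAt, hz, chordal, ht]
  have hcA : ∀ z ∉ P, ContinuousAt A z := fun z hz => (hM.2.1 z hz).continuousAt
  have hPc := (mero_closed hM).isOpen_compl
  have hSo : IsOpen S := by
    rw [isOpen_iff_mem_nhds]
    intro z hz
    by_cases hzP : z ∈ P
    · have := (mero_tendsto hM hzP).eventually_ge_atTop K
      rw [eventually_nhdsWithin_iff] at this
      filter_upwards [this] with w hw
      by_cases hwP : w ∈ P
      · exact hPS hwP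
      · exact hbig w hwP (hw (by rintro rfl; exact hwP hzP))
    · have h1 : ContinuousAt (fun w => 1 / Real.sqrt (1 + ‖A w‖ ^ 2)) z := by
        have := hcA z hzP
        apply ContinuousAt.div continuousAt_const (by fun_prop)
        positivity
      have h2 : 1 / Real.sqrt (1 + ‖A z‖ ^ 2) < t := by rw [← hval z hzP]; exact hz
      filter_upwards [h1.eventually (gt_mem_nhds h2), hPc.mem_nhds hzP] with w hw hw'
      rw [hS, mem_ofPred_eq, hval w hw']; exact hw
  have hCo : IsOpen C := by rw [hC]; exact hSo.connectedComponentIn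
  have hCS : C ⊆ S := by rw [hC]; exact connectedComponentIn_subset _ _
  classical
  set U : Set ℂ := {z | z ∈ C ∧ K < ‖A z‖} with hU
  set u : ℂ → ℝ := fun z => if z ∈ U then rlog ‖A z‖ - rlog K else 0 with hu
  have hcC : ContinuousOn (fun z => ‖A z‖) C := fun z hz =>
    (hcA z (hCP z hz)).norm.continuousWithinAt
  have hUo : IsOpen U := hcC.isOpen_inter_preimage hCo isOpen_Ioi
  have hUe : ∀ z ∈ C, u z = max (rlog (max ‖A z‖ K) - rlog K) 0 := by
    intro z hz
    by_cases h : K < ‖A z‖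
    · have h1 : z ∈ U := ⟨hz, h⟩
      have h2 := Real.log_lt_log hK0 h
      simp only [hu, if_pos h1]
      rw [max_eq_left h.le, max_eq_left (by linarith)]
    · have h1 : z ∉ U := fun h' => h h'.2
      simp only [hu, if_neg h1]
      rw [max_eq_right (not_lt.1 h)]; simp
  have T : Tr A U u K := by
    refine ⟨hUo, fun z hz => hM.2.1 z (hCP z hz.1), fun z hz h => ?_, ?_, fun z hz => ?_, fun z hz => ?_,
      fun z hz => ?_⟩
    · have := hz.2; rw [h, norm_zero] at this; linarith
    · rw [continuous_iff_continuousAt]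
      intro z
      by_cases hz : z ∈ C
      · have h1 : ContinuousAt (fun z => max (rlog (max ‖A z‖ K) - rlog K) 0) z := by
          have := hcA z (hCP z hz)
          have h2 : ContinuousAt (fun z => max ‖A z‖ K) z := this.norm.max continuousAt_const
          exact ((h2.log (lt_max_of_lt_right hK0).ne').sub continuousAt_const).max continuousAt_const
        apply h1.congr
        filter_upwards [hCo.mem_nhds hz] with w hw
        rw [hUe w hw]
      · have h0 : ∀ᶠ w in 𝓝 z, u w = 0 := by
          by_cases hzS : z ∈ S
          · have hop : IsOpen (connectedComponentIn S z) := hSo.connectedComponentIn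
            filter_upwards [hop.mem_nhds (mem_connectedComponentIn hzS)] with w hw
            have hwC : w ∉ C := by
              intro hwC
              rw [hC] at hwC
              have e1 := connectedComponentIn_eq hw
              have e2 := connectedComponentIn_eq hwC
              apply hz
              rw [hC, e2, ← e1]
              exact mem_connectedComponentIn hzS
            simp only [hu]
            rw [if_neg fun h => hwC h.1]
          · have hzP : z ∉ P := fun h => hzS (hPS h)
            have hlt : ‖A z‖ < K := by
              by_contra h
              exact hzS (hbig z hzP (not_lt.1 h))
            filter_upwards [(hcA z hzP).norm.eventually (gt_mem_nhds hlt)] with w hw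
            simp only [hu]
            rw [if_neg fun h => by have := h.2; linarith]
        exact continuousAt_const.congr (h0.mono fun w hw => hw.symm)
    · simp only [hu]; rw [if_pos hz]
      have := Real.log_lt_log hK0 hz.2
      linarith
    · simp only [hu]; rw [if_neg hz]
    · simp only [hu]; rw [if_pos hz]
  refine ⟨U, u, K, hK0, T, fun z hz => hCP z hz.1, ?_⟩
  rintro ⟨c, hc⟩
  have hne : U.Nonempty := by
    obtain ⟨B, hB⟩ := isBounded_iff_forall_norm_le.1 hCb
    have h1 : ∀ᶠ s in atTop, chordal (valueAt A P (γ s)) none < 1 / Real.sqrt (1 + K ^ 2) :=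
      hγ3.eventually (gt_mem_nhds (by positivity))
    obtain ⟨s, h1, h2, h3⟩ := (h1.and ((hγ2.eventually_gt_atTop B).and (eventually_ge_atTop 0))).exists
    have hsC : γ s ∈ C := by
      by_contra h
      have := hB (γ s) ⟨⟨s, h3, rfl⟩, h⟩
      linarith
    refine ⟨γ s, hsC, ?_⟩
    rw [hval _ (hCP _ hsC), one_div_lt_one_div (by positivity) (by positivity),
      Real.sqrt_lt_sqrt_iff (by positivity)] at h1
    exact lt_of_pow_lt_pow_left₀ 2 (norm_nonneg _) (by linarith)
  obtain ⟨R, hR⟩ := log_growth T hne hc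
  apply hA.2
  apply rational_of_growth hM (R := max R 1) (C := K * rexp |c|) (N := ⌈|c|⌉₊)
  intro z hz
  have hzU := hR z ((le_max_left _ _).trans_lt hz)
  have hz1 : 1 < ‖z‖ := (le_max_right _ _).trans_lt hz
  refine ⟨hCP z hzU.1, ?_⟩
  have e1 := hc z hz1.le
  rw [T.eq z hzU] at e1
  have hApos : 0 < ‖A z‖ := hK0.trans hzU.2
  rw [← Real.log_le_log_iff hApos (by positivity), Real.log_mul (by positivity) (by positivity),
    Real.log_mul (by positivity) (by positivity), Real.log_exp, Real.log_pow]
  have hl := Real.log_nonneg hz1.le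
  have hl2 : rlog ‖z‖ ≤ rlog (1 + ‖z‖) := Real.log_le_log (by linarith) (by linarith)
  have e2 : c * (1 + rlog ‖z‖) ≤ |c| * (1 + rlog ‖z‖) := by
    gcongr; exact le_abs_self c
  have e3 : |c| * rlog ‖z‖ ≤ (⌈|c|⌉₊ : ℝ) * rlog (1 + ‖z‖) := by
    apply mul_le_mul (Nat.le_ceil _) hl2 hl (by positivity)
  linarith

lemma blowup {A : ℂ → ℂ} {P : Set ℂ} (hA : TranscMeroPlane A P) (hd : DirectSingularityOverInfty A P)
    {k ε : ℝ} (hk : 1 ≤ k) (hε : 0 < ε) (X : ℝ) :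
    ∃ z0 ρ : ℂ, ∃ g : ℂ → ℂ, ρ ≠ 0 ∧ X ≤ ‖ρ ^ 2 * A z0‖ ∧ (∀ τ, ‖τ‖ < k → z0 + ρ * τ ∉ P) ∧
      DifferentiableOn ℂ g (ball 0 k) ∧ g 0 = 0 ∧
      (∀ τ, ‖τ‖ < k → A (z0 + ρ * τ) = A z0 * cexp (τ + g τ)) ∧
      (∀ τ, ‖τ‖ < k → ‖g τ‖ ≤ ε) ∧ (∀ τ, ‖τ‖ < k → ‖deriv g τ‖ ≤ ε) := by
  obtain ⟨U, u, K, hK, T, hUP, hn⟩ := sing_tr hA hd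
  obtain ⟨z0, ρ, g, h1, h2, h3, h4⟩ := blowup_aux hK T hn hk hε X
  exact ⟨z0, ρ, g, h1, h2, fun τ hτ => hUP _ (h3 τ hτ), h4⟩
end

section

lemma polar_ann {r R : ℝ} (hr : 0 < r) (hR : r < R) {Q : ℂ → ℝ} {q : ℝ → ℝ}
    (hQ : ContinuousOn Q {z | r ≤ ‖z‖ ∧ ‖z‖ ≤ R})
    (hq : ∀ s ∈ Ioo r R, ∫ θ in (-π)..Real.pi, Q (circleMap 0 s θ) = q s) :
    ∫ z in {z : ℂ | r < ‖z‖ ∧ ‖z‖ < R}, Q z = ∫ s in r..R, s * q s := by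
  have hms : MeasurableSet {z : ℂ | r < ‖z‖ ∧ ‖z‖ < R} :=
    ((isOpen_lt continuous_const continuous_norm).inter
      (isOpen_lt continuous_norm continuous_const)).measurableSet
  rw [← integral_indicator hms, ← Complex.integral_comp_polarCoord_symm]
  have hpm : ∀ p : ℝ × ℝ, Complex.polarCoord.symm p = circleMap 0 p.1 p.2 := by
    intro p
    rw [Complex.polarCoord_symm_apply, circleMap_zero, Complex.exp_mul_I]; push_cast; rfl
    
  have hnorm : ∀ p : ℝ × ℝ, ‖circleMap 0 p.1 p.2‖ = |p.1| := fun p => norm_circleMap_zero _ _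
  have e1 : ∫ p in polarCoord.target, p.1 • ({z : ℂ | r < ‖z‖ ∧ ‖z‖ < R}.indicator Q)
      (Complex.polarCoord.symm p) =
      ∫ p in Ioo r R ×ˢ Ioo (-π) π, p.1 * Q (circleMap 0 p.1 p.2) := by
    have hms2 : MeasurableSet (Ioo r R ×ˢ Ioo (-π) π) :=
      measurableSet_Ioo.prod measurableSet_Ioo
    have hms3 : MeasurableSet polarCoord.target := polarCoord.open_target.measurableSet
    rw [← integral_indicator hms2, ← integral_indicator hms3]
    congr 1
    ext p
    simp only [indicator, hpm, mem_ofPred_eq, hnorm, polarCoord_target, mem_prod, mem_Ioi, mem_Ioo]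
    by_cases h1 : 0 < p.1
    · rw [abs_of_pos h1]
      by_cases h2 : r < p.1 ∧ p.1 < R <;> by_cases h3 : -π < p.2 ∧ p.2 < π <;>
        simp [h1, h2, h3]
    · have : ¬ (r < p.1) := fun h => h1 (hr.trans h)
      simp [h1, this]
  rw [e1, Measure.volume_eq_prod, setIntegral_prod]
  · rw [intervalIntegral.integral_of_le hR.le, integral_Ioc_eq_integral_Ioo]
    apply setIntegral_congr_fun measurableSet_Ioo
    intro s hs
    simp only
    rw [← hq s hs, intervalIntegral.integral_of_le (by linarith [Real.pi_pos]),
      integral_Ioc_eq_integral_Ioo, integral_const_mul]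
  · rw [← Measure.volume_eq_prod]
    have : ContinuousOn (fun p : ℝ × ℝ => p.1 * Q (circleMap 0 p.1 p.2))
        (Icc r R ×ˢ Icc (-π) π) := by
      apply continuousOn_fst.mul
      apply hQ.comp
      · apply Continuous.continuousOn
        simp only [circleMap]; fun_prop
      · rintro p ⟨hp, -⟩
        simp only [mem_ofPred_eq, hnorm]
        rw [abs_of_pos (hr.trans_le hp.1)]; exact hp
    exact (this.integrableOn_compact (isCompact_Icc.prod isCompact_Icc)).mono_set
      (prod_mono Ioo_subset_Icc_self Ioo_subset_Icc_self)

lemma det_smulRight (c : ℂ) :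
    ((ContinuousLinearMap.toSpanSingleton ℂ c).restrictScalars ℝ : ℂ →L[ℝ] ℂ).det = ‖c‖ ^ 2 := by
  simp [ContinuousLinearMap.det, LinearMap.det_restrictScalars, Algebra.norm_complex_eq, Complex.normSq_eq_norm_sq]

lemma area_le {φ : ℂ → ℂ} {s : Set ℂ} (hs : IsOpen s) (hd : DifferentiableOn ℂ φ s) (hi : InjOn φ s)
    {c : ℂ} {R : ℝ} (hR : 0 ≤ R) (hb : ∀ z ∈ s, ‖φ z - c‖ ≤ R)
    {Q : ℂ → ℝ} (hQ : IntegrableOn Q s) (hle : ∀ z ∈ s, Q z ≤ ‖deriv φ z‖ ^ 2) :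
    ∫ z in s, Q z ≤ π * R ^ 2 := by
  have h1 := lintegral_abs_det_fderiv_eq_addHaar_image volume hs.measurableSet
    (f := φ) (f' := fun z => (ContinuousLinearMap.toSpanSingleton ℂ (deriv φ z)).restrictScalars ℝ)
    (fun x hx => ((hd.differentiableAt (hs.mem_nhds hx)).hasDerivAt.hasFDerivAt.restrictScalars ℝ).hasFDerivWithinAt) hi
  simp only [det_smulRight, abs_pow, abs_norm] at h1
  have h2 : volume (φ '' s) ≤ ENNReal.ofReal (π * R ^ 2) := by
    calc volume (φ '' s) ≤ volume (closedBall c R) := by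
          apply measure_mono; rintro _ ⟨z, hz, rfl⟩
          rw [mem_closedBall_iff_norm]; exact hb z hz
      _ = _ := by
        rw [Complex.volume_closedBall, mul_comm π, ENNReal.ofReal_mul (by positivity),
          ENNReal.ofReal_pow hR]
        congr 1
        rw [← NNReal.coe_real_pi, ENNReal.ofReal_coe_nnreal]
  have h3 : ENNReal.ofReal (∫ z in s, Q z) ≤ ENNReal.ofReal (π * R ^ 2) := by
    calc ENNReal.ofReal (∫ z in s, Q z) ≤ ENNReal.ofReal (∫ z in s, max (Q z) 0) := by
          apply ENNReal.ofReal_le_ofReal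
          exact integral_mono hQ hQ.pos_part (fun z => le_max_left _ _)
      _ = ∫⁻ z in s, ENNReal.ofReal (max (Q z) 0) := by
          rw [ofReal_integral_eq_lintegral_ofReal hQ.pos_part]
          exact ae_of_all _ fun z => le_max_right _ _
      _ ≤ ∫⁻ z in s, ENNReal.ofReal (‖deriv φ z‖ ^ 2) := by
          apply setLIntegral_mono' hs.measurableSet
          intro z hz
          exact ENNReal.ofReal_le_ofReal (max_le (hle z hz) (by positivity))
      _ ≤ _ := h1 ▸ h2
  exact (ENNReal.ofReal_le_ofReal_iff (by positivity)).1 h3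

set_option maxHeartbeats 1000000 in
lemma laurent_bound {m : ℂ → ℂ} {b0 : ℂ} (hm : DifferentiableOn ℂ m (ball 0 1))
    (hi : InjOn (fun z => 1 / z + b0 + z * m z) (ball 0 1 \ {0})) : ‖m 0‖ ≤ 12 := by
  set b := m 0 with hb
  have hman : ∀ z ∈ ball (0:ℂ) 1, AnalyticAt ℂ m z := fun z hz =>
    hm.analyticAt (Metric.isOpen_ball.mem_nhds hz)
  have h0 : (0:ℂ) ∈ ball (0:ℂ) 1 := by simp
  set n2 : ℂ → ℂ := fun z => z ^ 2 * m z with hn2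
  have hn2d : ∀ z ∈ ball (0:ℂ) 1, AnalyticAt ℂ n2 z := fun z hz =>
    (analyticAt_id.pow 2).mul (hman z hz)
  have hn20 : deriv n2 0 = 0 := by
    have := ((hasDerivAt_pow 2 (0:ℂ)).mul (hman 0 h0).differentiableAt.hasDerivAt)
    have h : deriv n2 0 = _ := this.deriv
    rw [h]; simp
  set n : ℂ → ℂ := fun z => m z + z * deriv m z with hn
  have hnan : ∀ z ∈ ball (0:ℂ) 1, AnalyticAt ℂ n z := fun z hz =>
    (hman z hz).add (analyticAt_id.mul (hman z hz).deriv)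
  have hn0 : n 0 = b := by simp [hn, hb]
  have ev : ∀ᶠ z in 𝓝 (0:ℂ), ‖m z‖ < ‖b‖ + 1 ∧ ‖deriv n2 z‖ < 1 := by
    refine Filter.Eventually.and ?_ ?_
    · exact (hman 0 h0).continuousAt.norm.eventually_lt continuousAt_const (by simp [hb])
    · exact (hn2d 0 h0).deriv.continuousAt.norm.eventually_lt continuousAt_const (by simp [hn20])
  obtain ⟨r1, hr1, hball⟩ := Metric.eventually_nhds_iff_ball.1 ev
  set r := min (r1 / 2) (1 / 10) with hr
  have hr0 : 0 < r := by positivity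
  have hr10 : r ≤ 1 / 10 := min_le_right _ _
  have hrr : r < r1 := (min_le_left _ _).trans_lt (by linarith)
  have hin : ∀ z : ℂ, ‖z‖ ≤ r → ‖m z‖ < ‖b‖ + 1 ∧ ‖deriv n2 z‖ < 1 := fun z hz =>
    hball z (by rw [mem_ball_zero_iff]; linarith)
  set φ : ℂ → ℂ := fun z => 1 / z + b0 + z * m z with hφ
  set Mr := 1 / r + (‖b‖ + 1) * r with hMr
  have hMr0 : 0 < Mr := by positivity
  set Ann : Set ℂ := {z | r < ‖z‖ ∧ ‖z‖ < 1 / 2} with hAnn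
  have hAo : IsOpen Ann := (isOpen_lt continuous_const continuous_norm).inter
      (isOpen_lt continuous_norm continuous_const)
  have hA1 : ∀ z ∈ Ann, z ∈ ball (0:ℂ) 1 \ {0} := by
    rintro z ⟨h1, h2⟩
    refine ⟨by rw [mem_ball_zero_iff]; linarith, ?_⟩
    rintro rfl; rw [norm_zero] at h1; linarith
  have hcont : ∀ z ∈ Ann, ‖φ z - b0‖ ≤ Mr := by
    intro z hz
    by_contra hcon
    push Not at hcon
    set v := φ z - b0 with hv
    have hv0 : v ≠ 0 := by intro h; rw [h, norm_zero] at hcon; linarith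
    have hvpos : 0 < ‖v‖ := norm_pos_iff.2 hv0
    have hiv : 1 / ‖v‖ ≤ r := by
      rw [div_le_iff₀ hvpos]
      have : 1 / r ≤ ‖v‖ := le_trans (by rw [hMr]; have : 0 ≤ (‖b‖ + 1) * r := by positivity
                                         linarith) hcon.le
      rw [div_le_iff₀ hr0] at this; linarith
    set T : ℂ → ℂ := fun z => (1 + n2 z) / v with hT
    have hmaps : MapsTo T (closedBall 0 r) (closedBall 0 r) := by
      intro z hz
      rw [mem_closedBall_zero_iff] at hz ⊢
      rw [hT]; simp only [norm_div]
      rw [div_le_iff₀ hvpos]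
      have e1 : ‖n2 z‖ ≤ r ^ 2 * (‖b‖ + 1) := by
        simp only [hn2, norm_mul, norm_pow]
        have := (hin z hz).1
        gcongr
      have e2 : ‖1 + n2 z‖ ≤ 1 + r ^ 2 * (‖b‖ + 1) := (norm_add_le _ _).trans (by simp; linarith)
      have e3 : r * Mr = 1 + r ^ 2 * (‖b‖ + 1) := by rw [hMr]; field_simp
      nlinarith
    have hlip : LipschitzOnWith (1/2) T (closedBall 0 r) := by
      apply Convex.lipschitzOnWith_of_nnnorm_deriv_le (𝕜 := ℂ) _ _ (convex_closedBall _ _)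
      · intro z hz
        rw [mem_closedBall_zero_iff] at hz
        have : AnalyticAt ℂ T z := (analyticAt_const.add (hn2d z (by rw [mem_ball_zero_iff]; linarith))).div
          analyticAt_const hv0
        exact this.differentiableAt
      · intro z hz
        rw [mem_closedBall_zero_iff] at hz
        have hz1 : z ∈ ball (0:ℂ) 1 := by rw [mem_ball_zero_iff]; linarith
        have : HasDerivAt T (deriv n2 z / v) z := by
          have := ((hn2d z hz1).differentiableAt.hasDerivAt.const_add 1).div_const v
          exact this
        rw [this.deriv, ← NNReal.coe_le_coe, coe_nnnorm, norm_div]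
        have := (hin z hz).2
        calc ‖deriv n2 z‖ / ‖v‖ ≤ 1 / ‖v‖ := by gcongr
          _ ≤ r := hiv
          _ ≤ _ := by push_cast; linarith
    have hcw : ContractingWith (1/2) (hmaps.restrict T _ _) :=
      ⟨by rw [← NNReal.coe_lt_coe]; push_cast; norm_num, hlip.mapsToRestrict hmaps⟩
    obtain ⟨z', hz', hfix, -⟩ := ContractingWith.exists_fixedPoint' (x := (0:ℂ))
      Metric.isClosed_closedBall.isComplete hmaps hcw (by simpa using hr0.le) (edist_ne_top _ _)
    have hfix' : (1 + n2 z') / v = z' := hfix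
    rw [div_eq_iff hv0] at hfix'
    have hz0 : z' ≠ 0 := by rintro rfl; simp [hn2] at hfix'
    rw [mem_closedBall_zero_iff] at hz'
    have : φ z' = φ z := by
      have e : v = 1 / z' + z' * m z' := by
        rw [hn2] at hfix'; simp only at hfix'; field_simp; linear_combination -hfix'
      have : φ z = b0 + v := by rw [hv]; ring
      rw [this, e, hφ]; ring
    have := hi ⟨by rw [mem_ball_zero_iff]; linarith, hz0⟩ (hA1 z hz) this
    rw [this] at hz'; exact absurd hz.1 (by linarith)
  set w : ℂ → ℂ := fun z => 2 * (starRingEnd ℂ b) * (n z - b) with hw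
  set Q : ℂ → ℝ := fun z => 1 / ‖z‖ ^ 4 + ‖b‖ ^ 2 + (-(2 * z ^ 2 * n z / ‖z‖ ^ 4) + w z).re with hQ
  have hder : ∀ z ∈ Ann, HasDerivAt φ (-1 / z ^ 2 + n z) z := by
    intro z hz
    have hz1 := hA1 z hz
    have hz0 : z ≠ 0 := hz1.2
    have h1 := ((hasDerivAt_inv hz0).add_const b0).add
      ((hasDerivAt_id z).mul (hman z hz1.1).differentiableAt.hasDerivAt)
    convert! h1 using 1
    · ext z; simp [hφ]
    · simp [hn]; ring
  have hle : ∀ z ∈ Ann, Q z ≤ ‖deriv φ z‖ ^ 2 := by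
    intro z hz
    have hz0 : z ≠ 0 := (hA1 z hz).2
    rw [(hder z hz).deriv]
    have hnz : ‖z‖ ≠ 0 := norm_ne_zero_iff.2 hz0
    set x := n z with hx
    have e1 : ‖-1 / z ^ 2 + x‖ ^ 2 = 1 / ‖z‖ ^ 4 + ‖x‖ ^ 2 + (-(2 * z ^ 2 * x / ‖z‖ ^ 4)).re := by
      have : -1 / z ^ 2 + x = (-1 + z ^ 2 * x) / z ^ 2 := by field_simp
      rw [this, norm_div, div_pow, ← Complex.normSq_eq_norm_sq, norm_pow]
      have h2 : Complex.normSq (-1 + z ^ 2 * x) = 1 + ‖z‖ ^ 4 * ‖x‖ ^ 2 - 2 * (z ^ 2 * x).re := by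
        rw [show ‖z‖ ^ 4 * ‖x‖ ^ 2 = Complex.normSq (z ^ 2 * x) by
          rw [Complex.normSq_eq_norm_sq, norm_mul, norm_pow]; ring, Complex.normSq_apply, Complex.normSq_apply]
        simp only [Complex.add_re, Complex.add_im, Complex.neg_re, Complex.neg_im, Complex.one_re, Complex.one_im]
        ring
      have h3 : (-(2 * z ^ 2 * x / ‖z‖ ^ 4)).re = - (2 * (z ^ 2 * x).re / ‖z‖ ^ 4) := by
        rw [Complex.neg_re, mul_assoc]
        congr 1
        rw [show ((‖z‖:ℂ)) ^ 4 = ((‖z‖ ^ 4 : ℝ) : ℂ) by push_cast; rfl, Complex.div_ofReal_re]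
        congr 1
        simp only [Complex.mul_re]; norm_num
      rw [h2, h3]; field_simp; ring
    have e2 : ‖b‖ ^ 2 + (2 * (starRingEnd ℂ b) * (x - b)).re ≤ ‖x‖ ^ 2 := by
      have := Complex.normSq_nonneg (x - b)
      rw [Complex.normSq_apply] at this
      rw [← Complex.normSq_eq_norm_sq, ← Complex.normSq_eq_norm_sq, Complex.normSq_apply, Complex.normSq_apply]
      simp only [Complex.mul_re, Complex.mul_im, Complex.conj_re, Complex.conj_im, Complex.sub_re, Complex.sub_im,
        Complex.re_ofNat, Complex.im_ofNat] at this ⊢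
      nlinarith
    rw [e1]; simp only [hQ, Complex.add_re, hw, ← hx] at e2 ⊢
    linarith
  have hnc : ContinuousOn n (ball 0 1) := fun z hz => (hnan z hz).continuousAt.continuousWithinAt
  have hQc : ContinuousOn Q {z | r ≤ ‖z‖ ∧ ‖z‖ ≤ 1 / 2} := by
    have h1 : ContinuousOn n {z | r ≤ ‖z‖ ∧ ‖z‖ ≤ 1 / 2} := hnc.mono (by
      rintro z ⟨-, h⟩; rw [mem_ball_zero_iff]; linarith)
    have h2 : ∀ z ∈ {z : ℂ | r ≤ ‖z‖ ∧ ‖z‖ ≤ 1 / 2}, ‖z‖ ^ 4 ≠ 0 := by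
      rintro z ⟨h, -⟩; have : 0 < ‖z‖ := by linarith
      positivity
    have h3 : ContinuousOn (fun z : ℂ => (‖z‖:ℂ) ^ 4) {z | r ≤ ‖z‖ ∧ ‖z‖ ≤ 1 / 2} := by fun_prop
    simp only [hQ, hw]
    refine ((continuousOn_const.div (by fun_prop) h2).add continuousOn_const).add ?_
    apply Complex.continuous_re.comp_continuousOn
    refine ContinuousOn.add (ContinuousOn.neg (ContinuousOn.div ?_ h3 ?_)) ?_
    · exact ContinuousOn.mul (by fun_prop) h1
    · intro z hz; exact_mod_cast h2 z hz
    · exact continuousOn_const.mul (h1.sub continuousOn_const)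
  have hq : ∀ s ∈ Ioo r (1/2), ∫ θ in (-π)..Real.pi, Q (circleMap 0 s θ)
      = 2 * π * (1 / s ^ 4 + ‖b‖ ^ 2) := by
    intro s hs
    have hs0 : 0 < s := hr0.trans hs.1
    set H : ℂ → ℂ := fun z => (1 / s ^ 4 + ‖b‖ ^ 2 : ℝ) + (-(2 * z ^ 2 * n z / s ^ 4) + w z) with hH
    have hHan : ∀ z ∈ ball (0:ℂ) 1, AnalyticAt ℂ H z := by
      intro z hz
      refine analyticAt_const.add (AnalyticAt.add (AnalyticAt.neg (AnalyticAt.div ?_ analyticAt_const ?_)) ?_)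
      · exact (analyticAt_const.mul (analyticAt_id.pow 2)).mul (hnan z hz)
      · exact pow_ne_zero _ (by exact_mod_cast hs0.ne')
      · exact analyticAt_const.mul ((hnan z hz).sub analyticAt_const)
    have e1 : ∀ θ, Q (circleMap 0 s θ) = (H (circleMap 0 s θ)).re := by
      intro θ
      simp only [hQ, hH, norm_circleMap_zero, abs_of_pos hs0, Complex.add_re, Complex.ofReal_re]
    have hper : Function.Periodic (fun θ => Q (circleMap 0 s θ)) (2 * π) := fun θ => by
      show Q _ = Q _; rw [periodic_circleMap 0 s θ]
    have e2 := hper.intervalIntegral_add_eq (-π) 0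
    have e3 : (-π) + 2 * π = π := by ring
    rw [e3, zero_add] at e2
    rw [e2]
    have havg := InnerProductSpace.HarmonicOnNhd.circleAverage_eq (c := (0:ℂ)) (R := s) (f := fun z => (H z).re)
      (fun z hz => (hHan z (by
        rw [abs_of_pos hs0, mem_closedBall_zero_iff] at hz; rw [mem_ball_zero_iff]; linarith [hs.2])).harmonicAt_re)
    rw [Real.circleAverage_def, smul_eq_mul] at havg
    simp_rw [← e1] at havg
    have h00 : (H 0).re = 1 / s ^ 4 + ‖b‖ ^ 2 := by
      simp only [hH, hw, hn0, Complex.add_re, Complex.ofReal_re]; simp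
    rw [h00] at havg
    rw [← havg]; field_simp
  have hint : IntegrableOn Q Ann := by
    have hc : IsCompact {z : ℂ | r ≤ ‖z‖ ∧ ‖z‖ ≤ 1 / 2} := by
      apply (isCompact_closedBall (0:ℂ) (1/2)).of_isClosed_subset
      · exact (isClosed_le continuous_const continuous_norm).inter (isClosed_le continuous_norm continuous_const)
      · rintro z ⟨-, h⟩; simpa using h
    exact (hQc.integrableOn_compact hc).mono_set (fun z hz => ⟨hz.1.le, hz.2.le⟩)
  have hfin := area_le hAo (fun z hz => (hder z hz).differentiableAt.differentiableWithinAt)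
    (hi.mono hA1) hMr0.le hcont hint hle
  rw [polar_ann hr0 (by linarith) hQc hq] at hfin
  have hI : ∫ s in r..(1/2:ℝ), s * (2 * π * (1 / s ^ 4 + ‖b‖ ^ 2))
      = π * (1 / r ^ 2 - 4) + π * ‖b‖ ^ 2 * (1 / 4 - r ^ 2) := by
    have hpos : ∀ s ∈ uIcc r (1/2:ℝ), s ≠ 0 := by
      intro s hs; rw [uIcc_of_le (by linarith)] at hs; linarith [hs.1]
    rw [intervalIntegral.integral_eq_sub_of_hasDerivAt
      (f := fun s => π * (- (1 / s ^ 2)) + π * ‖b‖ ^ 2 * s ^ 2)]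
    · ring
    · intro s hs
      have hs0 := hpos s hs
      have h1 := ((((hasDerivAt_pow 2 s).inv (pow_ne_zero 2 hs0)).neg).const_mul π).add
        ((hasDerivAt_pow 2 s).const_mul (π * ‖b‖ ^ 2))
      convert! h1 using 1
      · ext s; simp
      · field_simp; ring
    · apply ContinuousOn.intervalIntegrable
      apply continuousOn_id.mul (continuousOn_const.mul (ContinuousOn.add (ContinuousOn.div continuousOn_const (by fun_prop) ?_) continuousOn_const))
      intro s hs; exact pow_ne_zero _ (hpos s hs)
  rw [hI] at hfin
  have hpi := Real.pi_pos
  have h5 : (1 / r ^ 2 - 4) + ‖b‖ ^ 2 * (1 / 4 - r ^ 2) ≤ Mr ^ 2 := by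
    have : π * ((1 / r ^ 2 - 4) + ‖b‖ ^ 2 * (1 / 4 - r ^ 2)) ≤ π * Mr ^ 2 := by linarith
    exact le_of_mul_le_mul_left this hpi
  have h6 : Mr ^ 2 = 1 / r ^ 2 + 2 * (‖b‖ + 1) + (‖b‖ + 1) ^ 2 * r ^ 2 := by
    rw [hMr]; field_simp; ring
  rw [h6] at h5
  have hr2 : r ^ 2 ≤ 1 / 100 := by nlinarith
  have hbn := norm_nonneg b
  by_contra hcon
  push Not at hcon
  nlinarith [mul_nonneg (sq_nonneg (‖b‖+1)) (sub_nonneg.2 hr2), mul_nonneg (sq_nonneg (‖b‖)) (sub_nonneg.2 hr2)]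
end

section

lemma deriv_aff (G : ℂ → ℂ) (α β c r : ℂ) :
    deriv (fun z => α * G (c + r * z) + β) = fun z => (α * r) * deriv G (c + r * z) := by
  ext z
  rw [deriv_add_const, deriv_const_mul_field]
  have h1 := deriv_comp_mul_left r (fun w => G (c + w)) z
  simp only [smul_eq_mul] at h1
  rw [h1, deriv_comp_const_add]; ring

lemma schw_affine (G : ℂ → ℂ) {α β c r : ℂ} (hα : α ≠ 0) (hr : r ≠ 0) (z : ℂ) :
    schwarzian (fun z => α * G (c + r * z) + β) z = r ^ 2 * schwarzian G (c + r * z) := by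
  have h := fun (H : ℂ → ℂ) (a : ℂ) => deriv_aff H a 0 c r
  simp only [add_zero] at h
  unfold schwarzian
  rw [deriv_aff, h, h]
  by_cases h0 : deriv G (c + r * z) = 0
  · simp [h0]
  field_simp

lemma schw_congr {f g : ℂ → ℂ} {z : ℂ} (h : f =ᶠ[𝓝 z] g) : schwarzian f z = schwarzian g z := by
  unfold schwarzian
  rw [h.deriv_eq, h.deriv.deriv_eq, h.deriv.deriv.deriv_eq]

lemma schw_comp {F g : ℂ → ℂ} {z : ℂ} (hg : AnalyticAt ℂ g z) (hF : AnalyticAt ℂ F (g z))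
    (h1 : deriv F (g z) ≠ 0) (h2 : deriv g z ≠ 0) :
    schwarzian (fun z => F (g z)) z = schwarzian F (g z) * deriv g z ^ 2 + schwarzian g z := by
  have evF : ∀ᶠ w in 𝓝 z, AnalyticAt ℂ F (g w) := hg.continuousAt.eventually hF.eventually_analyticAt
  have evg := hg.eventually_analyticAt
  have d1 : deriv (fun z => F (g z)) =ᶠ[𝓝 z] fun w => deriv F (g w) * deriv g w := by
    filter_upwards [evF, evg] with w hw hw'
    exact (hw.differentiableAt.hasDerivAt.comp w hw'.differentiableAt.hasDerivAt).deriv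
  have d2 : deriv (deriv (fun z => F (g z))) =ᶠ[𝓝 z] fun w =>
      deriv (deriv F) (g w) * deriv g w * deriv g w + deriv F (g w) * deriv (deriv g) w := by
    filter_upwards [d1.deriv, evF, evg] with w hw0 hw hw'
    rw [hw0]
    exact ((hw.deriv.differentiableAt.hasDerivAt.comp w hw'.differentiableAt.hasDerivAt).mul
      hw'.deriv.differentiableAt.hasDerivAt).deriv
  have d3 : deriv (deriv (deriv (fun z => F (g z)))) z =
      (deriv (deriv (deriv F)) (g z) * deriv g z * deriv g z + deriv (deriv F) (g z) * deriv (deriv g) z) * deriv g z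
      + deriv (deriv F) (g z) * deriv g z * deriv (deriv g) z
      + (deriv (deriv F) (g z) * deriv g z * deriv (deriv g) z + deriv F (g z) * deriv (deriv (deriv g)) z) := by
    rw [d2.deriv_eq]
    have e1 := hg.differentiableAt.hasDerivAt
    have e2 := hg.deriv.differentiableAt.hasDerivAt
    have e3 := hg.deriv.deriv.differentiableAt.hasDerivAt
    exact ((((hF.deriv.deriv.differentiableAt.hasDerivAt.comp z e1).mul e2).mul e2).add
      ((hF.deriv.differentiableAt.hasDerivAt.comp z e1).mul e3)).deriv
  unfold schwarzian
  rw [d3, d2.eq_of_nhds, d1.eq_of_nhds]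
  field_simp
  ring

lemma schw_div {K : ℂ → ℂ} (hK : AnalyticAt ℂ K 0) (h1 : K 0 = 1) :
    schwarzian (fun z => z / K z) 0 = - 3 * deriv (deriv K) 0 := by
  have ev : ∀ᶠ z in 𝓝 (0:ℂ), AnalyticAt ℂ K z ∧ K z ≠ 0 :=
    hK.eventually_analyticAt.and (hK.continuousAt.eventually_ne (by rw [h1]; exact one_ne_zero))
  have d1 : deriv (fun z => z / K z) =ᶠ[𝓝 0] fun z => (K z - z * deriv K z) / K z ^ 2 := by
    filter_upwards [ev] with z hz
    have := ((hasDerivAt_id z).div hz.1.differentiableAt.hasDerivAt hz.2).deriv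
    exact Eq.trans this (by simp)
  have d2 : deriv (deriv (fun z => z / K z)) =ᶠ[𝓝 0] fun z =>
      (-z * deriv (deriv K) z * K z - 2 * (K z - z * deriv K z) * deriv K z) / K z ^ 3 := by
    filter_upwards [ev, d1.deriv] with z hz hz1
    rw [hz1]
    have e1 := hz.1.differentiableAt.hasDerivAt
    have e2 := hz.1.deriv.differentiableAt.hasDerivAt
    have := ((e1.sub ((hasDerivAt_id z).mul e2)).div (e1.pow 2) (pow_ne_zero 2 hz.2)).deriv
    refine Eq.trans this ?_
    have h := hz.2
    simp
    field_simp
  have d3 : deriv (deriv (deriv (fun z => z / K z))) 0 = -3 * deriv (deriv K) 0 + 6 * deriv K 0 ^ 2 := by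
    rw [d2.deriv_eq]
    have e1 := hK.differentiableAt.hasDerivAt
    have e2 := hK.deriv.differentiableAt.hasDerivAt
    have e3 := hK.deriv.deriv.differentiableAt.hasDerivAt
    have hz := (hasDerivAt_id (0:ℂ))
    have := (((((hz.neg).mul e3).mul e1).sub ((((e1.sub (hz.mul e2))).const_mul 2).mul e2)).div (e1.pow 3)
      (pow_ne_zero 3 (by rw [h1]; exact one_ne_zero))).deriv
    refine Eq.trans this ?_
    simp [h1]; ring
  unfold schwarzian
  rw [d3, d2.eq_of_nhds, d1.eq_of_nhds]
  simp [h1]; ring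

lemma schw_bound0 {G : ℂ → ℂ} (hd : DifferentiableOn ℂ G (ball 0 1)) (hi : InjOn G (ball 0 1))
    (h0 : G 0 = 0) (h1 : deriv G 0 = 1) : ‖schwarzian G 0‖ ≤ 72 := by
  have hB : ball (0:ℂ) 1 ∈ 𝓝 0 := Metric.ball_mem_nhds _ one_pos
  have hm0 : (0:ℂ) ∈ ball (0:ℂ) 1 := by simp
  set p := dslope G 0 with hp
  have hpd : DifferentiableOn ℂ p (ball 0 1) := (Complex.differentiableOn_dslope hB).2 hd
  have hp0 : p 0 = 1 := by rw [hp, dslope_same, h1]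
  have hGp : ∀ z, G z = z * p z := by
    intro z
    have := sub_smul_dslope G 0 z
    simpa [h0] using this.symm
  have hpne : ∀ z ∈ ball (0:ℂ) 1, p z ≠ 0 := by
    intro z hz h
    have : G z = G 0 := by rw [hGp z, h, h0, mul_zero]
    have := hi hz hm0 this
    rw [this, hp0] at h; exact one_ne_zero h
  set K : ℂ → ℂ := fun z => (p z)⁻¹ with hK
  have hKd : DifferentiableOn ℂ K (ball 0 1) := hpd.inv hpne
  have hK0 : K 0 = 1 := by simp [hK, hp0]
  set k1 := dslope K 0 with hk1
  have hk1d : DifferentiableOn ℂ k1 (ball 0 1) := (Complex.differentiableOn_dslope hB).2 hKd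
  set m := dslope k1 0 with hm
  have hmd : DifferentiableOn ℂ m (ball 0 1) := (Complex.differentiableOn_dslope hB).2 hk1d
  have e1 : ∀ z, K z = 1 + z * k1 z := by
    intro z
    have := sub_smul_dslope K 0 z
    rw [sub_zero, smul_eq_mul, hK0] at this
    rw [this]; ring
  have e2 : ∀ z, k1 z = k1 0 + z * m z := by
    intro z
    have := sub_smul_dslope k1 0 z
    rw [sub_zero, smul_eq_mul] at this
    rw [this]; ring
  have hb := laurent_bound (b0 := k1 0) hmd (by
    rintro x ⟨hx, hx0⟩ y ⟨hy, hy0⟩ hxy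
    have hx0 : x ≠ 0 := hx0
    have hy0 : y ≠ 0 := hy0
    have aux : ∀ x, x ≠ 0 → 1 / x + k1 0 + x * m x = (G x)⁻¹ := by
      intro x hx
      rw [hGp, mul_inv, show (p x)⁻¹ = K x from rfl, e1, e2 x]; field_simp; ring
    simp only at hxy
    rw [aux x hx0, aux y hy0] at hxy
    exact hi hx hy (inv_injective hxy))
  have hKan : AnalyticAt ℂ K 0 := hKd.analyticAt hB
  have hGK : G = fun z => z / K z := by
    ext z; rw [hGp z, hK]; simp [div_eq_mul_inv]
  rw [hGK, schw_div hKan hK0]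
  have hk1an : AnalyticAt ℂ k1 0 := hk1d.analyticAt hB
  have hman : AnalyticAt ℂ m 0 := hmd.analyticAt hB
  have hdK : deriv (deriv K) 0 = 2 * m 0 := by
    have hKe : K = fun z => 1 + z * k1 z := funext e1
    have d1 : deriv K =ᶠ[𝓝 0] fun z => k1 z + z * deriv k1 z := by
      filter_upwards [hk1an.eventually_analyticAt] with z hz
      rw [hKe]
      have := (((hasDerivAt_id z).mul hz.differentiableAt.hasDerivAt).const_add 1).deriv
      exact Eq.trans this (by simp)
    rw [d1.deriv_eq]
    have := (hk1an.differentiableAt.hasDerivAt.add ((hasDerivAt_id (0:ℂ)).mul hk1an.deriv.differentiableAt.hasDerivAt)).deriv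
    refine Eq.trans this ?_
    simp [hm, dslope_same]; ring
  rw [hdK, norm_mul, norm_mul]
  norm_num
  linarith

lemma schw_bound {G : ℂ → ℂ} {c : ℂ} {r : ℝ} (hr : 0 < r) (hd : DifferentiableOn ℂ G (ball c r))
    (hi : InjOn G (ball c r)) : ‖schwarzian G c‖ ≤ 72 / r ^ 2 := by
  by_cases h0 : deriv G c = 0
  · simp [schwarzian, h0]; positivity
  have hr0 : (r:ℂ) ≠ 0 := by exact_mod_cast hr.ne'
  set α : ℂ := (r * deriv G c)⁻¹ with hα
  have hα0 : α ≠ 0 := inv_ne_zero (mul_ne_zero hr0 h0)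
  have hmaps : ∀ z ∈ ball (0:ℂ) 1, c + r * z ∈ ball c r := by
    intro z hz
    rw [mem_ball_zero_iff] at hz
    rw [mem_ball_iff_norm, add_sub_cancel_left, norm_mul, Complex.norm_real, Real.norm_of_nonneg hr.le]
    nlinarith
  have h := schw_bound0 (G := fun z => α * G (c + r * z) + (-(α * G c))) ?_ ?_ ?_ ?_
  · rw [schw_affine G hα0 hr0] at h
    simp only [mul_zero, add_zero, norm_mul, norm_pow, Complex.norm_real, Real.norm_of_nonneg hr.le] at h
    rw [le_div_iff₀ (by positivity)]; linarith
  · refine DifferentiableOn.add_const _ (DifferentiableOn.const_mul ?_ _)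
    exact hd.comp (by fun_prop) hmaps
  · intro x hx y hy hxy
    have h1 : α * G (c + r * x) = α * G (c + r * y) := add_right_cancel hxy
    have h2 := hi (hmaps x hx) (hmaps y hy) (mul_left_cancel₀ hα0 h1)
    exact mul_left_cancel₀ hr0 (add_left_cancel h2)
  · simp
  · rw [deriv_aff]; simp only [mul_zero, add_zero, hα]; field_simp
end

section

lemma path_lift {X : Type*} [TopologicalSpace X] [T2Space X] {p : X → ℂ}
    (hp : IsLocalHomeomorph p) {γ : ℝ → ℂ} (hγ : Continuous γ) {x0 : X} (h0 : p x0 = γ 0)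
    (ext : ∀ T, 0 < T → T ≤ 1 → ∀ z : ℝ → X, ContinuousOn z (Ico 0 T) → z 0 = x0 →
      (∀ t ∈ Ico 0 T, p (z t) = γ t) → ∃ l, Tendsto z (𝓝[<] T) (𝓝 l)) :
    ∃ z : ℝ → X, ContinuousOn z (Icc 0 1) ∧ z 0 = x0 ∧ ∀ t ∈ Icc (0:ℝ) 1, p (z t) = γ t := by
  set Good : ℝ → Prop := fun T => ∃ z : ℝ → X, ContinuousOn z (Icc 0 T) ∧ z 0 = x0 ∧
    ∀ t ∈ Icc (0:ℝ) T, p (z t) = γ t with hG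
  have step : ∀ T, 0 ≤ T → Good T → ∃ T' > T, T' ≤ T + 1 ∧ ∀ s, T ≤ s → s ≤ T' → Good s := by
    rintro T hT ⟨z, hz, hz0, hzl⟩
    obtain ⟨e, hes, he⟩ := hp (z T)
    have hTT : γ T = e (z T) := by rw [← he]; exact (hzl T ⟨hT, le_rfl⟩).symm
    have : ∀ᶠ t in 𝓝 T, γ t ∈ e.target := by
      apply hγ.continuousAt.eventually
      rw [hTT]; exact e.open_target.mem_nhds (e.map_source hes)
    obtain ⟨ε, hε, hb⟩ := Metric.eventually_nhds_iff.1 this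
    refine ⟨T + min (ε/2) 1, by have := lt_min (half_pos hε) one_pos; linarith,
      by have := min_le_right (ε/2) 1; linarith, fun s hs1 hs2 => ?_⟩
    have hin : ∀ t ∈ Icc T s, γ t ∈ e.target := fun t ht => hb (by
      rw [Real.dist_eq, abs_lt]; have := min_le_left (ε/2) 1
      constructor <;> linarith [ht.1, ht.2])
    refine ⟨fun t => if t ≤ T then z t else e.symm (γ t), ?_, by simp [hT, hz0], ?_⟩
    · rw [← Icc_union_Icc_eq_Icc hT hs1]
      refine ContinuousOn.union_of_isClosed (hz.congr fun t ht => if_pos ht.2) ?_ isClosed_Icc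
        isClosed_Icc
      refine (e.continuousOn_symm.comp hγ.continuousOn hin).congr fun t ht => ?_
      by_cases h : t ≤ T
      · have : t = T := le_antisymm h ht.1
        subst this
        simp [hTT, e.left_inv hes]
      · simp [h]
    · intro t ht
      by_cases h : t ≤ T
      · simpa [h] using hzl t ⟨ht.1, h⟩
      · simp only [h, if_false]
        rw [he]; exact e.right_inv (hin t ⟨by linarith, ht.2⟩)
  have good0 : Good 0 := ⟨fun _ => x0, continuousOn_const, rfl, fun t ht => by
    have : t = 0 := le_antisymm ht.2 ht.1
    rw [this, h0]⟩
  have mono : ∀ s t, 0 ≤ s → s ≤ t → Good t → Good s := by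
    rintro s t _ hst ⟨z, h1, h2, h3⟩
    exact ⟨z, h1.mono (Icc_subset_Icc_right hst), h2, fun r hr => h3 r ⟨hr.1, hr.2.trans hst⟩⟩
  set A : Set ℝ := {T | 0 ≤ T ∧ T ≤ 1 ∧ Good T}
  have hA0 : (0:ℝ) ∈ A := ⟨le_rfl, zero_le_one, good0⟩
  have hAb : BddAbove A := ⟨1, fun T hT => hT.2.1⟩
  set T := sSup A
  have hT1 : T ≤ 1 := csSup_le ⟨0, hA0⟩ fun t ht => ht.2.1
  have hTpos : 0 < T := by
    obtain ⟨T', h1, h2, h3⟩ := step 0 le_rfl good0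
    have : min T' 1 ∈ A := ⟨by positivity, min_le_right _ _, h3 _ (by positivity) (min_le_left _ _)⟩
    exact lt_of_lt_of_le (by positivity) (le_csSup hAb this)
  have hlt : ∀ t, 0 ≤ t → t < T → Good t := by
    intro t h0 ht
    obtain ⟨s, hs, hts⟩ := exists_lt_of_lt_csSup ⟨0, hA0⟩ ht
    exact mono t s h0 hts.le hs.2.2
  have hch : ∀ t : ℝ, ∃ z : ℝ → X, 0 ≤ t → t < T → ContinuousOn z (Icc 0 t) ∧ z 0 = x0 ∧
    ∀ r ∈ Icc (0:ℝ) t, p (z r) = γ r := by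
    intro t
    by_cases h : 0 ≤ t ∧ t < T
    · obtain ⟨z, hz⟩ := hlt t h.1 h.2
      exact ⟨z, fun _ _ => hz⟩
    · exact ⟨fun _ => x0, fun h1 h2 => (h ⟨h1, h2⟩).elim⟩
  choose z hz using hch
  have uniq : ∀ s t r, 0 ≤ r → r ≤ s → r ≤ t → s < T → t < T → z s r = z t r := by
    intro s t r h0 hs ht hsT htT
    have h1 := hz s (h0.trans hs) hsT
    have h2 := hz t (h0.trans ht) htT
    refine (T2Space.isSeparatedMap p).eqOn_of_comp_eqOn hp.isLocallyInjective
      (isPreconnected_Icc (a := 0) (b := r)) (h1.1.mono (Icc_subset_Icc_right hs))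
      (h2.1.mono (Icc_subset_Icc_right ht)) (fun u hu => ?_) (left_mem_Icc.2 h0)
      (h1.2.1.trans h2.2.1.symm) (right_mem_Icc.2 h0)
    simp only [Function.comp]
    rw [h1.2.2 u ⟨hu.1, hu.2.trans hs⟩, h2.2.2 u ⟨hu.1, hu.2.trans ht⟩]
  set Z : ℝ → X := fun t => z t t
  have hZeq : ∀ s, 0 ≤ s → s < T → EqOn Z (z s) (Icc 0 s) := fun s h0 hs t ht =>
    uniq t s t ht.1 le_rfl ht.2 (lt_of_le_of_lt ht.2 hs) hs
  have hZc : ContinuousOn Z (Ico 0 T) := by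
    intro t ht
    set s := (t + T) / 2
    have hts : t < s := by simp only [s]; linarith [ht.2]
    have hsT : s < T := by simp only [s]; linarith [ht.2]
    have h1 : ContinuousWithinAt Z (Icc 0 s) t :=
      ((hz s (ht.1.trans hts.le) hsT).1.congr (hZeq s (ht.1.trans hts.le) hsT)) t ⟨ht.1, hts.le⟩
    refine h1.mono_of_mem_nhdsWithin ?_
    filter_upwards [self_mem_nhdsWithin, mem_nhdsWithin_of_mem_nhds (Iio_mem_nhds hts)] with u hu hu2
    exact ⟨hu.1, le_of_lt hu2⟩
  have hZ0 : Z 0 = x0 := (hz 0 le_rfl hTpos).2.1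
  have hZl : ∀ t ∈ Ico 0 T, p (Z t) = γ t := fun t ht => (hz t ht.1 ht.2).2.2 t ⟨ht.1, le_rfl⟩
  obtain ⟨l, hl⟩ := ext T hTpos hT1 Z hZc hZ0 hZl
  have hnb : (𝓝[<] T).NeBot := inferInstance
  have hIco : Ico 0 T ∈ 𝓝[<] T := Ico_mem_nhdsLT hTpos
  have hpl : p l = γ T := by
    refine tendsto_nhds_unique (f := γ) (l := 𝓝[<] T) ?_ (hγ.continuousAt.mono_left nhdsWithin_le_nhds)
    refine ((hp.continuous.tendsto l).comp hl).congr' ?_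
    filter_upwards [hIco] with t ht using hZl t ht
  have goodT : Good T := by
    classical
    refine ⟨Function.update Z T l, ?_, by simp [hTpos.ne, hZ0], ?_⟩
    · rw [← Ico_union_right hTpos.le]
      intro t ht
      rcases ht with ht | ht
      · have h1 : ContinuousWithinAt (Function.update Z T l) (Ico 0 T) t :=
          (hZc t ht).congr (fun u hu => Function.update_of_ne hu.2.ne _ _)
            (Function.update_of_ne ht.2.ne _ _)
        refine h1.mono_of_mem_nhdsWithin ?_
        filter_upwards [self_mem_nhdsWithin, mem_nhdsWithin_of_mem_nhds (Iio_mem_nhds ht.2)] with u hu hu2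
        rcases hu with hu | hu
        · exact hu
        · simp at hu; subst hu; simp at hu2
      · simp at ht; subst ht
        rw [Ico_union_right hTpos.le, continuousWithinAt_update_same]
        refine hl.mono_left (nhdsWithin_mono _ ?_)
        intro u hu; exact lt_of_le_of_ne hu.1.2 hu.2
    · intro t ht
      rcases eq_or_lt_of_le ht.2 with h | h
      · subst h; simp [hpl]
      · rw [Function.update_of_ne h.ne]; exact hZl t ⟨ht.1, h⟩
  have : T = 1 := by
    by_contra hne
    have hlt1 : T < 1 := lt_of_le_of_ne hT1 hne
    obtain ⟨T', h1, h2, h3⟩ := step T hTpos.le goodT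
    have h4 : min T' 1 ∈ A := ⟨le_min (by linarith) zero_le_one, min_le_right _ _,
      h3 _ (le_min h1.le hT1) (min_le_left _ _)⟩
    have := le_csSup hAb h4
    have := lt_min h1 hlt1
    linarith
  rw [this] at goodT
  exact goodT

lemma locHomeo {F : ℂ → ℂ} {W : Set ℂ} (hW : IsOpen W) (hF : ∀ z ∈ W, AnalyticAt ℂ F z)
    (hd : ∀ z ∈ W, deriv F z ≠ 0) : IsLocalHomeomorph (fun z : W => F z) := by
  rw [isLocalHomeomorph_iff_isLocalHomeomorphOn_univ]
  have h1 : IsLocalHomeomorphOn F W := by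
    refine IsLocalHomeomorphOn.mk _ _ fun z hz => ?_
    have := (hF z hz).hasStrictDerivAt
    refine ⟨(this.hasStrictFDerivAt_equiv (hd z hz)).toOpenPartialHomeomorph F,
      HasStrictFDerivAt.mem_toOpenPartialHomeomorph_source _, fun w _ => rfl⟩
  have h2 : IsLocalHomeomorph (Subtype.val : W → ℂ) := hW.isOpenEmbedding_subtypeVal.isLocalHomeomorph
  exact h1.comp h2.isLocalHomeomorphOn (fun z _ => z.2)

lemma lift_gen {F e : ℂ → ℂ} {W Ω : Set ℂ} (hW : IsOpen W) (hF : ∀ z ∈ W, AnalyticAt ℂ F z)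
    (hΩ : Convex ℝ Ω) (hΩo : IsOpen Ω) (he : DifferentiableOn ℂ e Ω) {ζ0 z0 : ℂ} (hζ0 : ζ0 ∈ Ω)
    (hz0 : z0 ∈ W) (h0 : F z0 = e ζ0) (hd : ∀ z ∈ W, ∀ ζ ∈ Ω, F z = e ζ → deriv F z ≠ 0)
    (ext : ∀ ζ ∈ Ω, ∀ T, 0 < T → T ≤ 1 → ∀ z : ℝ → ℂ, ContinuousOn z (Ico 0 T) → z 0 = z0 →
      (∀ t ∈ Ico 0 T, z t ∈ W ∧ F (z t) = e (ζ0 + t * (ζ - ζ0))) →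
      ∃ l ∈ W, Tendsto z (𝓝[<] T) (𝓝 l)) :
    ∃ g : ℂ → ℂ, DifferentiableOn ℂ g Ω ∧ g ζ0 = z0 ∧ ∀ ζ ∈ Ω, g ζ ∈ W ∧ F (g ζ) = e ζ := by
  set W' : Set ℂ := {z | z ∈ W ∧ deriv F z ≠ 0}
  have hW'o : IsOpen W' := by
    rw [isOpen_iff_mem_nhds]
    rintro z ⟨hz, hz'⟩
    filter_upwards [hW.mem_nhds hz, (hF z hz).deriv.continuousAt.eventually_ne hz'] with w h1 h2
    exact ⟨h1, h2⟩
  have hp := locHomeo hW'o (fun z hz => hF z hz.1) (fun z hz => hz.2)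
  have hpt : ∀ ζ ∈ Ω, ∀ t ∈ Icc (0:ℝ) 1, ζ0 + t * (ζ - ζ0) ∈ Ω := by
    intro ζ hζ t ht
    have := hΩ.add_smul_sub_mem hζ0 hζ ht
    simpa using this
  have hz0' : z0 ∈ W' := ⟨hz0, hd z0 hz0 ζ0 hζ0 h0⟩
  set f : C(unitInterval × Ω, ℂ) := ⟨fun x => e (ζ0 + (x.1:ℝ) * (x.2 - ζ0)), by
    refine he.continuousOn.comp_continuous (by fun_prop) (fun x => hpt _ x.2.2 _ x.1.2)⟩
  have hlift : ∀ ζ : Ω, ∃ z : ℝ → W', ContinuousOn z (Icc 0 1) ∧ z 0 = ⟨z0, hz0'⟩ ∧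
      ∀ t ∈ Icc (0:ℝ) 1, F (z t) = e (ζ0 + t * (ζ - ζ0)) := by
    intro ζ
    obtain ⟨z, h1, h2, h3⟩ := path_lift hp (γ := fun t => f (projIcc 0 1 zero_le_one t, ζ))
      (by fun_prop) (x0 := ⟨z0, hz0'⟩) (by simp [f, h0]) (by
        intro T hT hT1 z hz hz0e hzl
        have hcl : ∀ t ∈ Ico 0 T, F (z t) = e (ζ0 + t * (ζ - ζ0)) := fun t ht => by
          rw [hzl t ht, projIcc_of_mem _ (⟨ht.1, by linarith [ht.2]⟩ : t ∈ Icc (0:ℝ) 1)]; rfl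
        obtain ⟨l, hl, hlt⟩ := ext ζ ζ.2 T hT hT1 (fun t => (z t : ℂ))
          (continuous_subtype_val.comp_continuousOn hz) (by simp [hz0e])
          (fun t ht => ⟨(z t).2.1, hcl t ht⟩)
        have hTm : ζ0 + (T:ℂ) * (ζ - ζ0) ∈ Ω := hpt ζ ζ.2 T ⟨hT.le, hT1⟩
        have hFl : F l = e (ζ0 + T * (ζ - ζ0)) := by
          refine tendsto_nhds_unique (f := fun t : ℝ => e (ζ0 + t * (ζ - ζ0))) (l := 𝓝[<] T) ?_ ?_
          · refine (((hF l hl).continuousAt.tendsto).comp hlt).congr' ?_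
            filter_upwards [Ico_mem_nhdsLT hT] with t ht using hcl t ht
          · refine Tendsto.mono_left ?_ nhdsWithin_le_nhds
            have h1 : ContinuousAt e (ζ0 + (T:ℂ) * (ζ - ζ0)) :=
              he.continuousOn.continuousAt (hΩo.mem_nhds hTm)
            exact ContinuousAt.comp (f := fun t : ℝ => ζ0 + (t:ℂ) * (ζ - ζ0)) h1 (by fun_prop)
        refine ⟨⟨l, hl, hd l hl _ hTm hFl⟩, ?_⟩
        rw [tendsto_subtype_rng]; exact hlt)
    refine ⟨z, h1, h2, fun t ht => ?_⟩
    have := h3 t ht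
    simpa [projIcc_of_mem _ ht, f] using this
  choose z hz1 hz2 hz3 using hlift
  have hcont := hp.continuous_lift (T2Space.isSeparatedMap _) f (g := fun x => z x.2 x.1)
    (by ext x; exact hz3 x.2 x.1 x.1.2) (by simp [hz2, continuous_const])
    (fun a => continuousOn_iff_continuous_domRestrict.1 (hz1 a))
  classical
  set g : ℂ → ℂ := fun ζ => if h : ζ ∈ Ω then (z ⟨ζ, h⟩ 1 : ℂ) else 0
  have hgW : ∀ ζ ∈ Ω, g ζ ∈ W' ∧ F (g ζ) = e ζ := by
    intro ζ hζ
    simp only [g, hζ, dite_true]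
    refine ⟨(z ⟨ζ, hζ⟩ 1).2, ?_⟩
    rw [hz3 _ 1 (by simp)]; simp
  have hgc : ContinuousOn g Ω := by
    rw [continuousOn_iff_continuous_domRestrict]
    have : (fun ζ : Ω => (z ζ ((1:unitInterval):ℝ) : ℂ)) = Ω.domRestrict g := by
      ext ζ; simp [g]
    rw [← this]
    exact continuous_subtype_val.comp (hcont.comp (f := fun ζ : Ω => ((1:unitInterval), ζ)) (by fun_prop))
  refine ⟨g, ?_, ?_, fun ζ hζ => ⟨(hgW ζ hζ).1.1, (hgW ζ hζ).2⟩⟩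
  · intro ζ hζ
    obtain ⟨⟨h1, h2⟩, h3⟩ := hgW ζ hζ
    have hs := (hF _ h1).hasStrictDerivAt
    set φ := hs.localInverse F (deriv F (g ζ)) (g ζ) h2
    have hφ : HasDerivAt φ (deriv F (g ζ))⁻¹ (F (g ζ)) := (hs.to_localInverse h2).hasDerivAt
    have hli : ∀ᶠ w in 𝓝 (g ζ), φ (F w) = w :=
      (hs.hasStrictFDerivAt_equiv h2).eventually_left_inverse
    have hgcζ := hgc.continuousAt (hΩo.mem_nhds hζ)
    have hev : ∀ᶠ w in 𝓝 ζ, g w = φ (e w) := by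
      filter_upwards [hgcζ.eventually hli, hΩo.mem_nhds hζ] with w h4 h5
      rw [← (hgW w h5).2, h4]
    have : DifferentiableAt ℂ (fun w => φ (e w)) ζ := by
      rw [h3] at hφ
      exact hφ.differentiableAt.comp ζ (he.differentiableAt (hΩo.mem_nhds hζ))
    exact (this.congr_of_eventuallyEq hev).differentiableWithinAt
  · simp only [g, hζ0, dite_true]
    have h := (T2Space.isSeparatedMap (fun z : W' => F z)).constOn_of_comp hp.isLocallyInjective
      (isPreconnected_Icc (a := (0:ℝ)) (b := 1)) (hz1 ⟨ζ0, hζ0⟩)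
      (fun a ha a' ha' => by rw [hz3 _ a ha, hz3 _ a' ha']; simp) (a := 1) (a' := 0) (by simp) (by simp)
    rw [h, hz2]

end

section

structure Cov (F : ℂ → ℂ) (P S : Set ℂ) (M : ℕ) : Prop where
  closed : IsClosed P
  an : ∀ z ∉ P, AnalyticAt ℂ F z
  pole : ∀ p ∈ P, Tendsto (fun z => ‖F z‖) (𝓝[Pᶜ] p) atTop
  crit : ∀ z ∉ P, deriv F z = 0 → F z ∈ S
  asy : ∀ γ : ℝ → ℂ, ∀ w, ContinuousOn γ (Ici 0) → (∀ t, 0 ≤ t → γ t ∉ P) →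
    Tendsto (fun t => ‖γ t‖) atTop atTop → Tendsto (fun t => F (γ t)) atTop (𝓝 w) → w ∈ S
  mult : ∀ z ∉ P, ∃ q : ℕ, 1 ≤ q ∧ q ≤ M ∧ ∃ h : ℂ → ℂ, AnalyticAt ℂ h z ∧ h z ≠ 0 ∧
    ∀ᶠ w in 𝓝 z, F w = F z + (w - z) ^ q * h w

variable {F : ℂ → ℂ} {P S : Set ℂ} {M : ℕ}

lemma Cov.trap (hc : Cov F P S M) {z1 : ℂ} (hz : z1 ∉ P) {s : ℝ} (hs : 0 < s) :
    ∃ s' m : ℝ, 0 < s' ∧ s' < s ∧ 0 < m ∧ ∀ w ∈ sphere z1 s', m ≤ ‖F w - F z1‖ := by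
  obtain ⟨q, hq, -, h, hh, hh0, hF⟩ := hc.mult z1 hz
  obtain ⟨δ, hδ, hb⟩ := Metric.eventually_nhds_iff.1 ((hF.and (hh.continuousAt.eventually_ne hh0)).and
    ((hc.an z1 hz).eventually_analyticAt))
  set s' := min s δ / 2
  have hs' : 0 < s' := by positivity
  have h1 : s' < s := by have := min_le_left s δ; simp only [s']; linarith
  have h2 : s' < δ := by have := min_le_right s δ; simp only [s']; linarith
  have hin : ∀ w ∈ sphere z1 s', dist w z1 < δ := fun w hw => by rw [Metric.mem_sphere.1 hw]; exact h2
  obtain ⟨w0, hw0, hmin⟩ := (isCompact_sphere z1 s').exists_isMinOn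
    (NormedSpace.sphere_nonempty.2 hs'.le) (f := fun w => ‖F w - F z1‖)
    (fun w hw => ((hb (hin w hw)).2.continuousAt.sub continuousAt_const).norm.continuousWithinAt)
  refine ⟨s', ‖F w0 - F z1‖, hs', h1, ?_, fun w hw => isMinOn_iff.1 hmin w hw⟩
  have h3 := (hb (hin w0 hw0)).1
  rw [norm_pos_iff, h3.1, add_sub_cancel_left]
  refine mul_ne_zero (pow_ne_zero _ (sub_ne_zero.2 ?_)) h3.2
  rintro rfl; simp at hw0; linarith

lemma stay_in {α : Type*} [TopologicalSpace α] {I : Set α} (hI : IsPreconnected I) {g : α → ℂ}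
    (hg : ContinuousOn g I) {c : ℂ} {s : ℝ} (hs : ∀ x ∈ I, g x ∉ sphere c s) {x0 : α}
    (hx0 : x0 ∈ I) (h0 : g x0 ∈ ball c s) : ∀ x ∈ I, g x ∈ ball c s := by
  intro x hx
  by_contra hn
  rw [Metric.mem_ball, not_lt] at hn
  rw [Metric.mem_ball] at h0
  obtain ⟨y, hy, hye⟩ := hI.intermediate_value hx0 hx (f := fun x => dist (g x) c)
    ((continuous_id.dist continuous_const).comp_continuousOn hg) ⟨h0.le, hn⟩
  exact hs y hy hye

lemma Cov.dich (hc : Cov F P S M) {α : Type*} [TopologicalSpace α] {ι : Type*} {l : Filter α} [NeBot l]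
    {p : ι → Prop} {s : ι → Set α} (hl : l.HasBasis p s) (hpre : ∀ i, p i → IsPreconnected (s i))
    {V : Set α} (hV : V ∈ l) {g : α → ℂ} (hg : ContinuousOn g V) (hgP : ∀ x ∈ V, g x ∉ P) {w : ℂ}
    (hw : Tendsto (fun x => F (g x)) l (𝓝 w)) :
    Tendsto (fun x => ‖g x‖) l atTop ∨ ∃ z1 ∉ P, F z1 = w ∧ Tendsto g l (𝓝 z1) := by
  by_cases hT : Tendsto (fun x => ‖g x‖) l atTop
  · exact Or.inl hT
  right
  rw [tendsto_atTop] at hT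
  push Not at hT
  obtain ⟨R, hR⟩ := hT
  have hR' : ∃ᶠ x in l, g x ∈ closedBall (0:ℂ) R := by
    refine Frequently.mono hR fun x hx => ?_
    simpa using le_of_lt hx
  obtain ⟨z1, -, hz1⟩ := (isCompact_closedBall (0:ℂ) R).exists_mapClusterPt_of_frequently hR'
  have hfreq : ∀ U ∈ 𝓝 z1, ∃ᶠ x in l, g x ∈ U := fun U hU => mapClusterPt_iff_frequently.1 hz1 U hU
  have hzP : z1 ∉ P := by
    intro hp
    have h1 := hc.pole z1 hp
    have h2 := h1.eventually (eventually_gt_atTop (‖w‖ + 1))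
    rw [eventually_nhdsWithin_iff] at h2
    have h3 : ∀ᶠ x in l, ‖F (g x)‖ < ‖w‖ + 1 := hw.norm.eventually (gt_mem_nhds (by linarith))
    obtain ⟨x, hx1, hx2, hx3⟩ := ((hfreq _ h2).and_eventually (h3.and hV)).exists
    have := hx1 (hgP x hx3)
    linarith
  have hFz : F z1 = w := by
    have h1 : MapClusterPt (F z1) l (F ∘ g) := hz1.continuousAt_comp (hc.an z1 hzP).continuousAt
    have h2 : ClusterPt (F z1) (𝓝 w) := ClusterPt.mono h1 hw
    exact (eq_of_nhds_neBot h2)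
  refine ⟨z1, hzP, hFz, ?_⟩
  rw [Metric.tendsto_nhds]
  intro ε hε
  obtain ⟨s', m, hs', hs'ε, hm, hsph⟩ := hc.trap hzP hε
  have h1 : ∀ᶠ x in l, ‖F (g x) - F z1‖ < m ∧ x ∈ V := by
    rw [hFz]
    have := (tendsto_iff_norm_sub_tendsto_zero.1 hw).eventually (gt_mem_nhds hm)
    exact this.and hV
  obtain ⟨i, hi, hsub⟩ := hl.eventually_iff.1 h1
  have h2 := (hfreq _ (Metric.ball_mem_nhds z1 hs')).and_eventually (hl.mem_of_mem hi)
  obtain ⟨x0, hx0, hx0s⟩ := h2.exists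
  have h3 := stay_in (hpre i hi) (hg.mono fun x hx => (hsub hx).2) (c := z1) (s := s')
    (fun x hx hx' => by linarith [hsph _ hx', (hsub hx).1]) hx0s hx0
  filter_upwards [hl.mem_of_mem hi] with x hx
  exact (Metric.mem_ball.1 (h3 x hx)).trans hs'ε

lemma Cov.ext_end (hc : Cov F P S M) {T : ℝ} (hT : 0 < T) {z : ℝ → ℂ} (hz : ContinuousOn z (Ico 0 T))
    (hzP : ∀ t ∈ Ico 0 T, z t ∉ P) {w : ℂ} (hw : Tendsto (fun t => F (z t)) (𝓝[<] T) (𝓝 w)) :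
    (w ∈ S ∧ Tendsto (fun t => ‖z t‖) (𝓝[<] T) atTop) ∨ ∃ z1 ∉ P, F z1 = w ∧ Tendsto z (𝓝[<] T) (𝓝 z1) := by
  rcases hc.dich (nhdsLT_basis T) (fun i _ => isPreconnected_Ioo) (Ico_mem_nhdsLT hT) hz hzP hw with h | h
  · refine Or.inl ⟨?_, h⟩
    set κ : ℝ → ℝ := fun t => T - T / (1 + t)
    have hκ1 : ∀ t, 0 ≤ t → κ t ∈ Ico 0 T := by
      intro t ht
      have : T / (1 + t) ≤ T := div_le_self hT.le (by linarith)
      have : 0 < T / (1 + t) := by positivity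
      exact ⟨by simp only [κ]; linarith, by simp only [κ]; linarith⟩
    have hκ2 : Tendsto κ atTop (𝓝[<] T) := by
      refine tendsto_nhdsWithin_iff.2 ⟨?_, ?_⟩
      · have : Tendsto (fun t : ℝ => T / (1 + t)) atTop (𝓝 0) :=
          tendsto_const_nhds.div_atTop (tendsto_atTop_add_const_left _ _ tendsto_id)
        simpa using tendsto_const_nhds.sub this
      · filter_upwards [eventually_ge_atTop 0] with t ht using (hκ1 t ht).2
    have hκc : ContinuousOn κ (Ici 0) := by
      refine continuousOn_const.sub (continuousOn_const.div (by fun_prop) fun t ht => ?_)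
      have : (0:ℝ) ≤ t := ht
      positivity
    exact hc.asy (fun t => z (κ t)) _ (hz.comp hκc fun t ht => hκ1 t ht)
      (fun t ht => hzP _ (hκ1 t ht)) (h.comp hκ2) (hw.comp hκ2)
  · exact Or.inr h

lemma Cov.lift_convex (hc : Cov F P S M) {e : ℂ → ℂ} {Ω : Set ℂ} (hΩ : Convex ℝ Ω) (hΩo : IsOpen Ω)
    (he : DifferentiableOn ℂ e Ω) (heS : ∀ ζ ∈ Ω, e ζ ∉ S) {ζ0 z0 : ℂ} (hζ0 : ζ0 ∈ Ω) (hz0 : z0 ∉ P)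
    (h0 : F z0 = e ζ0) :
    ∃ g : ℂ → ℂ, DifferentiableOn ℂ g Ω ∧ g ζ0 = z0 ∧ ∀ ζ ∈ Ω, g ζ ∉ P ∧ F (g ζ) = e ζ := by
  refine lift_gen hc.closed.isOpen_compl hc.an hΩ hΩo he hζ0 hz0 h0
    (fun z hz ζ hζ h hd => heS ζ hζ (h ▸ hc.crit z hz hd)) ?_
  intro ζ hζ T hT hT1 z hz _ hzl
  have hTm : ζ0 + (T:ℂ) * (ζ - ζ0) ∈ Ω := by
    have := hΩ.add_smul_sub_mem hζ0 hζ (⟨hT.le, hT1⟩ : T ∈ Icc (0:ℝ) 1)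
    simpa using this
  have hcont : ContinuousAt (fun t : ℝ => e (ζ0 + t * (ζ - ζ0))) T :=
    ContinuousAt.comp (f := fun t : ℝ => ζ0 + (t:ℂ) * (ζ - ζ0))
      (he.continuousOn.continuousAt (hΩo.mem_nhds hTm)) (by fun_prop)
  have hw : Tendsto (fun t => F (z t)) (𝓝[<] T) (𝓝 (e (ζ0 + T * (ζ - ζ0)))) := by
    refine (hcont.tendsto.mono_left nhdsWithin_le_nhds).congr' ?_
    filter_upwards [Ico_mem_nhdsLT hT] with t ht using (hzl t ht).2.symm
  rcases hc.ext_end hT hz (fun t ht => (hzl t ht).1) hw with h | ⟨z1, h1, h2, h3⟩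
  · exact absurd h.1 (heS _ hTm)
  · exact ⟨z1, h1, h3⟩

lemma lift_unique {g g' : ℂ → ℂ} {Ω W : Set ℂ} (hW : IsOpen W) (hF : ∀ z ∈ W, AnalyticAt ℂ F z)
    (hΩ : IsPreconnected Ω) (hg : ContinuousOn g Ω) (hg' : ContinuousOn g' Ω)
    (hgW : ∀ ζ ∈ Ω, g ζ ∈ W ∧ deriv F (g ζ) ≠ 0) (hgW' : ∀ ζ ∈ Ω, g' ζ ∈ W ∧ deriv F (g' ζ) ≠ 0)
    (he : ∀ ζ ∈ Ω, F (g ζ) = F (g' ζ)) {ζ0 : ℂ} (h0 : ζ0 ∈ Ω) (h : g ζ0 = g' ζ0) : EqOn g g' Ω := by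
  set W' : Set ℂ := {z | z ∈ W ∧ deriv F z ≠ 0}
  have hW'o : IsOpen W' := by
    rw [isOpen_iff_mem_nhds]
    rintro z ⟨hz, hz'⟩
    filter_upwards [hW.mem_nhds hz, (hF z hz).deriv.continuousAt.eventually_ne hz'] with w h1 h2
    exact ⟨h1, h2⟩
  have hp := locHomeo hW'o (fun z hz => hF z hz.1) (fun z hz => hz.2)
  rw [isPreconnected_iff_preconnectedSpace] at hΩ
  have := (T2Space.isSeparatedMap (fun z : W' => F z)).eq_of_comp_eq hp.isLocallyInjective
    (g₁ := fun ζ : Ω => ⟨g ζ, hgW ζ ζ.2⟩) (g₂ := fun ζ : Ω => ⟨g' ζ, hgW' ζ ζ.2⟩)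
    ((continuousOn_iff_continuous_domRestrict.1 hg).subtype_mk _)
    ((continuousOn_iff_continuous_domRestrict.1 hg').subtype_mk _)
    (by ext ζ; exact he ζ ζ.2) ⟨ζ0, h0⟩ (by simpa using h)
  intro ζ hζ
  simpa using congrFun this ⟨ζ, hζ⟩

end

section

lemma cusp {k : ℂ → ℂ} {q : ℕ} (hq : 1 ≤ q)
    (hper : ∀ ζ : ℂ, 0 < ζ.re → k (ζ + 2 * π * I * q) = k ζ) {c : ℂ}
    (hol : ∀ᶠ ζ in comap Complex.re atTop, DifferentiableAt ℂ k ζ)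
    (hl : Tendsto k (comap Complex.re atTop) (𝓝 c)) :
    ∃ E : ℂ → ℂ, DifferentiableAt ℂ E 0 ∧ E 0 = c ∧ (∀ᶠ u in 𝓝 0, DifferentiableAt ℂ E u) ∧
      (∀ ζ : ℂ, 0 < ζ.re → E (cexp (-ζ / q)) = k ζ) ∧
      ∀ ζ : ℂ, 0 < ζ.re → DifferentiableAt ℂ k ζ → DifferentiableAt ℂ E (cexp (-ζ / q)) := by
  classical
  set h : ℝ := 2 * π * q with hh
  have hq0 : (0:ℝ) < q := by exact_mod_cast hq
  have hqc : (q:ℂ) ≠ 0 := by exact_mod_cast hq0.ne'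
  have hpos : 0 < h := by positivity
  set f : ℂ → ℂ := fun z => if 0 < z.im then k (-(I * z)) else 0 with hf
  have hfI : ∀ ζ : ℂ, 0 < ζ.re → f (I * ζ) = k ζ := by
    intro ζ hζ
    have h1 : -(I * (I * ζ)) = ζ := by rw [← mul_assoc, Complex.I_mul_I]; ring
    simp [hf, hζ, h1]
  have hperf : Function.Periodic f h := by
    intro z
    by_cases hz : 0 < z.im
    · have h1 := hper (-(I * (z + h))) (by simp [hz])
      have h2 : -(I * (z + h)) + 2 * π * I * q = -(I * z) := by
        rw [hh]; push_cast; ring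
      rw [h2] at h1
      simp [hf, hz, h1]
    · simp [hf, hz]
  have htI : Tendsto (fun z : ℂ => -(I * z)) (comap Complex.im atTop) (comap Complex.re atTop) := by
    rw [tendsto_comap_iff]
    simpa [Function.comp_def] using tendsto_comap (f := Complex.im) (x := atTop)
  have hev : f =ᶠ[comap Complex.im atTop] fun z => k (-(I * z)) := by
    filter_upwards [tendsto_comap.eventually (eventually_gt_atTop (0:ℝ))] with z hz
    simp [hf, hz]
  have hlf : Tendsto f (comap Complex.im atTop) (𝓝 c) := (hl.comp htI).congr' hev.symm
  have hnear : ∀ z : ℂ, 0 < z.im → f =ᶠ[𝓝 z] fun z => k (-(I * z)) := by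
    intro z hz
    filter_upwards [(isOpen_lt continuous_const Complex.continuous_im).mem_nhds hz] with w hw
    have hw' : 0 < w.im := hw
    simp [hf, hw']
  have hdf : ∀ z : ℂ, 0 < z.im → DifferentiableAt ℂ k (-(I * z)) → DifferentiableAt ℂ f z := by
    intro z hz hk
    refine DifferentiableAt.congr_of_eventuallyEq ?_ (hnear z hz)
    exact hk.comp z (by fun_prop)
  have hholf : ∀ᶠ z in comap Complex.im atTop, DifferentiableAt ℂ f z := by
    filter_upwards [htI.eventually hol, tendsto_comap.eventually (eventually_gt_atTop (0:ℝ))] with z h1 h2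
    exact hdf z h2 h1
  have hbd : BoundedAtFilter (comap Complex.im atTop) f := hlf.isBigO_one ℝ
  have hnb : NeBot (comap Complex.im atTop) := by
    refine comap_neBot fun t ht => ?_
    obtain ⟨x, hx⟩ := (eventually_mem_set.2 ht).exists
    exact ⟨x * I, by simpa using hx⟩
  have hqp : ∀ ζ : ℂ, Function.Periodic.qParam h (I * ζ) = cexp (-ζ / q) := by
    intro ζ
    unfold Function.Periodic.qParam
    congr 1
    have hπ : (π : ℂ) ≠ 0 := by exact_mod_cast Real.pi_ne_zero
    rw [hh]; push_cast
    field_simp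
    rw [Complex.I_sq]; ring
  have h0 := Function.Periodic.differentiableAt_cuspFunction_zero hpos hperf hholf hbd
  refine ⟨Function.Periodic.cuspFunction h f, h0, ?_, ?_, ?_, ?_⟩
  · exact tendsto_nhds_unique (Function.Periodic.tendsto_at_I_inf hpos hperf hholf hbd) hlf
  · have := Function.Periodic.eventually_differentiableAt_cuspFunction_nhds_ne_zero hpos hperf hholf
    rw [eventually_nhdsWithin_iff] at this
    filter_upwards [this] with u hu
    by_cases h : u = 0
    · rw [h]; exact h0
    · exact hu h
  · intro ζ hζ
    rw [← hqp, Function.Periodic.eq_cuspFunction hpos.ne' hperf, hfI ζ hζ]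
  · intro ζ hζ hk
    rw [← hqp]
    refine Function.Periodic.differentiableAt_cuspFunction hpos.ne' hperf (hdf _ (by simpa using hζ) ?_)
    have h1 : -(I * (I * ζ)) = ζ := by rw [← mul_assoc, Complex.I_mul_I]; ring
    rw [h1]; exact hk

def HP : Set ℂ := {ζ | 0 < ζ.re}

lemma HP_open : IsOpen HP := isOpen_lt continuous_const Complex.continuous_re

lemma HP_convex : Convex ℝ HP := convex_halfSpace_re_gt 0

structure Trt (F : ℂ → ℂ) (P : Set ℂ) (a : ℂ) (r : ℝ) (g : ℂ → ℂ) : Prop where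
  diff : DifferentiableOn ℂ g HP
  nP : ∀ ζ ∈ HP, g ζ ∉ P
  eq : ∀ ζ ∈ HP, F (g ζ) = a + r * cexp (-ζ)

variable {F : ℂ → ℂ} {P S : Set ℂ} {M : ℕ} {a : ℂ} {r : ℝ} {g g' : ℂ → ℂ}

lemma tr_ball {ζ : ℂ} (hr : 0 < r) (hζ : ζ ∈ HP) : a + r * cexp (-ζ) ≠ a ∧
    ‖a + r * cexp (-ζ) - a‖ < r := by
  constructor
  · simp [hr.ne']
  · rw [add_sub_cancel_left, norm_mul, Complex.norm_exp, Complex.norm_real, Real.norm_eq_abs, abs_of_pos hr]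
    have : rexp (-ζ).re < 1 := by
      rw [Real.exp_lt_one_iff]
      have : 0 < ζ.re := hζ
      simpa using this
    nlinarith

lemma Cov.tr_exists (hc : Cov F P S M) (hr : 0 < r) (hS : ∀ w, w ≠ a → ‖w - a‖ < r → w ∉ S) {z : ℂ}
    (hz : z ∉ P) (h1 : F z ≠ a) (h2 : ‖F z - a‖ < r) :
    ∃ g, Trt F P a r g ∧ ∃ ζ ∈ HP, g ζ = z := by
  have hrc : (r:ℂ) ≠ 0 := by exact_mod_cast hr.ne'
  have hne : (F z - a) / r ≠ 0 := div_ne_zero (sub_ne_zero.2 h1) hrc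
  set ζ0 := -Complex.log ((F z - a) / r)
  have hζ0 : ζ0 ∈ HP := by
    have h3 : ‖(F z - a) / r‖ < 1 := by
      rw [norm_div, Complex.norm_real, Real.norm_eq_abs, abs_of_pos hr, div_lt_one hr]; exact h2
    have := Real.log_neg (norm_pos_iff.2 hne) h3
    simp only [HP, mem_ofPred_eq, ζ0, Complex.neg_re, Complex.log_re]; linarith
  have h0 : F z = a + r * cexp (-ζ0) := by
    simp only [ζ0, neg_neg]; rw [Complex.exp_log hne]; field_simp; ring
  obtain ⟨g, h3, h4, h5⟩ := hc.lift_convex HP_convex HP_open (e := fun ζ => a + r * cexp (-ζ))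
    (by fun_prop) (fun ζ hζ => hS _ (tr_ball hr hζ).1 (tr_ball hr hζ).2) hζ0 hz h0
  exact ⟨g, ⟨h3, fun ζ hζ => (h5 ζ hζ).1, fun ζ hζ => (h5 ζ hζ).2⟩, ζ0, hζ0, h4⟩

lemma Cov.tr_dF (hc : Cov F P S M) (hr : 0 < r) (hS : ∀ w, w ≠ a → ‖w - a‖ < r → w ∉ S)
    (hg : Trt F P a r g) {ζ : ℂ} (hζ : ζ ∈ HP) : deriv F (g ζ) ≠ 0 := fun h => by
  have := hc.crit _ (hg.nP ζ hζ) h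
  rw [hg.eq ζ hζ] at this
  exact hS _ (tr_ball hr hζ).1 (tr_ball hr hζ).2 this

lemma shift_HP {ζ : ℂ} (hζ : ζ ∈ HP) (m : ℤ) : ζ + 2 * π * I * m ∈ HP := by
  simpa [HP] using hζ

lemma shift_exp (ζ : ℂ) (m : ℤ) : cexp (-(ζ + 2 * π * I * m)) = cexp (-ζ) := by
  rw [Complex.exp_eq_exp_iff_exists_int]; exact ⟨-m, by push_cast; ring⟩

lemma Cov.tr_shift (hc : Cov F P S M) (hr : 0 < r) (hS : ∀ w, w ≠ a → ‖w - a‖ < r → w ∉ S)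
    (hg : Trt F P a r g) (hg' : Trt F P a r g') {ζ1 ζ2 : ℂ} (h1 : ζ1 ∈ HP) (h2 : ζ2 ∈ HP)
    (h : g ζ1 = g' ζ2) : ∃ m : ℤ, ζ2 = ζ1 + 2 * π * I * m ∧
      ∀ ζ ∈ HP, g' (ζ + 2 * π * I * m) = g ζ := by
  have h3 := hg.eq ζ1 h1
  rw [h, hg'.eq ζ2 h2, add_right_inj] at h3
  have hrc : (r:ℂ) ≠ 0 := by exact_mod_cast hr.ne'
  have h4 := mul_left_cancel₀ hrc h3
  rw [Complex.exp_eq_exp_iff_exists_int] at h4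
  obtain ⟨n, hn⟩ := h4
  have hm : ζ2 = ζ1 + 2 * π * I * ((-n : ℤ) : ℂ) := by
    push_cast; linear_combination -hn
  refine ⟨-n, hm, fun ζ hζ => ?_⟩
  have := lift_unique (F := F) (W := Pᶜ) hc.closed.isOpen_compl hc.an HP_convex.isPreconnected
    (g := fun ζ => g' (ζ + 2 * π * I * ((-n : ℤ) : ℂ))) (g' := g)
    (hg'.diff.continuousOn.comp (by fun_prop) fun ζ hζ => shift_HP hζ _) hg.diff.continuousOn
    (fun ζ hζ => ⟨hg'.nP _ (shift_HP hζ _), hc.tr_dF hr hS hg' (shift_HP hζ _)⟩)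
    (fun ζ hζ => ⟨hg.nP _ hζ, hc.tr_dF hr hS hg hζ⟩)
    (fun ζ hζ => by
      rw [hg'.eq _ (shift_HP hζ _), hg.eq _ hζ, shift_exp])
    h1 (by rw [← hm, h])
  exact this hζ

lemma Cov.tr_injdisc (hc : Cov F P S M) (hr : 0 < r) (hS : ∀ w, w ≠ a → ‖w - a‖ < r → w ∉ S)
    (hg : Trt F P a r g) {ζ : ℂ} (hζ : π ≤ ζ.re) :
    ball ζ π ⊆ HP ∧ InjOn g (ball ζ π) := by
  have hsub : ball ζ π ⊆ HP := by
    intro w hw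
    have h1 := Complex.abs_re_le_norm (w - ζ)
    rw [Metric.mem_ball, dist_eq_norm] at hw
    have := (abs_le.1 h1).1
    simp only [Complex.sub_re] at this
    simp only [HP, mem_ofPred_eq]; linarith
  refine ⟨hsub, fun x hx y hy hxy => ?_⟩
  obtain ⟨m, hm, -⟩ := hc.tr_shift hr hS hg hg (hsub hx) (hsub hy) hxy
  have h1 : dist y x < 2 * π := by
    calc dist y x ≤ dist y ζ + dist x ζ := dist_triangle_right _ _ _
      _ < _ := by rw [Metric.mem_ball] at hx hy; linarith
  have h2 : dist y x = 2 * π * |(m:ℝ)| := by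
    rw [hm, dist_eq_norm, add_sub_cancel_left, norm_mul, norm_mul, norm_mul]
    simp [abs_of_pos Real.pi_pos]
  have h3 : |(m:ℝ)| < 1 := by
    rw [h2] at h1
    have := Real.pi_pos
    nlinarith
  have h4 : m = 0 := by
    rw [← Int.cast_abs] at h3
    have : |m| < 1 := by exact_mod_cast h3
    exact Int.abs_lt_one_iff.1 this
  rw [hm, h4]; simp

instance : NeBot (comap Complex.re atTop) := by
  refine comap_neBot fun t ht => ?_
  obtain ⟨x, hx⟩ := (eventually_mem_set.2 ht).exists
  exact ⟨x, by simpa using hx⟩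

lemma HP_mem : HP ∈ comap Complex.re atTop :=
  tendsto_comap.eventually (eventually_gt_atTop (0:ℝ))

lemma tr_tendsto (hg : Trt F P a r g) :
    Tendsto (fun ζ => F (g ζ)) (comap Complex.re atTop) (𝓝 a) := by
  have h1 : Tendsto (fun ζ : ℂ => a + r * cexp (-ζ)) (comap Complex.re atTop) (𝓝 (a + r * 0)) := by
    refine tendsto_const_nhds.add (tendsto_const_nhds.mul ?_)
    rw [tendsto_zero_iff_norm_tendsto_zero]
    simp only [Complex.norm_exp, Complex.neg_re]
    exact (Real.tendsto_exp_neg_atTop_nhds_zero).comp tendsto_comap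
  simp only [mul_zero, add_zero] at h1
  refine h1.congr' ?_
  filter_upwards [HP_mem] with ζ hζ using (hg.eq ζ hζ).symm

lemma Cov.tr_dich (hc : Cov F P S M) (hg : Trt F P a r g) :
    Tendsto (fun ζ => ‖g ζ‖) (comap Complex.re atTop) atTop ∨
      ∃ z1 ∉ P, F z1 = a ∧ Tendsto g (comap Complex.re atTop) (𝓝 z1) :=
  hc.dich (atTop_basis.comap Complex.re) (fun x _ => (convex_halfSpace_re_ge x).isPreconnected)
    HP_mem hg.diff.continuousOn hg.nP (tr_tendsto hg)

lemma tr_diffAt (hg : Trt F P a r g) {ζ : ℂ} (hζ : ζ ∈ HP) : DifferentiableAt ℂ g ζ :=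
  hg.diff.differentiableAt (HP_open.mem_nhds hζ)

lemma Cov.tr_inj (hc : Cov F P S M) (hr : 0 < r) (hS : ∀ w, w ≠ a → ‖w - a‖ < r → w ∉ S)
    (hub : ∀ R C : ℝ, ∃ z, R < ‖z‖ ∧ (z ∈ P ∨ C < ‖F z‖)) (hg : Trt F P a r g)
    (hi : Tendsto (fun ζ => ‖g ζ‖) (comap Complex.re atTop) atTop) : InjOn g HP := by
  by_contra hne
  obtain ⟨q, hq, hper⟩ : ∃ q : ℕ, 1 ≤ q ∧ ∀ ζ ∈ HP, g (ζ + 2 * π * I * q) = g ζ := by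
    simp only [InjOn] at hne
    push Not at hne
    obtain ⟨x, hx, y, hy, hxy, hn⟩ := hne
    obtain ⟨m, hm, hm2⟩ := hc.tr_shift hr hS hg hg hx hy hxy
    have hm0 : m ≠ 0 := by rintro rfl; apply hn; rw [hm]; simp
    refine ⟨m.natAbs, Int.natAbs_pos.2 hm0, fun ζ hζ => ?_⟩
    rcases Int.natAbs_eq m with h | h
    · have := hm2 ζ hζ
      rw [h, Int.cast_natCast] at this; exact this
    · have h3 := hm2 _ (shift_HP hζ (m.natAbs : ℤ))
      rw [Int.cast_natCast, h, Int.cast_neg, Int.cast_natCast, Int.natAbs_neg, Int.natAbs_natCast] at h3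
      rw [← h3]; congr 1; ring
  have hinv : Tendsto (fun ζ => (g ζ)⁻¹) (comap Complex.re atTop) (𝓝 0) := by
    rw [tendsto_zero_iff_norm_tendsto_zero]
    simp only [norm_inv]; exact hi.inv_tendsto_atTop
  have hg0 : ∀ᶠ ζ in comap Complex.re atTop, g ζ ≠ 0 := by
    filter_upwards [hi.eventually (eventually_gt_atTop 0)] with ζ hζ
    exact norm_pos_iff.1 hζ
  obtain ⟨E, hE0, hE00, hE1, hE2, -⟩ := cusp (k := fun ζ => (g ζ)⁻¹) hq
    (fun ζ hζ => by rw [hper ζ hζ]) (by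
      filter_upwards [hg0, HP_mem] with ζ h1 h2 using (tr_diffAt hg h2).inv h1) hinv
  have hEan : AnalyticAt ℂ E 0 := by
    rw [Complex.analyticAt_iff_eventually_differentiableAt]; exact hE1
  have hq0 : (0:ℝ) < q := by exact_mod_cast hq
  have hqc : (q:ℂ) ≠ 0 := by exact_mod_cast hq0.ne'
  have hte : Tendsto (fun ζ : ℂ => cexp (-ζ / q)) (comap Complex.re atTop) (𝓝 0) := by
    rw [tendsto_zero_iff_norm_tendsto_zero]
    have : (fun ζ : ℂ => ‖cexp (-ζ / q)‖) = (fun x => rexp (-(x / q))) ∘ Complex.re := by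
      ext ζ
      simp only [Complex.norm_exp, Function.comp]
      congr 1
      rw [show -ζ / (q:ℂ) = ((-(1/q) : ℝ) : ℂ) * ζ by push_cast; ring, Complex.re_ofReal_mul]; ring
    rw [this]
    exact (Real.tendsto_exp_neg_atTop_nhds_zero.comp (tendsto_id.atTop_div_const hq0)).comp tendsto_comap
  rcases hEan.eventually_constant_or_nhds_le_map_nhds with h | h
  · have h1 := hte.eventually h
    obtain ⟨ζ, h2, h3, h4⟩ := (h1.and (hg0.and HP_mem)).exists
    rw [hE2 ζ h4, hE00] at h2
    exact inv_ne_zero h3 h2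
  · have h1 : E '' ball 0 1 ∈ 𝓝 (E 0) := h (image_mem_map (Metric.ball_mem_nhds 0 one_pos))
    rw [hE00] at h1
    obtain ⟨δ, hδ, hb⟩ := Metric.mem_nhds_iff.1 h1
    obtain ⟨z, hz1, hz2⟩ := hub δ⁻¹ (‖a‖ + r)
    have hzpos : 0 < ‖z‖ := (inv_pos.2 hδ).trans hz1
    obtain ⟨u, hu1, hu2⟩ := hb (show z⁻¹ ∈ ball 0 δ by
      rw [mem_ball_zero_iff, norm_inv]; exact inv_lt_of_inv_lt₀ hδ hz1)
    have hu0 : u ≠ 0 := by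
      rintro rfl
      rw [hE00] at hu2
      exact inv_ne_zero (norm_pos_iff.1 hzpos) hu2.symm
    set ζ := -(q * Complex.log u)
    have hζ : ζ ∈ HP := by
      have := Real.log_neg (norm_pos_iff.2 hu0) (mem_ball_zero_iff.1 hu1)
      simp [HP, ζ, Complex.log_re]
      nlinarith
    have h3 : cexp (-ζ / q) = u := by
      simp only [ζ, neg_neg]; rw [mul_div_cancel_left₀ _ hqc, Complex.exp_log hu0]
    have h4 := hE2 ζ hζ
    rw [h3, hu2] at h4
    have h5 : g ζ = z := (inv_injective h4).symm
    rcases hz2 with h6 | h6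
    · exact hg.nP ζ hζ (h5 ▸ h6)
    · rw [← h5, hg.eq ζ hζ] at h6
      have h7 := norm_sub_norm_le (a + r * cexp (-ζ)) a
      linarith [(tr_ball (a := a) hr hζ).2]

end

section
variable {F : ℂ → ℂ} {P S : Set ℂ} {M : ℕ} {a : ℂ} {r : ℝ} {g g' : ℂ → ℂ}

lemma root_fn {h : ℂ → ℂ} {z1 : ℂ} {q : ℕ} (hq : 1 ≤ q) (hh : AnalyticAt ℂ h z1) (h0 : h z1 ≠ 0) :
    ∃ ψ : ℂ → ℂ, AnalyticAt ℂ ψ z1 ∧ deriv ψ z1 ≠ 0 ∧ ∀ᶠ w in 𝓝 z1, h z1 * ψ w ^ q = (w - z1) ^ q * h w := by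
  have hqc : (q:ℂ) ≠ 0 := by exact_mod_cast (by omega : q ≠ 0)
  have h1 : AnalyticAt ℂ (fun w => h w / h z1) z1 := hh.div analyticAt_const h0
  have h2 : AnalyticAt ℂ (fun w => cexp (Complex.log (h w / h z1) / q)) z1 :=
    ((h1.clog (by simp [div_self h0])).div analyticAt_const hqc).cexp
  refine ⟨fun w => (w - z1) * cexp (Complex.log (h w / h z1) / q),
    (analyticAt_id.sub analyticAt_const).mul h2, ?_, ?_⟩
  · have h3 := ((hasDerivAt_id z1).sub_const z1).mul h2.differentiableAt.hasDerivAt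
    have : deriv (fun w => (w - z1) * cexp (Complex.log (h w / h z1) / q)) z1 = 1 :=
      Eq.trans h3.deriv (by simp [div_self h0])
    rw [this]; exact one_ne_zero
  · filter_upwards [hh.continuousAt.eventually_ne h0] with w hw
    rw [mul_pow, ← Complex.exp_nat_mul, mul_div_cancel₀ _ hqc, Complex.exp_log (div_ne_zero hw h0)]
    field_simp

lemma Cov.tr_per (hc : Cov F P S M) (hr : 0 < r) (hS : ∀ w, w ≠ a → ‖w - a‖ < r → w ∉ S)
    (hg : Trt F P a r g) {z1 : ℂ} (hz1 : z1 ∉ P) (hF : F z1 = a)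
    (hi : Tendsto g (comap Complex.re atTop) (𝓝 z1)) :
    ∃ q : ℕ, 1 ≤ q ∧ q ≤ M ∧ (deriv F z1 ≠ 0 → q = 1) ∧
      ∀ ζ ∈ HP, g (ζ + 2 * π * I * q) = g ζ := by
  obtain ⟨q, hq, hqM, h, hh, h0, hloc⟩ := hc.mult z1 hz1
  have hqc : (q:ℂ) ≠ 0 := by exact_mod_cast (by omega : q ≠ 0)
  refine ⟨q, hq, hqM, fun hd => ?_, ?_⟩
  · by_contra hq1
    apply hd
    have h3 : HasDerivAt (fun w => F z1 + (w - z1) ^ q * h w) _ z1 :=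
      (((((hasDerivAt_id z1).sub_const z1).pow q).mul hh.differentiableAt.hasDerivAt).const_add (F z1))
    rw [Filter.EventuallyEq.deriv_eq hloc]
    refine Eq.trans h3.deriv ?_
    simp [show q ≠ 0 by omega, show q - 1 ≠ 0 by omega]
  obtain ⟨ψ, hψ, hψ', hψq⟩ := root_fn hq hh h0
  have hinj := hψ.hasStrictDerivAt.eventually_left_inverse hψ'
  have hev := hi.eventually (hloc.and (hψq.and (hψ.eventually_analyticAt.and hinj)))
  rw [eventually_comap] at hev
  obtain ⟨x0, hx0⟩ := eventually_atTop.1 (hev.and (eventually_gt_atTop 0))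
  set U : Set ℂ := {ζ | x0 < ζ.re}
  have hU : ∀ ζ ∈ U, ζ ∈ HP ∧ F (g ζ) = F z1 + (g ζ - z1) ^ q * h (g ζ) ∧
      h z1 * ψ (g ζ) ^ q = (g ζ - z1) ^ q * h (g ζ) ∧ AnalyticAt ℂ ψ (g ζ) ∧
      hψ.hasStrictDerivAt.localInverse ψ (deriv ψ z1) z1 hψ' (ψ (g ζ)) = g ζ := by
    intro ζ hζ
    have h1 := hx0 ζ.re (le_of_lt hζ)
    exact ⟨h1.2, h1.1 ζ rfl⟩
  have hUo : IsOpen U := isOpen_lt continuous_const Complex.continuous_re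
  have hUc : Convex ℝ U := convex_halfSpace_re_gt x0
  set m : ℂ → ℂ := fun ζ => ψ (g ζ) * cexp (ζ / q)
  have hm : ∀ ζ ∈ U, m ζ ^ q = r / h z1 := by
    intro ζ hζ
    obtain ⟨h1, h2, h3, -⟩ := hU ζ hζ
    rw [hg.eq ζ h1, hF, ← h3, add_right_inj] at h2
    simp only [m]
    rw [mul_pow, ← Complex.exp_nat_mul, mul_div_cancel₀ _ hqc, eq_div_iff h0]
    calc _ = (h z1 * ψ (g ζ) ^ q) * cexp ζ := by ring
      _ = _ := by rw [← h2, mul_assoc, ← Complex.exp_add]; simp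
  have hmd : DifferentiableOn ℂ m U := fun ζ hζ =>
    (((hU ζ hζ).2.2.2.1.differentiableAt.comp ζ (tr_diffAt hg (hU ζ hζ).1)).mul
      (by fun_prop)).differentiableWithinAt
  have hm0 : ∀ ζ ∈ U, m ζ ≠ 0 := fun ζ hζ h => by
    have := hm ζ hζ
    rw [h, zero_pow (by omega)] at this
    exact (div_ne_zero (by exact_mod_cast hr.ne') h0) this.symm
  have hmd0 : EqOn (deriv m) 0 U := by
    intro ζ hζ
    have h1 : HasDerivAt (fun ζ => m ζ ^ q) _ ζ :=
      (hmd.differentiableAt (hUo.mem_nhds hζ)).hasDerivAt.pow q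
    have h2 : (fun ζ => m ζ ^ q) =ᶠ[𝓝 ζ] fun _ => r / h z1 := by
      filter_upwards [hUo.mem_nhds hζ] with x hx using hm x hx
    have h3 := h1.unique ((hasDerivAt_const ζ (r / h z1)).congr_of_eventuallyEq h2)
    simpa [hqc, hm0 ζ hζ] using h3
  have hζ1 : ((x0 + 1 : ℝ) : ℂ) ∈ U := by simp [U]
  have hζ2 : ((x0 + 1 : ℝ) : ℂ) + 2 * π * I * q ∈ U := by simp [U]
  have h5 := hUo.is_const_of_deriv_eq_zero hUc.isPreconnected hmd hmd0 hζ2 hζ1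
  have h6 : ψ (g (((x0 + 1 : ℝ) : ℂ) + 2 * π * I * q)) = ψ (g ((x0 + 1 : ℝ) : ℂ)) := by
    have h7 : cexp ((((x0 + 1 : ℝ) : ℂ) + 2 * π * I * q) / q)
        = cexp (((x0 + 1 : ℝ) : ℂ) / q) := by
      rw [add_div, mul_div_cancel_right₀ _ hqc, Complex.exp_add, Complex.exp_two_pi_mul_I, mul_one]
    simp only [m] at h5
    rw [h7] at h5
    exact mul_right_cancel₀ (Complex.exp_ne_zero _) h5
  have h8 : g ((x0 + 1 : ℝ) : ℂ) = g (((x0 + 1 : ℝ) : ℂ) + 2 * π * I * q) := by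
    rw [← (hU _ hζ1).2.2.2.2, ← (hU _ hζ2).2.2.2.2, h6]
  obtain ⟨n, hn, hn2⟩ := hc.tr_shift hr hS hg hg (hU _ hζ1).1 (hU _ hζ2).1 h8
  have : (q:ℂ) = n := by
    have h9 := add_left_cancel hn
    exact mul_left_cancel₀ Complex.two_pi_I_ne_zero h9
  rw [this]; exact hn2

lemma Cov.tr_disc (hg : Trt F P a r g) {z1 : ℂ} (hz1 : z1 ∉ P)
    (hi : Tendsto g (comap Complex.re atTop) (𝓝 z1)) {q : ℕ} (hq : 1 ≤ q)
    (hper : ∀ ζ ∈ HP, g (ζ + 2 * π * I * q) = g ζ) :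
    ∃ E : ℂ → ℂ, DifferentiableOn ℂ E (ball 0 1) ∧ E 0 = z1 ∧
      (∀ ζ ∈ HP, E (cexp (-ζ / q)) = g ζ) ∧
      ∀ u : ℂ, u ≠ 0 → ‖u‖ < 1 → ∃ ζ ∈ HP, u = cexp (-ζ / q) ∧ ζ.re = - q * rlog ‖u‖ := by
  have hq0 : (0:ℝ) < q := by exact_mod_cast hq
  have hqc : (q:ℂ) ≠ 0 := by exact_mod_cast hq0.ne'
  obtain ⟨E, hE0, hE00, hE1, hE2, hE3⟩ := cusp (k := g) hq hper
    (by filter_upwards [HP_mem] with ζ h2 using tr_diffAt hg h2) hi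
  have key : ∀ u : ℂ, u ≠ 0 → ‖u‖ < 1 → ∃ ζ ∈ HP, u = cexp (-ζ / q) ∧ ζ.re = - q * rlog ‖u‖ := by
    intro u hu0 hu1
    have := Real.log_neg (norm_pos_iff.2 hu0) hu1
    refine ⟨-(q * Complex.log u), ?_, ?_, ?_⟩
    · simp [HP, Complex.log_re]
      nlinarith
    · rw [neg_neg, mul_div_cancel_left₀ _ hqc, Complex.exp_log hu0]
    · simp [Complex.log_re]
  refine ⟨E, fun u hu => ?_, hE00, hE2, key⟩
  by_cases hu0 : u = 0
  · rw [hu0]; exact hE0.differentiableWithinAt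
  · obtain ⟨ζ, h1, h2, -⟩ := key u hu0 (mem_ball_zero_iff.1 hu)
    rw [h2]; exact (hE3 ζ h1 (tr_diffAt hg h1)).differentiableWithinAt

lemma tr_max (hg : Trt F P a r g) {z1 : ℂ} (hz1 : z1 ∉ P)
    (hi : Tendsto g (comap Complex.re atTop) (𝓝 z1)) {q : ℕ} (hq : 1 ≤ q)
    (hper : ∀ ζ ∈ HP, g (ζ + 2 * π * I * q) = g ζ) {ζ1 : ℂ} (h1 : ζ1 ∈ HP) {D : ℝ}
    (hD : ∀ s ∈ Icc (0:ℝ) (2 * π * q), ‖g (ζ1 + s * I) - g ζ1‖ ≤ D) :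
    ‖z1 - g ζ1‖ ≤ D := by
  have hq0 : (0:ℝ) < q := by exact_mod_cast hq
  obtain ⟨E, hE, hE0, hE2, hE3⟩ := Cov.tr_disc hg hz1 hi hq hper
  have h1' : 0 < ζ1.re := h1
  set ρ := rexp (-ζ1.re / q)
  have hρ0 : 0 < ρ := Real.exp_pos _
  have hρ1 : ρ < 1 := by
    rw [Real.exp_lt_one_iff]; exact div_neg_of_neg_of_pos (by linarith) hq0
  have h2 : DiffContOnCl ℂ (fun u => E u - g ζ1) (ball 0 ρ) := by
    refine DifferentiableOn.diffContOnCl ?_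
    rw [closure_ball _ hρ0.ne']
    exact (hE.mono (Metric.closedBall_subset_ball hρ1)).sub_const _
  have h3 := Complex.norm_le_of_forall_mem_frontier_norm_le Metric.isBounded_ball h2 (C := D) (z := 0)
    (fun u hu => by
      rw [frontier_ball _ hρ0.ne', mem_sphere_zero_iff_norm] at hu
      have hu0 : u ≠ 0 := norm_pos_iff.1 (hu ▸ hρ0)
      obtain ⟨ζ, h4, h5, h6⟩ := hE3 u hu0 (hu ▸ hρ1)
      rw [h5, hE2 ζ h4]
      have h7 : ζ.re = ζ1.re := by
        rw [h6, hu, Real.log_exp]; field_simp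
      have hp : (0:ℝ) < 2 * π * q := by positivity
      set n := toIcoDiv hp 0 (ζ.im - ζ1.im)
      have h8 := sub_toIcoDiv_zsmul_mem_Ico hp 0 (ζ.im - ζ1.im)
      have h9 : ∀ n : ℤ, ∀ ζ ∈ HP, g (ζ + 2 * π * I * q * n) = g ζ := by
        intro n
        induction n using Int.induction_on with
        | zero => simp
        | succ n ih =>
          intro ζ hζ
          rw [← ih ζ hζ, ← hper (ζ + 2 * π * I * q * (n:ℤ)) (by simpa [HP] using hζ)]
          congr 1; push_cast; ring
        | pred n ih =>
          intro ζ hζ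
          rw [← ih ζ hζ, ← hper (ζ + 2 * π * I * q * ((-(n:ℤ) - 1 : ℤ) : ℂ)) (by simpa [HP] using hζ)]
          congr 1; push_cast; ring
      have h10 := hD _ ⟨h8.1, by simpa using h8.2.le⟩
      rw [← h9 (-n) ζ h4]
      convert! h10 using 4
      apply Complex.ext
      · simp [h7]
      · simp [n]
        have := self_sub_toIcoDiv_zsmul hp 0 (ζ.im - ζ1.im)
        rw [zsmul_eq_mul] at this
        linear_combination this) (subset_closure (Metric.mem_ball_self hρ0))
  simpa [hE0] using h3

lemma tr_branch (hr : 0 < r) (hg : Trt F P a r g) {z1 : ℂ} (hz1 : z1 ∉ P) (hF : F z1 = a)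
    (hi : Tendsto g (comap Complex.re atTop) (𝓝 z1))
    (hper : ∀ ζ ∈ HP, g (ζ + 2 * π * I) = g ζ) :
    ∃ G : ℂ → ℂ, DifferentiableOn ℂ G (ball a r) ∧ (∀ w ∈ ball a r, F (G w) = w) ∧
      ∀ ζ ∈ HP, G (F (g ζ)) = g ζ := by
  obtain ⟨E, hE, hE0, hE2, hE3⟩ := Cov.tr_disc hg hz1 hi le_rfl (by simpa using hper)
  have hrc : (r:ℂ) ≠ 0 := by exact_mod_cast hr.ne'
  have hb : ∀ w ∈ ball a r, ‖(w - a) / r‖ < 1 := fun w hw => by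
    rw [norm_div, Complex.norm_real, Real.norm_eq_abs, abs_of_pos hr, div_lt_one hr]
    exact mem_ball_iff_norm.1 hw
  simp only [Nat.cast_one, div_one] at hE2 hE3
  refine ⟨fun w => E ((w - a) / r), hE.comp (by fun_prop) fun w hw => mem_ball_zero_iff.2 (hb w hw), ?_, ?_⟩
  · intro w hw
    by_cases hwa : w = a
    · simp [hwa, hE0, hF]
    · obtain ⟨ζ, h1, h2, -⟩ := hE3 _ (div_ne_zero (sub_ne_zero.2 hwa) hrc) (hb w hw)
      show F (E _) = w
      rw [h2, hE2 ζ h1, hg.eq ζ h1, ← h2]; field_simp; ring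
  · intro ζ hζ
    show E _ = _
    rw [hg.eq ζ hζ, add_sub_cancel_left, mul_div_cancel_left₀ _ hrc, hE2 ζ hζ]

lemma schw_aexp (a : ℂ) (hr : r ≠ 0) (ζ : ℂ) : schwarzian (fun ζ => a + r * cexp (-ζ)) ζ = -1 / 2 := by
  have h := schw_affine cexp (α := r) (β := a) (c := 0) (r := -1) (by exact_mod_cast hr) (by norm_num) ζ
  have h2 : schwarzian cexp (0 + -1 * ζ) = -1 / 2 := by
    simp only [schwarzian, Complex.deriv_exp]
    rw [div_self (Complex.exp_ne_zero _)]; norm_num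
  rw [h2] at h
  convert! h using 1
  · congr 1; ext ζ; simp; ring
  · norm_num

lemma Cov.tr_sq (hc : Cov F P S M) (hr : 0 < r) (hS : ∀ w, w ≠ a → ‖w - a‖ < r → w ∉ S)
    (hg : Trt F P a r g) {ζ : ℂ} (hζ : ζ ∈ HP) :
    deriv F (g ζ) * deriv g ζ = - (r * cexp (-ζ)) ∧
    schwarzian F (g ζ) * deriv g ζ ^ 2 = -1 / 2 - schwarzian g ζ := by
  have hga : AnalyticAt ℂ g ζ := hg.diff.analyticAt (HP_open.mem_nhds hζ)
  have hFa := hc.an _ (hg.nP ζ hζ)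
  have h1 : (fun ζ => F (g ζ)) =ᶠ[𝓝 ζ] fun ζ => a + r * cexp (-ζ) := by
    filter_upwards [HP_open.mem_nhds hζ] with x hx using hg.eq x hx
  have h2 : HasDerivAt (fun ζ => F (g ζ)) (deriv F (g ζ) * deriv g ζ) ζ :=
    hFa.differentiableAt.hasDerivAt.comp ζ hga.differentiableAt.hasDerivAt
  have h3 : HasDerivAt (fun ζ => a + r * cexp (-ζ)) (-(r * cexp (-ζ))) ζ := by
    convert! (((hasDerivAt_neg ζ).cexp).const_mul (r:ℂ)).const_add a using 1; ring
  have h4 := h2.unique (h3.congr_of_eventuallyEq h1)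
  refine ⟨h4, ?_⟩
  have h5 : deriv g ζ ≠ 0 := fun h => by
    rw [h, mul_zero, zero_eq_neg] at h4
    exact mul_ne_zero (by exact_mod_cast hr.ne') (Complex.exp_ne_zero _) h4
  have h6 := schw_comp hga hFa (hc.tr_dF hr hS hg hζ) h5
  rw [schw_congr h1, schw_aexp a hr.ne'] at h6
  linear_combination -h6

end

section
variable {F F2 B : ℂ → ℂ} {P P2 S S2 U : Set ℂ} {M : ℕ} {r R0 β η : ℝ}

lemma follow {c c' : ℝ → ℂ} {L Λ : ℝ} (hΛ0 : 0 ≤ Λ) (hc : ContinuousOn c (Icc 0 L))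
    (hd : ∀ t ∈ Ico 0 L, HasDerivWithinAt c (c' t) (Ici t) t)
    (hb : ∀ t ∈ Ico 0 L, ‖c t - c 0‖ < η → ‖c' t‖ < Λ) (hΛ : Λ * L < η) :
    ∀ t ∈ Icc 0 L, ‖c t - c 0‖ ≤ Λ * t := by
  refine image_norm_le_of_norm_deriv_right_lt_deriv_boundary (f' := c') (B' := fun _ => Λ)
    (hc.sub continuousOn_const) (fun t ht => (hd t ht).sub_const _) (by simp)
    (fun x => by simpa using (hasDerivAt_id x).const_mul Λ) (fun t ht h => hb t ht ?_)
  rw [show ‖c t - c 0‖ = Λ * t from h]; exact lt_of_le_of_lt (mul_le_mul_of_nonneg_left ht.2.le hΛ0) hΛ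

structure Env (F : ℂ → ℂ) (P S : Set ℂ) (M : ℕ) (r R0 : ℝ) (F2 : ℂ → ℂ) (P2 S2 : Set ℂ) : Prop where
  c : Cov F P S M
  c2 : Cov F2 P2 S2 M
  hr : 0 < r
  hR : 0 < R0
  sep : ∀ a ∈ S, ∀ w, w ≠ a → ‖w - a‖ < r → w ∉ S
  bd : ∀ a ∈ S, ‖a‖ ≤ R0
  bd2 : ∀ w, ‖w‖ < R0⁻¹ → w ∉ S2
  inv : ∀ z, z ∉ P2 → F z = (F2 z)⁻¹
  inv2 : ∀ z, z ∉ P2 → (z ∈ P ↔ F2 z = 0)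
  inv3 : ∀ z ∈ P2, z ∉ P ∧ F z = 0
  ub : ∀ R C : ℝ, ∃ z, R < ‖z‖ ∧ (z ∈ P ∨ C < ‖F z‖)

def Reg (F : ℂ → ℂ) (P : Set ℂ) (B : ℂ → ℂ) (β : ℝ) (U : Set ℂ) : Prop :=
  ∀ τ ∈ U, τ ∉ P → deriv F τ ≠ 0 ∧ schwarzian F τ = 2 * B τ ∧ β ≤ ‖B τ‖

lemma sq_bd {x y s c : ℝ} (hs : 0 < s) (hx : 0 ≤ x) (hc : 0 ≤ c) (h : s * x ^ 2 ≤ y) (hy : y ≤ c ^ 2) :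
    x ≤ c / √s := by
  rw [le_div_iff₀ (Real.sqrt_pos.2 hs)]
  refine le_of_sq_le_sq ?_ hc |>.trans le_rfl
  rw [mul_pow, Real.sq_sqrt hs.le]; linarith

lemma branch_bd {G : ℂ → ℂ} {w0 b : ℂ} {s : ℝ} (hs : 0 < s) (hβ : 0 < β) (hFa : AnalyticAt ℂ F (G w0))
    (hG : DifferentiableOn ℂ G (ball w0 s)) (hFG : ∀ w ∈ ball w0 s, F (G w) = w)
    (hd : deriv F (G w0) ≠ 0) (hS : schwarzian F (G w0) = 2 * b) (hb : β ≤ ‖b‖) :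
    deriv F (G w0) * deriv G w0 = 1 ∧ ‖deriv G w0‖ ≤ 6 / s / √β := by
  have hw := Metric.ball_mem_nhds w0 hs
  have hGa : AnalyticAt ℂ G w0 := hG.analyticAt hw
  have h1 : (fun w => F (G w)) =ᶠ[𝓝 w0] id := by filter_upwards [hw] with w h using hFG w h
  have h2 : HasDerivAt (fun w => F (G w)) (deriv F (G w0) * deriv G w0) w0 :=
    hFa.differentiableAt.hasDerivAt.comp w0 hGa.differentiableAt.hasDerivAt
  have h4 := h2.unique ((hasDerivAt_id w0).congr_of_eventuallyEq h1)
  refine ⟨h4, ?_⟩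
  have h5 : deriv G w0 ≠ 0 := right_ne_zero_of_mul (h4 ▸ one_ne_zero)
  have h6 := schw_comp hGa hFa hd h5
  rw [schw_congr h1, hS] at h6
  have h7 : schwarzian id w0 = 0 := by
    have : deriv (id : ℂ → ℂ) = fun _ => 1 := by ext; simp
    simp [schwarzian, this]
  have h8 := schw_bound hs hG (fun x hx y hy h => by rw [← hFG x hx, h, hFG y hy])
  have h9 : schwarzian G w0 = -(2 * b * deriv G w0 ^ 2) := by linear_combination h7 - h6
  rw [h9, norm_neg, norm_mul, norm_mul, norm_pow, Complex.norm_two] at h8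
  refine sq_bd hβ (norm_nonneg _) (by positivity) (y := 36 / s ^ 2) ?_ (by rw [div_pow]; norm_num)
  have h10 : 72 / s ^ 2 = 2 * (36 / s ^ 2) := by ring
  nlinarith [sq_nonneg ‖deriv G w0‖, mul_le_mul_of_nonneg_right hb (sq_nonneg ‖deriv G w0‖)]

def Deep (F : ℂ → ℂ) (P S : Set ℂ) (r : ℝ) (X1 : ℝ) (τ : ℂ) : Prop :=
  ∃ a ∈ S, ∃ g, Trt F P a r g ∧ Tendsto (fun ζ => ‖g ζ‖) (comap Complex.re atTop) atTop ∧
    ∃ ζ, X1 ≤ ζ.re ∧ g ζ = τ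

variable {a : ℂ} {g : ℂ → ℂ}

lemma Cov.tr_dbd (hc : Cov F P S M) (hr : 0 < r) (hS : ∀ w, w ≠ a → ‖w - a‖ < r → w ∉ S)
    (hg : Trt F P a r g) (hβ : 0 < β) (hreg : Reg F P B β U) {ζ : ℂ} (hζ : π ≤ ζ.re) (hU : g ζ ∈ U) :
    ‖deriv g ζ‖ ≤ 3 / √β := by
  have hH : ζ ∈ HP := lt_of_lt_of_le Real.pi_pos hζ
  obtain ⟨h1, h2, h3⟩ := hreg _ hU (hg.nP ζ hH)
  have h4 := (hc.tr_sq hr hS hg hH).2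
  obtain ⟨h5, h6⟩ := hc.tr_injdisc hr hS hg hζ
  have h7 := schw_bound Real.pi_pos (hg.diff.mono h5) h6
  rw [h2] at h4
  have h8 : ‖2 * B (g ζ) * deriv g ζ ^ 2‖ ≤ 1 / 2 + 72 / π ^ 2 := by
    rw [h4]; refine (norm_sub_le _ _).trans (add_le_add (by norm_num) h7)
  rw [norm_mul, norm_mul, norm_pow, Complex.norm_two] at h8
  have h9 : 72 / π ^ 2 ≤ 8 := by
    rw [div_le_iff₀ (by positivity)]; nlinarith [Real.pi_gt_three]
  refine sq_bd hβ (norm_nonneg _) (by norm_num) (y := 9) ?_ (by norm_num)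
  nlinarith [sq_nonneg ‖deriv g ζ‖, mul_le_mul_of_nonneg_right h3 (sq_nonneg ‖deriv g ζ‖)]

lemma Env.claimB (h : Env F P S M r R0 F2 P2 S2) {X1 : ℝ} (hX1 : 4 ≤ X1) (hη : 0 < η) (hβ : 0 < β) {τ0 : ℂ}
    (hreg : Reg F P B β (ball τ0 (2 * η))) (hK : 100 * M < √β * η)
    (hN : ∀ τ ∈ ball τ0 η, ¬ Deep F P S r X1 τ) {τ : ℂ} (hτ : τ ∈ ball τ0 η) (hP : τ ∉ P) :
    1 ≤ (12 / (r * rexp (-X1)) / √β) * ‖deriv F τ‖ := by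
  have hr := h.hr
  have hsβ := Real.sqrt_pos.2 hβ
  have hsub : ball τ0 η ⊆ ball τ0 (2 * η) := Metric.ball_subset_ball (by linarith)
  set r1 := r * rexp (-X1)
  have hr1 : 0 < r1 := by positivity
  have hr1' : r1 ≤ r / 2 := by
    have h1 : rexp (-X1) ≤ 1 / 2 := by
      rw [Real.exp_neg, one_div]
      exact inv_anti₀ two_pos (by linarith [Real.add_one_le_exp X1])
    simp only [r1]; nlinarith
  have fin : ∀ τ ∈ ball τ0 η, τ ∉ P → ∀ G : ℂ → ℂ, ∀ s, r1 / 2 ≤ s → DifferentiableOn ℂ G (ball (F τ) s) →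
      (∀ w ∈ ball (F τ) s, F (G w) = w) → G (F τ) = τ → 1 ≤ (12 / r1 / √β) * ‖deriv F τ‖ := by
    intro τ hτ hP G s hs hG hFG hGτ
    obtain ⟨h1, h2, h3⟩ := hreg τ (hsub hτ) hP
    obtain ⟨h4, h5⟩ := branch_bd (s := s) (F := F) (G := G) (w0 := F τ) (b := B τ) (by linarith) hβ
      (by rw [hGτ]; exact h.c.an τ hP) hG hFG (by rwa [hGτ]) (by rwa [hGτ]) h3
    rw [hGτ] at h4
    have h6 : ‖deriv F τ‖ * ‖deriv G (F τ)‖ = 1 := by rw [← norm_mul, h4, norm_one]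
    have h7 : 6 / s / √β ≤ 12 / r1 / √β := by
      refine div_le_div_of_nonneg_right ?_ hsβ.le
      rw [div_le_div_iff₀ (by linarith) hr1]; linarith
    rw [← h6, mul_comm]
    exact mul_le_mul_of_nonneg_right (h5.trans h7) (norm_nonneg _)
  have c1 : ∀ τ ∈ ball τ0 η, τ ∉ P → ∀ a ∈ S, F τ ≠ a → ‖F τ - a‖ < r1 →
      1 ≤ (12 / r1 / √β) * ‖deriv F τ‖ := by
    intro τ hτ hP a ha hne hlt
    obtain ⟨g, hg, ζ, hζ, hgζ⟩ := h.c.tr_exists hr (h.sep a ha) hP hne (by linarith)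
    have hre : X1 ≤ ζ.re := by
      rw [← hgζ, hg.eq ζ hζ, add_sub_cancel_left, norm_mul, Complex.norm_exp, Complex.norm_real,
        Real.norm_eq_abs, abs_of_pos hr, mul_lt_mul_iff_right₀ hr, Real.exp_lt_exp] at hlt
      simp at hlt; linarith
    rcases h.c.tr_dich hg with hi | ⟨z1, hz1, hFz, hi⟩
    · exact absurd ⟨a, ha, g, hg, hi, ζ, hre, hgζ⟩ (hN τ hτ)
    obtain ⟨q, hq, hqM, hq1, hper⟩ := h.c.tr_per hr (h.sep a ha) hg hz1 hFz hi
    have hpi : π ≤ ζ.re := by linarith [Real.pi_lt_four]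
    have hq0 : (0:ℝ) < q := by exact_mod_cast hq
    have hqM' : (q:ℝ) ≤ M := by exact_mod_cast hqM
    have hL : 4 / √β * (2 * π * q) < η := by
      rw [div_mul_eq_mul_div, div_lt_iff₀ hsβ]
      nlinarith [Real.pi_lt_four, Real.pi_pos]
    have hD : ∀ s ∈ Icc (0:ℝ) (2 * π * q), ‖g (ζ + s * I) - g (ζ + (0:ℝ) * I)‖ ≤ 4 / √β * s := by
      have hmem : ∀ s : ℝ, ζ + s * I ∈ HP := fun s => by simpa [HP] using hζ
      have hdd : ∀ s : ℝ, HasDerivAt (fun s : ℝ => g (ζ + s * I)) (deriv g (ζ + s * I) * I) s := by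
        intro s
        have h1 := (tr_diffAt hg (hmem s)).hasDerivAt
        have h2 : HasDerivAt (fun s : ℝ => ζ + s * I) I s := by
          simpa using ((Complex.ofRealCLM.hasDerivAt (x := s)).mul_const I).const_add ζ
        exact h1.comp s h2
      refine follow (η := η) (by positivity) (fun s _ => (hdd s).continuousAt.continuousWithinAt)
        (fun s _ => (hdd s).hasDerivWithinAt) (fun s _ hlt => ?_) hL
      rw [norm_mul, Complex.norm_I, mul_one]
      refine lt_of_le_of_lt (h.c.tr_dbd hr (h.sep a ha) hg hβ hreg (by simpa using hpi) ?_)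
        (div_lt_div_of_pos_right (by norm_num) hsβ)
      rw [Complex.ofReal_zero, zero_mul, add_zero, hgζ] at hlt
      rw [mem_ball_iff_norm] at hτ ⊢
      calc _ ≤ ‖g (ζ + s * I) - τ‖ + ‖τ - τ0‖ := norm_sub_le_norm_sub_add_norm_sub _ _ _
        _ < _ := by linarith
    have hz1b := tr_max hg hz1 hi hq hper hζ (D := η) fun s hs => by
      have h1 := hD s hs
      rw [Complex.ofReal_zero, zero_mul, add_zero] at h1
      exact h1.trans ((mul_le_mul_of_nonneg_left hs.2 (by positivity)).trans hL.le)
    have hz1d : deriv F z1 ≠ 0 := (hreg z1 (by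
      rw [hgζ] at hz1b
      rw [mem_ball_iff_norm] at hτ ⊢
      calc _ ≤ ‖z1 - τ‖ + ‖τ - τ0‖ := norm_sub_le_norm_sub_add_norm_sub _ _ _
        _ < _ := by linarith) hz1).1
    have hq1' := hq1 hz1d
    subst hq1'
    obtain ⟨G, hG1, hG2, hG3⟩ := tr_branch hr hg hz1 hFz hi (by simpa using hper)
    have hsb : ball (F τ) (r1 / 2) ⊆ ball a r :=
      Metric.ball_subset_ball' (by rw [dist_eq_norm]; linarith)
    exact fin τ hτ hP G (r1 / 2) le_rfl (hG1.mono hsb) (fun w hw => hG2 w (hsb hw)) (by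
      have := hG3 ζ hζ; rwa [hgζ] at this)
  by_cases hex : ∃ a ∈ S, ‖F τ - a‖ < r1
  · obtain ⟨a, ha, hlt⟩ := hex
    by_cases hne : F τ = a
    · have hFa := h.c.an τ hP
      have e1 := (hFa.differentiableAt.hasDerivAt.eventually_ne (hreg τ (hsub hτ) hP).1 (c := a))
      have e2 : ∀ᶠ w in 𝓝 τ, w ∈ ball τ0 η ∧ w ∉ P ∧ ‖F w - a‖ < r1 := by
        filter_upwards [Metric.isOpen_ball.mem_nhds hτ, h.c.closed.isOpen_compl.mem_nhds hP,
          (hFa.continuousAt.sub continuousAt_const).norm.eventually_lt continuousAt_const hlt]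
          with w h1 h2 h3 using ⟨h1, h2, h3⟩
      refine ge_of_tendsto (x := 𝓝[≠] τ) ((hFa.deriv.continuousAt.norm.const_mul
        (12 / r1 / √β)).tendsto.mono_left nhdsWithin_le_nhds) ?_
      filter_upwards [e1, nhdsWithin_le_nhds e2] with w h1 h2
      exact c1 w h2.1 h2.2.1 a ha h1 h2.2.2
    · exact c1 τ hτ hP a ha hne hlt
  · push Not at hex
    obtain ⟨G, h1, h2, h3⟩ := h.c.lift_convex (convex_ball (F τ) r1) Metric.isOpen_ball (e := id)
      differentiableOn_id (fun w hw hwS => by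
        have := hex _ hwS
        rw [mem_ball_iff_norm, norm_sub_rev] at hw
        simp at this; linarith) (Metric.mem_ball_self hr1) hP rfl
    exact fin τ hτ hP G r1 (by linarith) h1 (fun w hw => (h3 w hw).2) h2

lemma mid_path (w0 v : ℂ) (s : ℝ) : HasDerivAt (fun s : ℝ => w0 + s * v) v s := by
  simpa using ((Complex.ofRealCLM.hasDerivAt (x := s)).mul_const v).const_add w0

lemma Env.start (h : Env F P S M r R0 F2 P2 S2) (hη : 0 < η) (hβ : 0 < β) {τ0 : ℂ}
    (hreg2 : Reg F2 P2 B β (ball τ0 (2 * η))) (hK : 100 < √β * η) :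
    ∃ τ ∈ ball τ0 (η / 2), τ ∉ P ∧ ‖F τ‖ ≤ 2 * R0 := by
  have hR := h.hR
  have hsβ := Real.sqrt_pos.2 hβ
  by_cases h0 : τ0 ∉ P ∧ ‖F τ0‖ ≤ 2 * R0
  · exact ⟨τ0, Metric.mem_ball_self (by linarith), h0⟩
  have hP2 : τ0 ∉ P2 := fun hh => h0 ⟨(h.inv3 τ0 hh).1, by rw [(h.inv3 τ0 hh).2]; simp; linarith⟩
  have hR2 : (2 * R0)⁻¹ < R0⁻¹ := inv_strictAnti₀ hR (by linarith)
  have hRh : (2 * R0)⁻¹ = R0⁻¹ / 2 := by rw [mul_inv]; ring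
  have hRp : 0 < (2 * R0)⁻¹ := by positivity
  have hlt : ‖F2 τ0‖ ≤ (2 * R0)⁻¹ := by
    by_cases hz : F2 τ0 = 0
    · rw [hz, norm_zero]; positivity
    have hP : τ0 ∉ P := fun hh => hz ((h.inv2 τ0 hP2).1 hh)
    rw [h.inv τ0 hP2, norm_inv] at h0
    have h1 : 2 * R0 < ‖F2 τ0‖⁻¹ := by
      by_contra hh; exact h0 ⟨hP, not_lt.1 hh⟩
    exact (lt_inv_of_lt_inv₀ (by positivity) h1).le
  obtain ⟨G, hG1, hG2, hG3⟩ := h.c2.lift_convex (convex_ball (0:ℂ) R0⁻¹) Metric.isOpen_ball (e := id)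
    differentiableOn_id (fun w hw => h.bd2 w (mem_ball_zero_iff.1 hw))
    (mem_ball_zero_iff.2 (hlt.trans_lt hR2)) hP2 rfl
  set u0 := F2 τ0
  set u1 : ℂ := (((2 * R0)⁻¹ : ℝ) : ℂ)
  have hu1 : ‖u1‖ = (2 * R0)⁻¹ := by simp [u1, abs_of_pos hR]
  have hseg : ∀ t ∈ Icc (0:ℝ) 1, ‖u0 + t * (u1 - u0)‖ ≤ (2 * R0)⁻¹ := by
    intro t ht
    have := (convex_closedBall (0:ℂ) (2 * R0)⁻¹).add_smul_sub_mem (x := u0) (y := u1)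
      (by simpa using hlt) (by simp [hu1]) ht
    simpa using this
  have hsb : ∀ t ∈ Icc (0:ℝ) 1, ball (u0 + t * (u1 - u0)) ((2 * R0)⁻¹) ⊆ ball 0 R0⁻¹ := fun t ht =>
    Metric.ball_subset_ball' (by rw [dist_zero_right]; linarith [hseg t ht])
  have hdd : ∀ t ∈ Icc (0:ℝ) 1, HasDerivAt (fun t : ℝ => G (u0 + t * (u1 - u0)))
      (deriv G (u0 + t * (u1 - u0)) * (u1 - u0)) t := fun t ht =>
    (hG1.differentiableAt (Metric.isOpen_ball.mem_nhds (hsb t ht (Metric.mem_ball_self hRp)))).hasDerivAt.comp t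
      (mid_path u0 (u1 - u0) t)
  have key := follow (η := η / 2) (Λ := 40 / √β) (L := 1) (by positivity) (fun t ht => (hdd t ht).continuousAt.continuousWithinAt)
    (fun t ht => (hdd t (Ico_subset_Icc_self ht)).hasDerivWithinAt) (fun t ht hlt => ?_)
    (by rw [mul_one, div_lt_iff₀ hsβ]; linarith) 1 (by simp)
  · simp only [Complex.ofReal_one, one_mul, add_sub_cancel, Complex.ofReal_zero, zero_mul, add_zero, hG2] at key
    have hm : u1 ∈ ball 0 R0⁻¹ := by rw [mem_ball_zero_iff, hu1]; exact hR2
    have hu10 : u1 ≠ 0 := norm_pos_iff.1 (hu1 ▸ hRp)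
    have hF2 : F2 (G u1) = u1 := (hG3 u1 hm).2
    refine ⟨G u1, ?_, fun hh => hu10 (hF2 ▸ (h.inv2 _ (hG3 u1 hm).1).1 hh), ?_⟩
    · rw [mem_ball_iff_norm]
      refine key.trans_lt ?_
      rw [mul_one, div_lt_iff₀ hsβ]; linarith
    · rw [h.inv _ (hG3 u1 hm).1, hF2, norm_inv, hu1, inv_inv]
  · simp only [Complex.ofReal_zero, zero_mul, add_zero, hG2] at hlt
    have ht' := Ico_subset_Icc_self ht
    set w := u0 + t * (u1 - u0)
    have hw := hG3 w (hsb t ht' (Metric.mem_ball_self hRp))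
    obtain ⟨h1, h2, h3⟩ := hreg2 (G w) (by rw [mem_ball_iff_norm]; linarith) hw.1
    have h4 := (branch_bd hRp hβ (h.c2.an _ hw.1) (hG1.mono (hsb t ht'))
      (fun x hx => (hG3 x (hsb t ht' hx)).2) h1 h2 h3).2
    have h5 : ‖u1 - u0‖ ≤ 2 * (2 * R0)⁻¹ := (norm_sub_le _ _).trans (by linarith)
    rw [norm_mul]
    calc _ ≤ 6 / (2 * R0)⁻¹ / √β * (2 * (2 * R0)⁻¹) := mul_le_mul h4 h5 (norm_nonneg _) (by positivity)
      _ = 12 / √β := by field_simp; norm_num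
      _ < _ := div_lt_div_of_pos_right (by norm_num) hsβ

lemma Env.deep (h : Env F P S M r R0 F2 P2 S2) {X1 : ℝ} (hX1 : 4 ≤ X1) (hη : 0 < η) (hβ : 0 < β) {τ0 : ℂ}
    (hreg : Reg F P B β (ball τ0 (2 * η))) (hreg2 : Reg F2 P2 B β (ball τ0 (2 * η)))
    (hK1 : 100 < √β * η) (hK : 100 * M < √β * η) (hK3 : 200 * R0 < r * rexp (-X1) * (√β * η)) :
    ∃ τ ∈ ball τ0 η, Deep F P S r X1 τ := by
  by_contra hN
  push Not at hN
  have hr := h.hr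
  have hR := h.hR
  have hsβ := Real.sqrt_pos.2 hβ
  have hB := fun τ (hτ : τ ∈ ball τ0 η) hP => h.claimB hX1 hη hβ hreg hK hN hτ hP
  set r1 := r * rexp (-X1)
  have hr1 : 0 < r1 := by positivity
  obtain ⟨τ1, hτ1, hτP, hτR⟩ := h.start hη hβ hreg2 hK1
  have hτ1' : τ1 ∈ ball τ0 (2 * η) := Metric.ball_subset_ball (by linarith) hτ1
  set W : Set ℂ := {z | z ∈ Pᶜ ∧ deriv F z ≠ 0}
  have hWo : IsOpen W := by
    rw [isOpen_iff_mem_nhds]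
    rintro z ⟨hz, hz'⟩
    filter_upwards [h.c.closed.isOpen_compl.mem_nhds hz, (h.c.an z hz).deriv.continuousAt.eventually_ne hz'] with w h1 h2
    exact ⟨h1, h2⟩
  obtain ⟨G, hG1, hG2, hG3⟩ := lift_gen hWo (fun z hz => h.c.an z hz.1) convex_univ isOpen_univ (e := id)
    differentiableOn_id (mem_univ (F τ1)) (⟨hτP, (hreg τ1 hτ1' hτP).1⟩ : τ1 ∈ W) rfl (fun z hz _ _ _ => hz.2) (by
    intro ζ _ T hT hT1 z hz hz0 hzl
    set w : ℝ → ℂ := fun t => F τ1 + t * (ζ - F τ1)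
    have hwc : ∀ t, HasDerivAt w (ζ - F τ1) t := mid_path _ _
    have hwt : Tendsto (fun t => F (z t)) (𝓝[<] T) (𝓝 (w T)) := by
      refine ((hwc T).continuousAt.tendsto.mono_left nhdsWithin_le_nhds).congr' ?_
      filter_upwards [Ico_mem_nhdsLT hT] with t ht using (hzl t ht).2.symm
    by_cases hTS : w T ∈ S
    · have hnorm : ‖ζ - F τ1‖ * T ≤ 3 * R0 := by
        have h1 : ‖(T:ℂ) * (ζ - F τ1)‖ ≤ ‖w T‖ + ‖F τ1‖ := by
          rw [show (T:ℂ) * (ζ - F τ1) = w T - F τ1 by simp [w]]; exact norm_sub_le _ _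
        rw [norm_mul, Complex.norm_real, Real.norm_eq_abs, abs_of_pos hT] at h1
        linarith [h.bd _ hTS]
      set Λ0 := 12 / r1 / √β
      have hΛ0 : 0 < Λ0 := by positivity
      set d := ‖ζ - F τ1‖
      have hd0 : 0 ≤ d := norm_nonneg _
      have hη2 : Λ0 * (4 * R0) < η / 2 := by
        simp only [Λ0]
        rw [div_div, div_mul_eq_mul_div, div_lt_iff₀ (by positivity)]
        nlinarith
      have hLT : Λ0 * (d + R0 / T) * T < η / 2 := by
        have : Λ0 * (d + R0 / T) * T = Λ0 * (d * T + R0) := by field_simp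
        rw [this]
        refine lt_of_le_of_lt (mul_le_mul_of_nonneg_left ?_ hΛ0.le) hη2
        linarith
      have key : ∀ t ∈ Ico 0 T, ‖z t - z 0‖ ≤ η / 2 := by
        intro t ht
        have hdz : ∀ s ∈ Ico 0 t, HasDerivWithinAt z ((deriv F (z s))⁻¹ * (ζ - F τ1)) (Ici s) s := by
          intro s hs
          have hsT : s ∈ Ico 0 T := ⟨hs.1, hs.2.trans ht.2⟩
          obtain ⟨⟨hs1, hs2⟩, hs3⟩ := hzl s hsT
          have hst := (h.c.an _ hs1).hasStrictDerivAt
          have h1 := hst.eventually_left_inverse hs2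
          have h2 := (hst.to_localInverse hs2).hasDerivAt
          have hmem : Ico 0 T ∈ 𝓝[Ici s] s := by
            filter_upwards [Ico_mem_nhdsGE hsT.2] with x hx using ⟨hs.1.trans hx.1, hx.2⟩
          have hcz : ContinuousWithinAt z (Ici s) s := (hz s hsT).mono_of_mem_nhdsWithin hmem
          rw [hs3] at h2
          have h3 := (h2.comp s (hwc s)).hasDerivWithinAt (s := Ici s)
          refine h3.congr_of_eventuallyEq ?_ ?_
          · filter_upwards [hcz.eventually h1, hmem] with x hx1 hx2
            rw [← hx1, (hzl x hx2).2]; rfl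
          · conv_lhs => rw [← h1.self_of_nhds]
            rw [hs3]; rfl
        have hsub : Icc 0 t ⊆ Ico 0 T := fun x hx => ⟨hx.1, hx.2.trans_lt ht.2⟩
        have hΛp : 0 ≤ Λ0 * (d + R0 / T) := by positivity
        have := follow (η := η / 2) hΛp (hz.mono hsub) hdz (fun s hs hlt => by
            have hsT := hzl s (hsub (Ico_subset_Icc_self hs))
            have h1 := hB (z s) (by
              rw [hz0] at hlt
              rw [mem_ball_iff_norm] at hτ1 ⊢
              calc _ ≤ ‖z s - τ1‖ + ‖τ1 - τ0‖ := norm_sub_le_norm_sub_add_norm_sub _ _ _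
                _ < _ := by linarith) hsT.1.1
            rw [norm_mul, norm_inv]
            have h2 : 0 < ‖deriv F (z s)‖ := norm_pos_iff.2 hsT.1.2
            rw [inv_mul_lt_iff₀ h2]
            have h3 : 0 < R0 / T := by positivity
            calc d < d + R0 / T := by linarith
              _ ≤ (Λ0 * ‖deriv F (z s)‖) * (d + R0 / T) := le_mul_of_one_le_left (by positivity) h1
              _ = _ := by ring)
          ((mul_le_mul_of_nonneg_left ht.2.le hΛp).trans_lt hLT) t ⟨ht.1, le_rfl⟩
        exact this.trans ((mul_le_mul_of_nonneg_left ht.2.le hΛp).trans hLT.le)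
      rcases h.c.ext_end hT hz (fun t ht => (hzl t ht).1.1) hwt with hh | ⟨z1, h1, h2, h3⟩
      · exfalso
        obtain ⟨t, ht1, ht2⟩ := ((hh.2.eventually (eventually_gt_atTop (‖z 0‖ + η))).and (Ico_mem_nhdsLT hT)).exists
        have := norm_sub_norm_le (z t) (z 0)
        linarith [key t ht2]
      · refine ⟨z1, ⟨h1, (hreg z1 ?_ h1).1⟩, h3⟩
        have h4 : ‖z1 - z 0‖ ≤ η / 2 := by
          refine le_of_tendsto (h3.sub_const (z 0)).norm ?_
          filter_upwards [Ico_mem_nhdsLT hT] with t ht using key t ht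
        rw [hz0] at h4
        rw [mem_ball_iff_norm] at hτ1 ⊢
        calc _ ≤ ‖z1 - τ1‖ + ‖τ1 - τ0‖ := norm_sub_le_norm_sub_add_norm_sub _ _ _
          _ < _ := by linarith
    · rcases h.c.ext_end hT hz (fun t ht => (hzl t ht).1.1) hwt with hh | ⟨z1, h1, h2, h3⟩
      · exact absurd hh.1 hTS
      · exact ⟨z1, ⟨h1, fun hd => hTS (h2 ▸ h.c.crit z1 h1 hd)⟩, h3⟩)
  obtain ⟨h1, h2, h3⟩ := hreg τ1 hτ1' hτP
  have hFG : ∀ w, F (G w) = w := fun w => (hG3 w (mem_univ _)).2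
  have h5 : deriv G (F τ1) ≠ 0 := by
    have := (branch_bd (G := G) (w0 := F τ1) one_pos hβ (by rw [hG2]; exact h.c.an τ1 hτP) (hG1.mono (subset_univ _))
      (fun w _ => hFG w) (by rwa [hG2]) (by rwa [hG2]) h3).1
    exact right_ne_zero_of_mul (this ▸ one_ne_zero)
  have hpos := norm_pos_iff.2 h5
  set x := ‖deriv G (F τ1)‖
  have hs : 0 < 12 / √β / x := by positivity
  have := (branch_bd (G := G) (w0 := F τ1) hs hβ (by rw [hG2]; exact h.c.an τ1 hτP) (hG1.mono (subset_univ _))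
      (fun w _ => hFG w) (by rwa [hG2]) (by rwa [hG2]) h3).2
  have h6 : 6 / (12 / √β / x) / √β = x / 2 := by field_simp; norm_num
  rw [h6] at this
  linarith [show x ≤ x / 2 from this]

end

section
def En (b : ℝ) (τ : ℂ) : ℂ := 4 * b * cexp (τ / 2)
def pp (b : ℝ) (g : ℂ → ℂ) (ζ : ℂ) : ℂ := 2 * b * cexp (g ζ / 2) * deriv g ζ
structure Gm (g : ℂ → ℂ) (b X1 k κ : ℝ) : Prop where
  diff : DifferentiableOn ℂ g HP
  inj : InjOn g HP
  hb : 0 < b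
  hX : 0 < X1
  hκ : κ ≤ 1 / 10 ^ 11
  key : ∀ ζ, X1 ≤ ζ.re → ‖g ζ‖ < k → ‖pp b g ζ - I‖ ≤ κ ∨ ‖pp b g ζ + I‖ ≤ κ
variable {g : ℂ → ℂ} {b X1 k κ : ℝ}

lemma En_deriv (τ : ℂ) : HasDerivAt (En b) (2 * b * cexp (τ / 2)) τ := by
  have := (((hasDerivAt_id τ).div_const 2).cexp).const_mul (4 * b : ℂ)
  refine this.congr_deriv ?_
  simp; ring

lemma En_norm (hb : 0 < b) (τ : ℂ) : ‖En b τ‖ = 4 * b * rexp (τ.re / 2) := by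
  simp [En, Complex.norm_exp, abs_of_pos hb]

lemma En_im (τ : ℂ) : (En b τ).im = 4 * b * (rexp (τ.re / 2) * Real.sin (τ.im / 2)) := by
  have : En b τ = ((4 * b : ℝ) : ℂ) * cexp (τ / 2) := by simp [En]
  rw [this, Complex.im_ofReal_mul, Complex.exp_im]; simp

lemma exp_lo {x : ℝ} (hx : -21 ≤ x) : 1 / 177147 ≤ rexp (x / 2) := by
  have h1 : rexp (-11) ≤ rexp (x / 2) := Real.exp_le_exp.2 (by linarith)
  have h2 : rexp 11 ≤ 3 ^ 11 := by
    rw [show (11:ℝ) = (11:ℕ) * 1 by norm_num, Real.exp_nat_mul]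
    exact pow_le_pow_left₀ (Real.exp_pos _).le (by linarith [Real.exp_one_lt_d9]) 11
  refine le_trans ?_ h1
  rw [Real.exp_neg, one_div]; exact inv_anti₀ (Real.exp_pos _) (h2.trans (by norm_num))

lemma exp_hi {x : ℝ} (hx : x ≤ 4) : rexp (x / 2) ≤ 8 := by
  have h1 : rexp (x / 2) ≤ rexp 2 := Real.exp_le_exp.2 (by linarith)
  have h2 : rexp 2 = rexp 1 ^ 2 := by rw [← Real.exp_nat_mul]; norm_num
  nlinarith [Real.exp_one_lt_d9, Real.exp_pos 1]

lemma pm_near {z : ℂ} {σ κ : ℝ} (hσ : σ = 1 ∨ σ = -1) (h : ‖z - I‖ ≤ κ ∨ ‖z + I‖ ≤ κ)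
    (hκ : κ ≤ 1 / 2) (hz : ‖z - σ * I‖ < 1) : ‖z - σ * I‖ ≤ κ := by
  have h2 : ‖(2:ℂ) * I‖ = 2 := by simp
  rcases hσ with rfl | rfl <;> rcases h with h | h
  · simpa using h
  · exfalso
    have := norm_sub_le (z + I) (z - (1:ℝ) * I)
    rw [show z + I - (z - (1:ℝ) * I) = 2 * I by push_cast; ring, h2] at this
    linarith
  · exfalso
    have := norm_sub_le (z - (-1:ℝ) * I) (z - I)
    rw [show z - ((-1:ℝ):ℂ) * I - (z - I) = 2 * I by push_cast; ring, h2] at this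
    push_cast at hz this; linarith
  · simpa using h

lemma exp_sub_one_lo {w : ℂ} (h : ‖w‖ ≤ 1 / 2) : ‖w‖ / 2 ≤ ‖cexp w - 1‖ := by
  have h1 := Complex.norm_exp_sub_one_sub_id_le (x := w) (by linarith)
  have h2 := norm_sub_le (cexp w - 1) (cexp w - 1 - w)
  rw [sub_sub_cancel] at h2
  nlinarith [norm_nonneg w]

lemma Gm.da (G : Gm g b X1 k κ) {ζ : ℂ} (h : X1 ≤ ζ.re) : AnalyticAt ℂ g ζ :=
  G.diff.analyticAt (HP_open.mem_nhds (show 0 < ζ.re from G.hX.trans_le h))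

lemma Gm.ppc (G : Gm g b X1 k κ) {ζ : ℂ} (h : X1 ≤ ζ.re) : ContinuousAt (pp b g) ζ :=
  (continuousAt_const.mul ((G.da h).continuousAt.div_const 2).cexp).mul (G.da h).deriv.continuousAt

lemma Gm.seg (G : Gm g b X1 k κ) {σ : ℝ} (hσ : σ = 1 ∨ σ = -1) {ζ1 d : ℂ} (h1 : X1 ≤ ζ1.re)
    (hs : ‖pp b g ζ1 - σ * I‖ ≤ κ) (hd : ‖d‖ ≤ 25)
    (hx : ∀ t ∈ Icc (0:ℝ) 1, -21 ≤ (g ζ1 + t * d).re ∧ (g ζ1 + t * d).re ≤ 4 ∧ ‖g ζ1 + t * d‖ + 1 < k)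
    (hZ : ∀ t ∈ Icc (0:ℝ) 1, X1 ≤ (ζ1 - σ * I * (En b (g ζ1 + t * d) - En b (g ζ1))).re) :
    ∀ t ∈ Icc (0:ℝ) 1, ‖g (ζ1 - σ * I * (En b (g ζ1 + t * d) - En b (g ζ1))) - (g ζ1 + t * d)‖ ≤ 1 / 1000
      ∧ ‖pp b g (ζ1 - σ * I * (En b (g ζ1 + t * d) - En b (g ζ1))) - σ * I‖ ≤ κ := by
  have hb := G.hb
  have hκ := G.hκ
  have hκ0 : 0 ≤ κ := (norm_nonneg _).trans hs
  have hσ2 : (σ:ℂ) ^ 2 = 1 := by rcases hσ with rfl | rfl <;> norm_num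
  set τ : ℝ → ℂ := fun t => g ζ1 + t * d with hτ
  set Z : ℝ → ℂ := fun t => ζ1 - σ * I * (En b (τ t) - En b (g ζ1)) with hZd
  have dτ : ∀ t, HasDerivAt τ d t := mid_path _ _
  have dE : ∀ t, HasDerivAt (fun t => En b (τ t)) (2 * b * cexp (τ t / 2) * d) t := fun t => by
    exact ((En_deriv (b := b) (τ t)).scomp t (dτ t)).congr_deriv (by rw [smul_eq_mul, mul_comm])
  have dZ : ∀ t, HasDerivAt Z (-(σ * I * (2 * b * cexp (τ t / 2) * d))) t := fun t => by
    simpa [hZd] using (((dE t).sub_const (En b (g ζ1))).const_mul (σ * I)).const_sub ζ1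
  have du : ∀ t ∈ Icc (0:ℝ) 1, HasDerivAt (fun t => En b (g (Z t)) - En b (τ t))
      (-(σ * I) * (pp b g (Z t) - σ * I) * (2 * b * cexp (τ t / 2) * d)) t := fun t ht => by
    have h := (((En_deriv (b := b) (g (Z t))).comp (Z t) (G.da (hZ t ht)).differentiableAt.hasDerivAt).scomp t (dZ t)).sub (dE t)
    refine h.congr_deriv ?_
    simp only [smul_eq_mul, pp]
    linear_combination (2 * b * cexp (τ t / 2) * d) * (-(σ:ℂ) ^ 2 * Complex.I_sq + hσ2)
  have cg : ContinuousOn (fun t => g (Z t)) (Icc 0 1) := fun t ht =>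
    ((G.da (hZ t ht)).continuousAt.comp (f := Z) (dZ t).continuousAt).continuousWithinAt
  have cτ : Continuous τ := continuous_iff_continuousAt.2 fun t => (dτ t).continuousAt
  have cv : ContinuousOn (fun t => ‖g (Z t) - τ t‖) (Icc 0 1) := (cg.sub cτ.continuousOn).norm
  have cp : ContinuousOn (fun t => ‖pp b g (Z t) - σ * I‖) (Icc 0 1) := fun t ht =>
    (((G.ppc (hZ t ht)).comp (f := Z) (dZ t).continuousAt).sub continuousAt_const).norm.continuousWithinAt
  have cu : ContinuousOn (fun t => ‖En b (g (Z t)) - En b (τ t)‖ - κ * (400 * b) * t) (Icc 0 1) := fun t ht =>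
    ((du t ht).continuousAt.norm.sub (continuousAt_const.mul continuousAt_id)).continuousWithinAt
  have key : Icc (0:ℝ) 1 ⊆ {t | ‖En b (g (Z t)) - En b (τ t)‖ - κ * (400 * b) * t ≤ 0 ∧
      ‖g (Z t) - τ t‖ ≤ 1 / 1000 ∧ ‖pp b g (Z t) - σ * I‖ ≤ κ} := by
    refine IsClosed.Icc_subset_of_forall_exists_gt ?_ ?_ ?_
    · have e := (cu.preimage_isClosed_of_isClosed isClosed_Icc isClosed_Iic (t := Iic 0)).inter
        ((cv.preimage_isClosed_of_isClosed isClosed_Icc isClosed_Iic (t := Iic (1/1000))).inter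
        (cp.preimage_isClosed_of_isClosed isClosed_Icc isClosed_Iic (t := Iic κ)))
      convert! e using 1
      ext t; simp only [mem_inter_iff, mem_preimage, mem_ofPred_eq, mem_Iic]; tauto
    · have : Z 0 = ζ1 := by simp [hZd, hτ]
      have h0 : τ 0 = g ζ1 := by simp [hτ]
      simp only [mem_ofPred_eq, this, h0, sub_self, norm_zero]
      exact ⟨by simp, by norm_num, hs⟩
    · rintro x ⟨⟨hx1, hx2, hx3⟩, hx0⟩ y hy
      have hxI : x ∈ Icc (0:ℝ) 1 := ⟨hx0.1, hx0.2.le⟩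
      have e1 : ∀ᶠ t in 𝓝[Icc 0 1] x, ‖g (Z t) - τ t‖ < 1 / 2 :=
        (cv x hxI).eventually (gt_mem_nhds (lt_of_le_of_lt hx2 (by norm_num)))
      have e2 : ∀ᶠ t in 𝓝[Icc 0 1] x, ‖pp b g (Z t) - σ * I‖ < 1 :=
        (cp x hxI).eventually (gt_mem_nhds (lt_of_le_of_lt (hx3.trans hκ) (by norm_num)))
      obtain ⟨δ, hδ, hδ'⟩ := Metric.mem_nhdsWithin_iff.1 (e1.and e2)
      set t1 := min (min y 1) (x + δ / 2)
      have ht1 : x < t1 := lt_min (lt_min hy hx0.2) (by linarith)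
      have ht1' : t1 ≤ 1 := (min_le_left _ _).trans (min_le_right _ _)
      have ht1δ : t1 ≤ x + δ / 2 := min_le_right _ _
      have all : ∀ t ∈ Icc x t1, t ∈ Icc (0:ℝ) 1 ∧ ‖g (Z t) - τ t‖ < 1 / 2 ∧ ‖pp b g (Z t) - σ * I‖ ≤ κ := by
        intro t ht
        have hI : t ∈ Icc (0:ℝ) 1 := ⟨hx0.1.trans ht.1, ht.2.trans ht1'⟩
        obtain ⟨q1, q2⟩ := hδ' (show t ∈ ball x δ ∩ Icc 0 1 from ⟨by rw [Metric.mem_ball, Real.dist_eq, abs_of_nonneg (by linarith [ht.1])]; linarith [ht.2], hI⟩)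
        refine ⟨hI, q1, pm_near hσ (G.key _ (hZ t hI) ?_) (hκ.trans (by norm_num)) q2⟩
        have := norm_sub_norm_le (g (Z t)) (τ t)
        linarith [(hx t hI).2.2]
      have hu := norm_image_sub_le_of_norm_deriv_le_segment' (f := fun t => En b (g (Z t)) - En b (τ t)) (C := κ * (400 * b))
        (fun t ht => (du t (all t ht).1).hasDerivWithinAt) (fun t ht => by
          have ht' := all t ⟨ht.1, ht.2.le⟩
          rw [norm_mul, norm_mul, norm_neg, norm_mul, norm_mul, norm_mul, norm_mul, Complex.norm_exp]
          have : ‖(σ:ℂ)‖ = 1 := by rcases hσ with rfl | rfl <;> simp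
          rw [this, Complex.norm_I, Complex.norm_two, Complex.norm_real, Real.norm_of_nonneg hb.le, one_mul, one_mul]
          have e3 : (τ t / 2).re = (τ t).re / 2 := by simp
          rw [e3]
          refine mul_le_mul ht'.2.2 ?_ (by positivity) hκ0
          have e4 := exp_hi (hx t ht'.1).2.1
          have : 2 * b * rexp ((τ t).re / 2) * ‖d‖ ≤ 2 * b * 8 * 25 := by gcongr
          linarith) t1 ⟨ht1.le, le_rfl⟩
      obtain ⟨q0, q1, q2⟩ := all t1 ⟨ht1.le, le_rfl⟩
      have hu1 : ‖En b (g (Z t1)) - En b (τ t1)‖ - κ * (400 * b) * t1 ≤ 0 := by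
        have := norm_sub_norm_le (En b (g (Z t1)) - En b (τ t1)) (En b (g (Z x)) - En b (τ x))
        linarith
      refine ⟨t1, ⟨hu1, ?_, q2⟩, ht1, (min_le_left _ _).trans (min_le_left _ _)⟩
      have e5 : En b (g (Z t1)) - En b (τ t1) = En b (τ t1) * (cexp ((g (Z t1) - τ t1) / 2) - 1) := by
        simp only [En]; rw [show g (Z t1) / 2 = τ t1 / 2 + (g (Z t1) - τ t1) / 2 by ring, Complex.exp_add]; ring
      rw [e5, norm_mul, En_norm hb] at hu1
      have e6 := exp_lo (hx t1 q0).1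
      have e7 := exp_sub_one_lo (w := (g (Z t1) - τ t1) / 2) (by rw [norm_div, Complex.norm_two]; linarith)
      rw [norm_div, Complex.norm_two] at e7
      have e8 : 4 * b * (1 / 177147) * (‖g (Z t1) - τ t1‖ / 2 / 2) ≤ 1 / 10 ^ 11 * (400 * b) * 1 := by
        calc _ ≤ 4 * b * rexp ((τ t1).re / 2) * ‖cexp ((g (Z t1) - τ t1) / 2) - 1‖ := by gcongr
          _ ≤ κ * (400 * b) * t1 := by linarith
          _ ≤ _ := by have := q0.1; have := q0.2; gcongr
      rw [show 4 * b * (1 / 177147) * (‖g (Z t1) - τ t1‖ / 2 / 2) = b * (‖g (Z t1) - τ t1‖ / 177147) by ring,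
        show 1 / 10 ^ 11 * (400 * b) * 1 = b * (400 / 10 ^ 11) by ring] at e8
      have := le_of_mul_le_mul_left e8 hb
      linarith
  exact fun t ht => (key ht).2

lemma Z_re (σ : ℝ) (ζ1 A B : ℂ) : (ζ1 - σ * I * (A - B)).re = ζ1.re + σ * (A.im - B.im) := by
  simp [Complex.mul_re, Complex.mul_im]

lemma Gm.exact (G : Gm g b X1 k κ) {σ : ℝ} (hσ : σ = 1 ∨ σ = -1) {ζ1 d0 : ℂ} (h1 : X1 ≤ ζ1.re)
    (hs : ‖pp b g ζ1 - σ * I‖ ≤ κ) (hd : ‖d0‖ ≤ 24)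
    (hx : ∀ d, ‖d - d0‖ ≤ 1 / 10 → ∀ t ∈ Icc (0:ℝ) 1,
      -21 ≤ (g ζ1 + t * d).re ∧ (g ζ1 + t * d).re ≤ 4 ∧ ‖g ζ1 + t * d‖ + 1 < k)
    (hZ : ∀ d, ‖d - d0‖ ≤ 1 / 10 → ∀ t ∈ Icc (0:ℝ) 1,
      X1 ≤ ζ1.re + σ * ((En b (g ζ1 + t * d)).im - (En b (g ζ1)).im)) :
    ∃ ζ, X1 ≤ ζ.re ∧ g ζ = g ζ1 + d0 ∧ ‖pp b g ζ - σ * I‖ ≤ κ ∧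
      ∃ d, ‖d - d0‖ ≤ 1 / 1000 ∧ ζ.re = ζ1.re + σ * ((En b (g ζ1 + d)).im - (En b (g ζ1)).im) := by
  have hσ0 : (σ:ℂ) * I ≠ 0 := by rcases hσ with rfl | rfl <;> simp
  set Z : ℂ → ℂ := fun d => ζ1 - σ * I * (En b (g ζ1 + d) - En b (g ζ1)) with hZd
  have a1 : ∀ d, ‖d - d0‖ ≤ 1 / 10 → X1 ≤ (Z d).re ∧ ‖g (Z d) - (g ζ1 + d)‖ ≤ 1 / 1000 ∧ ‖pp b g (Z d) - σ * I‖ ≤ κ := by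
    intro d h
    have h2 := G.seg hσ h1 hs (d := d) (by linarith [norm_le_norm_add_norm_sub' d d0, norm_sub_rev d d0]) (hx d h)
      (fun t ht => by rw [Z_re]; exact hZ d h t ht) 1 (by simp)
    have h3 := hZ d h 1 (by simp)
    rw [← Z_re] at h3
    simp only [Complex.ofReal_one, one_mul] at h2 h3
    exact ⟨h3, h2⟩
  have dZ : ∀ d, HasDerivAt Z (-(σ * I * (2 * b * cexp ((g ζ1 + d) / 2)))) d := fun d => by
    have := ((((En_deriv (b := b) (g ζ1 + d)).comp_const_add (g ζ1) d).sub_const (En b (g ζ1))).const_mul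
      (σ * I)).const_sub ζ1
    exact this
  have hdiff : DifferentiableOn ℂ (fun d => g (Z d)) (closedBall d0 (1/10)) := fun d hd => by
    have := (a1 d (by simpa [dist_eq_norm] using hd)).1
    exact ((G.da this).differentiableAt.comp d (dZ d).differentiableAt).differentiableWithinAt
  have a0 := a1 d0 (by simp)
  have hb' : (b:ℂ) ≠ 0 := by exact_mod_cast G.hb.ne'
  have sub := DiffContOnCl.ball_subset_image_closedBall (z₀ := d0) (r := 1/10) (ε := 1/20) (f := fun d => g (Z d))
    (hdiff.diffContOnCl_ball subset_rfl) (by norm_num) (fun z hz => by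
      have hz' : ‖z - d0‖ = 1 / 10 := by simpa [dist_eq_norm] using hz
      have q := (a1 z hz'.le).2.1
      have : ‖z - d0‖ ≤ ‖g (Z z) - g (Z d0)‖ + ‖g (Z z) - (g ζ1 + z)‖ + ‖g (Z d0) - (g ζ1 + d0)‖ := by
        rw [show z - d0 = (g (Z z) - g (Z d0)) - (g (Z z) - (g ζ1 + z)) + (g (Z d0) - (g ζ1 + d0)) by ring]
        exact (norm_add_le _ _).trans (add_le_add_left (norm_sub_le _ _) _)
      show _ ≤ ‖g (Z z) - g (Z d0)‖
      linarith [a0.2.1]) (by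
      have e := (dZ d0).eventually_ne (c := Z d0) (by simp [hσ0, hb'])
      refine Eventually.frequently ?_ |>.filter_mono (nhdsWithin_le_nhds (s := {d0}ᶜ))
      filter_upwards [e, nhdsWithin_le_nhds (Metric.closedBall_mem_nhds d0 (by norm_num : (0:ℝ) < 1/10))] with z hz hz2 hh
      have := (a1 z (by simpa [dist_eq_norm] using hz2)).1
      exact hz (G.inj (show 0 < (Z z).re from G.hX.trans_le this) (show 0 < (Z d0).re from G.hX.trans_le a0.1) hh))
  obtain ⟨d, hd1, hd2⟩ := sub (show g ζ1 + d0 ∈ _ by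
    rw [Metric.mem_ball, dist_eq_norm, norm_sub_rev]; exact a0.2.1.trans_lt (by norm_num))
  have hd3 : ‖d - d0‖ ≤ 1 / 10 := by simpa [dist_eq_norm] using hd1
  obtain ⟨q1, q2, q3⟩ := a1 d hd3
  refine ⟨Z d, q1, hd2, q3, d, ?_, Z_re _ _ _ _⟩
  have hd2' : g (Z d) = g ζ1 + d0 := hd2
  rw [hd2', add_sub_add_left_eq_sub, norm_sub_rev] at q2; exact q2

lemma exp9 {x : ℝ} (hx : x ≤ -18) : rexp (x / 2) ≤ 1 / 7000 := by
  have h1 : rexp (x / 2) ≤ rexp (-9) := Real.exp_le_exp.2 (by linarith)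
  have h2 : (2.7:ℝ) ^ 9 ≤ rexp 9 := by
    rw [show (9:ℝ) = (9:ℕ) * 1 by norm_num, Real.exp_nat_mul]
    exact pow_le_pow_left₀ (by norm_num) (by linarith [Real.exp_one_gt_d9]) 9
  refine h1.trans ?_
  rw [Real.exp_neg, one_div]; exact inv_anti₀ (by norm_num) (le_trans (by norm_num) h2)

lemma En_small (hb : 0 < b) {τ : ℂ} (h : τ.re ≤ -18) {σ : ℝ} (hσ : σ = 1 ∨ σ = -1) : |σ * (En b τ).im| ≤ b / 1750 := by
  rw [abs_mul, show |σ| = 1 by rcases hσ with rfl | rfl <;> simp, one_mul]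
  refine (Complex.abs_im_le_norm _).trans ?_
  rw [En_norm hb]
  have := mul_le_mul_of_nonneg_left (exp9 h) (by linarith : 0 ≤ 4 * b)
  linarith

lemma Gm.depth (G : Gm g b X1 k κ) {σ : ℝ} (hσ : σ = 1 ∨ σ = -1) {ζ1 : ℂ} (h1 : X1 ≤ ζ1.re)
    (hs : ‖pp b g ζ1 - σ * I‖ ≤ κ) (hX : X1 ≤ b / 10 ^ 4) (hx : -19 ≤ (g ζ1).re) (hx' : (g ζ1).re ≤ 3)
    (hk : ‖g ζ1‖ + 50 < k) : ζ1.re ≤ σ * (En b (g ζ1)).im + b / 100 := by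
  by_contra hc
  push Not at hc
  have hb := G.hb
  set τ1 := g ζ1
  have l1 : ∀ t ∈ Icc (0:ℝ) 1, (τ1 + t * (-(τ1.re + 20) : ℝ)).re ≤ τ1.re ∧ -20 ≤ (τ1 + t * (-(τ1.re + 20) : ℝ)).re ∧
      (τ1 + t * (-(τ1.re + 20) : ℝ)).im = τ1.im := fun t ht => by
    rw [← Complex.ofReal_mul]; simp only [Complex.add_re, Complex.ofReal_re, Complex.add_im, Complex.ofReal_im, add_zero]
    refine ⟨by nlinarith [ht.1], by nlinarith [ht.1, ht.2], trivial⟩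
  have n1 : ‖((-(τ1.re + 20) : ℝ) : ℂ)‖ ≤ 23 := by
    rw [Complex.norm_real, Real.norm_eq_abs, abs_le]; constructor <;> linarith
  have l2 : ∀ t ∈ Icc (0:ℝ) 1, X1 ≤ ζ1.re + σ * ((En b (τ1 + t * (-(τ1.re + 20) : ℝ))).im - (En b τ1).im) := fun t ht => by
    obtain ⟨e1, e2, e3⟩ := l1 t ht
    set x := τ1 + t * (-(τ1.re + 20) : ℝ)
    have e4 : rexp (x.re / 2) ≤ rexp (τ1.re / 2) := Real.exp_le_exp.2 (by linarith)
    rw [En_im] at hc ⊢; rw [En_im, e3]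
    rcases le_total 0 (σ * Real.sin (τ1.im / 2)) with h | h
    · have : 0 ≤ 4 * b * (rexp (x.re / 2) * (σ * Real.sin (τ1.im / 2))) := by positivity
      linarith
    · have : 0 ≤ 4 * b * ((rexp (x.re / 2) - rexp (τ1.re / 2)) * (σ * Real.sin (τ1.im / 2))) :=
        mul_nonneg (by linarith) (mul_nonneg_of_nonpos_of_nonpos (by linarith) h)
      linarith
  obtain ⟨s1, s2⟩ := G.seg hσ h1 hs (d := (-(τ1.re + 20) : ℝ)) (n1.trans (by norm_num)) (fun t ht => by
    obtain ⟨e1, e2, e3⟩ := l1 t ht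
    refine ⟨by linarith, by linarith, ?_⟩
    have : ‖τ1 + t * (-(τ1.re + 20) : ℝ)‖ ≤ ‖τ1‖ + 1 * 23 := by
      refine (norm_add_le _ _).trans (add_le_add_right ?_ _)
      rw [norm_mul, Complex.norm_real, Real.norm_of_nonneg ht.1]
      exact mul_le_mul ht.2 n1 (norm_nonneg _) zero_le_one
    linarith) (fun t ht => by rw [Z_re]; exact l2 t ht) 1 (by simp)
  have l21 := l2 1 (by simp)
  have r2 := Z_re σ ζ1 (En b (τ1 + (1:ℝ) * (-(τ1.re + 20) : ℝ))) (En b τ1)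
  set ζ2 := ζ1 - σ * I * (En b (τ1 + (1:ℝ) * (-(τ1.re + 20) : ℝ)) - En b τ1)
  set τ2 := g ζ2
  rw [← r2] at l21
  have f1 : (τ1 + (1:ℝ) * (-(τ1.re + 20) : ℝ)).re = -20 := by
    rw [← Complex.ofReal_mul]; simp only [Complex.add_re, Complex.ofReal_re]; ring
  have f2 := abs_le.1 (En_small hb (by rw [f1]; norm_num : (τ1 + (1:ℝ) * (-(τ1.re + 20) : ℝ)).re ≤ -18) hσ)
  have f3 := abs_le.1 ((Complex.abs_re_le_norm _).trans s1)
  rw [Complex.sub_re, f1] at f3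
  have n4 : ‖(4 * π * I : ℂ)‖ ≤ 13 := by
    simp [abs_of_pos Real.pi_pos]; linarith [Real.pi_lt_d2]
  have f4 : ∀ t : ℝ, (τ2 + t * (4 * π * I)).re = τ2.re := fun t => by
    simp [Complex.mul_re, Complex.mul_im]
  have f5 : ‖τ2‖ ≤ ‖τ1‖ + 24 := by
    have q1 := norm_sub_norm_le τ2 (τ1 + (1:ℝ) * (-(τ1.re + 20) : ℝ))
    have q2 := norm_add_le τ1 ((1:ℝ) * ((-(τ1.re + 20) : ℝ):ℂ))
    rw [Complex.ofReal_one, one_mul] at q2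
    rw [Complex.ofReal_one, one_mul] at q1 s1
    linarith
  have s3 := (G.seg hσ l21 s2 (d := 4 * π * I) (n4.trans (by norm_num)) (fun t ht => by
    rw [f4]; refine ⟨by linarith, by linarith, ?_⟩
    have : ‖τ2 + t * (4 * π * I)‖ ≤ ‖τ2‖ + 1 * 13 := by
      refine (norm_add_le _ _).trans (add_le_add_right ?_ _)
      rw [norm_mul, Complex.norm_real, Real.norm_of_nonneg ht.1]
      exact mul_le_mul ht.2 n4 (norm_nonneg _) zero_le_one
    linarith) (fun t ht => by
      rw [Z_re]
      have e1 := abs_le.1 (En_small hb (by linarith [f4 t] : (τ2 + t * (4 * π * I)).re ≤ -18) hσ)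
      have e2 := abs_le.1 (En_small hb (by linarith : τ2.re ≤ -18) hσ)
      linarith) 1 (by simp)).1
  have per : En b (τ2 + (1:ℝ) * (4 * π * I)) = En b τ2 := by
    simp only [En]
    rw [show (τ2 + (1:ℝ) * (4 * π * I)) / 2 = τ2 / 2 + 2 * π * I by push_cast; ring,
      Complex.exp_periodic]
  rw [per, sub_self, mul_zero, sub_zero, sub_add_cancel_left, norm_neg] at s3
  simp [abs_of_pos Real.pi_pos] at s3
  linarith [Real.pi_gt_three]
end

section
def X1 : ℝ := 10 ^ 8
def κ1 : ℝ := 1 / 10 ^ 11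
def Yj (j : ℕ) : ℝ := π + 2 * π * j
structure Nm (F : ℂ → ℂ) (P S : Set ℂ) (M : ℕ) (r R0 : ℝ) (F2 : ℂ → ℂ) (P2 S2 : Set ℂ) (B : ℂ → ℂ) (b k : ℝ) : Prop where
  env : Env F P S M r R0 F2 P2 S2
  hb : 0 < b
  reg : ∀ τ, ‖τ‖ < k → τ ∉ P → deriv F τ ≠ 0 ∧ schwarzian F τ = 2 * B τ
  reg2 : ∀ τ, ‖τ‖ < k → τ ∉ P2 → deriv F2 τ ≠ 0 ∧ schwarzian F2 τ = 2 * B τ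
  hB : ∀ τ, ‖τ‖ < k → ∃ c : ℂ, ‖c‖ ≤ 1 / 10 ^ 12 ∧ B τ = b ^ 2 * cexp (τ + c)
  hX : X1 ≤ b / 10 ^ 4
  hK1 : 100 < b / 5000
  hK : 100 * M < b / 5000
  hK3 : 200 * R0 < r * rexp (-X1) * (b / 5000)
variable {F : ℂ → ℂ} {P S : Set ℂ} {M : ℕ} {r R0 : ℝ} {F2 : ℂ → ℂ} {P2 S2 : Set ℂ} {B : ℂ → ℂ} {b k : ℝ}
  {a : ℂ} {g : ℂ → ℂ}

lemma Nm.gm (N : Nm F P S M r R0 F2 P2 S2 B b k) (ha : a ∈ S) (hg : Trt F P a r g)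
    (hi : Tendsto (fun ζ => ‖g ζ‖) (comap Complex.re atTop) atTop) : Gm g b X1 k κ1 := by
  have hS := N.env.sep a ha
  have hX0 : 0 < X1 := by norm_num [X1]
  have hinj := N.env.c.tr_inj N.env.hr hS N.env.ub hg hi
  refine ⟨hg.diff, hinj, N.hb, hX0, le_rfl, fun ζ hζ hk => ?_⟩
  have hH : ζ ∈ HP := hX0.trans_le hζ
  obtain ⟨c, hc, hBc⟩ := N.hB _ hk
  have h1 := (N.env.c.tr_sq N.env.hr hS hg hH).2
  rw [(N.reg _ hk (hg.nP _ hH)).2, hBc, Complex.exp_add] at h1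
  have hsub : ball ζ X1 ⊆ HP := fun w hw => by
    have := (abs_le.1 ((Complex.abs_re_le_norm (w - ζ)).trans (mem_ball_iff_norm.1 hw).le)).1
    have h3 := mem_ball_iff_norm.1 hw
    have h4 := (abs_lt.1 ((Complex.abs_re_le_norm (w - ζ)).trans_lt h3)).1
    rw [Complex.sub_re] at h4
    show 0 < w.re; linarith
  have h2 := schw_bound hX0 (hg.diff.mono hsub) (hinj.mono hsub)
  have h2' : ‖schwarzian g ζ‖ ≤ 1 / 10 ^ 13 := h2.trans (by norm_num [X1])
  have h3 : pp b g ζ ^ 2 = 4 * b ^ 2 * cexp (g ζ) * deriv g ζ ^ 2 := by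
    rw [pp, mul_pow, mul_pow, mul_pow, ← Complex.exp_nat_mul]; push_cast; rw [mul_div_cancel₀ _ two_ne_zero]; ring
  have h4 : pp b g ζ ^ 2 + 1 = -(1 + 2 * schwarzian g ζ) * (cexp (-c) - 1) - 2 * schwarzian g ζ := by
    have e : cexp c * cexp (-c) = 1 := by rw [← Complex.exp_add, add_neg_cancel, Complex.exp_zero]
    rw [h3]
    linear_combination (2 * cexp (-c)) * h1 - 4 * b ^ 2 * cexp (g ζ) * deriv g ζ ^ 2 * e
  have h5 : ‖cexp (-c) - 1‖ ≤ 2 / 10 ^ 12 := by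
    have := Complex.norm_exp_sub_one_le (x := -c) (by rw [norm_neg]; exact hc.trans (by norm_num))
    rw [norm_neg] at this; linarith
  have h6 : ‖(pp b g ζ - I) * (pp b g ζ + I)‖ ≤ κ1 := by
    rw [show (pp b g ζ - I) * (pp b g ζ + I) = pp b g ζ ^ 2 + 1 by
      linear_combination - Complex.I_sq, h4]
    have e1 : ‖1 + 2 * schwarzian g ζ‖ ≤ 2 := by
      refine (norm_add_le _ _).trans ?_
      rw [norm_one, norm_mul, Complex.norm_two]; linarith
    refine (norm_sub_le _ _).trans ?_
    rw [norm_mul, norm_neg, norm_mul, Complex.norm_two]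
    have := mul_le_mul e1 h5 (norm_nonneg _) zero_le_two
    rw [κ1]; linarith
  rw [norm_mul] at h6
  by_contra hn
  push Not at hn
  have h7 := norm_sub_le (pp b g ζ + I) (pp b g ζ - I)
  rw [show pp b g ζ + I - (pp b g ζ - I) = 2 * I by ring, norm_mul, Complex.norm_I, Complex.norm_two] at h7
  have hκ : 0 < κ1 := by norm_num [κ1]
  rcases le_total 1 ‖pp b g ζ + I‖ with h | h
  · nlinarith [norm_nonneg (pp b g ζ - I)]
  · nlinarith [norm_nonneg (pp b g ζ + I)]

lemma En_strip (j : ℕ) (τ : ℂ) : (-1) ^ j * (En b τ).im = 4 * b * (rexp (τ.re / 2) * Real.cos ((τ.im - Yj j) / 2)) := by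
  rw [En_im, show τ.im / 2 = ((τ.im - Yj j) / 2 + π / 2) + j * π by rw [Yj]; ring, Real.sin_add_nat_mul_pi,
    Real.sin_add_pi_div_two]
  have : ((-1:ℝ) ^ j) * (-1) ^ j = 1 := by rw [← mul_pow]; simp
  linear_combination 4 * b * (rexp (τ.re / 2) * Real.cos ((τ.im - Yj j) / 2)) * this

lemma sg (j : ℕ) : (-1:ℝ) ^ j = 1 ∨ (-1:ℝ) ^ j = -1 := neg_one_pow_eq_or ℝ j

lemma En_lip (hb : 0 < b) {τ τ' : ℂ} (h : ‖τ' - τ‖ ≤ 1) (j : ℕ) :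
    |(-1) ^ j * (En b τ').im - (-1) ^ j * (En b τ).im| ≤ 4 * b * rexp (τ.re / 2) * ‖τ' - τ‖ := by
  rw [← mul_sub, abs_mul, abs_pow, abs_neg, abs_one, one_pow, one_mul, ← Complex.sub_im]
  refine (Complex.abs_im_le_norm _).trans ?_
  rw [show En b τ' - En b τ = En b τ * (cexp ((τ' - τ) / 2) - 1) by
    simp only [En]; rw [show τ' / 2 = τ / 2 + (τ' - τ) / 2 by ring, Complex.exp_add]; ring, norm_mul, En_norm hb]
  have := Complex.norm_exp_sub_one_le (x := (τ' - τ) / 2) (by rw [norm_div, Complex.norm_two]; linarith)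
  rw [norm_div, Complex.norm_two] at this
  gcongr; linarith

lemma norm_re_im (z : ℂ) : ‖z‖ ≤ |z.re| + |z.im| := Complex.norm_le_abs_re_add_abs_im z

lemma Yj_pos (j : ℕ) : 3 ≤ Yj j := by
  have : 0 ≤ 2 * π * j := by positivity
  rw [Yj]; linarith [Real.pi_gt_three]

lemma ex3 {x : ℝ} (h : x ≤ -5.98) : rexp (x / 2) ≤ 0.052 := by
  have h1 : rexp (x / 2) ≤ rexp (-3) * rexp (0.01) := by
    rw [← Real.exp_add]; exact Real.exp_le_exp.2 (by linarith)
  have h2 : rexp (-3) ≤ 0.0504 := by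
    rw [Real.exp_neg, show (3:ℝ) = (3:ℕ) * 1 by norm_num, Real.exp_nat_mul]
    refine (inv_anti₀ (by norm_num) (pow_le_pow_left₀ (by norm_num) (Real.exp_one_gt_d9.le) 3)).trans (by norm_num)
  have h3 : rexp 0.01 ≤ 1.02 := by
    have := Real.add_one_le_exp (-0.01 : ℝ)
    rw [Real.exp_neg] at this
    have h4 := inv_anti₀ (by norm_num) this
    rw [inv_inv] at h4; exact h4.trans (by norm_num)
  nlinarith [Real.exp_pos (-3), Real.exp_pos 0.01]

lemma ex1 {x : ℝ} (h : -2.02 ≤ x) : 0.36 ≤ rexp (x / 2) := by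
  have h1 : rexp (-1) * rexp (-0.01) ≤ rexp (x / 2) := by
    rw [← Real.exp_add]; exact Real.exp_le_exp.2 (by linarith)
  have h2 := Real.add_one_le_exp (-0.01 : ℝ)
  have h3 : 0.367 ≤ rexp (-1) := by
    rw [Real.exp_neg]; exact le_trans (by norm_num) (inv_anti₀ (Real.exp_pos _) Real.exp_one_lt_d9.le)
  nlinarith

lemma ex4 {x : ℝ} (h : -7 ≤ x) : 1 / 81 ≤ rexp (x / 2) := by
  have h1 : rexp (-4) ≤ rexp (x / 2) := Real.exp_le_exp.2 (by linarith)
  refine le_trans ?_ h1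
  rw [Real.exp_neg, show (4:ℝ) = (4:ℕ) * 1 by norm_num, Real.exp_nat_mul]
  exact le_trans (by norm_num) (inv_anti₀ (by positivity) (pow_le_pow_left₀ (Real.exp_pos _).le (by linarith [Real.exp_one_lt_d9] : rexp 1 ≤ 3) 4))

lemma cos_lo {x y : ℝ} (h : |x| ≤ y) : 1 - y ^ 2 / 2 ≤ Real.cos x := by
  have := Real.one_sub_sq_div_two_le_cos (x := x)
  nlinarith [sq_abs x, abs_nonneg x]

structure Strip (F : ℂ → ℂ) (P S : Set ℂ) (r b k : ℝ) (j : ℕ) (a : ℂ) (g : ℂ → ℂ) : Prop where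
  ha : a ∈ S
  tr : Trt F P a r g
  hi : Tendsto (fun ζ => ‖g ζ‖) (comap Complex.re atTop) atTop
  gm : Gm g b X1 k κ1
  box : ∀ p : ℂ, -1 ≤ p.re → p.re ≤ 3 → |p.im - Yj j| ≤ 2.2 → ∃ ζ, X1 ≤ ζ.re ∧ g ζ = p ∧
    ‖pp b g ζ - ((-1) ^ j : ℝ) * I‖ ≤ κ1 ∧ (-1) ^ j * (En b p).im - b / 4 ≤ ζ.re

lemma Gm.dep (G : Gm g b X1 k κ1) (hX : X1 ≤ b / 10 ^ 4) {ζ : ℂ} (h : X1 ≤ ζ.re) (hx : -19 ≤ (g ζ).re) (hx' : (g ζ).re ≤ 3)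
    (hk : ‖g ζ‖ + 50 < k) : ζ.re ≤ 4 * b * rexp ((g ζ).re / 2) + b / 100 := by
  have h0 := (Complex.abs_im_le_norm (En b (g ζ)))
  rw [En_norm G.hb] at h0
  have h0' := abs_le.1 h0
  rcases G.key ζ h (by linarith) with h1 | h1
  · have := G.depth (σ := 1) (Or.inl rfl) h (by simpa using h1) hX hx hx' hk
    linarith
  · have := G.depth (σ := -1) (Or.inr rfl) h (by simpa using h1) hX hx hx' hk
    linarith

set_option maxHeartbeats 1000000 in
lemma Nm.strip (N : Nm F P S M r R0 F2 P2 S2 B b k) (j : ℕ) (hk : Yj j + 100 < k) : ∃ a g, Strip F P S r b k j a g := by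
  have hb := N.hb
  have hY := Yj_pos j
  have hsq : √((b / 50) ^ 2) = b / 50 := Real.sqrt_sq (by positivity)
  have nτ0 : ∀ τ : ℂ, ∀ s : ℝ, ‖τ - ⟨-6, Yj j⟩‖ ≤ s → |τ.re + 6| ≤ s ∧ |τ.im - Yj j| ≤ s := fun τ s h => by
    have h1 := (Complex.abs_re_le_norm _).trans h
    have h2 := (Complex.abs_im_le_norm _).trans h
    simp only [Complex.sub_re, Complex.sub_im, sub_neg_eq_add] at h1 h2
    exact ⟨h1, h2⟩
  have inb : ∀ τ ∈ ball (⟨-6, Yj j⟩ : ℂ) (2 * (1 / 100)), ‖τ‖ < k ∧ (b / 50) ^ 2 ≤ ‖B τ‖ := by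
    intro τ hτ
    obtain ⟨h1, h2⟩ := nτ0 τ _ (mem_ball_iff_norm.1 hτ).le
    rw [abs_le] at h1 h2
    have hk' : ‖τ‖ < k := (norm_re_im τ).trans_lt (by
      rw [abs_of_neg (by linarith), abs_of_pos (by linarith)]; linarith)
    refine ⟨hk', ?_⟩
    obtain ⟨c, hc, hBc⟩ := N.hB τ hk'
    rw [hBc, norm_mul, norm_pow, Complex.norm_real, Real.norm_of_nonneg hb.le, Complex.norm_exp]
    have h3 := (abs_le.1 ((Complex.abs_re_le_norm c).trans hc)).1
    have h4 := ex4 (x := -7) le_rfl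
    have h5 : rexp (-7 / 2) * rexp (-7 / 2) ≤ rexp (τ + c).re := by
      rw [← Real.exp_add]; refine Real.exp_le_exp.2 ?_
      rw [Complex.add_re]; linarith
    have h4' : 1 / 2500 ≤ rexp (-7 / 2) * rexp (-7 / 2) := by
      rw [← Real.exp_add, show (-7/2 + -7/2 : ℝ) = -((7:ℕ) * 1) by norm_num, Real.exp_neg, Real.exp_nat_mul]
      exact le_trans (by norm_num) (inv_anti₀ (by positivity) (pow_le_pow_left₀ (Real.exp_pos _).le (by linarith [Real.exp_one_lt_d9] : rexp 1 ≤ 3) 7))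
    rw [div_pow]
    have : b ^ 2 * (1 / 2500) ≤ b ^ 2 * rexp (τ + c).re := by gcongr; linarith
    linarith
  have hη : √((b / 50) ^ 2) * (1 / 100) = b / 5000 := by rw [hsq]; ring
  obtain ⟨τ1, hτ1, a, ha, g, hg, hi, ζ1, hζ1, e1⟩ := N.env.deep (X1 := X1) (η := 1 / 100) (β := (b / 50) ^ 2) (B := B)
    (τ0 := ⟨-6, Yj j⟩) (by norm_num [X1]) (by norm_num) (by positivity)
    (fun τ h hP => ⟨(N.reg τ (inb τ h).1 hP).1, (N.reg τ (inb τ h).1 hP).2, (inb τ h).2⟩)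
    (fun τ h hP => ⟨(N.reg2 τ (inb τ h).1 hP).1, (N.reg2 τ (inb τ h).1 hP).2, (inb τ h).2⟩)
    (by rw [hη]; exact N.hK1) (by rw [hη]; exact N.hK) (by rw [hη]; exact N.hK3)
  have G := N.gm ha hg hi
  refine ⟨a, g, ha, hg, hi, G, ?_⟩
  obtain ⟨x1, y1⟩ := nτ0 τ1 _ (mem_ball_iff_norm.1 hτ1).le
  have x1' := abs_le.1 x1
  have y1' := abs_le.1 y1
  have n1 : ‖τ1‖ ≤ Yj j + 8 := (norm_re_im τ1).trans (by
      rw [abs_of_neg (by linarith), abs_of_pos (by linarith)]; linarith)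
  subst e1
  set τ1 := g ζ1
  have hH1 := En_strip (b := b) j τ1
  have cosl : 0.99 ≤ Real.cos ((τ1.im - Yj j) / 2) :=
    le_trans (by norm_num) (cos_lo (y := 1/100) (by rw [abs_div, abs_two]; linarith))
  have hs : ‖pp b g ζ1 - ((-1) ^ j : ℝ) * I‖ ≤ κ1 := by
    by_contra hn
    have hopp : ‖pp b g ζ1 - (-(-1) ^ j : ℝ) * I‖ ≤ κ1 := by
      rcases sg j with h | h <;> rw [h] at hn ⊢ <;> rcases G.key ζ1 hζ1 (by linarith) with q | q
      · exact absurd (by simpa using q) hn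
      · simpa using q
      · simpa using q
      · exact absurd (by simpa using q) hn
    have hd := G.depth (σ := -(-1) ^ j) (by rcases sg j with h | h <;> rw [h] <;> simp) hζ1 hopp N.hX
      (by linarith) (by linarith) (by linarith)
    have h2 := ex4 (x := τ1.re) (by linarith)
    have h3 : (1 / 81 : ℝ) * 0.99 ≤ rexp (τ1.re / 2) * Real.cos ((τ1.im - Yj j) / 2) := by gcongr
    rw [neg_mul, hH1] at hd
    have : 0 < X1 := by norm_num [X1]
    have h4 := mul_le_mul_of_nonneg_left h3 hb.le
    linarith
  have q4 : ∀ t : ℝ, (τ1 + t * 4).re = τ1.re + t * 4 ∧ (τ1 + t * 4).im = τ1.im := fun t => by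
    constructor <;> simp [Complex.mul_re, Complex.mul_im]
  have d1 : ∀ t ∈ Icc (0:ℝ) 1, X1 ≤ ζ1.re + ((-1) ^ j : ℝ) * ((En b (τ1 + t * 4)).im - (En b τ1).im) := fun t ht => by
    rw [mul_sub, hH1, En_strip, (q4 t).1, (q4 t).2]
    have : rexp (τ1.re / 2) ≤ rexp ((τ1.re + t * 4) / 2) := Real.exp_le_exp.2 (by linarith [ht.1])
    have : 4 * b * (rexp (τ1.re / 2) * Real.cos ((τ1.im - Yj j) / 2)) ≤
      4 * b * (rexp ((τ1.re + t * 4) / 2) * Real.cos ((τ1.im - Yj j) / 2)) := by gcongr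
    linarith
  obtain ⟨s1, s2⟩ := G.seg (sg j) hζ1 hs (d := 4) (by norm_num) (fun t ht => by
    refine ⟨by rw [(q4 t).1]; linarith [ht.1], by rw [(q4 t).1]; linarith [ht.2], ?_⟩
    have : ‖τ1 + t * 4‖ ≤ ‖τ1‖ + 1 * 4 := by
      refine (norm_add_le _ _).trans (add_le_add_right ?_ _)
      rw [norm_mul, Complex.norm_real, Real.norm_of_nonneg ht.1]
      exact mul_le_mul ht.2 (by norm_num) (norm_nonneg _) zero_le_one
    linarith) (fun t ht => by rw [Z_re]; exact d1 t ht) 1 (by simp)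
  have d11 := d1 1 (by simp)
  have r2 := Z_re ((-1) ^ j) ζ1 (En b (τ1 + (1:ℝ) * 4)) (En b τ1)
  set ζ2 := ζ1 - ((-1) ^ j : ℝ) * I * (En b (τ1 + (1:ℝ) * 4) - En b τ1)
  rw [← r2] at d11
  rw [mul_sub, hH1] at r2
  have x2 := abs_le.1 ((Complex.abs_re_le_norm _).trans s1)
  have y2 := abs_le.1 ((Complex.abs_im_le_norm _).trans s1)
  rw [Complex.sub_re, (q4 1).1] at x2
  rw [Complex.sub_im, (q4 1).2] at y2
  set τ2 := g ζ2
  have l2 := (abs_le.1 (En_lip hb (s1.trans (by norm_num)) j)).2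
  have l3 : rexp (τ1.re / 2) ≤ 0.052 := ex3 (by linarith)
  have l4 : 4 * b * (rexp (τ1.re / 2) * Real.cos ((τ1.im - Yj j) / 2)) ≤ 4 * b * (0.052 * 1) := by
    gcongr; exact Real.cos_le_one _
  have l5 : 4 * b * rexp ((τ1 + (1:ℝ) * 4).re / 2) * ‖τ2 - (τ1 + (1:ℝ) * 4)‖ ≤ 4 * b * 1 * (1 / 1000) := by
    gcongr; rw [Real.exp_le_one_iff, (q4 1).1]; linarith
  have D2 : (-1) ^ j * (En b τ2).im - 0.22 * b + X1 ≤ ζ2.re := by linarith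
  have x2' : -2.1 ≤ τ2.re ∧ τ2.re ≤ -1.9 := ⟨by linarith, by linarith⟩
  have x2'' : -2.02 ≤ τ2.re := by linarith
  have y2' : -0.1 ≤ τ2.im - Yj j ∧ τ2.im - Yj j ≤ 0.1 := ⟨by linarith, by linarith⟩
  clear l2 l3 l4 l5 x2 y2 hH1 cosl x1 y1 x1' y1' n1 r2 d1 hs s1
  intro p hp1 hp2 hp3
  have hp3' := abs_le.1 hp3
  have pos : ∀ d : ℂ, ‖d - (p - τ2)‖ ≤ 1 / 10 → ∀ t ∈ Icc (0:ℝ) 1, -2.02 ≤ (τ2 + t * d).re ∧ (τ2 + t * d).re ≤ 4 ∧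
      |(τ2 + t * d).im - Yj j| ≤ 2.3 := fun d hd t ht => by
    have h1 := abs_le.1 ((Complex.abs_re_le_norm _).trans hd)
    have h2 := abs_le.1 ((Complex.abs_im_le_norm _).trans hd)
    simp only [Complex.sub_re, Complex.sub_im] at h1 h2
    have e1 : (τ2 + t * d).re = τ2.re + t * d.re := by simp
    have e2 : (τ2 + t * d).im = τ2.im + t * d.im := by simp
    rw [e1, e2, abs_le]
    obtain ⟨t0, t1⟩ := ht
    have e3 : τ2.re + t * d.re = (1 - t) * τ2.re + t * (τ2.re + d.re) := by ring
    have e4 : τ2.im + t * d.im - Yj j = (1 - t) * (τ2.im - Yj j) + t * (τ2.im - Yj j + d.im) := by ring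
    have t2 : 0 ≤ 1 - t := by linarith
    have cv : ∀ u v c : ℝ, u ≤ c → v ≤ c → (1 - t) * u + t * v ≤ c := fun u v c hu hv => by
      linarith only [mul_le_mul_of_nonneg_left hu t2, mul_le_mul_of_nonneg_left hv t0]
    have cv' : ∀ u v c : ℝ, c ≤ u → c ≤ v → c ≤ (1 - t) * u + t * v := fun u v c hu hv => by
      linarith only [mul_le_mul_of_nonneg_left hu t2, mul_le_mul_of_nonneg_left hv t0]
    rw [e3, e4]
    refine ⟨cv' _ _ _ ?_ ?_, cv _ _ _ ?_ ?_, cv' _ _ _ ?_ ?_, cv _ _ _ ?_ ?_⟩ <;> linarith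
  obtain ⟨ζ, hζ, e, f1, d, hd, f2⟩ := G.exact (sg j) d11 s2 (d0 := p - τ2) (by
    refine (norm_re_im _).trans ?_
    rw [Complex.sub_re, Complex.sub_im]
    have h1 : |p.re - τ2.re| ≤ 6 := abs_le.2 ⟨by linarith, by linarith⟩
    have h2 : |p.im - τ2.im| ≤ 6 := abs_le.2 ⟨by linarith, by linarith⟩
    linarith) (fun d hd t ht => by
      obtain ⟨h1, h2, h3⟩ := pos d hd t ht
      refine ⟨by linarith, h2, ?_⟩
      have h3' := abs_le.1 h3
      have := norm_re_im (τ2 + t * d)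
      have h4 : |(τ2 + t * d).re| ≤ 4 := abs_le.2 ⟨by linarith, by linarith⟩
      have h5 : |(τ2 + t * d).im| ≤ Yj j + 3 := abs_le.2 ⟨by linarith, by linarith⟩
      linarith) (fun d hd t ht => by
      obtain ⟨h1, h2, h3⟩ := pos d hd t ht
      rw [mul_sub, En_strip]
      have h4 := ex1 h1
      have h5 := cos_lo (x := ((τ2 + t * d).im - Yj j) / 2) (y := 1.15) (by rw [abs_div, abs_two]; linarith)
      have h6 : 4 * b * (0.36 * 0.33) ≤ 4 * b * (rexp ((τ2 + t * d).re / 2) * Real.cos (((τ2 + t * d).im - Yj j) / 2)) := by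
        gcongr; linarith
      linarith)
  rw [add_sub_cancel] at e
  refine ⟨ζ, hζ, e, f1, ?_⟩
  have e9 : τ2 + d - p = d - (p - τ2) := by ring
  have l6 := (abs_le.1 (En_lip hb (τ' := τ2 + d) (τ := p) (by rw [e9]; exact hd.trans (by norm_num)) j)).1
  have l7 : 4 * b * rexp (p.re / 2) * ‖τ2 + d - p‖ ≤ 4 * b * 5 * (1 / 1000) := by
    rw [e9]; gcongr
    have h1 : rexp (p.re / 2) ≤ rexp 1.5 := Real.exp_le_exp.2 (by linarith)
    have h2 : rexp 1.5 * rexp 1.5 = rexp 1 ^ 3 := by rw [← Real.exp_add, ← Real.exp_nat_mul]; norm_num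
    have h3 : rexp 1 ^ 3 ≤ 2.7182818286 ^ 3 := pow_le_pow_left₀ (Real.exp_pos _).le Real.exp_one_lt_d9.le 3
    nlinarith
  have : 0 < X1 := by norm_num [X1]
  rw [f2, mul_sub]
  linarith
end

section

lemma max_contra {G B : ℂ → ℂ} {τ c d : ℂ} (hG : AnalyticAt ℂ G τ) (h1 : deriv G τ ≠ 0) (hS : schwarzian G τ = 2 * B τ)
    (hB : 0 < (B τ).re) (h0 : c + d * G τ ≠ 0) {f : ℂ → ℝ} (hf : ∀ᶠ z in 𝓝 τ, f z = ‖(c + d * G z) ^ 2 / deriv G z‖)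
    (hm : IsLocalMax (fun s : ℝ => f (τ + s * I)) 0) : False := by
  set u : ℂ → ℂ := fun z => (c + d * G z) ^ 2 / deriv G z
  have hn : AnalyticAt ℂ (fun z => c + d * G z) τ := analyticAt_const.add (analyticAt_const.mul hG)
  have hu : AnalyticAt ℂ u τ := (hn.pow 2).div hG.deriv h1
  have hu0 : u τ ≠ 0 := div_ne_zero (pow_ne_zero _ h0) h1
  set ℓ : ℂ → ℂ := fun z => Complex.log (u z / u τ)
  have hℓ : AnalyticAt ℂ ℓ τ := by
    refine AnalyticAt.clog (hu.div analyticAt_const hu0) ?_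
    rw [div_self hu0]; exact Complex.one_mem_slitPlane
  have hu1 : ∀ᶠ z in 𝓝 τ, u z ≠ 0 := hu.continuousAt.eventually_ne hu0
  have he : ∀ᶠ z in 𝓝 τ, f z = ‖u τ‖ * rexp (ℓ z).re := by
    filter_upwards [hf, hu1] with z hz h
    rw [hz, ← Complex.norm_exp, Complex.exp_log (div_ne_zero h hu0), norm_div (u z), mul_div_cancel₀ _ (norm_ne_zero_iff.2 hu0)]
  have hq : ∀ᶠ z in 𝓝 τ, deriv ℓ z = 2 * d * deriv G z / (c + d * G z) - deriv (deriv G) z / deriv G z := by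
    have hs : ∀ᶠ z in 𝓝 τ, u z / u τ ∈ Complex.slitPlane :=
      (hu.div analyticAt_const hu0).continuousAt.eventually_mem (Complex.isOpen_slitPlane.mem_nhds (by
        show u τ / u τ ∈ _; rw [div_self hu0]; exact Complex.one_mem_slitPlane))
    filter_upwards [hs, hG.eventually_analyticAt, hn.continuousAt.eventually_ne h0, hG.deriv.continuousAt.eventually_ne h1] with z a1 a2 a3 a4
    have e1 : HasDerivAt G (deriv G z) z := a2.differentiableAt.hasDerivAt
    have e2 : HasDerivAt (deriv G) (deriv (deriv G) z) z := a2.deriv.differentiableAt.hasDerivAt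
    have e3 := ((((e1.const_mul d).const_add c).pow 2).div e2 a4).div_const (u τ)
    refine (HasDerivAt.clog e3 a1).deriv.trans ?_
    have ez : ((fun x => c + d * G x) ^ 2 / deriv G) z = (c + d * G z) ^ 2 / deriv G z := rfl
    simp only [Pi.pow_apply, ez]
    field_simp
    push_cast
    ring
  have hq2 : deriv (deriv ℓ) τ = - (2 * B τ) - 1 / 2 * (deriv ℓ τ) ^ 2 := by
    rw [Filter.EventuallyEq.deriv_eq hq, hq.self_of_nhds, ← hS, schwarzian]
    have e1 : HasDerivAt G (deriv G τ) τ := hG.differentiableAt.hasDerivAt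
    have e2 : HasDerivAt (deriv G) (deriv (deriv G) τ) τ := hG.deriv.differentiableAt.hasDerivAt
    have e3 : HasDerivAt (deriv (deriv G)) (deriv (deriv (deriv G)) τ) τ := hG.deriv.deriv.differentiableAt.hasDerivAt
    have := ((e2.const_mul (2 * d)).div ((e1.const_mul d).const_add c) h0).sub (e3.div e2 h1)
    refine (HasDerivAt.deriv this).trans ?_
    field_simp
    ring
  have hline : ∀ s : ℝ, HasDerivAt (fun s : ℝ => τ + s * I) I s := fun s => by
    simpa using ((hasDerivAt_id s).ofReal_comp.mul_const I).const_add τ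
  have hlc : Tendsto (fun s : ℝ => τ + s * I) (𝓝 0) (𝓝 τ) := by
    simpa [ContinuousAt] using (hline 0).continuousAt
  have hd1 : ∀ᶠ s : ℝ in 𝓝 0, HasDerivAt (fun s : ℝ => (ℓ (τ + s * I)).re) (deriv ℓ (τ + s * I) * I).re s := by
    filter_upwards [hlc.eventually hℓ.eventually_analyticAt] with s hs
    have h2 := HasDerivAt.scomp (g₁ := ℓ) s hs.differentiableAt.hasDerivAt (hline s)
    have := (Complex.reCLM.hasFDerivAt.comp_hasDerivAt s h2)
    simpa [mul_comm, Function.comp_def] using this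
  have hd2 : HasDerivAt (fun s : ℝ => (deriv ℓ (τ + s * I) * I).re) (deriv (deriv ℓ) τ * I * I).re 0 := by
    have h2 := HasDerivAt.scomp (g₁ := deriv ℓ) (g₁' := deriv (deriv ℓ) τ) 0 (by rw [Complex.ofReal_zero, zero_mul, add_zero]; exact hℓ.deriv.differentiableAt.hasDerivAt) (hline 0)
    have := (Complex.reCLM.hasFDerivAt.comp_hasDerivAt _ (h2.mul_const I))
    refine this.congr_deriv ?_
    simp [mul_comm]
  set h : ℝ → ℝ := fun s : ℝ => (ℓ (τ + s * I)).re
  have hmax : IsLocalMax h 0 := by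
    have e1 := hlc.eventually he
    filter_upwards [hm, e1] with s a1 a2
    have e0 := he.self_of_nhds
    simp only [Complex.ofReal_zero, zero_mul, add_zero] at a1
    rw [a2, e0] at a1
    have := Real.exp_le_exp.1 (le_of_mul_le_mul_left a1 (norm_pos_iff.2 hu0))
    simpa [h] using this
  have hder0 : deriv h 0 = 0 := hmax.deriv_eq_zero
  have hdd : deriv (deriv h) 0 = (deriv (deriv ℓ) τ * I * I).re := by
    rw [Filter.EventuallyEq.deriv_eq (hd1.mono fun s hs => hs.deriv)]; exact hd2.deriv
  have him : (deriv ℓ τ).im = 0 := by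
    have := hd1.self_of_nhds.deriv
    rw [hder0] at this; simpa using this.symm
  have hpos : 0 < deriv (deriv h) 0 := by
    rw [hdd, hq2, mul_assoc, Complex.I_mul_I]
    have : ((deriv ℓ τ) ^ 2).re = (deriv ℓ τ).re ^ 2 := by rw [pow_two, Complex.mul_re, him]; ring
    have e : (-(2 * B τ) - 1 / 2 * deriv ℓ τ ^ 2) * -1 = (2:ℝ) * B τ + (1/2 : ℝ) * deriv ℓ τ ^ 2 := by push_cast; ring
    rw [e, Complex.add_re, Complex.re_ofReal_mul, Complex.re_ofReal_mul, this]
    positivity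
  have hmin := isLocalMin_of_deriv_deriv_pos hpos hder0 hd1.self_of_nhds.continuousAt
  have hc : h =ᶠ[𝓝 0] fun _ => h 0 := by
    filter_upwards [hmax, hmin] with s a1 a2
    exact le_antisymm a1 a2
  have := hc.deriv.deriv_eq
  rw [this] at hpos
  simp at hpos

variable {F : ℂ → ℂ} {P S : Set ℂ} {M : ℕ} {r R0 : ℝ} {F2 : ℂ → ℂ} {P2 S2 : Set ℂ} {B : ℂ → ℂ} {b k : ℝ}
  {a : ℂ} {g g' : ℂ → ℂ}
open scoped Classical in
def ff (F : ℂ → ℂ) (P : Set ℂ) (F2 : ℂ → ℂ) (a τ : ℂ) : ℝ :=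
  if τ ∈ P then ‖(1 + -a * F2 τ) ^ 2 / deriv F2 τ‖ else ‖(-a + 1 * F τ) ^ 2 / deriv F τ‖

lemma Nm.chart (N : Nm F P S M r R0 F2 P2 S2 B b k) (a : ℂ) {τ : ℂ} (hk : ‖τ‖ < k) : ∃ (G : ℂ → ℂ) (c d : ℂ), AnalyticAt ℂ G τ ∧
    deriv G τ ≠ 0 ∧ schwarzian G τ = 2 * B τ ∧ ∀ᶠ z in 𝓝 τ, ff F P F2 a z = ‖(c + d * G z) ^ 2 / deriv G z‖ := by
  by_cases hP : τ ∈ P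
  · have hP2 : τ ∉ P2 := fun h => (N.env.inv3 τ h).1 hP
    refine ⟨F2, 1, -a, N.env.c2.an τ hP2, (N.reg2 τ hk hP2).1, (N.reg2 τ hk hP2).2, ?_⟩
    filter_upwards [N.env.c2.closed.isOpen_compl.mem_nhds hP2] with z hz
    rw [ff]
    split_ifs with h
    · rfl
    · have h2 : F2 z ≠ 0 := fun h3 => h ((N.env.inv2 z hz).2 h3)
      have e : F =ᶠ[𝓝 z] fun w => (F2 w)⁻¹ := by
        filter_upwards [N.env.c2.closed.isOpen_compl.mem_nhds hz] with w hw using N.env.inv w hw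
      rw [e.deriv_eq, N.env.inv z hz, ((N.env.c2.an z hz).differentiableAt.hasDerivAt.fun_inv h2).deriv]
      rw [show (-a + 1 * (F2 z)⁻¹) ^ 2 / (-deriv F2 z / F2 z ^ 2) = - ((1 + -a * F2 z) ^ 2 / deriv F2 z) by field_simp; ring, norm_neg]
  · refine ⟨F, -a, 1, N.env.c.an τ hP, (N.reg τ hk hP).1, (N.reg τ hk hP).2, ?_⟩
    filter_upwards [N.env.c.closed.isOpen_compl.mem_nhds hP] with z hz
    rw [ff, if_neg hz]

lemma Nm.ff_val (N : Nm F P S M r R0 F2 P2 S2 B b k) (ha : a ∈ S) (hg : Trt F P a r g) {ζ : ℂ} (hζ : ζ ∈ HP) :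
    ff F P F2 a (g ζ) * (2 * b * rexp ((g ζ).re / 2)) = r * rexp (-ζ.re) * ‖pp b g ζ‖ := by
  have h1 := (N.env.c.tr_sq N.env.hr (N.env.sep a ha) hg hζ).1
  have hb := N.hb
  have hr := N.env.hr
  rw [ff, if_neg (hg.nP ζ hζ), hg.eq ζ hζ, pp]
  have h2 : ‖(r:ℂ) * cexp (-ζ)‖ = r * rexp (-ζ.re) := by
    rw [norm_mul, Complex.norm_exp, Complex.norm_real, Real.norm_of_nonneg hr.le, Complex.neg_re]
  have h3 : ‖deriv F (g ζ)‖ * ‖deriv g ζ‖ = r * rexp (-ζ.re) := by rw [← norm_mul, h1, norm_neg, h2]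
  have h4 : ‖deriv F (g ζ)‖ ≠ 0 := fun h => by
    rw [h, zero_mul] at h3; have := Real.exp_pos (-ζ.re); have := mul_pos hr this; linarith
  rw [show -a + 1 * (a + r * cexp (-ζ)) = r * cexp (-ζ) by ring, norm_div, norm_pow, h2, norm_mul, norm_mul, norm_mul,
    Complex.norm_exp, Complex.norm_real, Real.norm_of_nonneg hb.le, Complex.norm_two, Complex.div_ofNat_re]
  field_simp
  rw [← h3]

lemma pp_bd {w : ℂ} {σ : ℝ} (hσ : σ = 1 ∨ σ = -1) (h : ‖w - σ * I‖ ≤ κ1) : 1 / 2 ≤ ‖w‖ ∧ ‖w‖ ≤ 2 := by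
  have e : ‖(σ:ℂ) * I‖ = 1 := by rcases hσ with h | h <;> simp [h]
  have h1 := norm_sub_norm_le w (σ * I)
  have h2 := norm_sub_norm_le (σ * I) w
  rw [norm_sub_rev] at h2
  rw [e] at h1 h2
  norm_num [κ1] at h
  constructor <;> linarith

lemma Nm.ff_lt (N : Nm F P S M r R0 F2 P2 S2 B b k) {j : ℕ} (hk : Yj j + 100 < k) (h : Strip F P S r b k j a g) {σ : ℝ} (hσ : |σ| = 1) :
    ff F P F2 a ⟨1, Yj j + 1.6 * σ⟩ < ff F P F2 a ⟨1, Yj j + 2 * σ⟩ := by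
  have hb := N.hb
  have hY := Yj_pos j
  have hr := N.env.hr
  have hX0 : 0 < X1 := by norm_num [X1]
  have hbb := N.hX
  norm_num [X1] at hbb
  obtain ⟨z0, c0, e0, p0, d0⟩ := h.box ⟨1, Yj j + 1.6 * σ⟩ (by norm_num) (by norm_num) (by
    simp only [add_sub_cancel_left, abs_mul, hσ]; norm_num)
  obtain ⟨z1, c1, e1, p1, d1⟩ := h.box ⟨1, Yj j + 2 * σ⟩ (by norm_num) (by norm_num) (by
    simp only [add_sub_cancel_left, abs_mul, hσ]; norm_num)
  have v0 := N.ff_val h.ha h.tr (hX0.trans_le c0)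
  have v1 := N.ff_val h.ha h.tr (hX0.trans_le c1)
  have hs := abs_le.1 hσ.le
  have dp := h.gm.depth (sg j) c1 p1 N.hX (by rw [e1]; norm_num) (by rw [e1]; norm_num) (by
    rw [e1]
    have := norm_re_im ⟨1, Yj j + 2 * σ⟩
    simp only [abs_one] at this
    rw [abs_of_nonneg (by linarith)] at this
    linarith)
  rw [e1, En_strip] at dp
  rw [En_strip] at d0
  rw [e0] at v0
  rw [e1] at v1
  have q0 := (pp_bd (sg j) p0).2
  have q1 := (pp_bd (sg j) p1).1
  simp only [add_sub_cancel_left] at dp d0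
  have cc : ∀ t : ℝ, Real.cos (t * σ / 2) = Real.cos (t / 2) := fun t => by
    rcases (abs_eq zero_le_one).1 hσ with h | h
    · rw [h, mul_one]
    · rw [h, mul_neg_one, neg_div, Real.cos_neg]
  rw [cc] at dp d0
  have k1 : Real.cos (2 / 2) ≤ 5 / 9 := by norm_num; exact Real.cos_one_le
  have k0 : 0.68 ≤ Real.cos (1.6 / 2) := le_trans (by norm_num) (cos_lo (y := 0.8) (by norm_num))
  have k2 : 3 / 2 ≤ rexp ((1:ℝ) / 2) := le_trans (by norm_num) (Real.add_one_le_exp _)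
  set E := rexp ((1:ℝ) / 2)
  have hE : 0 < E := by linarith
  have m1 : 4 * b * (E * Real.cos (2 / 2)) ≤ 4 * b * (E * (5 / 9)) := by gcongr
  have m0 : 4 * b * (E * 0.68) ≤ 4 * b * (E * Real.cos (1.6 / 2)) := by gcongr
  have m2 : b * (3 / 2) ≤ b * E := by gcongr
  have hz : z1.re + 4 ≤ z0.re := by linarith
  have x1 : rexp (-z0.re) * 5 ≤ rexp (-z1.re) := by
    have := Real.exp_le_exp.2 (show -z0.re + 4 ≤ -z1.re by linarith)
    rw [Real.exp_add] at this
    have h5 := Real.add_one_le_exp (4:ℝ)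
    nlinarith [Real.exp_pos (-z0.re)]
  have x2 : rexp (-z0.re) * ‖pp b g z0‖ < rexp (-z1.re) * ‖pp b g z1‖ := by
    have y1 : rexp (-z0.re) * ‖pp b g z0‖ ≤ rexp (-z0.re) * 2 := by gcongr
    have y2 : rexp (-z1.re) * (1/2) ≤ rexp (-z1.re) * ‖pp b g z1‖ := by gcongr
    have := Real.exp_pos (-z0.re)
    linarith
  have x3 := mul_lt_mul_of_pos_left x2 hr
  rw [← mul_assoc, ← mul_assoc, ← v0, ← v1] at x3
  exact lt_of_mul_lt_mul_right x3 (by positivity)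

lemma Nm.adj (N : Nm F P S M r R0 F2 P2 S2 B b k) {j : ℕ} (hk : Yj (j + 1) + 100 < k) (h : Strip F P S r b k j a g)
    (h' : Strip F P S r b k (j + 1) a g') : False := by
  have hY := Yj_pos j
  have hπ := Real.pi_gt_d2
  have hπ' := Real.pi_lt_d2
  have eY : Yj (j + 1) = Yj j + 2 * π := by simp only [Yj]; push_cast; ring
  have l1 := N.ff_lt (by linarith) h (σ := 1) (by simp)
  have l2 := N.ff_lt hk h' (σ := -1) (by simp)
  set s0 := Yj j + 1.6 * 1 with hs0
  set s3 := Yj (j+1) + 1.6 * -1 with hs3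
  set s1 := Yj j + 2 * 1 with hs1
  set s2 := Yj (j+1) + 2 * -1 with hs2
  have nk : ∀ s ∈ Icc s0 s3, ‖(⟨1, s⟩ : ℂ)‖ < k := fun s hs => by
    have := norm_re_im ⟨1, s⟩
    have h1 := hs.1
    have h2 := hs.2
    simp only [abs_one] at this
    rw [abs_of_nonneg (by linarith)] at this
    linarith
  have eL : ∀ s t : ℝ, (⟨1, s⟩ : ℂ) + t * I = ⟨1, s + t⟩ := fun s t => by
    apply Complex.ext <;> simp
  have cont : ContinuousOn (fun s : ℝ => ff F P F2 a ⟨1, s⟩) (Icc s0 s3) := by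
    intro s hs
    obtain ⟨G, c, d, a1, a2, a3, a4⟩ := N.chart a (nk s hs)
    have : ContinuousAt (ff F P F2 a) ⟨1, s⟩ := by
      refine ContinuousAt.congr ?_ (EventuallyEq.symm a4)
      exact ((((analyticAt_const.add (analyticAt_const.mul a1)).pow 2).div a1.deriv a2).continuousAt).norm
    have hc : ContinuousAt (fun s : ℝ => (⟨1, s⟩ : ℂ)) s := by
      have : (fun s : ℝ => (⟨1, s⟩ : ℂ)) = fun s : ℝ => 1 + s * I := by
        funext s; apply Complex.ext <;> simp
      rw [this]; fun_prop
    exact (ContinuousAt.comp (f := fun s : ℝ => (⟨1, s⟩ : ℂ)) this hc).continuousWithinAt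
  obtain ⟨s, hs, hmax⟩ := isCompact_Icc.exists_isMaxOn (nonempty_Icc.2 (by linarith)) cont
  have m1 := hmax (show s1 ∈ Icc s0 s3 from ⟨by linarith, by linarith⟩)
  have m2 := hmax (show s2 ∈ Icc s0 s3 from ⟨by linarith, by linarith⟩)
  simp only [mem_ofPred_eq] at m1 m2
  have n0 : s ≠ s0 := fun e => by rw [e] at m1; exact absurd l1 (not_lt.2 m1)
  have n3 : s ≠ s3 := fun e => by rw [e] at m2; exact absurd l2 (not_lt.2 m2)
  have i0 : s0 < s := lt_of_le_of_ne hs.1 n0.symm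
  have i3 : s < s3 := lt_of_le_of_ne hs.2 n3
  obtain ⟨G, c, d, a1, a2, a3, a4⟩ := N.chart a (nk s hs)
  have fpos : 0 < ff F P F2 a ⟨1, s⟩ := lt_of_le_of_lt (by rw [ff]; split_ifs <;> positivity) (l1.trans_le m1)
  refine max_contra a1 a2 a3 ?_ ?_ a4 ?_
  · obtain ⟨c, hc, e⟩ := N.hB _ (nk s hs)
    have hci := abs_le.1 ((Complex.abs_im_le_norm c).trans hc)
    have hb := N.hb
    rw [e, show ((b:ℂ) ^ 2) = ((b ^ 2 : ℝ) : ℂ) by push_cast; rfl, Complex.re_ofReal_mul, Complex.exp_re]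
    have : 0 < Real.cos ((⟨1, s⟩ + c : ℂ).im) := by
      rw [Complex.add_im, show s + c.im = (s + c.im - 2 * π * (j + 1)) + (j + 1 : ℕ) * (2 * π) by push_cast; ring, Real.cos_add_nat_mul_two_pi]
      have := hs.1
      have := hs.2
      have e1 : Yj j = 2 * π * (j + 1) - π := by rw [Yj]; ring
      have t1 : (1:ℝ) / 10 ^ 12 ≤ 0.001 := by norm_num
      refine Real.cos_pos_of_mem_Ioo ⟨?_, ?_⟩ <;> linarith
    positivity
  · intro h0
    rw [a4.self_of_nhds, h0] at fpos
    simp at fpos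
  · have : ∀ᶠ t : ℝ in 𝓝 0, s + t ∈ Icc s0 s3 := by
      have hc : ContinuousAt (fun t : ℝ => s + t) 0 := by fun_prop
      exact hc.eventually_mem (Icc_mem_nhds (by simpa using i0) (by simpa using i3))
    filter_upwards [this] with t ht
    have := hmax ht
    simp only [mem_ofPred_eq] at this
    simp only [eL, add_zero]
    exact this
end

section

def HasLg (K : Set ℂ) (p : ℂ) : Prop := ∃ ℓ : ℂ → ℂ, ContinuousOn ℓ K ∧ ∀ z ∈ K, cexp (ℓ z) = z - p

lemma lg_near {K : Set ℂ} {p : ℂ} (hK : IsCompact K) (hp : p ∉ K) : ∀ᶠ q in 𝓝 p, (HasLg K p ↔ HasLg K q) := by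
  obtain ⟨δ, hδ, hb⟩ := Metric.isOpen_iff.1 hK.isClosed.isOpen_compl p hp
  filter_upwards [Metric.ball_mem_nhds p hδ] with q hq
  have hd : ∀ z ∈ K, δ ≤ ‖z - p‖ := fun z hz => by
    by_contra h; exact hb (mem_ball_iff_norm.2 (not_le.1 h)) hz
  have hq' := mem_ball_iff_norm.1 hq
  have hne : ∀ z ∈ K, z - p ≠ 0 := fun z hz h => by have := hd z hz; rw [h, norm_zero] at this; linarith
  set w : ℂ → ℂ := fun z => 1 + (p - q) / (z - p)
  have hs : ∀ z ∈ K, w z ∈ Complex.slitPlane := fun z hz => by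
    refine Complex.mem_slitPlane_of_norm_lt_one ?_
    rw [norm_div, div_lt_one (norm_pos_iff.2 (hne z hz)), norm_sub_rev]
    exact hq'.trans_le (hd z hz)
  have hw : ContinuousOn w K := continuousOn_const.add (continuousOn_const.div (by fun_prop) hne)
  have hl := hw.clog hs
  have he : ∀ z ∈ K, cexp (Complex.log (w z)) = (z - q) / (z - p) := fun z hz => by
    rw [Complex.exp_log (Complex.slitPlane_ne_zero (hs z hz))]
    have := hne z hz
    simp only [w]; field_simp; ring
  have hne2 : ∀ z ∈ K, z - q ≠ 0 := fun z hz h => by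
    have := he z hz; rw [h, zero_div] at this; exact Complex.exp_ne_zero _ this
  constructor
  · rintro ⟨ℓ, h1, h2⟩
    refine ⟨fun z => ℓ z + Complex.log (w z), h1.add hl, fun z hz => ?_⟩
    rw [Complex.exp_add, h2 z hz, he z hz, mul_div_cancel₀ _ (hne z hz)]
  · rintro ⟨ℓ, h1, h2⟩
    refine ⟨fun z => ℓ z - Complex.log (w z), h1.sub hl, fun z hz => ?_⟩
    rw [Complex.exp_sub, h2 z hz, he z hz, div_div_cancel₀ (hne2 z hz)]

lemma lg_far {K Q : Set ℂ} {p : ℂ} (hK : IsCompact K) (hQ : IsPreconnected Q) (hd : Disjoint Q K) (hu : ∀ R, ∃ q ∈ Q, R < ‖q‖)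
    (hp : p ∈ Q) : HasLg K p := by
  obtain ⟨R, hR⟩ := hK.isBounded.exists_norm_le
  obtain ⟨q, hq, hRq⟩ := hu (max R 0)
  have hq0 : q ≠ 0 := by rintro rfl; simp at hRq
  have hlq : HasLg K q := by
    have hs : ∀ z ∈ K, 1 + -z / q ∈ Complex.slitPlane := fun z hz => by
      refine Complex.mem_slitPlane_of_norm_lt_one ?_
      rw [norm_div, norm_neg, div_lt_one (norm_pos_iff.2 hq0)]
      exact (hR z hz).trans_lt ((le_max_left _ _).trans_lt hRq)
    refine ⟨fun z => Complex.log (1 + -z / q) + Complex.log (-q), ContinuousOn.add (ContinuousOn.clog (by fun_prop) hs) continuousOn_const, fun z hz => ?_⟩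
    rw [Complex.exp_add, Complex.exp_log (Complex.slitPlane_ne_zero (hs z hz)), Complex.exp_log (neg_ne_zero.2 hq0)]
    field_simp; ring
  have ho : ∀ v : Prop, IsOpen {q | q ∉ K ∧ (HasLg K q ↔ v)} := fun v => by
    rw [isOpen_iff_mem_nhds]
    rintro q ⟨h1, h2⟩
    filter_upwards [lg_near hK h1, hK.isClosed.isOpen_compl.mem_nhds h1] with q' h3 h4
    exact ⟨h4, h3.symm.trans h2⟩
  have hnk : ∀ q ∈ Q, q ∉ K := fun q h1 h2 => hd.le_bot ⟨h1, h2⟩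
  have := IsPreconnected.subset_left_of_subset_union (ho True) (ho False) (disjoint_left.2 fun q h1 h2 => by
    have := h1.2; have := h2.2; tauto) (fun q h => by
      by_cases h' : HasLg K q
      · exact Or.inl ⟨hnk q h, by tauto⟩
      · exact Or.inr ⟨hnk q h, by tauto⟩) ⟨q, hq, hnk q hq, by tauto⟩ hQ
  have := (this hp).2
  tauto

lemma exp_const {T : Set ℂ} (hT : IsPreconnected T) {D : ℂ → ℂ} {c : ℂ} (hD : ContinuousOn D T) (he : ∀ z ∈ T, cexp (D z) = c)
    {z w : ℂ} (hz : z ∈ T) (hw : w ∈ T) : D z = D w :=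
  lift_unique (F := cexp) (W := univ) (g' := fun _ => D w) isOpen_univ (fun z _ => Complex.differentiable_exp.analyticAt z) hT hD continuousOn_const
    (fun ζ _ => ⟨trivial, by simp [Complex.exp_ne_zero]⟩) (fun ζ _ => ⟨trivial, by simp [Complex.exp_ne_zero]⟩)
    (fun ζ h => by rw [he ζ h, he w hw]) hw rfl hz

lemma no_wind {α W Q1 Q2 : Set ℂ} {y : ℝ} {z1 z2 : ℂ} (hα : IsCompact α) (hW : IsCompact W) (cα : IsPreconnected α) (cW : IsPreconnected W)
    (c1 : IsPreconnected Q1) (c2 : IsPreconnected Q2) (u1 : ∀ R, ∃ q ∈ Q1, R < ‖q‖) (u2 : ∀ R, ∃ q ∈ Q2, R < ‖q‖)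
    (d1 : Disjoint Q1 (α ∪ W)) (d2 : Disjoint Q2 (α ∪ W)) (p1 : (⟨1, y⟩ : ℂ) ∈ Q1) (p2 : (⟨-1, y⟩ : ℂ) ∈ Q2)
    (hz1 : z1 ∈ α ∩ W) (hz2 : z2 ∈ α ∩ W) (y1 : z1.im < y) (y2 : y < z2.im)
    (ha : ∀ z ∈ α, z.im = y → -1 ≤ z.re → z.re ≤ 1 → False) (hw : ∀ z ∈ W, z.im = y → z.re = 0) : False := by
  obtain ⟨ℓ1, k1, e1⟩ := lg_far (hα.union hW) c1 d1 u1 p1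
  obtain ⟨ℓ2, k2, e2⟩ := lg_far (hα.union hW) c2 d2 u2 p2
  set u : ℂ → ℂ := fun z => (z - ⟨1, y⟩) / (z - ⟨-1, y⟩)
  have n1 : ∀ z ∈ α ∪ W, z - ⟨1, y⟩ ≠ 0 := fun z hz => by rw [← e1 z hz]; exact Complex.exp_ne_zero _
  have n2 : ∀ z ∈ α ∪ W, z - ⟨-1, y⟩ ≠ 0 := fun z hz => by rw [← e2 z hz]; exact Complex.exp_ne_zero _
  have un : ∀ z ∈ α ∪ W, u z ≠ 0 := fun z hz => div_ne_zero (n1 z hz) (n2 z hz)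
  have uc : ContinuousOn u (α ∪ W) := ContinuousOn.div (by fun_prop) (by fun_prop) n2
  have him : ∀ z, (u z).im = 2 * (z.im - y) / Complex.normSq (z - ⟨-1, y⟩) := fun z => by
    simp only [u, Complex.div_im, Complex.sub_re, Complex.sub_im]; ring
  have hre : ∀ z, z.im = y → (u z).re = (z.re - 1) * (z.re + 1) / Complex.normSq (z - ⟨-1, y⟩) := fun z h => by
    simp only [u, Complex.div_re, Complex.sub_re, Complex.sub_im, h]; ring
  have nsq : ∀ z ∈ α ∪ W, 0 < Complex.normSq (z - ⟨-1, y⟩) := fun z hz => Complex.normSq_pos.2 (n2 z hz)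
  have imne : ∀ z ∈ α ∪ W, z.im ≠ y → (u z).im ≠ 0 := fun z hz h => by
    rw [him]; exact div_ne_zero (mul_ne_zero two_ne_zero (sub_ne_zero.2 h)) (nsq z hz).ne'
  have sα : ∀ z ∈ α, u z ∈ Complex.slitPlane := fun z hz => by
    rw [Complex.mem_slitPlane_iff]
    by_cases h : z.im = y
    · left; rw [hre z h]
      refine div_pos ?_ (nsq z (Or.inl hz))
      rcases lt_or_ge z.re (-1) with h1 | h1
      · nlinarith
      · have : 1 < z.re := by by_contra h2; exact ha z hz h h1 (not_lt.1 h2)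
        nlinarith
    · right; exact imne z (Or.inl hz) h
  have sW : ∀ z ∈ W, -u z ∈ Complex.slitPlane := fun z hz => by
    rw [Complex.mem_slitPlane_iff]
    by_cases h : z.im = y
    · left; rw [Complex.neg_re, hre z h, hw z hz h]
      rw [← neg_div]
      exact div_pos (by norm_num) (nsq z (Or.inr hz))
    · right; rw [Complex.neg_im]; exact neg_ne_zero.2 (imne z (Or.inr hz) h)
  have eL : ∀ z ∈ α ∪ W, cexp (ℓ1 z - ℓ2 z) = u z := fun z hz => by rw [Complex.exp_sub, e1 z hz, e2 z hz]
  have A1 := exp_const cα (D := fun z => ℓ1 z - ℓ2 z - Complex.log (u z)) (c := 1)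
    (((k1.sub k2).mono subset_union_left).sub ((uc.mono subset_union_left).clog sα)) (fun z hz => by
      rw [Complex.exp_sub, eL z (Or.inl hz), Complex.exp_log (un z (Or.inl hz)), div_self (un z (Or.inl hz))]) hz1.1 hz2.1
  have A2 := exp_const cW (D := fun z => ℓ1 z - ℓ2 z - Complex.log (-u z)) (c := -1)
    (((k1.sub k2).mono subset_union_right).sub ((uc.mono subset_union_right).neg.clog sW)) (fun z hz => by
      rw [Complex.exp_sub, eL z (Or.inr hz), Complex.exp_log (neg_ne_zero.2 (un z (Or.inr hz))), div_neg, div_self (un z (Or.inr hz))]) hz1.2 hz2.2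
  have i1 : (u z1).im < 0 := by
    rw [him]; exact div_neg_of_neg_of_pos (by linarith) (nsq _ (Or.inl hz1.1))
  have i2 : 0 < (u z2).im := by
    rw [him]; exact div_pos (by linarith) (nsq _ (Or.inl hz2.1))
  have B1 := congrArg Complex.im A1
  have B2 := congrArg Complex.im A2
  simp only [Complex.sub_im, Complex.log_im] at B1 B2
  rw [Complex.arg_neg_eq_arg_add_pi_of_im_neg i1, Complex.arg_neg_eq_arg_sub_pi_of_im_pos i2] at B2
  linarith [Real.pi_pos]

def Hs (x0 x1 y : ℝ) : Set ℂ := (fun t : ℝ => (⟨t, y⟩ : ℂ)) '' Icc x0 x1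
def Vs (x y0 y1 : ℝ) : Set ℂ := (fun t : ℝ => (⟨x, t⟩ : ℂ)) '' Icc y0 y1
lemma Hs_c {y : ℝ} : Continuous (fun t : ℝ => (⟨t, y⟩ : ℂ)) := by
  have : (fun t : ℝ => (⟨t, y⟩ : ℂ)) = fun t : ℝ => (t : ℂ) + y * I := by
    funext s; apply Complex.ext <;> simp
  rw [this]; fun_prop
lemma Vs_c {y : ℝ} : Continuous (fun t : ℝ => (⟨y, t⟩ : ℂ)) := by
  have : (fun t : ℝ => (⟨y, t⟩ : ℂ)) = fun t : ℝ => (y : ℂ) + t * I := by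
    funext s; apply Complex.ext <;> simp
  rw [this]; fun_prop

variable {F : ℂ → ℂ} {P S : Set ℂ} {M : ℕ} {r R0 : ℝ} {F2 : ℂ → ℂ} {P2 S2 : Set ℂ} {B : ℂ → ℂ} {b k : ℝ}
  {a a1 a2 : ℂ} {g g1 g2 gj : ℂ → ℂ}

lemma Nm.disj (N : Nm F P S M r R0 F2 P2 S2 B b k) (ha : a ∈ S) (ha1 : a1 ∈ S) (hne : a1 ≠ a) (hg : Trt F P a r g)
    (hg1 : Trt F P a1 r g1) {ζ ζ1 : ℂ} (h : X1 ≤ ζ.re) (h1 : X1 ≤ ζ1.re) (he : g1 ζ1 = g ζ) : False := by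
  have hX0 : 0 < X1 := by norm_num [X1]
  have hr := N.env.hr
  have e := hg.eq ζ (hX0.trans_le h)
  rw [← he, hg1.eq ζ1 (hX0.trans_le h1)] at e
  have nb : ∀ ζ : ℂ, X1 ≤ ζ.re → ‖(r:ℂ) * cexp (-ζ)‖ < r / 2 := fun ζ h => by
    rw [norm_mul, Complex.norm_exp, Complex.norm_real, Real.norm_of_nonneg hr.le, Complex.neg_re, div_eq_mul_inv]
    refine mul_lt_mul_of_pos_left ?_ hr
    rw [Real.exp_neg]
    refine inv_strictAnti₀ two_pos ?_
    have := Real.add_one_le_exp ζ.re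
    norm_num [X1] at h; linarith
  refine N.env.sep a ha a1 hne ?_ ha1
  rw [show a1 - a = r * cexp (-ζ) - r * cexp (-ζ1) by linear_combination e]
  exact (norm_sub_le _ _).trans_lt (by linarith [nb ζ h, nb ζ1 h1])

set_option maxHeartbeats 1000000 in
lemma Nm.noloop (N : Nm F P S M r R0 F2 P2 S2 B b k) {i j : ℕ} (hij : i + 1 < j) (hk : Yj (j + 1) + 100 < k)
    (hi : Strip F P S r b k i a g) (h1 : Strip F P S r b k (i + 1) a1 g1) (hj : Strip F P S r b k j a gj)
    (h2 : Strip F P S r b k (j + 1) a2 g2) (n1 : a1 ≠ a) (n2 : a2 ≠ a) {m : ℤ}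
    (hm : ∀ ζ ∈ HP, gj (ζ + 2 * π * I * m) = g ζ) : False := by
  have hX0 : 0 < X1 := by norm_num [X1]
  have hb := N.hb
  have hbb := N.hX
  have hY := Yj_pos i
  have hπ := Real.pi_gt_three
  have Ym : ∀ p q : ℕ, p < q → Yj p + 6 ≤ Yj q := fun p q h => by
    have : (p : ℝ) + 1 ≤ q := by exact_mod_cast h
    simp only [Yj]; nlinarith
  have Y1 := Ym i (i+1) (by omega)
  have Y2 := Ym (i+1) j hij
  have Y3 := Ym j (j+1) (by omega)
  have E1 : 1.64 ≤ rexp ((1:ℝ) / 2) := by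
    have := Real.quadratic_le_exp_of_nonneg (x := (1:ℝ)/2) (by norm_num)
    have h3 : rexp (1/2) * rexp (1/2) = rexp 1 := by rw [← Real.exp_add]; norm_num
    have := Real.exp_one_gt_d9
    nlinarith
  have E2 : rexp ((1:ℝ) / 2) ≤ 1.65 := by
    have h3 : rexp (1/2) * rexp (1/2) = rexp 1 := by rw [← Real.exp_add]; norm_num
    have := Real.exp_one_lt_d9
    nlinarith
  have E3 : 2.7 ≤ rexp (2 / 2) := by norm_num; linarith [Real.exp_one_gt_d9]
  have ez : ∀ (n : ℕ) (x : ℝ), (-1) ^ n * (En b ⟨x, Yj n⟩).im = 4 * b * rexp (x / 2) := fun n x => by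
    rw [En_strip]; simp
  obtain ⟨ζi, ci, ei, -, di⟩ := hi.box ⟨1, Yj i⟩ (by norm_num) (by norm_num) (by norm_num)
  obtain ⟨ζj, cj, ej, -, dj⟩ := hj.box ⟨1, Yj j⟩ (by norm_num) (by norm_num) (by norm_num)
  obtain ⟨ζ1, k1, e1, -, d1⟩ := h1.box ⟨2, Yj (i+1)⟩ (by norm_num) (by norm_num) (by norm_num)
  obtain ⟨ζ2, k2, e2, -, d2⟩ := h2.box ⟨2, Yj (j+1)⟩ (by norm_num) (by norm_num) (by norm_num)
  rw [ez] at di dj d1 d2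
  have m1 : b * 1.64 ≤ b * rexp (1 / 2) := by gcongr
  have m2 : b * 2.7 ≤ b * rexp (2 / 2) := by gcongr
  have m3 : b * rexp (1 / 2) ≤ b * 1.65 := by gcongr
  set ζj' := ζj - 2 * π * I * m with hζj'
  have rj : ζj'.re = ζj.re := by simp [hζj']
  have ej' : g ζj' = ⟨1, Yj j⟩ := by
    rw [← hm ζj' (show 0 < ζj'.re by rw [rj]; exact hX0.trans_le cj), hζj', sub_add_cancel, ej]
  set T := segment ℝ ζi ζj'
  have hT : ∀ ζ ∈ T, 6.3 * b ≤ ζ.re := fun ζ h => by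
    have : T ⊆ {z : ℂ | 6.3 * b ≤ z.re} := (convex_halfSpace_re_ge _).segment_subset
      (show 6.3 * b ≤ ζi.re by linarith) (show 6.3 * b ≤ ζj'.re by rw [rj]; linarith)
    exact this h
  have hTX : ∀ ζ ∈ T, X1 ≤ ζ.re := fun ζ h => by linarith [hT ζ h]
  have hTc : ContinuousOn g T := hi.tr.diff.continuousOn.mono fun ζ h => hX0.trans_le (hTX ζ h)
  have Tcomp : IsCompact T := by
    have e : T = _ := segment_eq_image_lineMap ℝ ζi ζj'
    rw [e]; exact isCompact_Icc.image AffineMap.lineMap_continuous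
  have nrm : ∀ p : ℂ, -1 ≤ p.re → p.re ≤ 3 → 0 ≤ p.im → p.im ≤ Yj (j+1) → ‖p‖ + 50 < k := fun p q1 q2 q3 q4 => by
    have := norm_re_im p
    rw [abs_of_nonneg q3] at this
    have h3 : |p.re| ≤ 3 := abs_le.2 ⟨by linarith, q2⟩
    linarith
  have ray : ∀ (n : ℕ) (a' : ℂ) (g' : ℂ → ℂ) (ζ' : ℂ), Strip F P S r b k n a' g' → X1 ≤ ζ'.re → IsPreconnected ((fun t : ℝ => g' (ζ' + t)) '' Ici 0) ∧
      ∀ R, ∃ q ∈ (fun t : ℝ => g' (ζ' + t)) '' Ici 0, R < ‖q‖ := by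
    intro n a' g' ζ' h hX
    constructor
    · refine isPreconnected_Ici.image _ (h.tr.diff.continuousOn.comp (by fun_prop) fun t ht => ?_)
      have : (0:ℝ) ≤ t := ht
      show 0 < (ζ' + t).re
      simp only [Complex.add_re, Complex.ofReal_re]; linarith
    · intro R
      have ht : Tendsto (fun t : ℝ => ζ' + t) atTop (comap Complex.re atTop) := by
        rw [tendsto_comap_iff]
        have : (Complex.re ∘ fun t : ℝ => ζ' + t) = fun t => ζ'.re + t := by funext t; simp
        rw [this]; exact tendsto_atTop_add_const_left _ _ tendsto_id
      obtain ⟨t, h3, h4⟩ := (((h.hi.comp ht).eventually (eventually_gt_atTop R)).and (eventually_ge_atTop 0)).exists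
      exact ⟨_, ⟨t, h4, rfl⟩, h3⟩
  obtain ⟨r1c, r1u⟩ := ray _ _ _ ζ1 h1 k1
  obtain ⟨r2c, r2u⟩ := ray _ _ _ ζ2 h2 k2
  have hseg : ∀ (n : ℕ) (a' : ℂ) (g' : ℂ → ℂ) (ζ' : ℂ), Strip F P S r b k n a' g' → X1 ≤ ζ'.re → 10 * b ≤ ζ'.re → -1 ≤ (g' ζ').re → (g' ζ').re ≤ 1 →
      0 ≤ (g' ζ').im → (g' ζ').im ≤ Yj (j+1) → False := by
    intro n a' g' ζ' h q0 q q1 q2 q3 q4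
    have := h.gm.dep N.hX q0 (by linarith) (by linarith) (nrm _ q1 (by linarith) q3 q4)
    have h5 : 4 * b * rexp ((g' ζ').re / 2) ≤ 4 * b * rexp (1 / 2) := by gcongr
    linarith
  have htr : ∀ (ζ' : ℂ) (t : ℝ), (ζ' + t).re = ζ'.re + t := fun ζ' t => by simp
  have boxα : ∀ (n : ℕ) (a' : ℂ) (g' : ℂ → ℂ), Strip F P S r b k n a' g' → a' ≠ a → ∀ z ∈ g '' T, z.im = Yj n → -1 ≤ z.re → z.re ≤ 3 → False := by
    rintro n a' g' h hn z ⟨ζ, hζ, rfl⟩ q1 q2 q3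
    obtain ⟨ζ', c', e', -, -⟩ := h.box (g ζ) q2 q3 (by rw [q1]; norm_num)
    exact N.disj hi.ha h.ha hn hi.tr h.tr (hTX ζ hζ) c' e'
  have depα : ∀ z ∈ g '' T, z.re = -1 → 0 ≤ z.im → z.im ≤ Yj (j+1) → False := by
    rintro z ⟨ζ, hζ, rfl⟩ q1 q3 q4
    have := hi.gm.dep N.hX (hTX ζ hζ) (by linarith) (by linarith) (nrm _ (by linarith) (by linarith) q3 q4)
    have h5 : 4 * b * rexp ((g ζ).re / 2) ≤ 4 * b * 1 := by gcongr; rw [Real.exp_le_one_iff]; linarith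
    linarith [hT ζ hζ]
  set W := Hs 0 1 (Yj i) ∪ (Vs 0 (Yj i) (Yj j) ∪ Hs 0 1 (Yj j)) with hW
  have Wm : ∀ z ∈ W, 0 ≤ z.re ∧ z.re ≤ 1 ∧ Yj i ≤ z.im ∧ z.im ≤ Yj j ∧ (z.im = Yj i ∨ z.im = Yj j ∨ z.re = 0) := by
    rintro z (⟨t, ⟨s1, s2⟩, rfl⟩ | ⟨t, ⟨s1, s2⟩, rfl⟩ | ⟨t, ⟨s1, s2⟩, rfl⟩)
    · exact ⟨s1, s2, le_rfl, by show Yj i ≤ _; linarith, Or.inl rfl⟩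
    · exact ⟨le_rfl, zero_le_one, s1, s2, Or.inr (Or.inr rfl)⟩
    · exact ⟨s1, s2, by show _ ≤ Yj j; linarith, le_rfl, Or.inr (Or.inl rfl)⟩
  have Hp : ∀ x0 x1 y, IsPreconnected (Hs x0 x1 y) := fun x0 x1 y => isPreconnected_Icc.image _ Hs_c.continuousOn
  have Vp : ∀ x y0 y1, IsPreconnected (Vs x y0 y1) := fun x y0 y1 => isPreconnected_Icc.image _ Vs_c.continuousOn
  have rayW : ∀ (n : ℕ) (a' : ℂ) (g' : ℂ → ℂ) (ζ' : ℂ), Strip F P S r b k n a' g' → a' ≠ a → X1 ≤ ζ'.re → 10 * b ≤ ζ'.re → ∀ t : ℝ, 0 ≤ t →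
      g' (ζ' + t) ∉ g '' T ∪ W := by
    rintro n a' g' ζ' h hn hX h10 t ht (⟨ζ, hζ, e⟩ | h')
    · exact N.disj hi.ha h.ha hn hi.tr h.tr (hTX ζ hζ) (by rw [htr]; linarith) e.symm
    · obtain ⟨w1, w2, w3, w4, -⟩ := Wm _ h'
      exact hseg n a' g' (ζ' + t) h (by rw [htr]; linarith) (by rw [htr]; linarith) (by linarith) w2 (by linarith) (by linarith)
  refine no_wind (α := g '' T) (W := W) (y := Yj (i+1)) (z1 := ⟨1, Yj i⟩) (z2 := ⟨1, Yj j⟩)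
    (Q1 := Hs 1 2 (Yj (i+1)) ∪ (fun t : ℝ => g1 (ζ1 + t)) '' Ici 0)
    (Q2 := Vs (-1) (Yj (i+1)) (Yj (j+1)) ∪ (Hs (-1) 2 (Yj (j+1)) ∪ (fun t : ℝ => g2 (ζ2 + t)) '' Ici 0))
    (Tcomp.image_of_continuousOn hTc)
    ((isCompact_Icc.image Hs_c).union ((isCompact_Icc.image Vs_c).union (isCompact_Icc.image Hs_c)))
    ((convex_segment _ _).isPreconnected.image _ hTc) ?_ ?_ ?_ ?_ ?_ ?_ ?_ ?_ ?_ ?_ ?_ ?_ ?_ ?_ ?_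
  · exact (Hp _ _ _).union ⟨0, Yj i⟩ ⟨0, by norm_num, rfl⟩ (Or.inl ⟨Yj i, ⟨le_rfl, by linarith⟩, rfl⟩)
      ((Vp _ _ _).union ⟨0, Yj j⟩ ⟨Yj j, ⟨by linarith, le_rfl⟩, rfl⟩ ⟨0, by norm_num, rfl⟩ (Hp _ _ _))
  · exact (Hp _ _ _).union ⟨2, Yj (i+1)⟩ ⟨2, by norm_num, rfl⟩ ⟨0, self_mem_Ici, by simp [e1]⟩ r1c
  · exact (Vp _ _ _).union ⟨-1, Yj (j+1)⟩ ⟨Yj (j+1), ⟨by linarith, le_rfl⟩, rfl⟩ (Or.inl ⟨-1, by norm_num, rfl⟩)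
      ((Hp _ _ _).union ⟨2, Yj (j+1)⟩ ⟨2, by norm_num, rfl⟩ ⟨0, self_mem_Ici, by simp [e2]⟩ r2c)
  · intro R; obtain ⟨q, h, h'⟩ := r1u R; exact ⟨q, Or.inr h, h'⟩
  · intro R; obtain ⟨q, h, h'⟩ := r2u R; exact ⟨q, Or.inr (Or.inr h), h'⟩
  · rw [disjoint_left]
    rintro z (⟨t, ⟨s1, s2⟩, rfl⟩ | ⟨t, ht, rfl⟩)
    · rintro (h | h)
      · exact boxα _ _ _ h1 n1 _ h rfl (by show -1 ≤ t; linarith) (by show t ≤ 3; linarith)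
      · obtain ⟨w1, w2, w3, w4, w5⟩ := Wm _ h
        simp only at w5
        rcases w5 with w | w | w <;> linarith
    · exact rayW _ _ _ _ h1 n1 k1 (by linarith) t ht
  · rw [disjoint_left]
    rintro z (⟨t, ⟨s1, s2⟩, rfl⟩ | ⟨t, ⟨s1, s2⟩, rfl⟩ | ⟨t, ht, rfl⟩)
    · rintro (h | h)
      · exact depα _ h rfl (by show 0 ≤ t; linarith) s2
      · have := (Wm _ h).1
        norm_num at this
    · rintro (h | h)
      · exact boxα _ _ _ h2 n2 _ h rfl s1 (by show t ≤ 3; linarith)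
      · have := (Wm _ h).2.2.2.1
        simp only at this; linarith
    · exact rayW _ _ _ _ h2 n2 k2 (by linarith) t ht
  · exact Or.inl ⟨1, by norm_num, rfl⟩
  · exact Or.inl ⟨Yj (i+1), ⟨le_rfl, by linarith⟩, rfl⟩
  · exact ⟨⟨ζi, left_mem_segment _ _ _, ei⟩, Or.inl ⟨1, by norm_num, rfl⟩⟩
  · exact ⟨⟨ζj', right_mem_segment _ _ _, ej'⟩, Or.inr (Or.inr ⟨1, by norm_num, rfl⟩)⟩
  · show Yj i < Yj (i+1); linarith
  · show Yj (i+1) < Yj j; linarith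
  · intro z hz q1 q2 q3
    exact boxα _ _ _ h1 n1 z hz q1 q2 (by linarith)
  · intro z hz q1
    obtain ⟨w1, w2, w3, w4, w5⟩ := Wm _ hz
    rcases w5 with w | w | w
    · linarith
    · linarith
    · exact w

lemma Nm.many (N : Nm F P S M r R0 F2 P2 S2 B b k) (n : ℕ) (hk : Yj (n + 1) + 100 < k) : ∃ (a : ℕ → ℂ) (g : ℕ → ℂ → ℂ),
    (∀ i, i ≤ n → a i ∈ S ∧ Trt F P (a i) r (g i) ∧ Tendsto (fun ζ => ‖g i ζ‖) (comap Complex.re atTop) atTop) ∧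
    ∀ i j, i ≤ n → j ≤ n → i ≠ j → a i = a j → ∀ ζ1 ∈ HP, ∀ ζ2 ∈ HP, g i ζ1 ≠ g j ζ2 := by
  have Yk : ∀ j, j ≤ n + 1 → Yj j + 100 < k := fun j h => by
    have : (j:ℝ) ≤ (n + 1 : ℕ) := by exact_mod_cast h
    have : 2 * π * j ≤ 2 * π * (n + 1 : ℕ) := by gcongr
    simp only [Yj] at hk ⊢; linarith
  have : ∀ j, ∃ a g, j ≤ n + 1 → Strip F P S r b k j a g := fun j => by
    by_cases h : j ≤ n + 1
    · obtain ⟨a, g, h'⟩ := N.strip j (Yk j h); exact ⟨a, g, fun _ => h'⟩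
    · exact ⟨0, id, fun h' => absurd h' h⟩
  choose a g h using this
  have adj : ∀ j, j ≤ n → a (j + 1) ≠ a j := fun j hj e => by
    have h' := h (j + 1) (by omega)
    rw [e] at h'
    exact N.adj (Yk _ (by omega)) (h j (by omega)) h'
  have main : ∀ i j, i < j → j ≤ n → a i = a j → ∀ ζ1 ∈ HP, ∀ ζ2 ∈ HP, g i ζ1 ≠ g j ζ2 := by
    intro i j hij hj ha ζ1 q1 ζ2 q2 he
    have hne : j ≠ i + 1 := fun e => adj i (by omega) (by rw [← e, ha])
    have hi := h i (by omega)
    have hj' := h j (by omega)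
    rw [← ha] at hj'
    obtain ⟨m, -, hm⟩ := N.env.c.tr_shift N.env.hr (N.env.sep _ hi.ha) hi.tr hj'.tr q1 q2 he
    exact N.noloop (by omega) (Yk _ (by omega)) hi (h (i+1) (by omega)) hj' (h (j+1) (by omega)) (adj i (by omega))
      (by rw [ha]; exact adj j hj) hm
  refine ⟨a, g, fun i hi => ⟨(h i (by omega)).ha, (h i (by omega)).tr, (h i (by omega)).hi⟩, fun i j hi hj hn ha ζ1 q1 ζ2 q2 he => ?_⟩
  rcases lt_or_gt_of_ne hn with h' | h'
  · exact main i j h' hj ha ζ1 q1 ζ2 q2 he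
  · exact main j i h' hi ha.symm ζ2 q2 ζ1 q1 he.symm
end

section

lemma form_deriv {F h : ℂ → ℂ} {z c : ℂ} {q : ℕ} (hq : 1 ≤ q) (hh : AnalyticAt ℂ h z) (h0 : h z ≠ 0)
    (hF : ∀ᶠ w in 𝓝 z, F w = c + (w - z) ^ q * h w) : ∃ k : ℂ → ℂ, AnalyticAt ℂ k z ∧ k z ≠ 0 ∧
      ∀ᶠ w in 𝓝 z, deriv F w = (w - z) ^ (q - 1) * k w := by
  refine ⟨fun w => q * h w + (w - z) * deriv h w, by have := hh.deriv; fun_prop, ?_, ?_⟩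
  · have : (q:ℂ) ≠ 0 := by exact_mod_cast (by omega : q ≠ 0)
    simp [this, h0]
  · filter_upwards [hF.eventually_nhds, hh.eventually_analyticAt] with w h1 h2
    rw [Filter.EventuallyEq.deriv_eq h1]
    have := ((((hasDerivAt_id w).sub_const z).pow q).mul h2.differentiableAt.hasDerivAt).const_add c
    refine (HasDerivAt.deriv this).trans ?_
    obtain ⟨p, rfl⟩ := Nat.exists_eq_add_of_le hq
    simp only [id, Pi.pow_apply, add_tsub_cancel_left]
    push_cast
    ring

lemma crit_blow {G A h : ℂ → ℂ} {z c : ℂ} {q : ℕ} (hq : 1 ≤ q) (hh : AnalyticAt ℂ h z) (h0 : h z ≠ 0)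
    (hF : ∀ᶠ w in 𝓝 z, G w = c + (w - z) ^ q * h w) (hA : ContinuousAt A z)
    (hS : ∀ᶠ w in 𝓝[≠] z, schwarzian G w = 2 * A w) : deriv G z ≠ 0 ∧ schwarzian G z = 2 * A z := by
  have hG : AnalyticAt ℂ G z := by
    refine AnalyticAt.congr ?_ (EventuallyEq.symm hF)
    fun_prop
  obtain ⟨k, hk, k0, hd⟩ := form_deriv hq hh h0 hF
  have hA' : Tendsto (fun w => 2 * A w) (𝓝[≠] z) (𝓝 (2 * A z)) := (hA.tendsto.mono_left nhdsWithin_le_nhds).const_mul 2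
  have hq1 : q - 1 = 0 := by
    set p := q - 1
    have hk1 : AnalyticAt ℂ (fun w => deriv k w / k w) z := hk.deriv.div hk k0
    set v : ℂ → ℂ := fun w => deriv k w / k w
    have hT : ∀ᶠ w in 𝓝[≠] z, deriv G w ≠ 0 ∧ deriv (deriv G) w / deriv G w = p / (w - z) + v w := by
      filter_upwards [nhdsWithin_le_nhds hd.eventually_nhds, nhdsWithin_le_nhds hk.eventually_analyticAt,
        nhdsWithin_le_nhds (hk.continuousAt.eventually_ne k0), self_mem_nhdsWithin] with w h1 h2 h3 h4
      have h4' : w - z ≠ 0 := sub_ne_zero.2 h4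
      have e0 := h1.self_of_nhds
      have e1 : deriv (deriv G) w = p * (w - z) ^ (p - 1) * k w + (w - z) ^ p * deriv k w := by
        rw [Filter.EventuallyEq.deriv_eq h1]
        have := (((hasDerivAt_id w).sub_const z).pow p).mul h2.differentiableAt.hasDerivAt
        refine (HasDerivAt.deriv this).trans ?_
        simp
      refine ⟨by rw [e0]; exact mul_ne_zero (pow_ne_zero _ h4') h3, ?_⟩
      rw [e1, e0]
      simp only [v]
      rcases Nat.eq_zero_or_pos p with hp | hp
      · rw [hp]; simp
      · obtain ⟨s, hs⟩ := Nat.exists_eq_add_of_le' hp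
        rw [hs]; simp only [add_tsub_cancel_right]; field_simp; push_cast; ring
    have hSs : ∀ᶠ w in 𝓝[≠] z, (w - z) ^ 2 * (2 * A w) = -p + (w - z) ^ 2 * deriv v w - 1 / 2 * (p + (w - z) * v w) ^ 2 := by
      have ee := (eventually_eventually_nhdsWithin.2 hT)
      filter_upwards [hS, ee, hT, nhdsWithin_le_nhds hG.eventually_analyticAt, self_mem_nhdsWithin,
        nhdsWithin_le_nhds hk1.eventually_analyticAt] with w h1 h2 h3 h4 h5 h6
      have h5' : w - z ≠ 0 := sub_ne_zero.2 h5
      have hn : 𝓝[≠] z ⊓ 𝓝 w ≤ 𝓝 w := inf_le_right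
      have h2' : ∀ᶠ y in 𝓝 w, deriv (deriv G) y / deriv G y = p / (y - z) + v y := by
        rw [eventually_nhdsWithin_iff] at h2
        filter_upwards [h2, isOpen_ne.mem_nhds h5] with y a1 a2 using (a1 a2).2
      rw [← h1, schwarzian]
      have e3 : HasDerivAt (deriv (deriv G)) (deriv (deriv (deriv G)) w) w := h4.deriv.deriv.differentiableAt.hasDerivAt
      have e2 : HasDerivAt (deriv G) (deriv (deriv G) w) w := h4.deriv.differentiableAt.hasDerivAt
      have d1 := (e3.div e2 h3.1).deriv
      have d2 := ((((hasDerivAt_const w (p:ℂ)).div ((hasDerivAt_id w).sub_const z) h5').add h6.differentiableAt.hasDerivAt)).deriv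
      have d3 : deriv (deriv (deriv G) / deriv G) w = deriv ((fun _ => (p:ℂ)) / (fun x => id x - z) + v) w :=
        Filter.EventuallyEq.deriv_eq h2'
      rw [d1, d2] at d3
      have e5 : deriv (deriv (deriv G)) w / deriv G w = (deriv (deriv (deriv G)) w * deriv G w - deriv (deriv G) w * deriv (deriv G) w) / deriv G w ^ 2
        + (deriv (deriv G) w / deriv G w) ^ 2 := by have := h3.1; field_simp; ring
      rw [e5, d3, h3.2]
      simp only [id]
      field_simp
      ring
    have l1 : Tendsto (fun w => (w - z) ^ 2 * (2 * A w)) (𝓝[≠] z) (𝓝 0) := by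
      have : Tendsto (fun w => (w - z) ^ 2) (𝓝[≠] z) (𝓝 ((z - z) ^ 2)) :=
        (Continuous.tendsto (by fun_prop) z).mono_left nhdsWithin_le_nhds
      simpa using this.mul hA'
    have l2 : Tendsto (fun w => -(p:ℂ) + (w - z) ^ 2 * deriv v w - 1 / 2 * (p + (w - z) * v w) ^ 2) (𝓝[≠] z) (𝓝 (-p - 1 / 2 * (p:ℂ) ^ 2)) := by
      have : AnalyticAt ℂ (fun w => -(p:ℂ) + (w - z) ^ 2 * deriv v w - 1 / 2 * (p + (w - z) * v w) ^ 2) z := by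
        have := hk1.deriv; fun_prop
      simpa using this.continuousAt.tendsto.mono_left nhdsWithin_le_nhds
    have := tendsto_nhds_unique (l2.congr' (hSs.mono fun w h => h.symm)) l1
    have h9 : (p:ℂ) * (p + 2) = 0 := by linear_combination -2 * this
    have : p * (p + 2) = 0 := by exact_mod_cast h9
    rcases Nat.mul_eq_zero.1 this with h | h <;> omega
  rw [hq1] at hd
  have hd0 : deriv G z ≠ 0 := by rw [hd.self_of_nhds]; simpa using k0
  refine ⟨hd0, ?_⟩
  have hc : ContinuousAt (schwarzian G) z := by
    have : AnalyticAt ℂ (schwarzian G) z :=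
      (hG.deriv.deriv.deriv.div hG.deriv hd0).sub (analyticAt_const.mul ((hG.deriv.deriv.div hG.deriv hd0).pow 2))
    exact this.continuousAt
  exact tendsto_nhds_unique ((hc.tendsto.mono_left nhdsWithin_le_nhds).congr' hS) hA'

lemma mero_conn {f : ℂ → ℂ} {P : Set ℂ} (hf : MeroPlane f P) : IsPreconnected Pᶜ := by
  refine (Set.Countable.isConnected_compl_of_one_lt_rank (by rw [Complex.rank_real_complex]; norm_num) ?_).isPreconnected
  have : P ⊆ ⋃ n : ℕ, P ∩ closedBall 0 n := fun z hz => by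
    obtain ⟨n, hn⟩ := exists_nat_ge ‖z‖
    exact mem_iUnion.2 ⟨n, hz, by simpa using hn⟩
  exact (countable_iUnion fun n : ℕ => (hf.1 _ (isCompact_closedBall 0 (n:ℝ))).countable).mono this

variable {f : ℂ → ℂ} {P : Set ℂ}

lemma loc_f (hf : TranscMeroPlane f P) {z : ℂ} (hz : z ∉ P) : ∃ (q : ℕ) (h : ℂ → ℂ), 1 ≤ q ∧ AnalyticAt ℂ h z ∧ h z ≠ 0 ∧
    ∀ᶠ w in 𝓝 z, f w = f z + (w - z) ^ q * h w := by
  have hfa := hf.1.2.1 z hz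
  have ha : AnalyticAt ℂ (fun w => f w - f z) z := hfa.sub analyticAt_const
  have hne : ¬ ∀ᶠ w in 𝓝 z, f w - f z = 0 := fun h => by
    have := AnalyticOnNhd.eqOn_of_preconnected_of_eventuallyEq (f := f) (g := fun _ => f z) (U := Pᶜ) (fun w hw => hf.1.2.1 w hw)
      (fun w _ => analyticAt_const) (mero_conn hf.1) hz (h.mono fun w hw => sub_eq_zero.1 hw)
    exact hf.2 ⟨Polynomial.C (f z), 1, one_ne_zero, fun w hw _ => by simpa using this hw⟩
  obtain ⟨q, h, hh, h0, he⟩ := ha.exists_eventuallyEq_pow_smul_nonzero_iff.2 hne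
  refine ⟨q, h, ?_, hh, h0, he.mono fun w hw => by rw [← smul_eq_mul, ← hw]; ring⟩
  by_contra hq
  have : q = 0 := by omega
  have h1 := he.self_of_nhds
  rw [this] at h1
  simp at h1; exact h0 h1.symm

lemma loc_M {M : ℕ} (hM : 0 < M) (hmult : ∀ z μ, MultiplePointWithMult f z μ → μ ≤ M) {z : ℂ} (hz : AnalyticAt ℂ f z) {q : ℕ} {h : ℂ → ℂ}
    (hq : 1 ≤ q) (hh : AnalyticAt ℂ h z) (h0 : h z ≠ 0) (hF : ∀ᶠ w in 𝓝 z, f w = f z + (w - z) ^ q * h w) :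
    q ≤ M ∧ (deriv f z = 0 → MultiplePoint f z) := by
  obtain ⟨k, hk, k0, hd⟩ := form_deriv hq hh h0 hF
  rcases (by omega : q = 1 ∨ 2 ≤ q) with h1 | h2
  · refine ⟨by omega, fun h => ?_⟩
    rw [h1] at hd
    have := hd.self_of_nhds
    rw [h] at this; simp at this; exact absurd this.symm k0
  · have : MultiplePointWithMult f z q := ⟨h2, Or.inr ⟨hz, by omega, k, hk, k0, hd⟩⟩
    exact ⟨hmult z q this, fun _ => ⟨q, this⟩⟩
end

section

open scoped Classical in
def FF (f : ℂ → ℂ) (P : Set ℂ) (b0 z : ℂ) : ℂ := if z ∈ P then 0 else (f z - b0)⁻¹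
def PP (f : ℂ → ℂ) (P : Set ℂ) (b0 : ℂ) : Set ℂ := {z | z ∉ P ∧ f z = b0}
open scoped Classical in
def wv (b0 a : ℂ) : Option ℂ := if a = 0 then none else some (b0 + a⁻¹)

lemma wv_inj (b0 : ℂ) : Function.Injective (wv b0) := by
  intro a b h
  unfold wv at h
  split_ifs at h with h1 h2 h2
  · rw [h1, h2]
  · simpa using h

variable {f : ℂ → ℂ} {P : Set ℂ} {b0 : ℂ}

lemma FF_in {z : ℂ} (hz : z ∈ P) : FF f P b0 z = 0 := if_pos hz
lemma FF_out {z : ℂ} (hz : z ∉ P) : FF f P b0 z = (f z - b0)⁻¹ := if_neg hz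

lemma loc_FF (hf : TranscMeroPlane f P) {M : ℕ} (hM : 0 < M) (hmult : ∀ z μ, MultiplePointWithMult f z μ → μ ≤ M)
    {z : ℂ} (hz : z ∉ PP f P b0) : ∃ (q : ℕ) (h : ℂ → ℂ), 1 ≤ q ∧ q ≤ M ∧ AnalyticAt ℂ h z ∧ h z ≠ 0 ∧
      (∀ᶠ w in 𝓝 z, FF f P b0 w = FF f P b0 z + (w - z) ^ q * h w) ∧ (deriv (FF f P b0) z = 0 → MultiplePoint f z) := by
  suffices H : ∃ (q : ℕ) (h : ℂ → ℂ), 1 ≤ q ∧ q ≤ M ∧ AnalyticAt ℂ h z ∧ h z ≠ 0 ∧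
      (∀ᶠ w in 𝓝 z, FF f P b0 w = FF f P b0 z + (w - z) ^ q * h w) ∧ (2 ≤ q → MultiplePoint f z) by
    obtain ⟨q, h, h1, h2, h3, h4, h5, h6⟩ := H
    refine ⟨q, h, h1, h2, h3, h4, h5, fun h7 => h6 ?_⟩
    by_contra hn
    obtain ⟨k, hk, k0, hd⟩ := form_deriv h1 h3 h4 h5
    rw [(by omega : q - 1 = 0)] at hd
    have := hd.self_of_nhds
    rw [h7] at this; simp at this; exact k0 this.symm
  by_cases hzP : z ∈ P
  · obtain ⟨m, hm⟩ := mero_pole hf.1 hzP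
    obtain ⟨m0, g, hg, g0, hgf⟩ := id hm
    have m2 : 2 ≤ m → MultiplePointWithMult f z m := fun h => ⟨h, Or.inl hm⟩
    have ha : AnalyticAt ℂ (fun w => g w - b0 * (w - z) ^ m) z := by fun_prop
    have h0 : g z - b0 * (z - z) ^ m ≠ 0 := by simpa [m0.ne'] using g0
    refine ⟨m, fun w => (g w - b0 * (w - z) ^ m)⁻¹, m0, ?_, ha.inv h0, inv_ne_zero h0, ?_, fun h => ⟨m, m2 h⟩⟩
    · rcases (by omega : m = 1 ∨ 2 ≤ m) with h | h
      · omega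
      · exact hmult z m (m2 h)
    · have e1 := mero_punct hf.1 z
      rw [eventually_nhdsWithin_iff] at e1 hgf
      filter_upwards [e1, hgf, ha.continuousAt.eventually_ne h0] with w w1 w2 w3
      rw [FF_in hzP]
      by_cases hw : w = z
      · rw [hw, FF_in hzP]; simp [m0.ne']
      · have hw' : w - z ≠ 0 := sub_ne_zero.2 hw
        rw [FF_out (w1 hw), w2 hw, zero_add, ← div_eq_mul_inv, ← inv_div]
        congr 1
        field_simp
  · have hne : f z - b0 ≠ 0 := fun h => hz ⟨hzP, sub_eq_zero.1 h⟩
    have hfa := hf.1.2.1 z hzP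
    obtain ⟨q, h, hq, hh, h0, hF⟩ := loc_f hf hzP
    have hL := loc_M hM hmult hfa hq hh h0 hF
    have ha : AnalyticAt ℂ (fun w => (f w - b0) * (f z - b0)) z := by fun_prop
    refine ⟨q, fun w => - h w / ((f w - b0) * (f z - b0)), hq, hL.1, hh.neg.div ha (mul_ne_zero hne hne),
      div_ne_zero (neg_ne_zero.2 h0) (mul_ne_zero hne hne), ?_, fun h2 => hL.2 ?_⟩
    · filter_upwards [hF, (mero_closed hf.1).isOpen_compl.mem_nhds hzP,
        (hfa.sub (analyticAt_const (v := b0))).continuousAt.eventually_ne hne] with w w1 w2 w3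
      have w3' : f w - b0 ≠ 0 := w3
      rw [FF_out w2, FF_out hzP]
      have : (w - z) ^ q * (-h w / ((f w - b0) * (f z - b0))) = (f z - f w) / ((f w - b0) * (f z - b0)) := by
        rw [w1]; ring
      rw [this]; field_simp; ring
    · obtain ⟨k, hk, k0, hd⟩ := form_deriv hq hh h0 hF
      rw [hd.self_of_nhds, sub_self, zero_pow (by omega), zero_mul]

lemma PP_punct (hf : TranscMeroPlane f P) (b0 p : ℂ) : ∀ᶠ z in 𝓝[≠] p, z ∉ P ∧ f z ≠ b0 := by
  have e1 := mero_punct hf.1 p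
  by_cases hp : p ∈ P
  · filter_upwards [e1, (mero_tendsto hf.1 hp).eventually_gt_atTop ‖b0‖] with z h1 h2
    exact ⟨h1, fun h => by rw [h] at h2; exact lt_irrefl _ h2⟩
  · by_cases hb : f p = b0
    · obtain ⟨q, h, hq, hh, h0, hF⟩ := loc_f hf hp
      filter_upwards [e1, nhdsWithin_le_nhds hF, nhdsWithin_le_nhds (hh.continuousAt.eventually_ne h0), self_mem_nhdsWithin] with z h1 h2 h3 h4
      refine ⟨h1, ?_⟩
      rw [h2, hb]
      simpa using ⟨fun h => absurd (sub_eq_zero.1 h) h4, h3⟩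
    · filter_upwards [e1, nhdsWithin_le_nhds ((hf.1.2.1 p hp).continuousAt.eventually_ne hb)] with z h1 h2 using ⟨h1, h2⟩

lemma mero_FF (hf : TranscMeroPlane f P) {M : ℕ} (hM : 0 < M) (hmult : ∀ z μ, MultiplePointWithMult f z μ → μ ≤ M) :
    MeroPlane (FF f P b0) (PP f P b0) := by
  refine ⟨fun K hK => ?_, fun z hz => ?_, fun p hp => ?_⟩
  · refine hK.induction_on (p := fun s => (PP f P b0 ∩ s).Finite) (by simp) (fun s t hst h => h.subset (inter_subset_inter_right _ hst))
      (fun s t h1 h2 => by rw [inter_union_distrib_left]; exact h1.union h2) fun p _ => ?_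
    have := PP_punct hf b0 p
    rw [eventually_nhdsWithin_iff] at this
    refine ⟨_, nhdsWithin_le_nhds this, (finite_singleton p).subset ?_⟩
    rintro z ⟨h1, h2⟩
    by_contra h
    exact (h2 h).2 h1.2
  · obtain ⟨q, h, -, -, h3, -, h5, -⟩ := loc_FF hf hM hmult hz
    refine AnalyticAt.congr ?_ (EventuallyEq.symm h5)
    fun_prop
  · have h1 : Tendsto (fun z => f z - b0) (𝓝[(PP f P b0)ᶜ] p) (𝓝[≠] 0) := by
      refine tendsto_nhdsWithin_iff.2 ⟨?_, ?_⟩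
      · have := ((hf.1.2.1 p hp.1).sub (analyticAt_const (v := b0))).continuousAt.tendsto
        simp only [Pi.sub_apply, hp.2, sub_self] at this
        exact this.mono_left nhdsWithin_le_nhds
      · filter_upwards [self_mem_nhdsWithin, nhdsWithin_le_nhds ((mero_closed hf.1).isOpen_compl.mem_nhds hp.1)] with z h1 h2 h3
        exact h1 ⟨h2, sub_eq_zero.1 h3⟩
    refine (tendsto_norm_inv_nhdsNE_zero_atTop.comp h1).congr' ?_
    filter_upwards [nhdsWithin_le_nhds ((mero_closed hf.1).isOpen_compl.mem_nhds hp.1)] with z h2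
    simp only [Function.comp]; rw [FF_out h2]

lemma ub_FF (hf : TranscMeroPlane f P) {M : ℕ} (hM : 0 < M) (hmult : ∀ z μ, MultiplePointWithMult f z μ → μ ≤ M)
    (R C : ℝ) : ∃ z, R < ‖z‖ ∧ (z ∈ PP f P b0 ∨ C < ‖FF f P b0 z‖) := by
  by_contra! hn
  have hm := mero_FF (b0 := b0) hf hM hmult
  obtain ⟨p, q, hq, h⟩ := rational_of_growth hm (R := R) (C := C) (N := 0) fun z hz => by simpa using hn z hz
  have hfin : (PP f P b0).Finite := (hm.1 _ (isCompact_closedBall 0 R)).subset fun z hz =>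
    ⟨hz, by by_contra h; exact (hn z (by simpa using h)).1 hz⟩
  set Q : Polynomial ℂ := ∏ x ∈ hfin.toFinset, (Polynomial.X - Polynomial.C x)
  have hQ : Q ≠ 0 := Finset.prod_ne_zero_iff.2 fun x _ => Polynomial.X_sub_C_ne_zero x
  have hQe : ∀ z, Q.eval z ≠ 0 → z ∉ PP f P b0 := fun z hz h => hz (by
    rw [Polynomial.eval_prod]; exact Finset.prod_eq_zero (hfin.mem_toFinset.2 h) (by simp))
  have key : ∀ z, z ∉ P → Q.eval z ≠ 0 → q.eval z ≠ 0 → p.eval z ≠ 0 ∧ f z = b0 + q.eval z / p.eval z := fun z h1 h2 h3 => by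
    have h4 := h z (hQe z h2) h3
    have h5 : f z - b0 ≠ 0 := fun h => hQe z h2 ⟨h1, sub_eq_zero.1 h⟩
    rw [FF_out h1] at h4
    have h6 : p.eval z ≠ 0 := fun h6 => by rw [h6, zero_div] at h4; exact inv_ne_zero h5 h4
    exact ⟨h6, by rw [← inv_div, ← h4, inv_inv]; ring⟩
  by_cases hp : p = 0
  · refine hf.2 ⟨0, q * Q, mul_ne_zero hq hQ, fun z h1 h2 => ?_⟩
    rw [Polynomial.eval_mul] at h2
    have := (key z h1 (right_ne_zero_of_mul h2) (left_ne_zero_of_mul h2)).1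
    rw [hp] at this; simp at this
  · refine hf.2 ⟨(Polynomial.C b0 * p + q) * (q * Q), p * (q * Q), mul_ne_zero hp (mul_ne_zero hq hQ), fun z h1 h2 => ?_⟩
    rw [Polynomial.eval_mul, Polynomial.eval_mul] at h2
    have h3 := right_ne_zero_of_mul h2
    obtain ⟨h4, h5⟩ := key z h1 (right_ne_zero_of_mul h3) (left_ne_zero_of_mul h3)
    rw [h5]
    simp only [Polynomial.eval_mul, Polynomial.eval_add, Polynomial.eval_C]
    have := left_ne_zero_of_mul h3
    have := right_ne_zero_of_mul h3
    field_simp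

lemma sq1 (x : ℂ) : 1 ≤ √(1 + ‖x‖ ^ 2) ∧ ‖x‖ ≤ √(1 + ‖x‖ ^ 2) ∧ √(1 + ‖x‖ ^ 2) ≤ 1 + ‖x‖ := by
  have := norm_nonneg x
  refine ⟨Real.le_sqrt_of_sq_le (by nlinarith), Real.le_sqrt_of_sq_le (by nlinarith), Real.sqrt_le_left (by linarith) |>.2 (by nlinarith)⟩

lemma ch1 {z : ℂ} (hz : z ∉ PP f P b0) (a : ℂ) :
    chordal (valueAt f P z) (wv b0 a) ≤ (1 + ‖b0‖) * (1 + ‖a‖⁻¹) * ‖FF f P b0 z - a‖ := by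
  have hb := norm_nonneg b0
  have hz' := norm_nonneg (f z)
  by_cases hzP : z ∈ P
  · rw [FF_in hzP, valueAt, if_pos hzP, wv]
    split_ifs with ha
    · simp [chordal, ha]
    · have ha' := norm_pos_iff.2 ha
      simp only [chordal, zero_sub, norm_neg]
      have h1 := (sq1 (b0 + a⁻¹)).1
      calc _ ≤ (1:ℝ) := by rw [div_le_one (by linarith)]; exact h1
        _ ≤ (1 + ‖b0‖) * (‖a‖ + 1) := by nlinarith
        _ = _ := by field_simp
  · have hu : f z - b0 ≠ 0 := fun h => hz ⟨hzP, sub_eq_zero.1 h⟩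
    have hu' := norm_pos_iff.2 hu
    rw [FF_out hzP, valueAt, if_neg hzP, wv]
    obtain ⟨s1, s2, -⟩ := sq1 (f z)
    have hub : ‖f z - b0‖ ≤ (1 + ‖b0‖) * √(1 + ‖f z‖ ^ 2) := (norm_sub_le _ _).trans (by nlinarith)
    split_ifs with ha
    · simp only [chordal, ha, norm_zero, inv_zero, add_zero, mul_one, sub_zero, norm_inv]
      rw [← div_eq_mul_inv, div_le_div_iff₀ (by linarith) hu']
      linarith
    · have ha' := norm_pos_iff.2 ha
      obtain ⟨w1, -, -⟩ := sq1 (b0 + a⁻¹)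
      simp only [chordal]
      rw [Real.sqrt_mul (by positivity)]
      have e1 : f z - (b0 + a⁻¹) = -((f z - b0)⁻¹ - a) * (f z - b0) / a := by field_simp; ring
      rw [e1, norm_div, norm_mul, norm_neg]
      set N := ‖(f z - b0)⁻¹ - a‖
      have hN : 0 ≤ N := norm_nonneg _
      rw [div_le_iff₀ (by positivity)]
      calc N * ‖f z - b0‖ / ‖a‖ ≤ N * ((1 + ‖b0‖) * √(1 + ‖f z‖ ^ 2)) / ‖a‖ := by gcongr
        _ = (1 + ‖b0‖) * (0 + ‖a‖⁻¹) * N * (√(1 + ‖f z‖ ^ 2) * 1) := by ring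
        _ ≤ _ := by gcongr; norm_num

lemma ch2 (f : ℂ → ℂ) (P : Set ℂ) (b0 a : ℂ) {r : ℝ} (hr : 0 < r) : ∃ t > 0, ∀ z, chordal (valueAt f P z) (wv b0 a) < t →
    z ∉ PP f P b0 ∧ ‖FF f P b0 z - a‖ < r := by
  have hb := norm_nonneg b0
  by_cases ha : a = 0
  · refine ⟨1 / (2 + ‖b0‖ + 1 / r), by positivity, fun z h => ?_⟩
    rw [wv, if_pos ha, valueAt] at h
    by_cases hzP : z ∈ P
    · exact ⟨fun h => h.1 hzP, by rw [FF_in hzP, ha]; simpa using hr⟩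
    · rw [if_neg hzP] at h
      simp only [chordal] at h
      obtain ⟨s1, s2, s3⟩ := sq1 (f z)
      rw [div_lt_div_iff_of_pos_left one_pos (by linarith) (by positivity)] at h
      have h1 : 1 / r < ‖f z - b0‖ := by
        have := norm_sub_norm_le (f z) b0; linarith
      have h2 : 0 < ‖f z - b0‖ := lt_trans (by positivity) h1
      refine ⟨fun h => ?_, ?_⟩
      · rw [h.2] at h2; simp at h2
      · rw [FF_out hzP, ha, sub_zero, norm_inv]
        rw [one_div] at h1
        exact inv_lt_of_inv_lt₀ hr h1
  · have ha' := norm_pos_iff.2 ha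
    set w := b0 + a⁻¹ with hw
    obtain ⟨w1, w2, w3⟩ := sq1 w
    set W := √(1 + ‖w‖ ^ 2)
    have hw0 := norm_nonneg w
    set e := min (1 / (2 * ‖a‖)) (r / (2 * ‖a‖ ^ 2)) with he
    have he0 : 0 < e := by positivity
    have e1 : e ≤ 1 / (2 * ‖a‖) := min_le_left _ _
    have e2 : e ≤ r / (2 * ‖a‖ ^ 2) := min_le_right _ _
    refine ⟨min (1 / (2 * W)) (e / (2 * W * (1 + ‖w‖))), by positivity, fun z h => ?_⟩
    rw [wv, if_neg ha, valueAt, ← hw] at h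
    obtain ⟨t1, t2⟩ := lt_min_iff.1 h
    by_cases hzP : z ∈ P
    · rw [if_pos hzP] at t1
      simp only [chordal] at t1
      rw [div_lt_div_iff_of_pos_left one_pos (by linarith) (by linarith)] at t1
      linarith
    · rw [if_neg hzP] at t1 t2
      simp only [chordal] at t1 t2
      obtain ⟨s1, s2, s3⟩ := sq1 (f z)
      rw [Real.sqrt_mul (by positivity), div_lt_div_iff₀ (by positivity) (by positivity)] at t1 t2
      set D := ‖f z - w‖
      have hD : 0 ≤ D := norm_nonneg _
      have h3 : ‖f z‖ ≤ ‖w‖ + D := by have := norm_sub_norm_le (f z) w; linarith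
      have W0 : 0 < W := by linarith
      set s := √(1 + ‖f z‖ ^ 2)
      have u1 : D * 2 < s := by
        refine lt_of_mul_lt_mul_right (a := W) ?_ W0.le
        calc D * 2 * W = D * (2 * W) := by ring
          _ < _ := t1
          _ = _ := by ring
      have u2 : D * (2 * (1 + ‖w‖)) < e * s := by
        refine lt_of_mul_lt_mul_right (a := W) ?_ W0.le
        calc _ = D * (2 * W * (1 + ‖w‖)) := by ring
          _ < _ := t2
          _ = _ := by ring
      have u3 : s ≤ 2 * (1 + ‖w‖) := by linarith
      have u4 : D < e := by
        refine lt_of_mul_lt_mul_right (a := 2 * (1 + ‖w‖)) ?_ (by linarith)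
        exact u2.trans_le (by gcongr)
      have v0 : ‖a⁻¹‖ = 1 / ‖a‖ := by rw [norm_inv, one_div]
      have v1 : 1 / (2 * ‖a‖) < ‖f z - b0‖ := by
        have h5 : a⁻¹ = (f z - b0) - (f z - w) := by rw [hw]; ring
        have h6 : 1 / ‖a‖ ≤ ‖f z - b0‖ + D := by rw [← v0, h5]; exact norm_sub_le _ _
        have h7 : 1 / ‖a‖ = 1 / (2 * ‖a‖) + 1 / (2 * ‖a‖) := by field_simp; norm_num
        linarith
      have v2 : 0 < ‖f z - b0‖ := lt_trans (by positivity) v1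
      have v3 : f z - b0 ≠ 0 := norm_pos_iff.1 v2
      refine ⟨fun h => v3 (sub_eq_zero.2 h.2), ?_⟩
      rw [FF_out hzP]
      have : (f z - b0)⁻¹ - a = -(a * (f z - w)) / (f z - b0) := by rw [hw]; field_simp; ring
      rw [this, norm_div, norm_neg, norm_mul, div_lt_iff₀ v2]
      calc ‖a‖ * D < ‖a‖ * e := by gcongr
        _ ≤ ‖a‖ * (r / (2 * ‖a‖ ^ 2)) := by gcongr
        _ = r * (1 / (2 * ‖a‖)) := by field_simp
        _ ≤ _ := by gcongr
end

section

lemma schw_inv {x : ℂ} (hx : x ≠ 0) : schwarzian (fun x => x⁻¹) x = 0 ∧ deriv (fun x : ℂ => x⁻¹) x ≠ 0 := by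
  have h1 : deriv (fun x : ℂ => x⁻¹) = fun x => -1 * x ^ (-2:ℤ) := by
    ext y; rw [deriv_inv, zpow_neg, neg_one_mul]; norm_cast
  have h2 : ∀ (c : ℂ) (m : ℤ), deriv (fun x : ℂ => c * x ^ m) = fun x => c * m * x ^ (m - 1) := fun c m => by
    ext y; rw [deriv_const_mul_field, deriv_zpow]; ring
  unfold schwarzian
  rw [h1, h2, h2]
  refine ⟨?_, by simpa using hx⟩
  have e1 : (-2:ℤ) - 1 = -3 := by norm_num
  have e2 : (-3:ℤ) - 1 = -4 := by norm_num
  simp only [e1, e2]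
  have : x ^ (-3:ℤ) = (x ^ 3)⁻¹ := by rw [zpow_neg]; norm_cast
  have h3 : x ^ (-4:ℤ) = (x ^ 4)⁻¹ := by rw [zpow_neg]; norm_cast
  have h4 : x ^ (-2:ℤ) = (x ^ 2)⁻¹ := by rw [zpow_neg]; norm_cast
  rw [this, h3, h4]
  push_cast
  field_simp
  norm_num

variable {f A : ℂ → ℂ} {P : Set ℂ} {b0 : ℂ} {M : ℕ}

lemma deriv_sc (f : ℂ → ℂ) (b0 : ℂ) : deriv (fun z => f z - b0) = deriv f := by ext z; exact deriv_sub_const _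

lemma schw_sc (f : ℂ → ℂ) (b0 z : ℂ) : schwarzian (fun z => f z - b0) z = schwarzian f z := by
  unfold schwarzian; rw [deriv_sc]

lemma reg_GG (hf : TranscMeroPlane f P) (hSf : ∀ z, z ∉ P → deriv f z ≠ 0 → schwarzian f z = 2 * A z) {z : ℂ}
    (hA : ContinuousAt A z) (hz : z ∉ P) : deriv (fun z => f z - b0) z ≠ 0 ∧ schwarzian (fun z => f z - b0) z = 2 * A z := by
  rw [deriv_sc, schw_sc]
  obtain ⟨q, h, hq, hh, h0, hF⟩ := loc_f hf hz
  obtain ⟨k, hk, k0, hd⟩ := form_deriv hq hh h0 hF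
  refine crit_blow hq hh h0 hF hA ?_
  filter_upwards [mero_punct hf.1 z, nhdsWithin_le_nhds hd, nhdsWithin_le_nhds (hk.continuousAt.eventually_ne k0), self_mem_nhdsWithin] with w h1 h2 h3 h4
  exact hSf w h1 (by rw [h2]; exact mul_ne_zero (pow_ne_zero _ (sub_ne_zero.2 h4)) h3)

lemma reg_FF (hf : TranscMeroPlane f P) (hM : 0 < M) (hmult : ∀ z μ, MultiplePointWithMult f z μ → μ ≤ M)
    (hSf : ∀ z, z ∉ P → deriv f z ≠ 0 → schwarzian f z = 2 * A z) {z : ℂ}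
    (hA : ContinuousAt A z) (hz : z ∉ PP f P b0) : deriv (FF f P b0) z ≠ 0 ∧ schwarzian (FF f P b0) z = 2 * A z := by
  obtain ⟨q, h, hq, -, hh, h0, hF, -⟩ := loc_FF hf hM hmult hz
  obtain ⟨k, hk, k0, hd⟩ := form_deriv hq hh h0 hF
  refine crit_blow hq hh h0 hF hA ?_
  filter_upwards [PP_punct hf b0 z, nhdsWithin_le_nhds hd, nhdsWithin_le_nhds (hk.continuousAt.eventually_ne k0), self_mem_nhdsWithin] with w h1 h2 h3 h4
  have hFw : deriv (FF f P b0) w ≠ 0 := by rw [h2]; exact mul_ne_zero (pow_ne_zero _ (sub_ne_zero.2 h4)) h3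
  have hfw : f w - b0 ≠ 0 := sub_ne_zero.2 h1.2
  have hev : FF f P b0 =ᶠ[𝓝 w] fun y => (fun x => x⁻¹) ((fun z => f z - b0) y) := by
    filter_upwards [(mero_closed hf.1).isOpen_compl.mem_nhds h1.1] with y hy using FF_out hy
  have hfa := hf.1.2.1 w h1.1
  have hd0 : deriv f w ≠ 0 := fun h => hFw (by
    rw [hev.deriv_eq]
    have := hfa.differentiableAt.hasDerivAt.sub_const b0
    refine (this.inv hfw).deriv.trans ?_; rw [h]; simp)
  rw [schw_congr hev, schw_comp (g := fun z => f z - b0) (F := fun x => x⁻¹) (hfa.sub analyticAt_const) (analyticAt_inv hfw) (schw_inv hfw).2 (by rw [deriv_sc]; exact hd0),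
    (schw_inv hfw).1, schw_sc, hSf w h1.1 hd0]
  ring

lemma cov_GG (hf : TranscMeroPlane f P) (hM : 0 < M) (hmult : ∀ z μ, MultiplePointWithMult f z μ → μ ≤ M) :
    Cov (fun z => f z - b0) P {w | SingularValue f P (some (w + b0))} M := by
  refine ⟨mero_closed hf.1, fun z hz => (hf.1.2.1 z hz).sub analyticAt_const, fun p hp => ?_, fun z hz h => ?_, fun γ w h1 h2 h3 h4 => ?_, fun z hz => ?_⟩
  · refine tendsto_atTop_mono (fun z => norm_sub_norm_le (f z) b0) ?_
    exact tendsto_atTop_add_const_right _ _ (hf.1.2.2 p hp)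
  · rw [deriv_sc] at h
    obtain ⟨q, k, hq, hh, h0, hF⟩ := loc_f hf hz
    exact Or.inl ⟨z, (loc_M hM hmult (hf.1.2.1 z hz) hq hh h0 hF).2 h, by rw [valueAt, if_neg hz]; simp⟩
  · refine Or.inr ⟨γ, h1, h3, ?_⟩
    refine squeeze_zero' (g := fun t => ‖(f (γ t) - b0) - w‖) (Eventually.of_forall fun t => ?_) ?_ ?_
    · unfold valueAt; split_ifs <;> simp only [chordal] <;> positivity
    · filter_upwards [eventually_ge_atTop 0] with t ht
      rw [valueAt, if_neg (h2 t ht)]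
      simp only [chordal]
      rw [Real.sqrt_mul (by positivity), sub_sub, add_comm b0 w]
      exact div_le_self (norm_nonneg _) (one_le_mul_of_one_le_of_one_le (sq1 _).1 (sq1 _).1)
    · exact tendsto_iff_norm_sub_tendsto_zero.1 h4
  · obtain ⟨q, k, hq, hh, h0, hF⟩ := loc_f hf hz
    exact ⟨q, hq, (loc_M hM hmult (hf.1.2.1 z hz) hq hh h0 hF).1, k, hh, h0, hF.mono fun w hw => by rw [hw]; ring⟩

lemma chordal_nonneg (a b : Option ℂ) : 0 ≤ chordal a b := by
  rcases a with _ | a <;> rcases b with _ | b <;> simp only [chordal] <;> positivity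

lemma ch_tendsto {γ : ℝ → ℂ} {a : ℂ} (h2 : ∀ t, 0 ≤ t → γ t ∉ PP f P b0) (h4 : Tendsto (fun t => FF f P b0 (γ t)) atTop (𝓝 a)) :
    Tendsto (fun t => chordal (valueAt f P (γ t)) (wv b0 a)) atTop (𝓝 0) := by
  refine squeeze_zero' (Eventually.of_forall fun t => chordal_nonneg _ _)
    ((eventually_ge_atTop 0).mono fun t ht => ch1 (h2 t ht) a) ?_
  simpa using (tendsto_iff_norm_sub_tendsto_zero.1 h4).const_mul ((1 + ‖b0‖) * (1 + ‖a‖⁻¹))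

lemma cov_FF (hf : TranscMeroPlane f P) (hM : 0 < M) (hmult : ∀ z μ, MultiplePointWithMult f z μ → μ ≤ M) :
    Cov (FF f P b0) (PP f P b0) {a | SingularValue f P (wv b0 a)} M := by
  have hm := mero_FF (b0 := b0) hf hM hmult
  refine ⟨mero_closed hm, hm.2.1, hm.2.2, fun z hz h => ?_, fun γ w h1 h2 h3 h4 => Or.inr ⟨γ, h1, h3, ch_tendsto h2 h4⟩, fun z hz => ?_⟩
  · obtain ⟨q, k, -, -, -, -, -, h6⟩ := loc_FF hf hM hmult hz
    refine Or.inl ⟨z, h6 h, ?_⟩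
    by_cases hzP : z ∈ P
    · rw [FF_in hzP, wv, if_pos rfl, valueAt, if_pos hzP]
    · have hne : f z - b0 ≠ 0 := fun h => hz ⟨hzP, sub_eq_zero.1 h⟩
      rw [FF_out hzP, wv, if_neg (inv_ne_zero hne), valueAt, if_neg hzP, inv_inv, add_sub_cancel]
  · obtain ⟨q, k, h1, h2, h3, h4, h5, -⟩ := loc_FF hf hM hmult hz
    exact ⟨q, h1, h2, k, h3, h4, h5⟩

lemma sv_fin (hcrit : (CriticalValues f P).Finite) (hsing : FinitelyManyTranscSing f P) : {w | SingularValue f P w}.Finite := by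
  have : {w | ∃ γ : ℝ → ℂ, AsymptoticPath f P w γ}.Finite := by
    by_contra hinf
    obtain ⟨n, hn⟩ := hsing
    obtain ⟨s, hs, hc⟩ := Set.Infinite.exists_subset_card_eq hinf (n + 1)
    have e := (Finset.equivFinOfCardEq hc).symm
    choose γ hγ using fun i : Fin (n + 1) => hs (e i).2
    have := hn (n + 1) (fun i => (e i).1) γ hγ fun i j hij => Or.inl fun h => hij (e.injective (Subtype.ext h))
    omega
  exact hcrit.union this

lemma fin_far {T : Set ℂ} (hT : T.Finite) (h0 : (0:ℂ) ∉ T) : ∃ r > 0, ∀ w, ‖w‖ < r → w ∉ T := by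
  obtain ⟨r, hr, h⟩ := Metric.isOpen_iff.1 hT.isClosed.isOpen_compl 0 h0
  exact ⟨r, hr, fun w hw => h (by simpa using hw)⟩

lemma env_exists (hf : TranscMeroPlane f P) (hM : 0 < M) (hmult : ∀ z μ, MultiplePointWithMult f z μ → μ ≤ M)
    (hcrit : (CriticalValues f P).Finite) (hsing : FinitelyManyTranscSing f P) :
    ∃ (b0 : ℂ) (S : Set ℂ) (r R0 : ℝ) (S2 : Set ℂ), Env (FF f P b0) (PP f P b0) S M r R0 (fun z => f z - b0) P S2 := by
  have hfin := sv_fin hcrit hsing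
  obtain ⟨b0, hb0⟩ := (hfin.preimage (Option.some_injective ℂ).injOn).exists_notMem
  have hS := hfin.preimage (wv_inj b0).injOn
  have hS2 : {w | SingularValue f P (some (w + b0))}.Finite :=
    hfin.preimage (f := fun w => some (w + b0)) fun x _ y _ h => by simpa using h
  set S := {a | SingularValue f P (wv b0 a)}
  replace hS : S.Finite := hS
  obtain ⟨r, hr, h1⟩ := fin_far (T := (fun p : ℂ × ℂ => p.1 - p.2) '' (S ×ˢ S) \ {0}) (((hS.prod hS).image _).sdiff) (by simp)
  obtain ⟨δ, hδ, h2⟩ := fin_far hS2 (by simpa using hb0)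
  obtain ⟨K, hK⟩ := hS.isBounded.exists_norm_le
  have hR : 0 < |K| + δ⁻¹ := by positivity
  refine ⟨b0, S, r, |K| + δ⁻¹, _, cov_FF hf hM hmult, cov_GG hf hM hmult, hr, hR, fun a ha w hw h hwS => ?_, fun a ha => ?_, fun w hw => h2 w (hw.trans_le ?_),
    fun z hz => FF_out hz, fun z hz => ?_, fun z hz => ⟨fun h => h.1 hz, FF_in hz⟩, ub_FF hf hM hmult⟩
  · exact h1 (w - a) h ⟨⟨(w, a), ⟨hwS, ha⟩, rfl⟩, sub_ne_zero.2 hw⟩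
  · exact (hK a ha).trans ((le_abs_self K).trans (by simpa using hδ.le))
  · exact inv_le_of_inv_le₀ hδ (by simp)
  · rw [sub_eq_zero]; exact ⟨fun h => h.2, fun h => ⟨hz, h⟩⟩
end

section

variable {F : ℂ → ℂ} {P S : Set ℂ} {M : ℕ} {r R0 : ℝ} {F2 : ℂ → ℂ} {P2 S2 : Set ℂ} {a : ℂ} {g : ℂ → ℂ}

lemma deriv_aff1 (G : ℂ → ℂ) (c r : ℂ) : deriv (fun z => G (c + r * z)) = fun z => r * deriv G (c + r * z) := by
  simpa using deriv_aff G 1 0 c r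

lemma schw_aff1 (G : ℂ → ℂ) {c r : ℂ} (hr : r ≠ 0) (z : ℂ) : schwarzian (fun z => G (c + r * z)) z = r ^ 2 * schwarzian G (c + r * z) := by
  simpa using schw_affine G (β := 0) (c := c) one_ne_zero hr z

lemma Cov.aff (hc : Cov F P S M) (c : ℂ) {ρ : ℂ} (hρ : ρ ≠ 0) : Cov (fun τ => F (c + ρ * τ)) {τ | c + ρ * τ ∈ P} S M := by
  have hφ : Continuous fun τ : ℂ => c + ρ * τ := by fun_prop
  refine ⟨hc.closed.preimage hφ, fun z hz => ?_, fun p hp => ?_, fun z hz h => ?_, fun γ w h1 h2 h3 h4 => ?_, fun z hz => ?_⟩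
  · exact (hc.an _ hz).comp' (g := F) (f := fun τ => c + ρ * τ) (by fun_prop)
  · refine (hc.pole _ hp).comp (tendsto_nhdsWithin_iff.2 ⟨hφ.continuousAt.tendsto.mono_left nhdsWithin_le_nhds, ?_⟩)
    filter_upwards [self_mem_nhdsWithin] with w hw using hw
  · rw [deriv_aff1] at h
    exact hc.crit _ hz ((mul_eq_zero.1 h).resolve_left hρ)
  · refine hc.asy (fun t => c + ρ * γ t) w (hφ.comp_continuousOn h1) h2 ?_ h4
    have : Tendsto (fun t => ‖ρ‖ * ‖γ t‖ + -‖c‖) atTop atTop :=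
      tendsto_atTop_add_const_right _ _ (h3.const_mul_atTop (norm_pos_iff.2 hρ))
    refine tendsto_atTop_mono (fun t => ?_) this
    have := norm_sub_norm_le (ρ * γ t) (-c)
    rw [norm_neg, norm_mul, sub_neg_eq_add, add_comm (ρ * γ t)] at this
    linarith
  · obtain ⟨q, h1, h2, h, h3, h4, h5⟩ := hc.mult _ hz
    refine ⟨q, h1, h2, fun τ => ρ ^ q * h (c + ρ * τ), ?_, mul_ne_zero (pow_ne_zero _ hρ) h4, ?_⟩
    · exact analyticAt_const.mul (h3.comp' (g := h) (f := fun τ => c + ρ * τ) (by fun_prop))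
    · filter_upwards [hφ.continuousAt.eventually h5] with w hw
      rw [hw, show c + ρ * w - (c + ρ * z) = ρ * (w - z) by ring, mul_pow]; ring

lemma Env.aff (E : Env F P S M r R0 F2 P2 S2) (c : ℂ) {ρ : ℂ} (hρ : ρ ≠ 0) :
    Env (fun τ => F (c + ρ * τ)) {τ | c + ρ * τ ∈ P} S M r R0 (fun τ => F2 (c + ρ * τ)) {τ | c + ρ * τ ∈ P2} S2 := by
  refine ⟨E.c.aff c hρ, E.c2.aff c hρ, E.hr, E.hR, E.sep, E.bd, E.bd2, fun z hz => E.inv _ hz, fun z hz => E.inv2 _ hz, fun z hz => E.inv3 _ hz, fun R C => ?_⟩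
  obtain ⟨z, h1, h2⟩ := E.ub (‖c‖ + ‖ρ‖ * R) C
  have e : c + ρ * ((z - c) / ρ) = z := by field_simp; ring
  refine ⟨(z - c) / ρ, ?_, by simpa only [mem_ofPred_eq, e] using h2⟩
  have := norm_sub_norm_le z c
  rw [norm_div, lt_div_iff₀ (norm_pos_iff.2 hρ)]
  linarith

lemma tr_open (hc : Cov F P S M) (hr : 0 < r) (hS : ∀ w, w ≠ a → ‖w - a‖ < r → w ∉ S) (hg : Trt F P a r g) : IsOpen (g '' HP) := by
  rw [isOpen_iff_mem_nhds]
  rintro _ ⟨ζ, hζ, rfl⟩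
  have hga : AnalyticAt ℂ g ζ := hg.diff.analyticAt (HP_open.mem_nhds hζ)
  have h0 : deriv g ζ ≠ 0 := fun h => by
    have := (hc.tr_sq hr hS hg hζ).1
    rw [h, mul_zero, eq_comm, neg_eq_zero] at this
    simp [hr.ne'] at this
  rw [← hga.hasStrictDerivAt.map_nhds_eq h0]
  exact image_mem_map (HP_open.mem_nhds hζ)

lemma tr_comp (hc : Cov F P S M) (hr : 0 < r) (hS : ∀ w, w ≠ a → ‖w - a‖ < r → w ∉ S) (hg : Trt F P a r g)
    (hi : Tendsto (fun ζ => ‖g ζ‖) (comap Complex.re atTop) atTop) {D : Set ℂ} (hD : IsPreconnected D)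
    (hDs : ∀ z ∈ D, z ∉ P ∧ ‖F z - a‖ < r) (hne : (D ∩ g '' HP).Nonempty) : D ⊆ g '' HP := by
  refine hD.subset_of_closure_inter_subset (tr_open hc hr hS hg) hne ?_
  rintro z ⟨hz, hzD⟩
  obtain ⟨hzP, hza⟩ := hDs z hzD
  by_cases h : F z = a
  · exfalso
    have h1 := hi.eventually_gt_atTop (‖z‖ + 1)
    obtain ⟨s, hs, h2⟩ := mem_comap.1 h1
    obtain ⟨T, hT⟩ := mem_atTop_sets.1 hs
    have h3 : ∀ᶠ w in 𝓝 z, ‖F w - a‖ < r * rexp (-T) ∧ ‖w‖ < ‖z‖ + 1 := by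
      refine Eventually.and ?_ (continuous_norm.continuousAt.eventually_lt continuousAt_const (by simp))
      refine ((hc.an z hzP).continuousAt.sub continuousAt_const).norm.eventually_lt continuousAt_const ?_
      simp only [Pi.sub_apply, h, sub_self, norm_zero]; positivity
    obtain ⟨_, ⟨h4, h5⟩, ζ, hζ, rfl⟩ := mem_closure_iff_nhds.1 hz _ h3
    rw [hg.eq ζ hζ, add_sub_cancel_left, norm_mul, Complex.norm_exp, Complex.norm_real, Real.norm_of_nonneg hr.le,
      mul_lt_mul_iff_right₀ hr, Real.exp_lt_exp, Complex.neg_re] at h4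
    have : ‖z‖ + 1 < ‖g ζ‖ := h2 (hT _ (by linarith))
    linarith
  · obtain ⟨g', hg', ζ, hζ, hz'⟩ := hc.tr_exists hr hS hzP h hza
    obtain ⟨_, ⟨ζ2, h2, rfl⟩, ζ1, h1, he⟩ := mem_closure_iff_nhds.1 hz _ ((tr_open hc hr hS hg').mem_nhds ⟨ζ, hζ, hz'⟩)
    obtain ⟨m, -, hm⟩ := hc.tr_shift hr hS hg' hg h2 h1 he.symm
    exact ⟨_, shift_HP hζ m, by rw [hm ζ hζ, hz']⟩

variable {f A : ℂ → ℂ} {b0 : ℂ}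

lemma path_of (hg : Trt (FF f P b0) (PP f P b0) a r g) (hi : Tendsto (fun ζ => ‖g ζ‖) (comap Complex.re atTop) atTop) :
    AsymptoticPath f P (wv b0 a) (fun t => g ((1 + t : ℝ) : ℂ)) := by
  have hH : ∀ t : ℝ, 0 ≤ t → ((1 + t : ℝ) : ℂ) ∈ HP := fun t ht => show 0 < (((1 + t : ℝ) : ℂ)).re by rw [Complex.ofReal_re]; linarith
  have hT : Tendsto (fun t : ℝ => ((1 + t : ℝ) : ℂ)) atTop (comap Complex.re atTop) := by
    rw [tendsto_comap_iff]
    exact tendsto_atTop_add_const_left _ 1 tendsto_id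
  refine ⟨hg.diff.continuousOn.comp (by fun_prop) fun t ht => hH t ht, hi.comp hT, ch_tendsto (fun t ht => hg.nP _ (hH t ht)) ((tr_tendsto hg).comp hT)⟩

lemma comp_of (hc : Cov (FF f P b0) (PP f P b0) S M) (hr : 0 < r) (hS : ∀ w, w ≠ a → ‖w - a‖ < r → w ∉ S)
    (hg : Trt (FF f P b0) (PP f P b0) a r g) (hi : Tendsto (fun ζ => ‖g ζ‖) (comap Complex.re atTop) atTop)
    {t : ℝ} (ht : 0 < t) (h : ∀ z, chordal (valueAt f P z) (wv b0 a) < t → z ∉ PP f P b0 ∧ ‖FF f P b0 z - a‖ < r) :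
    ∃ C, IsComponentOf C {z | chordal (valueAt f P z) (wv b0 a) < t} ∧ C ⊆ g '' HP ∧
      IsBounded ((fun t : ℝ => g ((1 + t : ℝ) : ℂ)) '' Ici 0 \ C) := by
  obtain ⟨h1, h2, h3⟩ := path_of hg hi
  obtain ⟨T0, hT0⟩ := eventually_atTop.1 (h3.eventually_lt_const ht)
  set T := max T0 0
  set γ := fun t : ℝ => g ((1 + t : ℝ) : ℂ)
  have hT : ∀ s, T ≤ s → γ s ∈ {z | chordal (valueAt f P z) (wv b0 a) < t} := fun s hs => hT0 s ((le_max_left _ _).trans hs)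
  have hU := connectedComponentIn_subset {z | chordal (valueAt f P z) (wv b0 a) < t} (γ T)
  refine ⟨_, ⟨γ T, hT T le_rfl, rfl⟩, ?_, ?_⟩
  · refine tr_comp hc hr hS hg hi isPreconnected_connectedComponentIn (fun z hz => h z (hU hz))
      ⟨γ T, mem_connectedComponentIn (hT T le_rfl), _, ?_, rfl⟩
    show 0 < (((1 + T : ℝ) : ℂ)).re
    rw [Complex.ofReal_re]; have : 0 ≤ T := le_max_right _ _; linarith
  · have hsub : γ '' Ici T ⊆ connectedComponentIn {z | chordal (valueAt f P z) (wv b0 a) < t} (γ T) := by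
      refine IsPreconnected.subset_connectedComponentIn ?_ ⟨T, mem_Ici.2 le_rfl, rfl⟩ (image_subset_iff.2 hT)
      exact isPreconnected_Ici.image _ (h1.mono (Ici_subset_Ici.2 (le_max_right _ _)))
    refine ((isCompact_Icc (a := 0) (b := T)).image_of_continuousOn (h1.mono Icc_subset_Ici_self)).isBounded.subset ?_
    rintro _ ⟨⟨s, hs, rfl⟩, hn⟩
    refine ⟨s, ⟨hs, ?_⟩, rfl⟩
    by_contra hs'
    exact hn (hsub ⟨s, mem_Ici.2 (le_of_not_ge hs'), rfl⟩)

lemma too_many {n : ℕ} (E : Env (FF f P b0) (PP f P b0) S M r R0 F2 P2 S2)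
    (hn : ∀ m : ℕ, ∀ a : Fin m → Option ℂ, ∀ γ : Fin m → ℝ → ℂ, (∀ i, AsymptoticPath f P (a i) (γ i)) →
      (∀ i j, i ≠ j → DistinctSingularities f P (a i) (a j) (γ i) (γ j)) → m ≤ n)
    (a : ℕ → ℂ) (g : ℕ → ℂ → ℂ) (h1 : ∀ i, i ≤ n → a i ∈ S ∧ Trt (FF f P b0) (PP f P b0) (a i) r (g i) ∧
      Tendsto (fun ζ => ‖g i ζ‖) (comap Complex.re atTop) atTop)
    (h2 : ∀ i j, i ≤ n → j ≤ n → i ≠ j → a i = a j → ∀ ζ1 ∈ HP, ∀ ζ2 ∈ HP, g i ζ1 ≠ g j ζ2) : False := by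
  have := hn (n + 1) (fun i => wv b0 (a i)) (fun i t => g i ((1 + t : ℝ) : ℂ))
    (fun i => path_of (h1 i (by omega)).2.1 (h1 i (by omega)).2.2) fun i j hij => ?_
  · omega
  · by_cases hw : a i = a j
    · obtain ⟨hi1, hi2, hi3⟩ := h1 i (by omega)
      obtain ⟨hj1, hj2, hj3⟩ := h1 j (by omega)
      obtain ⟨t, ht, h⟩ := ch2 f P b0 (a i) E.hr
      obtain ⟨C1, c1, c2, c3⟩ := comp_of E.c E.hr (E.sep _ hi1) hi2 hi3 ht h
      obtain ⟨C2, d1, d2, d3⟩ := comp_of E.c E.hr (E.sep _ hj1) hj2 hj3 ht (by rw [← hw]; exact h)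
      refine Or.inr ⟨t, ht, C1, C2, c1, d1, ?_, c3, d3⟩
      rw [Set.disjoint_left]
      intro z z1 z2
      obtain ⟨ζ1, k1, e1⟩ := c2 z1
      obtain ⟨ζ2, k2, e2⟩ := d2 z2
      exact h2 i j (by omega) (by omega) (fun h => hij (Fin.ext h)) hw ζ1 k1 ζ2 k2 (e1.trans e2.symm)
    · exact Or.inl fun h => hw (wv_inj b0 h)

theorem final_thm
    (M : ℕ) (hM : 0 < M)
    (f A : ℂ → ℂ) (Pf PA : Set ℂ)
    (hf : TranscMeroPlane f Pf)
    (hSf : ∀ z, z ∉ Pf → deriv f z ≠ 0 → schwarzian f z = 2 * A z)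
    (hcrit : (CriticalValues f Pf).Finite)
    (hmult : ∀ z μ, MultiplePointWithMult f z μ → μ ≤ M)
    (hsing : FinitelyManyTranscSing f Pf)
    (hA : TranscMeroPlane A PA) :
    ¬ DirectSingularityOverInfty A PA := by
  intro hd
  obtain ⟨b0, S, r, R0, S2, E⟩ := env_exists hf hM hmult hcrit hsing
  obtain ⟨n, hn⟩ := hsing
  set k := Yj (n + 1) + 101 with hk
  have hk0 : 0 < Yj (n + 1) := by unfold Yj; positivity
  have hE := E.hr
  have hR := E.hR
  set L : ℝ := 1 + 10 ^ 4 * X1 + 5000 * 100 + 5000 * (100 * M) + 5000 * (200 * R0 / (r * rexp (-X1))) with hL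
  have hX0 : 0 < X1 := by norm_num [X1]
  have l1 : 0 ≤ 200 * R0 / (r * rexp (-X1)) := by positivity
  have l2 : (0:ℝ) ≤ M := Nat.cast_nonneg _
  obtain ⟨z0, ρ, g, hρ, hX, hP, -, -, heq, hg, -⟩ := blowup hA hd (k := k + 4) (ε := 1 / 10 ^ 12) (by linarith) (by norm_num) (L ^ 2)
  set v := ρ ^ 2 * A z0 with hv
  set b := √‖v‖ with hb
  set c := z0 - ρ * (I * Complex.arg v) with hc
  have hbL : L ≤ b := Real.le_sqrt_of_sq_le hX
  have hb2 : b ^ 2 = ‖v‖ := Real.sq_sqrt (norm_nonneg _)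
  have hτ : ∀ τ : ℂ, ‖τ‖ < k → ‖τ - I * Complex.arg v‖ < k + 4 ∧ c + ρ * τ = z0 + ρ * (τ - I * Complex.arg v) := fun τ h => by
    refine ⟨?_, by rw [hc]; ring⟩
    have h1 := norm_sub_le τ (I * Complex.arg v)
    rw [norm_mul, Complex.norm_I, one_mul, Complex.norm_real, Real.norm_eq_abs] at h1
    have := Complex.abs_arg_le_pi v
    linarith [Real.pi_lt_four]
  have hcA : ∀ τ : ℂ, ‖τ‖ < k → ContinuousAt A (c + ρ * τ) := fun τ h => by
    rw [(hτ τ h).2]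
    exact (hA.1.2.1 _ (hP _ (hτ τ h).1)).continuousAt
  have N : Nm (fun τ => FF f Pf b0 (c + ρ * τ)) {τ | c + ρ * τ ∈ PP f Pf b0} S M r R0 (fun τ => f (c + ρ * τ) - b0) {τ | c + ρ * τ ∈ Pf} S2 (fun τ => ρ ^ 2 * A (c + ρ * τ)) b k := by
    refine ⟨E.aff c hρ, by linarith, fun τ h1 h2 => ?_, fun τ h1 h2 => ?_, fun τ h1 => ?_, ?_, ?_, ?_, ?_⟩
    · obtain ⟨h3, h4⟩ := reg_FF hf hM hmult hSf (hcA τ h1) h2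
      rw [deriv_aff1, schw_aff1 _ hρ, h4]
      exact ⟨mul_ne_zero hρ h3, by ring⟩
    · obtain ⟨h3, h4⟩ := reg_GG (b0 := b0) hf hSf (hcA τ h1) h2
      rw [deriv_aff1 (fun z => f z - b0), schw_aff1 (fun z => f z - b0) hρ, h4]
      exact ⟨mul_ne_zero hρ h3, by ring⟩
    · obtain ⟨h2, h3⟩ := hτ τ h1
      refine ⟨g (τ - I * Complex.arg v), hg _ h2, ?_⟩
      have e := Complex.norm_mul_exp_arg_mul_I v
      simp only [h3]
      rw [heq _ h2, ← mul_assoc, ← hv]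
      have hb3 : (b:ℂ) ^ 2 = ‖v‖ := by exact_mod_cast hb2
      rw [hb3]
      nth_rewrite 1 [← e]
      rw [mul_assoc, ← Complex.exp_add]
      congr 2; ring
    · linarith
    · linarith
    · linarith
    · have h5 : 0 < r * rexp (-X1) := by positivity
      have : 200 * R0 / (r * rexp (-X1)) < b / 5000 := by linarith
      rw [div_lt_iff₀ h5] at this; linarith
  obtain ⟨a, G, h1, h2⟩ := N.many n (by linarith)
  refine too_many E hn a (fun i ζ => c + ρ * G i ζ) (fun i hi => ?_) fun i j hi hj hij he ζ1 k1 ζ2 k2 h => ?_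
  · obtain ⟨h3, h4, h5⟩ := h1 i hi
    refine ⟨h3, ⟨(h4.diff.const_mul ρ).const_add c, h4.nP, h4.eq⟩, ?_⟩
    have : Tendsto (fun t => ‖ρ‖ * ‖G i t‖ + -‖c‖) (comap Complex.re atTop) atTop :=
      tendsto_atTop_add_const_right _ _ (h5.const_mul_atTop (norm_pos_iff.2 hρ))
    refine tendsto_atTop_mono (fun t => ?_) this
    have := norm_sub_norm_le (ρ * G i t) (-c)
    rw [norm_neg, norm_mul, sub_neg_eq_add, add_comm (ρ * G i t)] at this
    linarith
  · exact h2 i j hi hj hij he ζ1 k1 ζ2 k2 (mul_left_cancel₀ hρ (add_left_cancel h))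
end

end

theorem schwarzian_no_direct_singularity_over_infty
    (M : ℕ) (hM : 0 < M)
    (f A : ℂ → ℂ) (Pf PA : Set ℂ)
    (hf : TranscMeroPlane f Pf)
    (hSf : ∀ z, z ∉ Pf → deriv f z ≠ 0 → schwarzian f z = 2 * A z)
    (hcrit : (CriticalValues f Pf).Finite)
    (hmult : ∀ z μ, MultiplePointWithMult f z μ → μ ≤ M)
    (hsing : FinitelyManyTranscSing f Pf)
    (hA : TranscMeroPlane A PA) :
    ¬ DirectSingularityOverInfty A PA := by
  exact final_thm M hM f A Pf PA hf hSf hcrit hmult hsing hA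

end
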